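/- Let p be a prime, q = p^m, r ≥ 2, and let f(x) = a_k x^k + … + a_1 x + a_0 ∈ F_{q^r}[x] with a_k ≠ 0 and k ≥ 1. Set d = max(k, r), and suppose one of the following holds: (1) k > r ≥ 3 and p ∤ k; (2) k = r ≥ 4; (3) 0 < k < r and r ≥ 3. If q > 2rd², then the number N_f of elements x ∈ F_{q^r} satisfying N(x) = T(f(x)) (equivalently, the number of affine F_{q^r}-rational points of the Norm-Trace curve N_{q,r} lying on the curve y = f(x)) satisfies |N_f − q^{r-1}| ≤ (d−1)(d−2)·q^{r−3/2} + 5·d^{13/3}·q^{r−2}. -/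

import Mathlib

namespace NTW

section Analytic

open PowerSeries

theorem newton_bound (E ν : PowerSeries ℂ) (C : ℕ) (R : ℝ) (hR : 0 ≤ R)
    (hE : X * d⁄dX ℂ E = E * ν) (h0 : ‖coeff 0 E‖ ≤ 1) (hν0 : coeff 0 ν = 0)
    (hν : ∀ n, ‖coeff n ν‖ ≤ C * R ^ n) (n : ℕ) :
    ‖coeff n E‖ ≤ ((n : ℝ) + 1) ^ C * R ^ n := by
  have aux : ∀ n : ℕ, 1 ≤ n → (C : ℝ) * ∑ i ∈ Finset.range n, ((i : ℝ) + 1) ^ C ≤ n * ((n : ℝ) + 1) ^ C := by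
    intro n hn
    induction n, hn using Nat.le_induction with
    | base =>
      simp
      have := (Nat.lt_two_pow_self (n := C)).le
      norm_num
      exact_mod_cast this
    | succ n hn ih =>
      rw [Finset.sum_range_succ, mul_add]
      have hB := one_add_mul_le_pow (a := (1:ℝ) / (n + 1)) (le_trans (by norm_num) (by positivity : (0:ℝ) ≤ _)) C
      have hpos : (0:ℝ) < (n:ℝ) + 1 := by positivity
      have e : (1 + (1:ℝ) / (n + 1)) ^ C * ((n:ℝ) + 1) ^ C = ((n:ℝ) + 2) ^ C := by
        rw [← mul_pow]; congr 1; field_simp; ring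
      have h2 : ((n:ℝ) + 1 + C) * ((n:ℝ) + 1) ^ C ≤ ((n:ℝ) + 1) * ((n:ℝ) + 2) ^ C := by
        rw [← e]
        have : ((n:ℝ) + 1 + C) = (n + 1) * (1 + C * (1 / (n + 1))) := by field_simp
        rw [this, mul_assoc]
        gcongr
      push_cast
      have : (n:ℝ) + 1 + 1 = n + 2 := by ring
      rw [this]
      have h3 : (0:ℝ) ≤ ((n:ℝ) + 1) ^ C := by positivity
      nlinarith
  induction n using Nat.strong_induction_on with
  | _ n ih =>
    rcases Nat.eq_zero_or_pos n with rfl | hn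
    · simpa using h0
    obtain ⟨m, rfl⟩ : ∃ m, n = m + 1 := ⟨n - 1, by omega⟩
    have h := congrArg (coeff (m + 1)) hE
    rw [coeff_succ_X_mul, coeff_derivative, coeff_mul,
      Finset.Nat.sum_antidiagonal_eq_sum_range_succ (fun i j => coeff i E * coeff j ν),
      Finset.sum_range_succ, Nat.sub_self, hν0, mul_zero, add_zero] at h
    have hb : ‖∑ i ∈ Finset.range (m + 1), coeff i E * coeff (m + 1 - i) ν‖ ≤
        ∑ i ∈ Finset.range (m + 1), ((i : ℝ) + 1) ^ C * (C * R ^ (m + 1)) := by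
      refine (norm_sum_le _ _).trans (Finset.sum_le_sum fun i hi => ?_)
      have hi' := Finset.mem_range.1 hi
      rw [norm_mul]
      calc _ ≤ (((i : ℝ) + 1) ^ C * R ^ i) * (C * R ^ (m + 1 - i)) := by
            gcongr
            · exact ih i hi'
            · exact hν _
        _ = ((i : ℝ) + 1) ^ C * (C * (R ^ i * R ^ (m + 1 - i))) := by ring
        _ = _ := by rw [← pow_add, Nat.add_sub_cancel' hi'.le]
    rw [← h, norm_mul, ← Finset.sum_mul] at hb
    have e1 : ‖(m : ℂ) + 1‖ = (m : ℝ) + 1 := by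
      have := Complex.norm_natCast (m + 1)
      push_cast at this
      exact this
    rw [e1] at hb
    have := aux (m + 1) (by omega)
    push_cast at this ⊢
    have hRp : 0 ≤ R ^ (m + 1) := by positivity
    have h5 := mul_le_mul_of_nonneg_right this hRp
    have hpos : (0:ℝ) < (m:ℝ) + 1 := by positivity
    refine le_of_mul_le_mul_right ?_ hpos
    refine hb.trans ?_
    linarith

theorem no_small_root (L : Polynomial ℂ) (ν : PowerSeries ℂ) (C R : ℝ) (hR : 0 ≤ R)
    (hL0 : L.coeff 0 ≠ 0)
    (hE : (X : PowerSeries ℂ) * d⁄dX ℂ (L : PowerSeries ℂ) = L * ν)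
    (hν : ∀ n, ‖coeff n ν‖ ≤ C * R ^ n) (z : ℂ) (hz : L.eval z = 0) : 1 ≤ ‖z‖ * R := by
  by_contra hlt
  push Not at hlt
  have hLne : L ≠ 0 := by rintro rfl; simp at hL0
  have hz0 : z ≠ 0 := by
    rintro rfl
    rw [← Polynomial.coeff_zero_eq_eval_zero] at hz
    exact hL0 hz
  have hC : 0 ≤ C := by
    have := (norm_nonneg _).trans (hν 0)
    simpa using this
  -- numeric identity
  have hsum : ∀ w : ℂ, ‖w‖ * R < 1 → Summable (fun n => ‖coeff n ν * w ^ n‖) := by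
    intro w hw
    refine Summable.of_nonneg_of_le (fun _ => norm_nonneg _) (fun n => ?_)
      ((summable_geometric_of_lt_one (by positivity) hw).mul_left C)
    rw [norm_mul, norm_pow, mul_pow]
    calc _ ≤ (C * R ^ n) * ‖w‖ ^ n := by gcongr; exact hν n
      _ = _ := by ring
  have hpoly : ∀ (Q : Polynomial ℂ) (w : ℂ), HasSum (fun n => Q.coeff n * w ^ n) (Q.eval w) := by
    intro Q w
    rw [Polynomial.eval_eq_sum_range]
    apply hasSum_sum_of_ne_finset_zero
    intro b hb
    rw [Polynomial.coeff_eq_zero_of_natDegree_lt (by simpa using hb), zero_mul]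
  have hpolys : ∀ (Q : Polynomial ℂ) (w : ℂ), Summable (fun n => ‖Q.coeff n * w ^ n‖) := by
    intro Q w
    apply summable_of_ne_finset_zero (s := Finset.range (Q.natDegree + 1))
    intro b hb
    rw [Polynomial.coeff_eq_zero_of_natDegree_lt (by simpa using hb), zero_mul, norm_zero]
  have hid : ∀ w : ℂ, ‖w‖ * R < 1 →
      w * (Polynomial.derivative L).eval w = L.eval w * ∑' n, coeff n ν * w ^ n := by
    intro w hw
    rw [← (hpoly L w).tsum_eq, tsum_mul_tsum_eq_tsum_sum_antidiagonal_of_summable_norm (hpolys L w) (hsum w hw)]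
    have : w * (Polynomial.derivative L).eval w = (Polynomial.X * Polynomial.derivative L).eval w := by simp
    rw [this, ← (hpoly _ w).tsum_eq]
    congr 1
    ext n
    have h := congrArg (coeff n) hE
    rw [derivative_coe, ← Polynomial.coe_X, ← Polynomial.coe_mul, Polynomial.coeff_coe, coeff_mul] at h
    rw [h, Finset.sum_mul]
    refine Finset.sum_congr rfl fun x hx => ?_
    rw [Polynomial.coeff_coe, ← (Finset.HasAntidiagonal.mem_antidiagonal.1 hx), pow_add]
    ring
  have hbd : ∀ w : ℂ, ‖w‖ * R < 1 → ‖∑' n, coeff n ν * w ^ n‖ ≤ C * (1 - ‖w‖ * R)⁻¹ := by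
    intro w hw
    rw [← tsum_geometric_of_lt_one (by positivity) hw, ← tsum_mul_left]
    refine (norm_tsum_le_tsum_norm (hsum w hw)).trans ?_
    refine Summable.tsum_le_tsum (fun n => ?_) (hsum w hw) ((summable_geometric_of_lt_one (by positivity) hw).mul_left C)
    rw [norm_mul, norm_pow, mul_pow]
    calc _ ≤ (C * R ^ n) * ‖w‖ ^ n := by gcongr; exact hν n
      _ = _ := by ring
  obtain ⟨M, hM, hMz⟩ := Polynomial.exists_eq_pow_rootMultiplicity_mul_and_not_dvd L hLne z
  set m := Polynomial.rootMultiplicity z L with hm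
  have hmpos : 0 < m := (Polynomial.rootMultiplicity_pos hLne).2 hz
  have hMz' : M.eval z ≠ 0 := by
    intro h; exact hMz (Polynomial.dvd_iff_isRoot.2 h)
  obtain ⟨l, hl⟩ : ∃ l, m = l + 1 := ⟨m - 1, by omega⟩
  have hLe : L = (Polynomial.X - Polynomial.C z) ^ (l + 1) * M := by rw [← hl]; exact hM
  have hid2 : ∀ w : ℂ, w ≠ z → ‖w‖ * R < 1 →
      w * ((l + 1) * M.eval w + (w - z) * (Polynomial.derivative M).eval w) =
        (w - z) * M.eval w * ∑' n, coeff n ν * w ^ n := by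
    intro w hwz hw
    have h := hid w hw
    rw [hLe] at h
    simp only [Polynomial.derivative_mul, Polynomial.derivative_pow, Polynomial.eval_mul, Polynomial.eval_add,
      Polynomial.eval_pow, Polynomial.eval_sub, Polynomial.eval_X, Polynomial.eval_C, Polynomial.derivative_sub,
      Polynomial.derivative_X, Polynomial.derivative_C, Polynomial.eval_one, Polynomial.eval_zero] at h
    have hne : (w - z) ^ l ≠ 0 := pow_ne_zero _ (sub_ne_zero.2 hwz)
    apply mul_left_cancel₀ hne
    push_cast at h
    try simp only [Nat.add_sub_cancel] at h
    rw [pow_succ] at h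
    linear_combination h
  -- take limits
  have hT1 : Filter.Tendsto (fun w : ℂ => ‖w * ((l + 1) * M.eval w + (w - z) * (Polynomial.derivative M).eval w)‖)
      (nhdsWithin z {z}ᶜ) (nhds ‖z * ((l + 1) * M.eval z + (z - z) * (Polynomial.derivative M).eval z)‖) := by
    apply Filter.Tendsto.mono_left _ nhdsWithin_le_nhds
    apply Continuous.tendsto
    fun_prop
  have hT2 : Filter.Tendsto (fun w : ℂ => ‖(w - z) * M.eval w‖ * (C * (1 - ‖w‖ * R)⁻¹))
      (nhdsWithin z {z}ᶜ) (nhds (‖(z - z) * M.eval z‖ * (C * (1 - ‖z‖ * R)⁻¹))) := by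
    apply Filter.Tendsto.mono_left _ nhdsWithin_le_nhds
    apply Filter.Tendsto.mul
    · apply Continuous.tendsto
      fun_prop
    · apply Filter.Tendsto.const_mul
      apply Filter.Tendsto.inv₀
      · apply Continuous.tendsto
        fun_prop
      · linarith
  have hev : ∀ᶠ w in nhdsWithin z {z}ᶜ,
      ‖w * ((l + 1) * M.eval w + (w - z) * (Polynomial.derivative M).eval w)‖ ≤
        ‖(w - z) * M.eval w‖ * (C * (1 - ‖w‖ * R)⁻¹) := by
    have h1 : ∀ᶠ w in nhdsWithin z {z}ᶜ, ‖w‖ * R < 1 := by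
      apply nhdsWithin_le_nhds
      have : Continuous (fun w : ℂ => ‖w‖ * R) := by fun_prop
      exact this.tendsto z |>.eventually (gt_mem_nhds hlt)
    filter_upwards [h1, self_mem_nhdsWithin] with w hw hwz
    rw [hid2 w hwz hw, norm_mul]
    gcongr
    exact hbd w hw
  have hfin := le_of_tendsto_of_tendsto hT1 hT2 hev
  simp only [sub_self, zero_mul, add_zero, norm_zero] at hfin
  have h0 := norm_le_zero_iff.1 hfin
  have hl1 : ((l : ℂ) + 1) ≠ 0 := by exact_mod_cast Nat.succ_ne_zero l
  exact mul_ne_zero hz0 (mul_ne_zero hl1 hMz') h0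

theorem coeff_one_bound (L : Polynomial ℂ) (R : ℝ) (hR : 0 < R) (N : ℕ) (hL0 : L.coeff 0 = 1)
    (hdeg : L.natDegree ≤ N) (hroot : ∀ z, L.eval z = 0 → 1 ≤ ‖z‖ * R) : ‖L.coeff 1‖ ≤ N * R := by
  have hLne : L ≠ 0 := by rintro rfl; simp at hL0
  have htr : L.natTrailingDegree = 0 := by
    apply Polynomial.natTrailingDegree_eq_zero.2; right; rw [hL0]; exact one_ne_zero
  have hnd : L.reverse.natDegree = L.natDegree := by
    rw [Polynomial.reverse_natDegree, htr, Nat.sub_zero]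
  have hmon : L.reverse.Monic := by
    rw [Polynomial.Monic, Polynomial.reverse_leadingCoeff, Polynomial.trailingCoeff, htr, hL0]
  rcases Nat.eq_zero_or_pos L.natDegree with h0 | hpos
  · rw [Polynomial.coeff_eq_zero_of_natDegree_lt (by omega)]; simp; positivity
  have hco : L.coeff 1 = L.reverse.nextCoeff := by
    rw [Polynomial.nextCoeff_of_natDegree_pos (by omega), hnd, Polynomial.coeff_reverse,
      Polynomial.revAt_le (by omega)]
    congr 1; omega
  have hsp := IsAlgClosed.splits L.reverse
  rw [hco, hsp.nextCoeff_eq_neg_sum_roots_of_monic hmon, norm_neg]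
  have hr : ∀ w ∈ L.reverse.roots, ‖w‖ ≤ R := by
    intro w hw
    by_cases hw0 : w = 0
    · simp [hw0, hR.le]
    have hw1 : L.reverse.eval w = 0 := (Polynomial.mem_roots'.1 hw).2
    have h2 : L.eval w⁻¹ = 0 := by
      let _ := invertibleOfNonzero (inv_ne_zero hw0)
      have := Polynomial.eval₂_reverse_eq_zero_iff (RingHom.id ℂ) w⁻¹ L
      rw [invOf_eq_inv, inv_inv] at this
      exact this.1 hw1
    have h3 := hroot _ h2
    rw [norm_inv] at h3
    have : 0 < ‖w‖ := norm_pos_iff.2 hw0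
    rwa [← div_eq_inv_mul, one_le_div this] at h3
  have hb : ∀ s : Multiset ℂ, (∀ w ∈ s, ‖w‖ ≤ R) → ‖s.sum‖ ≤ Multiset.card s * R := by
    intro s
    induction s using Multiset.induction_on with
    | empty => simp
    | cons a s ih =>
      intro h
      rw [Multiset.sum_cons, Multiset.card_cons]
      have h1 := ih (fun w hw => h w (Multiset.mem_cons_of_mem hw))
      have h2 := h a (Multiset.mem_cons_self a s)
      push_cast
      refine (norm_add_le _ _).trans ?_
      linarith
  refine (hb _ hr).trans ?_
  gcongr
  exact (Polynomial.card_roots' _).trans (by omega)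

theorem weil_of_zeta (q d g : ℕ) (hq : 2 ≤ q) (hd : 1 ≤ d) (hg : 1 ≤ g) (A N : ℕ → ℕ) (C : ℕ)
    (hA0 : A 0 = 1) (hN0 : N 0 = 0)
    (hNewton : ∀ n, n * A n = ∑ x ∈ Finset.HasAntidiagonal.antidiagonal n, A x.1 * N x.2)
    (hC : ∀ n, 1 ≤ n → |(N n : ℝ) - (q : ℝ) ^ n| ≤ C * (Real.sqrt q) ^ n)
    (hsym : ∀ n n', d ∣ n + n' → 2 * g - 1 ≤ n → 2 * g - 1 ≤ n' →
      A n * (q ^ (n' + 1 - g) - 1) = A n' * (q ^ (n + 1 - g) - 1)) :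
    |(N 1 : ℝ) - q - 1| ≤ 2 * g * Real.sqrt q := by
  set R := Real.sqrt q with hRdef
  have hq1 : (1:ℝ) < q := by exact_mod_cast hq
  have hR1 : 1 < R := by
    rw [hRdef]; exact Real.lt_sqrt_of_sq_lt (by simpa using hq1)
  have hRR : R * R = q := Real.mul_self_sqrt (by positivity)
  -- power series
  let Z : PowerSeries ℂ := PowerSeries.mk fun n => (A n : ℂ)
  let ν : PowerSeries ℂ := PowerSeries.mk fun n => (N n : ℂ)
  have hZ : X * d⁄dX ℂ Z = Z * ν := by
    ext n
    have h : ((n * A n : ℕ) : ℂ) = _ := congrArg _ (hNewton n)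
    push_cast at h
    rw [coeff_mul (n := n) (φ := Z)]
    simp only [Z, ν, coeff_mk]
    rw [← h]
    rcases n with _ | n
    · simp
    · rw [coeff_succ_X_mul, coeff_derivative, coeff_mk]; push_cast; ring
  have hgeo : ∀ c : ℂ, (X : PowerSeries ℂ) * d⁄dX ℂ (1 - PowerSeries.C c * X) = (1 - PowerSeries.C c * X) *
      (1 - PowerSeries.mk fun n => c ^ n) := by
    intro c
    have h1 : (1 - PowerSeries.C c * X) * (PowerSeries.mk fun n => c ^ n) = 1 := by
      ext n
      rw [sub_mul, one_mul, map_sub, mul_assoc, coeff_C_mul]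
      rcases n with _ | n
      · simp
      · rw [coeff_succ_X_mul, coeff_mk, coeff_mk, coeff_one]; simp [pow_succ]; ring
    rw [mul_sub, h1]
    simp [mul_comm]
  have hprod : ∀ E F μ η : PowerSeries ℂ, X * d⁄dX ℂ E = E * μ → X * d⁄dX ℂ F = F * η →
      X * d⁄dX ℂ (E * F) = (E * F) * (μ + η) := by
    intro E F μ η h1 h2
    simp only [Derivation.leibniz, smul_eq_mul]
    linear_combination F * h1 + E * h2
  let E : PowerSeries ℂ := (1 - PowerSeries.C (q : ℂ) * X) * Z
  let νE : PowerSeries ℂ := (1 - PowerSeries.mk fun n => (q : ℂ) ^ n) + ν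
  have hE : X * d⁄dX ℂ E = E * νE := hprod _ _ _ _ (hgeo q) hZ
  have hEn : ∀ n, coeff (n + 1) E = A (n + 1) - q * A n := by
    intro n
    simp only [E, sub_mul, one_mul, map_sub, mul_assoc, coeff_C_mul, coeff_succ_X_mul, Z, coeff_mk]
  have hE0 : coeff 0 E = 1 := by
    simp [E, Z, hA0]
  have hνE0 : coeff 0 νE = 0 := by simp [νE, ν, hN0]
  have hνEn : ∀ n, 1 ≤ n → coeff n νE = N n - (q:ℂ) ^ n := by
    intro n hn
    simp only [νE, ν, map_add, map_sub, coeff_mk, coeff_one, if_neg (by omega : n ≠ 0)]; ring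
  have hνEb : ∀ n, ‖coeff n νE‖ ≤ C * R ^ n := by
    intro n
    rcases Nat.eq_zero_or_pos n with rfl | hn
    · rw [hνE0]; simp
    · rw [hνEn n hn]
      have : ((N n : ℂ) - (q:ℂ) ^ n) = (((N n : ℝ) - (q:ℝ) ^ n : ℝ) : ℂ) := by push_cast; rfl
      rw [this, Complex.norm_real]
      exact hC n hn
  have hEb := newton_bound E νE C R (by linarith) hE (by rw [hE0]; simp) hνE0 hνEb
  -- quotient constants
  have hppos : ∀ n, 2 * g - 1 ≤ n → (0:ℝ) < (q:ℝ) ^ (n + 1 - g) - 1 := by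
    intro n hn
    have : 1 < (q:ℝ) ^ (n + 1 - g) := one_lt_pow₀ hq1 (by omega)
    linarith
  let c : ℕ → ℝ := fun n => A n / ((q:ℝ) ^ (n + 1 - g) - 1)
  have hsymR : ∀ n n', d ∣ n + n' → 2 * g - 1 ≤ n → 2 * g - 1 ≤ n' → c n = c n' := by
    intro n n' h1 h2 h3
    have h := hsym n n' h1 h2 h3
    have h' : ((A n * (q ^ (n' + 1 - g) - 1) : ℕ) : ℝ) = _ := congrArg _ h
    rw [Nat.cast_mul, Nat.cast_mul, Nat.cast_sub (Nat.one_le_pow _ _ (by omega)),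
      Nat.cast_sub (Nat.one_le_pow _ _ (by omega))] at h'
    push_cast at h'
    simp only [c]
    rw [div_eq_div_iff (hppos n h2).ne' (hppos n' h3).ne']
    linarith
  have hper : ∀ n, 2 * g - 1 ≤ n → ∀ j, c (n + d * j) = c n := by
    intro n hn j
    have hn2 : n ≤ d * n := Nat.le_mul_of_pos_left n hd
    have hn3 : n ≤ d * (n + 1) - n + n := by omega
    have hk : ∃ n', d ∣ n + n' ∧ 2 * g - 1 ≤ n' := by
      refine ⟨d * (2 * n) - n, ?_, ?_⟩
      · have : n + (d * (2 * n) - n) = d * (2 * n) := by nlinarith [Nat.sub_add_cancel (show n ≤ d * (2 * n) by nlinarith)]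
        rw [this]; exact Dvd.intro _ rfl
      · have : n + n ≤ d * (2 * n) := by nlinarith
        omega
    obtain ⟨n', h1, h2⟩ := hk
    rw [hsymR n n' h1 hn h2, hsymR (n + d * j) n' _ (by omega) h2]
    have : n + d * j + n' = (n + n') + d * j := by ring
    rw [this]; exact dvd_add h1 (Dvd.intro _ rfl)
  -- A n = c n (q^(n+1-g) -1)
  have hAc : ∀ n, 2 * g - 1 ≤ n → (A n : ℝ) = c n * ((q:ℝ) ^ (n + 1 - g) - 1) := by
    intro n hn; simp only [c]; rw [div_mul_cancel₀ _ (hppos n hn).ne']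
  have hcc : ∀ n, 2 * g - 1 ≤ n → c (n + 1) = c n := by
    intro n hn
    -- limit along n + d j
    have key : ∀ j : ℕ, |(c (n+1) - c n) * (q:ℝ) ^ (n + d * j + 2 - g) + (q * c n - c (n+1))| ≤
        ((n + d * j + 1 : ℕ) + 1 : ℝ) ^ C * R ^ (n + d * j + 1) := by
      intro j
      have h := hEb (n + d * j + 1)
      rw [hEn] at h
      have e : ((A (n + d * j + 1) : ℂ) - q * A (n + d * j)) = (((A (n + d * j + 1) : ℝ) - q * A (n + d * j) : ℝ) : ℂ) := by
        push_cast; rfl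
      rw [e, Complex.norm_real, hAc _ (by omega), hAc _ (by omega), hper n hn j] at h
      have e2 : n + d * j + 1 = (n + 1) + d * j := by ring
      have e3 : c (n + d * j + 1) = c (n + 1) := by rw [e2]; exact hper _ (by omega) j
      rw [e3] at h
      refine le_trans (le_of_eq ?_) h
      rw [Real.norm_eq_abs]
      congr 1
      have e4 : n + d * j + 1 + 1 - g = (n + d * j + 1 - g) + 1 := by omega
      have e5 : n + d * j + 2 - g = (n + d * j + 1 - g) + 1 := by omega
      rw [e4, pow_succ]; ring
    have hlim : Filter.Tendsto (fun M : ℕ => (q:ℝ) ^ g * (((M:ℝ) + 1) ^ C * R ^ M) / (q:ℝ) ^ (M+1)) Filter.atTop (nhds 0) := by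
      have h1 : |R⁻¹| < 1 := by
        rw [abs_of_pos (by positivity)]; exact inv_lt_one_of_one_lt₀ hR1
      have h2 := tendsto_pow_const_mul_const_pow_of_abs_lt_one C h1
      have h3 := (h2.comp (Filter.tendsto_add_atTop_nat 1)).const_mul ((q:ℝ) ^ g * R / q)
      rw [mul_zero] at h3
      refine h3.congr fun M => ?_
      simp only [Function.comp]
      have hRp : R ≠ 0 := by positivity
      rw [← hRR]
      push_cast
      field_simp
      rw [← mul_pow, ← pow_succ']
      congr 1
      field_simp
    have hsub : Filter.Tendsto (fun j : ℕ => n + d * j + 1) Filter.atTop Filter.atTop := by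
      apply Filter.tendsto_atTop_mono (f := fun j => j) _ Filter.tendsto_id
      intro j; nlinarith
    have hlim2 := hlim.comp hsub
    have hlim3 : Filter.Tendsto (fun j : ℕ => |q * c n - c (n+1)| * (q:ℝ) ^ g / (q:ℝ) ^ (n + d * j + 1 + 1)) Filter.atTop (nhds 0) := by
      have h1 : Filter.Tendsto (fun M : ℕ => |q * c n - c (n+1)| * (q:ℝ) ^ g / (q:ℝ) ^ M) Filter.atTop (nhds 0) :=
        Filter.Tendsto.const_div_atTop (tendsto_pow_atTop_atTop_of_one_lt hq1) _
      exact h1.comp ((Filter.tendsto_add_atTop_nat 1).comp hsub)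
    have hlim4 := hlim2.add hlim3
    have : |c (n+1) - c n| ≤ 0 := by
      refine ge_of_tendsto (by simpa using hlim4) (Filter.Eventually.of_forall fun j => ?_)
      have hk := key j
      have e5 : (q:ℝ) ^ (n + d * j + 1 + 1) = (q:ℝ) ^ (n + d * j + 2 - g) * (q:ℝ) ^ g := by
        rw [← pow_add]; congr 1; omega
      have hp : (0:ℝ) < (q:ℝ) ^ (n + d * j + 1 + 1) := by positivity
      rw [← add_div, le_div_iff₀ hp]
      have h6 : |(c (n+1) - c n) * (q:ℝ) ^ (n + d * j + 2 - g)| ≤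
        ((n + d * j + 1 : ℕ) + 1 : ℝ) ^ C * R ^ (n + d * j + 1) + |q * c n - c (n+1)| := by
        have := abs_sub_abs_le_abs_sub ((c (n+1) - c n) * (q:ℝ) ^ (n + d * j + 2 - g)) (-(q * c n - c (n+1)))
        rw [sub_neg_eq_add, abs_neg] at this
        linarith
      rw [abs_mul, abs_of_pos (by positivity : (0:ℝ) < (q:ℝ) ^ (n + d * j + 2 - g))] at h6
      rw [e5, ← mul_assoc]
      have hg' : (0:ℝ) < (q:ℝ) ^ g := by positivity
      have := mul_le_mul_of_nonneg_right h6 hg'.le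
      push_cast at this ⊢
      linarith
    exact sub_eq_zero.1 (abs_nonpos_iff.1 this)
  -- L
  let Lp : PowerSeries ℂ := (1 - PowerSeries.C (1 : ℂ) * X) * E
  let νL : PowerSeries ℂ := (1 - PowerSeries.mk fun n => (1 : ℂ) ^ n) + νE
  have hL : X * d⁄dX ℂ Lp = Lp * νL := hprod _ _ _ _ (hgeo 1) hE
  have hLn : ∀ n, coeff (n + 1) Lp = coeff (n+1) E - coeff n E := by
    intro n
    simp only [Lp, sub_mul, one_mul, map_sub, mul_assoc, coeff_C_mul, coeff_succ_X_mul]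
  have hL0 : coeff 0 Lp = 1 := by
    simp only [Lp, sub_mul, one_mul, map_sub, mul_assoc, coeff_C_mul, hE0]
    simp
  have hLbig : ∀ n, 2 * g < n → coeff n Lp = 0 := by
    intro n hn
    obtain ⟨k, rfl⟩ : ∃ k, n = k + 2 := ⟨n - 2, by omega⟩
    rw [hLn, hEn, hEn]
    have h1 : ((A (k+1+1) : ℝ) - q * A (k+1)) - (A (k+1) - q * A k) = 0 := by
      rw [hAc (k+1+1) (by omega), hAc (k+1) (by omega), hAc k (by omega), hcc (k+1) (by omega), hcc k (by omega)]
      have e1 : k + 1 + 1 + 1 - g = (k + 1 - g) + 2 := by omega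
      have e2 : k + 1 + 1 - g = (k + 1 - g) + 1 := by omega
      rw [e1, e2]; ring
    have h2 := congrArg (fun x : ℝ => (x : ℂ)) h1
    push_cast at h2
    exact h2
  let L : Polynomial ℂ := trunc (2 * g + 1) Lp
  have hLL : (L : PowerSeries ℂ) = Lp := by
    ext n
    rw [Polynomial.coeff_coe, coeff_trunc]
    split_ifs with h
    · rfl
    · exact (hLbig n (by omega)).symm
  have hLdeg : L.natDegree ≤ 2 * g := by
    have := natDegree_trunc_lt Lp (2 * g)
    exact Nat.lt_succ_iff.1 this
  have hLc0 : L.coeff 0 = 1 := by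
    rw [← Polynomial.coeff_coe, hLL, hL0]
  have hνLb : ∀ n, ‖coeff n νL‖ ≤ ((C : ℝ) + 2) * R ^ n := by
    intro n
    have hone : 1 ≤ R ^ n := one_le_pow₀ hR1.le
    simp only [νL, map_add, map_sub, coeff_mk, one_pow, coeff_one]
    refine (norm_add_le _ _).trans ?_
    have h1 : ‖(if n = 0 then (1:ℂ) else 0) - 1‖ ≤ 1 := by split_ifs <;> simp
    have := hνEb n
    nlinarith
  have hroots : ∀ z, L.eval z = 0 → 1 ≤ ‖z‖ * R :=
    no_small_root L νL (C + 2) R (by linarith) (by rw [hLc0]; exact one_ne_zero) (by rw [hLL]; exact hL) hνLb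
  have hfin := coeff_one_bound L R (by linarith) (2 * g) hLc0 hLdeg hroots
  have hc1 : L.coeff 1 = (((N 1 : ℝ) - q - 1 : ℝ) : ℂ) := by
    rw [← Polynomial.coeff_coe, hLL, hLn 0, hEn 0, hE0, hA0]
    have := hNewton 1
    simp [Finset.Nat.antidiagonal_succ, hN0, hA0] at this
    rw [this]; push_cast; ring
  rw [hc1, Complex.norm_real, Real.norm_eq_abs] at hfin
  push_cast at hfin
  exact hfin

end Analytic

end NTW


namespace NTW

open Polynomial Polynomial.Bivariate

section Basics

variable {k : Type*} [CommRing k]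

/-- The homomorphism `X ↦ Z`, `Y ↦ Y Z`, used to handle the total degree. -/
noncomputable def Th : k[X][Y] →+* k[X][Y] :=
  eval₂RingHom (mapRingHom (C : k →+* k[X])) (C X * X)

theorem coeff_Th (p : k[X][Y]) (n j : ℕ) :
    ((Th p).coeff n).coeff j = if j ≤ n then (p.coeff j).coeff (n - j) else 0 := by
  induction p using Polynomial.induction_on' with
  | add p q hp hq =>
    rw [map_add, coeff_add, coeff_add, hp, hq, coeff_add, coeff_add]
    split_ifs <;> simp
  | monomial m a =>
    have : Th (monomial m a) = (a.map C) * (C (X ^ m) * X ^ m) := by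
      simp [Th, mul_pow]
    rw [this, ← mul_assoc, coeff_mul_X_pow', coeff_monomial]
    have e : ((map C a * C (X ^ m)).coeff (n - m)).coeff j = if j = m then a.coeff (n - m) else 0 := by
      rw [coeff_mul_C, coeff_map, coeff_C_mul, coeff_X_pow]; simp
    by_cases hjm : m = j
    · subst hjm
      rw [if_pos rfl]
      split_ifs with h
      · rw [e, if_pos rfl]
      · simp
    · rw [if_neg hjm]
      split_ifs with h
      · rw [e, if_neg (Ne.symm hjm)]; simp
      · rw [e, if_neg (Ne.symm hjm)]
      · simp
      · simp

/-- total degree at most `n` -/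
def TD (n : ℕ) (p : k[X][Y]) : Prop := ∀ i j, n < i + j → (p.coeff j).coeff i = 0

theorem TD_iff (n : ℕ) (p : k[X][Y]) : TD n p ↔ (Th p).natDegree ≤ n := by
  rw [natDegree_le_iff_coeff_eq_zero]
  constructor
  · intro h N hN
    ext j
    rw [coeff_Th]
    split_ifs with hj
    · rw [h _ _ (by omega)]; simp
    · simp
  · intro h i j hij
    have := congrArg (fun f => f.coeff j) (h (i + j) hij)
    simp only [coeff_Th] at this
    simpa using this

/-- dehomogenised homogeneous part of degree `n` -/
noncomputable def top (n : ℕ) (p : k[X][Y]) : k[X] := (Th p).coeff n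

theorem coeff_top (p : k[X][Y]) (n j : ℕ) :
    (top n p).coeff j = if j ≤ n then (p.coeff j).coeff (n - j) else 0 := coeff_Th p n j

theorem natDegree_top_le (p : k[X][Y]) (n : ℕ) : (top n p).natDegree ≤ n := by
  rw [natDegree_le_iff_coeff_eq_zero]
  intro j hj
  rw [coeff_top, if_neg (by omega)]

theorem Th_injective : Function.Injective (Th : k[X][Y] →+* k[X][Y]) := by
  rw [injective_iff_map_eq_zero]
  intro p hp
  ext j i
  have := coeff_Th p (i + j) j
  rw [hp] at this
  simpa using this.symm

theorem TD.mul {m n : ℕ} {p q : k[X][Y]} (hp : TD m p) (hq : TD n q) : TD (m + n) (p * q) := by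
  rw [TD_iff] at *
  rw [map_mul]
  exact natDegree_mul_le_of_le hp hq

theorem top_mul {m n : ℕ} {p q : k[X][Y]} (hp : TD m p) (hq : TD n q) :
    top (m + n) (p * q) = top m p * top n q := by
  rw [TD_iff] at *
  rw [top, map_mul]
  exact coeff_mul_add_eq_of_natDegree_le hp hq

theorem TD.add {n : ℕ} {p q : k[X][Y]} (hp : TD n p) (hq : TD n q) : TD n (p + q) := by
  intro i j h; rw [coeff_add, coeff_add, hp i j h, hq i j h, add_zero]

theorem TD.sub {n : ℕ} {p q : k[X][Y]} (hp : TD n p) (hq : TD n q) : TD n (p - q) := by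
  intro i j h; rw [coeff_sub, coeff_sub, hp i j h, hq i j h, sub_zero]

theorem TD.neg {n : ℕ} {p : k[X][Y]} (hp : TD n p) : TD n (-p) := by
  intro i j h; rw [coeff_neg, coeff_neg, hp i j h, neg_zero]

theorem TD.mono {m n : ℕ} (h : m ≤ n) {p : k[X][Y]} (hp : TD m p) : TD n p :=
  fun i j hij => hp i j (by omega)

theorem TD_exists (p : k[X][Y]) : ∃ n, TD n p := ⟨_, (TD_iff _ p).2 le_rfl⟩

theorem TD_zero (n : ℕ) : TD n (0 : k[X][Y]) := fun i j _ => by simp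

theorem TD_monomial (i j : ℕ) (a : k) : TD (i + j) (monomial j (monomial i a) : k[X][Y]) := by
  intro i' j' h
  rw [coeff_monomial]
  split_ifs with h1
  · rw [coeff_monomial, if_neg (by omega)]
  · simp

theorem top_add (n : ℕ) (p q : k[X][Y]) : top n (p + q) = top n p + top n q := by simp [top]
theorem top_sub (n : ℕ) (p q : k[X][Y]) : top n (p - q) = top n p - top n q := by simp [top]
theorem top_neg (n : ℕ) (p : k[X][Y]) : top n (-p) = - top n p := by simp [top]

theorem top_eq_zero_of_TD {m n : ℕ} (h : m < n) {p : k[X][Y]} (hp : TD m p) : top n p = 0 :=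
  coeff_eq_zero_of_natDegree_lt (((TD_iff m p).1 hp).trans_lt h)

theorem TD_pred {n : ℕ} {p : k[X][Y]} (hp : TD (n + 1) p) (h : top (n + 1) p = 0) : TD n p := by
  intro i j hij
  rcases Nat.lt_or_ge (n + 1) (i + j) with h1 | h1
  · exact hp i j h1
  · have : i + j = n + 1 := by omega
    have h2 := coeff_top p (n + 1) j
    rw [h, if_pos (by omega), show n + 1 - j = i by omega] at h2
    simpa using h2.symm

/-- homogeneous polynomial with given dehomogenisation -/
noncomputable def hom (n : ℕ) (w : k[X]) : k[X][Y] :=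
  ∑ j ∈ Finset.range (n + 1), monomial j (monomial (n - j) (w.coeff j))

theorem coeff_hom (n : ℕ) (w : k[X]) (i j : ℕ) :
    ((hom n w).coeff j).coeff i = if i + j = n then w.coeff j else 0 := by
  rw [hom, finset_sum_coeff, finset_sum_coeff]
  simp only [coeff_monomial]
  by_cases h : j ≤ n
  · rw [Finset.sum_eq_single j]
    · simp only [if_true, coeff_monomial]
      by_cases h2 : i + j = n
      · rw [if_pos (by omega), if_pos h2]
      · rw [if_neg (by omega), if_neg h2]
    · intro b _ hb; rw [if_neg hb]; simp
    · intro hj; simp at hj; omega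
  · rw [if_neg (by omega)]
    apply Finset.sum_eq_zero
    intro b hb
    simp at hb
    rw [if_neg (by omega)]; simp

theorem TD_hom (n : ℕ) (w : k[X]) : TD n (hom n w) := by
  intro i j h; rw [coeff_hom, if_neg (by omega)]

theorem top_hom (n : ℕ) (w : k[X]) (hw : w.natDegree ≤ n) : top n (hom n w) = w := by
  ext j
  rw [coeff_top, coeff_hom]
  split_ifs with h1 h2
  · rfl
  · omega
  · rw [coeff_eq_zero_of_natDegree_lt (by omega)]

theorem coeff_swap (p : k[X][Y]) (i j : ℕ) : ((swap p).coeff i).coeff j = (p.coeff j).coeff i := by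
  induction p using Polynomial.induction_on' with
  | add p q hp hq => simp [hp, hq]
  | monomial m a =>
    induction a using Polynomial.induction_on' with
    | add p q hp hq => simp only [map_add, coeff_add, hp, hq]
    | monomial l a =>
      rw [swap_monomial_monomial]
      simp only [coeff_monomial]
      split_ifs <;> simp_all [coeff_monomial]

/-- partial derivative with respect to the inner variable -/
noncomputable def pX (p : k[X][Y]) : k[X][Y] := swap (derivative (swap p))

theorem coeff_pX (p : k[X][Y]) (i j : ℕ) :
    ((pX p).coeff j).coeff i = (p.coeff j).coeff (i + 1) * (i + 1) := by
  rw [pX, coeff_swap, coeff_derivative, ← coeff_swap p]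
  have : ((i : k[X]) + 1) = C ((i : k) + 1) := by simp
  rw [this, coeff_mul_C]

theorem pX_mul (p q : k[X][Y]) : pX (p * q) = pX p * q + p * pX q := by
  simp [pX, derivative_mul, swap_swap_apply]

theorem pX_add (p q : k[X][Y]) : pX (p + q) = pX p + pX q := by simp [pX]

theorem TD_pX {n : ℕ} {p : k[X][Y]} (hp : TD (n + 1) p) : TD n (pX p) := by
  intro i j h; rw [coeff_pX, hp _ _ (by omega), zero_mul]

theorem TD_derivative {n : ℕ} {p : k[X][Y]} (hp : TD (n + 1) p) : TD n (derivative p) := by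
  intro i j h
  rw [coeff_derivative]
  have : ((j : k[X]) + 1) = C ((j : k) + 1) := by simp
  rw [this, coeff_mul_C, hp _ _ (by omega), zero_mul]

theorem top_derivative (n : ℕ) (p : k[X][Y]) :
    top n (derivative p) = derivative (top (n + 1) p) := by
  ext j
  rw [coeff_top, coeff_derivative, coeff_derivative, coeff_top]
  have : ((j : k[X]) + 1) = C ((j : k) + 1) := by simp
  rw [this, coeff_mul_C]
  by_cases h : j ≤ n
  · rw [if_pos h, if_pos (by omega)]; rw [show n + 1 - (j + 1) = n - j by omega]
  · rw [if_neg h, if_neg (by omega), zero_mul]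

theorem top_pX (n : ℕ) (p : k[X][Y]) :
    top n (pX p) = C ((n : k) + 1) * top (n + 1) p - X * derivative (top (n + 1) p) := by
  ext j
  rw [coeff_sub, coeff_C_mul, coeff_top, coeff_pX]
  rcases j with _ | j
  · rw [coeff_X_mul_zero, coeff_top]; simp; ring
  · rw [coeff_X_mul, coeff_derivative, coeff_top]
    by_cases h : j + 1 ≤ n
    · rw [if_pos h, if_pos (by omega), show n + 1 - (j + 1) = n - (j + 1) + 1 by omega,
        show ((n - (j + 1) : ℕ) : k) = (n : k) - (j + 1 : k) by rw [Nat.cast_sub h]; push_cast; ring]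
      ring
    · rw [if_neg h]
      by_cases h2 : j = n
      · subst h2; simp; ring
      · rw [if_neg (by omega)]; ring

/-- A plane curve of degree `d` smooth everywhere (also at infinity), in general position. -/
structure Good (d : ℕ) (P : k[X][Y]) : Prop where
  monic : P.Monic
  natDegree : P.natDegree = d
  td : TD d P
  sep : (top d P).Separable
  smooth : ∃ u v w : k[X][Y], u * P + v * pX P + w * derivative P = 1

end Basics

section Irred

variable {k : Type*} [Field k]

theorem top_monic_of {n : ℕ} {p : k[X][Y]} (hm : p.Monic) (hn : p.natDegree = n) :
    (top n p).Monic := by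
  apply monic_of_natDegree_le_of_coeff_eq_one n (natDegree_top_le p n)
  rw [coeff_top, if_pos le_rfl, ← hn, hm.coeff_natDegree]; simp

theorem natDegree_top_of {n : ℕ} {p : k[X][Y]} (hm : p.Monic) (hn : p.natDegree = n) :
    (top n p).natDegree = n := by
  apply le_antisymm (natDegree_top_le p n)
  apply le_natDegree_of_ne_zero
  rw [coeff_top, if_pos le_rfl, ← hn, hm.coeff_natDegree]; simp

theorem not_coprime_of_top (P1 P2 : k[X][Y]) (d1 d2 : ℕ) (h1 : 0 < d1) (h2 : 0 < d2)
    (m1 : P1.Monic) (n1 : P1.natDegree = d1) (t1 : TD d1 P1)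
    (m2 : P2.Monic) (n2 : P2.natDegree = d2) (t2 : TD d2 P2)
    (hc : IsCoprime (top d1 P1) (top d2 P2)) :
    ∀ (M : ℕ) (u v : k[X][Y]), TD M (u * P1) → TD M (v * P2) → u * P1 + v * P2 = 1 → False := by
  have hdeg : ∀ (d' M : ℕ) (Q u : k[X][Y]), Q.Monic → Q.natDegree = d' → TD d' Q → TD M (u * Q) →
      u ≠ 0 → d' ≤ M ∧ TD (M - d') u := by
    intro d' M Q u hm hn ht hM hu
    have hQ : (Th Q).natDegree = d' := by
      apply le_antisymm ((TD_iff _ _).1 ht)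
      apply le_natDegree_of_ne_zero
      intro h0
      have := top_monic_of hm hn
      rw [top, h0] at this
      exact not_monic_zero this
    have hu' : Th u ≠ 0 := by
      intro h; exact hu (Th_injective (by rw [h, map_zero]))
    have hQ' : Th Q ≠ 0 := by
      intro h; exact hm.ne_zero (Th_injective (by rw [h, map_zero]))
    have := (TD_iff _ _).1 hM
    rw [map_mul, natDegree_mul hu' hQ', hQ] at this
    exact ⟨by omega, (TD_iff _ _).2 (by omega)⟩
  intro M
  induction M with
  | zero =>
    intro u v hu hv h
    by_cases hu0 : u = 0
    · by_cases hv0 : v = 0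
      · simp [hu0, hv0] at h
      · have := (hdeg d2 0 P2 v m2 n2 t2 hv hv0).1; omega
    · have := (hdeg d1 0 P1 u m1 n1 t1 hu hu0).1; omega
  | succ M ih =>
    intro u v hu hv h
    have htop : top (M + 1) (u * P1) + top (M + 1) (v * P2) = 0 := by
      rw [← top_add, h]
      apply top_eq_zero_of_TD (Nat.succ_pos M)
      intro i j hij
      rw [coeff_one]
      split_ifs with h0
      · rw [coeff_one, if_neg (by omega)]
      · simp
    by_cases hu0 : u = 0
    · have : v * P2 = 1 := by simpa [hu0] using h
      have h3 := congrArg natDegree this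
      have hv0 : v ≠ 0 := by rintro rfl; simp at this
      rw [natDegree_mul hv0 m2.ne_zero, natDegree_one] at h3
      omega
    by_cases hv0 : v = 0
    · have : u * P1 = 1 := by simpa [hv0] using h
      have h3 := congrArg natDegree this
      rw [natDegree_mul hu0 m1.ne_zero, natDegree_one] at h3
      omega
    obtain ⟨a1, a2⟩ := hdeg _ _ _ _ m1 n1 t1 hu hu0
    obtain ⟨b1, b2⟩ := hdeg _ _ _ _ m2 n2 t2 hv hv0
    obtain ⟨e1, he1⟩ : ∃ e1, M + 1 = e1 + d1 := ⟨M + 1 - d1, by omega⟩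
    obtain ⟨e2, he2⟩ : ∃ e2, M + 1 = e2 + d2 := ⟨M + 1 - d2, by omega⟩
    rw [show M + 1 - d1 = e1 by omega] at a2
    rw [show M + 1 - d2 = e2 by omega] at b2
    have et : top e1 u * top d1 P1 + top e2 v * top d2 P2 = 0 := by
      rw [← top_mul a2 t1, ← top_mul b2 t2, ← he1, ← he2]; exact htop
    have hdv : top d2 P2 ∣ top e1 u := by
      apply hc.symm.dvd_of_dvd_mul_right
      exact ⟨- top e2 v, by linear_combination et⟩
    obtain ⟨w, hw⟩ := hdv
    have hP2ne := (top_monic_of m2 n2).ne_zero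
    have hwv : top e2 v = - (w * top d1 P1) := by
      apply mul_right_cancel₀ hP2ne
      rw [hw] at et
      linear_combination et
    by_cases hw0 : w = 0
    · apply ih u v _ _ h
      · apply TD_pred hu
        rw [he1, top_mul a2 t1, hw, hw0]; simp
      · apply TD_pred hv
        rw [he2, top_mul b2 t2, hwv, hw0]; simp
    have hwd : w.natDegree + d2 ≤ e1 := by
      have := natDegree_top_le u e1
      rw [hw, natDegree_mul hP2ne hw0, natDegree_top_of m2 n2] at this
      omega
    obtain ⟨e, he⟩ : ∃ e, e1 = e + d2 := ⟨e1 - d2, by omega⟩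
    have he' : e2 = e + d1 := by omega
    have tW := TD_hom e w
    have topW := top_hom e w (by omega)
    have tW2 : TD (M + 1) (hom e w * P2 * P1) := by rw [he1, he]; exact (tW.mul t2).mul t1
    have tW1 : TD (M + 1) (hom e w * P1 * P2) := by rw [he2, he']; exact (tW.mul t1).mul t2
    refine ih (u - hom e w * P2) (v + hom e w * P1) ?_ ?_ (by linear_combination h)
    · apply TD_pred
      · rw [sub_mul]; exact hu.sub tW2
      · rw [sub_mul, top_sub, he1, top_mul a2 t1, he, top_mul (tW.mul t2) t1, top_mul tW t2, topW, ← he, hw]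
        ring
    · apply TD_pred
      · rw [add_mul]; exact hv.add tW1
      · rw [add_mul, top_add, he2, top_mul b2 t2, he', top_mul (tW.mul t1) t2, top_mul tW t1, topW, ← he', hwv]
        ring

theorem Good.irreducible {d : ℕ} (hd : 0 < d) {P : k[X][Y]} (hP : Good d P) : Irreducible P := by
  have hP1 : P ≠ 1 := by
    intro h
    have := hP.natDegree
    rw [h, natDegree_one] at this
    omega
  rw [hP.monic.irreducible_iff_natDegree]
  refine ⟨hP1, ?_⟩
  intro P1 P2 m1 m2 hPP
  by_contra hcon
  push Not at hcon
  set d1 := P1.natDegree with hd1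
  set d2 := P2.natDegree with hd2
  have hdd : d1 + d2 = d := by
    rw [← hP.natDegree, ← hPP, m1.natDegree_mul m2]
  have hThne : ∀ {Q : k[X][Y]}, Q.Monic → Th Q ≠ 0 := by
    intro Q hm h
    exact hm.ne_zero (Th_injective (by rw [h, map_zero]))
  have hge : ∀ {Q : k[X][Y]}, Q.Monic → Q.natDegree ≤ (Th Q).natDegree := by
    intro Q hm
    apply le_natDegree_of_ne_zero
    intro h0
    have := top_monic_of hm rfl
    rw [top, h0] at this
    exact not_monic_zero this
  have hle := (TD_iff _ _).1 hP.td
  rw [← hPP, map_mul, natDegree_mul (hThne m1) (hThne m2)] at hle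
  have g1 := hge m1
  have g2 := hge m2
  have t1 : TD d1 P1 := (TD_iff _ _).2 (by omega)
  have t2 : TD d2 P2 := (TD_iff _ _).2 (by omega)
  have hs := hP.sep
  rw [← hPP, ← hdd, top_mul t1 t2] at hs
  have hc := hs.isCoprime
  by_cases hI : Ideal.span {P1, P2} = ⊤
  · rw [Ideal.eq_top_iff_one, Ideal.mem_span_pair] at hI
    obtain ⟨u, v, huv⟩ := hI
    obtain ⟨M1, hM1⟩ := TD_exists (u * P1)
    obtain ⟨M2, hM2⟩ := TD_exists (v * P2)
    exact not_coprime_of_top P1 P2 d1 d2 (by omega) (by omega) m1 rfl t1 m2 rfl t2 hc (max M1 M2) u v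
      (hM1.mono (le_max_left _ _)) (hM2.mono (le_max_right _ _)) huv
  · have p1 : P1 ∈ Ideal.span {P1, P2} := Ideal.subset_span (by simp)
    have p2 : P2 ∈ Ideal.span {P1, P2} := Ideal.subset_span (by simp)
    obtain ⟨u, v, w, h⟩ := hP.smooth
    apply hI
    rw [Ideal.eq_top_iff_one, ← h, ← hPP, pX_mul, derivative_mul]
    refine Ideal.add_mem _ (Ideal.add_mem _ ?_ ?_) ?_
    · exact Ideal.mul_mem_left _ _ (Ideal.mul_mem_left _ _ p2)
    · exact Ideal.mul_mem_left _ _ (Ideal.add_mem _ (Ideal.mul_mem_left _ _ p2) (Ideal.mul_mem_right _ _ p1))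
    · exact Ideal.mul_mem_left _ _ (Ideal.add_mem _ (Ideal.mul_mem_left _ _ p2) (Ideal.mul_mem_right _ _ p1))

end Irred

end NTW


namespace NTW

open Polynomial Polynomial.Bivariate

section Filt

variable {k : Type*} [Field k]

theorem TD_modByMonic {d : ℕ} {P : k[X][Y]} (hm : P.Monic) (hn : P.natDegree = d) (ht : TD d P) (m : ℕ) :
    ∀ (n : ℕ) (p : k[X][Y]), p.natDegree ≤ n → TD m p → TD m (p %ₘ P) := by
  intro n
  induction n with
  | zero =>
    intro p hp htp
    by_cases h : p.degree < P.degree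
    · rw [(modByMonic_eq_self_iff hm).2 h]; exact htp
    · have h1 : P.natDegree = 0 := by
        have := natDegree_le_natDegree (not_lt.1 h); omega
      have hP1 : P = 1 := hm.natDegree_eq_zero.1 h1
      rw [hP1, modByMonic_one]; exact TD_zero m
  | succ n ih =>
    intro p hp htp
    by_cases h : p.degree < P.degree
    · rw [(modByMonic_eq_self_iff hm).2 h]; exact htp
    by_cases hp1 : p.natDegree ≤ n
    · exact ih p hp1 htp
    have hpn : p.natDegree = n + 1 := by omega
    have hdn : d ≤ n + 1 := by
      rw [← hpn, ← hn]; exact natDegree_le_natDegree (not_lt.1 h)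
    have hlead : ∀ i, m < i + (n + 1) → (p.coeff (n + 1)).coeff i = 0 := fun i hi => htp i _ hi
    have hpne : p.coeff (n+1) ≠ 0 := by
      rw [← hpn]; intro h0
      have : p = 0 := leadingCoeff_eq_zero.1 h0
      rw [this] at hpn; simp at hpn
    have hmn : n + 1 ≤ m := by
      by_contra hlt
      apply hpne; ext i
      rw [hlead i (by omega)]; simp
    have htq : TD (m - d) (monomial (n + 1 - d) (p.coeff (n + 1))) := by
      intro i j hij
      rw [coeff_monomial]
      split_ifs with h1
      · exact hlead i (by omega)
      · simp
    have htq2 : TD m (monomial (n + 1 - d) (p.coeff (n + 1)) * P) := by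
      have := htq.mul ht
      rwa [show m - d + d = m by omega] at this
    have key : p %ₘ P = (p - monomial (n + 1 - d) (p.coeff (n + 1)) * P) %ₘ P := by
      rw [sub_modByMonic, mul_self_modByMonic hm, sub_zero]
    rw [key]
    apply ih _ _ (htp.sub htq2)
    have hle : (p - monomial (n + 1 - d) (p.coeff (n + 1)) * P).natDegree ≤ n + 1 := by
      refine (natDegree_sub_le _ _).trans (max_le hp ?_)
      refine natDegree_mul_le.trans ?_
      have := natDegree_monomial_le (p.coeff (n+1)) (m := n + 1 - d)
      omega
    rw [natDegree_le_iff_coeff_eq_zero]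
    intro N hN
    rcases Nat.lt_or_ge (n + 1) N with h1 | h1
    · exact coeff_eq_zero_of_natDegree_lt (by omega)
    · have : N = n + 1 := by omega
      subst this
      rw [coeff_sub]
      have e : (monomial (n + 1 - d) (p.coeff (n + 1)) * P).coeff (n + 1) = p.coeff (n + 1) := by
        rw [show n + 1 = d + (n + 1 - d) by omega, show d + (n + 1 - d) - d = n + 1 - d by omega, coeff_monomial_mul, ← hn, hm.coeff_natDegree, mul_one]
      rw [e, sub_self]

/-- elements represented by polynomials of total degree at most `m` -/
noncomputable def Am (P : k[X][Y]) (m : ℕ) : Submodule k (AdjoinRoot P) where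
  carrier := {x | ∃ p, TD m p ∧ AdjoinRoot.mk P p = x}
  add_mem' := by
    rintro _ _ ⟨p, hp, rfl⟩ ⟨q, hq, rfl⟩
    exact ⟨p + q, hp.add hq, map_add _ _ _⟩
  zero_mem' := ⟨0, TD_zero m, map_zero _⟩
  smul_mem' := by
    rintro c _ ⟨p, hp, rfl⟩
    refine ⟨c • p, ?_, ?_⟩
    · intro i j h; rw [coeff_smul, coeff_smul, hp i j h, smul_zero]
    · rw [AdjoinRoot.smul_mk]

theorem Am_mul {P : k[X][Y]} {m n : ℕ} {x y : AdjoinRoot P} (hx : x ∈ Am P m) (hy : y ∈ Am P n) :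
    x * y ∈ Am P (m + n) := by
  obtain ⟨p, hp, rfl⟩ := hx
  obtain ⟨q, hq, rfl⟩ := hy
  exact ⟨p * q, hp.mul hq, map_mul _ _ _⟩

theorem Am_mono {P : k[X][Y]} {m n : ℕ} (h : m ≤ n) : Am P m ≤ Am P n := by
  rintro _ ⟨p, hp, rfl⟩
  exact ⟨p, hp.mono h, rfl⟩

theorem Am_exists {P : k[X][Y]} (x : AdjoinRoot P) : ∃ m, x ∈ Am P m := by
  obtain ⟨p, rfl⟩ := AdjoinRoot.mk_surjective x
  obtain ⟨m, hm⟩ := TD_exists p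
  exact ⟨m, p, hm, rfl⟩

/-- the monomial basis `s^a t^c` -/
noncomputable def bas {P : k[X][Y]} (hm : P.Monic) : Module.Basis (ℕ × Fin P.natDegree) k (AdjoinRoot P) :=
  (basisMonomials k).smulTower (AdjoinRoot.powerBasisAux' hm)

theorem bas_apply {P : k[X][Y]} (hm : P.Monic) (x : ℕ × Fin P.natDegree) :
    bas hm x = AdjoinRoot.mk P (monomial x.2 (monomial x.1 1)) := by
  have hb : AdjoinRoot.powerBasisAux' hm x.2 = AdjoinRoot.root P ^ (x.2 : ℕ) := by
    have := (AdjoinRoot.powerBasis' hm).basis_eq_pow x.2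
    exact this
  rw [bas, Module.Basis.smulTower_apply, hb]
  simp only [coe_basisMonomials]
  rw [← C_mul_X_pow_eq_monomial (n := (x.2 : ℕ)), map_mul, map_pow, AdjoinRoot.mk_X, AdjoinRoot.mk_C, Algebra.smul_def]
  rfl

theorem bas_repr {P : k[X][Y]} (hm : P.Monic) (x : AdjoinRoot P) (i : ℕ × Fin P.natDegree) :
    (bas hm).repr x i = ((AdjoinRoot.modByMonicHom hm x).coeff i.2).coeff i.1 := by
  rw [bas, Module.Basis.smulTower_repr]
  rfl

theorem mem_Am_iff {d : ℕ} {P : k[X][Y]} (hm : P.Monic) (hn : P.natDegree = d) (ht : TD d P) (m : ℕ)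
    (x : AdjoinRoot P) : x ∈ Am P m ↔ ∀ i : ℕ × Fin P.natDegree, m < i.1 + i.2 → (bas hm).repr x i = 0 := by
  constructor
  · rintro ⟨p, hp, rfl⟩ i hi
    rw [bas_repr, AdjoinRoot.modByMonicHom_mk]
    exact TD_modByMonic hm hn ht m _ p le_rfl hp _ _ hi
  · intro h
    refine ⟨AdjoinRoot.modByMonicHom hm x, ?_, AdjoinRoot.mk_leftInverse hm x⟩
    intro i j hij
    by_cases hj : j < P.natDegree
    · have := h (i, ⟨j, hj⟩) hij
      rwa [bas_repr] at this
    · have hdeg : (AdjoinRoot.modByMonicHom hm x).coeff j = 0 := by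
        obtain ⟨p, rfl⟩ := AdjoinRoot.mk_surjective x
        rw [AdjoinRoot.modByMonicHom_mk]
        apply coeff_eq_zero_of_degree_lt
        refine (degree_modByMonic_lt p hm).trans_le ?_
        rw [degree_eq_natDegree hm.ne_zero]
        exact_mod_cast not_lt.1 hj
      rw [hdeg]; simp

/-- index set of the monomial basis of `Am P m` -/
def Sm (d m : ℕ) : Finset (ℕ × Fin d) :=
  (Finset.range (m + 1) ×ˢ Finset.univ).filter fun i => i.1 + i.2 ≤ m

theorem mem_Sm {d m : ℕ} (i : ℕ × Fin d) : i ∈ Sm d m ↔ i.1 + i.2 ≤ m := by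
  simp [Sm]; omega

/-- dimension of `Am P m` -/
def hdim (d m : ℕ) : ℕ := ∑ c ∈ Finset.range d, (m + 1 - c)

theorem card_Sm (d m : ℕ) : (Sm d m).card = hdim d m := by
  rw [hdim, Finset.card_eq_sum_card_fiberwise (f := fun i => i.2) (t := Finset.univ) (fun _ _ => Finset.mem_univ _),
    ← Fin.sum_univ_eq_sum_range (fun c => m + 1 - c)]
  refine Finset.sum_congr rfl fun c _ => ?_
  have : (Sm d m).filter (fun i => i.2 = c) = (Finset.range (m + 1 - c)).image (fun a => (a, c)) := by
    ext ⟨a, b⟩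
    simp only [Finset.mem_filter, mem_Sm, Finset.mem_image, Finset.mem_range, Prod.mk.injEq]
    constructor
    · rintro ⟨h, rfl⟩; exact ⟨a, by change a + (b:ℕ) ≤ m at h; omega, rfl, rfl⟩
    · rintro ⟨a', h, rfl, rfl⟩; exact ⟨by change a' + (c:ℕ) ≤ m; omega, rfl⟩
  rw [this, Finset.card_image_of_injective _ (fun a b h => (Prod.mk.inj h).1), Finset.card_range]

theorem hdim_eq (d m : ℕ) (h : d ≤ m + 2) : 2 * (hdim d m : ℤ) = d * (2 * m + 3 - d) := by
  induction d with
  | zero => simp [hdim]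
  | succ d ih =>
    have := ih (by omega)
    rw [hdim, Finset.sum_range_succ] at *
    rw [Nat.cast_add, mul_add, this, Nat.cast_sub (by omega)]
    push_cast; ring

theorem Am_eq_span {d : ℕ} {P : k[X][Y]} (hm : P.Monic) (hn : P.natDegree = d) (ht : TD d P) (m : ℕ) :
    Am P m = Submodule.span k (bas hm '' (Sm P.natDegree m : Set (ℕ × Fin P.natDegree))) := by
  ext x
  rw [mem_Am_iff hm hn ht, Module.Basis.mem_span_image]
  constructor
  · intro h i hi
    rw [Finset.mem_coe, mem_Sm]
    by_contra hlt
    exact (Finsupp.mem_support_iff.1 hi) (h i (by omega))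
  · intro h i hi
    by_contra hne
    have := h (Finsupp.mem_support_iff.2 hne)
    rw [Finset.mem_coe, mem_Sm] at this
    omega

theorem finite_Am {d : ℕ} {P : k[X][Y]} (hm : P.Monic) (hn : P.natDegree = d) (ht : TD d P) (m : ℕ) :
    Module.Finite k (Am P m) := by
  rw [Am_eq_span hm hn ht]
  exact FiniteDimensional.span_of_finite k ((Finset.finite_toSet _).image _)

theorem finrank_Am {d : ℕ} {P : k[X][Y]} (hm : P.Monic) (hn : P.natDegree = d) (ht : TD d P) (m : ℕ) :
    Module.finrank k (Am P m) = hdim d m := by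
  classical
  rw [Am_eq_span hm hn ht, ← hn, ← card_Sm]
  have hli : LinearIndependent k (fun i : (Sm P.natDegree m : Set (ℕ × Fin P.natDegree)) => bas hm i) :=
    (bas hm).linearIndependent.comp _ Subtype.val_injective
  have := finrank_span_eq_card hli
  rw [Set.image_eq_range]
  rw [this]; simp

end Filt

end NTW


namespace NTW

open Polynomial Polynomial.Bivariate

section Quot

variable {k : Type*} [Field k]

theorem hdim_add (d N B : ℕ) (h : d ≤ N + 2) : hdim d (N + B) = hdim d N + d * B := by
  have h1 := hdim_eq d N h
  have h2 := hdim_eq d (N + B) (by omega)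
  have : (2 * hdim d (N + B) : ℤ) = 2 * (hdim d N + d * B) := by
    rw [h2, mul_add, h1]; push_cast; ring
  exact_mod_cast (mul_left_cancel₀ two_ne_zero this)

theorem finrank_quot {d B : ℕ} {P : k[X][Y]} [IsDomain (AdjoinRoot P)] (hm : P.Monic) (hn : P.natDegree = d)
    (ht : TD d P) (h : AdjoinRoot P) (hh : h ∈ Am P B) (h0 : h ≠ 0) :
    Module.Finite k (AdjoinRoot P ⧸ Ideal.span {h}) ∧
      Module.finrank k (AdjoinRoot P ⧸ Ideal.span {h}) ≤ d * B := by
  have hr : Module.rank k (AdjoinRoot P ⧸ Ideal.span {h}) ≤ (d * B : ℕ) := by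
    apply rank_le
    intro s hs
    choose f hf using (Ideal.Quotient.mk_surjective (I := Ideal.span {h}))
    choose g hg using (Am_exists (P := P))
    set N := d + s.sup (fun x => g (f x)) with hN
    have hsN : ∀ x ∈ s, f x ∈ Am P (N + B) := fun x hx =>
      Am_mono (by have := Finset.le_sup (f := fun x => g (f x)) hx; omega) (hg (f x))
    let π : Am P (N + B) →ₗ[k] (AdjoinRoot P ⧸ Ideal.span {h}) :=
      (Ideal.Quotient.mkₐ k (Ideal.span {h})).toLinearMap ∘ₗ (Am P (N + B)).subtype
    haveI := finite_Am hm hn ht (N + B)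
    haveI := finite_Am hm hn ht N
    have e1 : s.card ≤ Module.finrank k (LinearMap.range π) := by
      have hsr : ∀ x : s, (x : AdjoinRoot P ⧸ Ideal.span {h}) ∈ LinearMap.range π := by
        intro x
        exact ⟨⟨f x, hsN x x.2⟩, hf x⟩
      have hli : LinearIndependent k (fun x : s => (⟨x, hsr x⟩ : LinearMap.range π)) := by
        apply LinearIndependent.of_comp (LinearMap.range π).subtype
        exact hs
      have := hli.fintype_card_le_finrank
      simpa using this
    have e2 : hdim d N ≤ Module.finrank k (LinearMap.ker π) := by
      rw [← finrank_Am hm hn ht]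
      let μ : Am P N →ₗ[k] LinearMap.ker π :=
        { toFun := fun x => ⟨⟨x * h, Am_mul x.2 hh⟩, by
            change Ideal.Quotient.mk _ _ = 0
            rw [Ideal.Quotient.eq_zero_iff_mem]
            exact Ideal.mul_mem_left _ _ (Ideal.mem_span_singleton_self h)⟩
          map_add' := fun x y => by ext; simp [add_mul]
          map_smul' := fun c x => by ext; simp }
      refine LinearMap.finrank_le_finrank_of_injective (f := μ) ?_
      intro x y hxy
      have : (x : AdjoinRoot P) * h = y * h := congrArg (fun z : LinearMap.ker π => ((z : Am P (N + B)) : AdjoinRoot P)) hxy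
      exact Subtype.ext (mul_right_cancel₀ h0 this)
    have e3 := LinearMap.finrank_range_add_finrank_ker π
    rw [finrank_Am hm hn ht, hdim_add d N B (by omega)] at e3
    omega
  have hfin : Module.Finite k (AdjoinRoot P ⧸ Ideal.span {h}) :=
    Module.rank_lt_aleph0_iff.1 (hr.trans_lt (Cardinal.natCast_lt_aleph0))
  refine ⟨hfin, ?_⟩
  rw [← Module.finrank_eq_rank] at hr
  exact_mod_cast hr

theorem card_points_le {d B : ℕ} {P : k[X][Y]} [IsDomain (AdjoinRoot P)] (hm : P.Monic) (hn : P.natDegree = d)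
    (ht : TD d P) (h : AdjoinRoot P) (hh : h ∈ Am P B) (h0 : h ≠ 0) (S : Finset (AdjoinRoot P →ₐ[k] k))
    (hS : ∀ φ ∈ S, φ h = 0) : S.card ≤ d * B := by
  obtain ⟨hfin, hle⟩ := finrank_quot hm hn ht h hh h0
  refine le_trans ?_ hle
  have hk : ∀ φ : S, ∀ a ∈ Ideal.span {h}, φ.1 a = 0 := by
    intro φ a ha
    obtain ⟨b, rfl⟩ := Ideal.mem_span_singleton.1 ha
    rw [map_mul, hS _ φ.2, zero_mul]
  let g : S → Module.Dual k (AdjoinRoot P ⧸ Ideal.span {h}) := fun φ =>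
    (Ideal.Quotient.liftₐ (Ideal.span {h}) φ.1 (hk φ)).toLinearMap
  have hli : LinearIndependent k g := by
    have h1 : LinearIndependent k (fun φ : S => ((φ.1 : AdjoinRoot P →* k) : AdjoinRoot P → k)) := by
      apply (linearIndependent_monoidHom (AdjoinRoot P) k).comp (fun φ : S => (φ.1 : AdjoinRoot P →* k))
      intro a b hab
      apply Subtype.ext
      exact AlgHom.ext fun x => DFunLike.congr_fun hab x
    let T : Module.Dual k (AdjoinRoot P ⧸ Ideal.span {h}) →ₗ[k] (AdjoinRoot P → k) :=
      { toFun := fun ψ a => ψ (Ideal.Quotient.mk _ a)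
        map_add' := fun _ _ => rfl
        map_smul' := fun _ _ => rfl }
    apply LinearIndependent.of_comp T
    exact h1
  have := hli.fintype_card_le_finrank
  rw [Subspace.dual_finrank_eq] at this
  simpa using this

end Quot

end NTW


namespace NTW

open Polynomial Polynomial.Bivariate

section Pts

variable {k K : Type*} [Field k] [Field K] [Algebra k K]

/-- the point `(x, y)` as an algebra map -/
noncomputable def pt (P : k[X][Y]) (x y : K) (h : eval₂ ((aeval x : k[X] →ₐ[k] K) : k[X] →+* K) y P = 0) :
    AdjoinRoot P →ₐ[k] K := AdjoinRoot.liftAlgHom P (aeval x) y h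

/-- first coordinate function -/
noncomputable def cs (P : k[X][Y]) : AdjoinRoot P := AdjoinRoot.of P X

/-- second coordinate function -/
noncomputable def ct (P : k[X][Y]) : AdjoinRoot P := AdjoinRoot.root P

theorem pt_cs (P : k[X][Y]) (x y : K) (h) : pt P x y h (cs P) = x := by
  simp [pt, cs]

theorem pt_ct (P : k[X][Y]) (x y : K) (h) : pt P x y h (ct P) = y := by
  simp [pt, ct]

theorem bas_eq {P : k[X][Y]} (hm : P.Monic) (i : ℕ × Fin P.natDegree) :
    bas hm i = cs P ^ i.1 * ct P ^ (i.2 : ℕ) := by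
  rw [bas_apply, ← C_mul_X_pow_eq_monomial, map_mul, map_pow, AdjoinRoot.mk_X, AdjoinRoot.mk_C,
    monomial_one_right_eq_X_pow, map_pow]; rfl

theorem hom_mk {P : k[X][Y]} (φ : AdjoinRoot P →ₐ[k] K) (p : k[X][Y]) :
    φ (AdjoinRoot.mk P p) = eval₂ ((aeval (φ (cs P)) : k[X] →ₐ[k] K) : k[X] →+* K) (φ (ct P)) p := by
  have h1 : ((φ : AdjoinRoot P →+* K).comp (AdjoinRoot.mk P)) =
      eval₂RingHom ((aeval (φ (cs P)) : k[X] →ₐ[k] K) : k[X] →+* K) (φ (ct P)) := by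
    apply Polynomial.ringHom_ext
    · intro a
      have h2 : ((φ : AdjoinRoot P →+* K).comp (AdjoinRoot.of P)) =
          ((aeval (φ (cs P)) : k[X] →ₐ[k] K) : k[X] →+* K) := by
        apply Polynomial.ringHom_ext
        · intro c
          simp only [RingHom.comp_apply, RingHom.coe_coe, aeval_C]
          exact φ.commutes c
        · simp [cs]
      have := RingHom.congr_fun h2 a
      simpa using this
    · simp [ct]
  have := RingHom.congr_fun h1 p
  simpa using this

theorem hom_root {P : k[X][Y]} (φ : AdjoinRoot P →ₐ[k] K) :
    eval₂ ((aeval (φ (cs P)) : k[X] →ₐ[k] K) : k[X] →+* K) (φ (ct P)) P = 0 := by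
  rw [← hom_mk, AdjoinRoot.mk_self, map_zero]

theorem hom_ext {P : k[X][Y]} {φ ψ : AdjoinRoot P →ₐ[k] K} (h1 : φ (cs P) = ψ (cs P))
    (h2 : φ (ct P) = ψ (ct P)) : φ = ψ := by
  refine AlgHom.ext fun x => ?_
  obtain ⟨p, rfl⟩ := AdjoinRoot.mk_surjective x
  rw [hom_mk, hom_mk, h1, h2]

theorem Am_one {P : k[X][Y]} (m : ℕ) : (1 : AdjoinRoot P) ∈ Am P m := by
  refine ⟨1, ?_, map_one _⟩
  intro i j hij
  rw [coeff_one]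
  split_ifs with h
  · rw [coeff_one, if_neg (by omega)]
  · simp

theorem Am_pow {P : k[X][Y]} {m : ℕ} {x : AdjoinRoot P} (hx : x ∈ Am P m) (n : ℕ) : x ^ n ∈ Am P (n * m) := by
  induction n with
  | zero => simpa using Am_one 0
  | succ n ih => rw [pow_succ, Nat.succ_mul]; exact Am_mul ih hx

theorem bas_mem {P : k[X][Y]} (hm : P.Monic) {m : ℕ} {i : ℕ × Fin P.natDegree} (hi : i ∈ Sm P.natDegree m) :
    bas hm i ∈ Am P m := by
  rw [mem_Sm] at hi
  rw [bas_apply]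
  refine ⟨_, ?_, rfl⟩
  intro a b hab
  rw [coeff_monomial]
  split_ifs with h
  · rw [coeff_monomial, if_neg (by omega)]
  · simp

end Pts

section Step

variable {L : Type*} [Field L] [IsAlgClosed L]

theorem infinite_points {P : L[X][Y]} (hm : P.Monic) (hd : 0 < P.natDegree) : Infinite (AdjoinRoot P →ₐ[L] L) := by
  have : ∀ x : L, ∃ y : L, eval₂ ((aeval x : L[X] →ₐ[L] L) : L[X] →+* L) y P = 0 := by
    intro x
    have hmm := hm.map ((aeval x : L[X] →ₐ[L] L) : L[X] →+* L)
    obtain ⟨y, hy⟩ := IsAlgClosed.exists_root (P.map ((aeval x : L[X] →ₐ[L] L) : L[X] →+* L)) (by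
      rw [degree_eq_natDegree hmm.ne_zero, hm.natDegree_map]
      exact_mod_cast hd.ne')
    exact ⟨y, by rwa [IsRoot, eval_map] at hy⟩
  choose y hy using this
  apply Infinite.of_injective (fun x : L => pt P x (y x) (hy x))
  intro a b hab
  have := congrArg (fun φ => φ (cs P)) hab
  simpa only [pt_cs] using this

variable {d : ℕ} {P : L[X][Y]} [IsDomain (AdjoinRoot P)] (hm : P.Monic) (hn : P.natDegree = d) (ht : TD d P)
  (hd : 0 < d)

include hm hn ht hd

theorem pow_mem_bound (φ : AdjoinRoot P →ₐ[L] L) (B n : ℕ) (h : AdjoinRoot P) (hh : h ∈ Am P B) (h0 : h ≠ 0)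
    (hmem : h ∈ (RingHom.ker φ) ^ n) : n ≤ d * B := by
  obtain ⟨hfin, hle⟩ := finrank_quot hm hn ht h hh h0
  refine le_trans ?_ hle
  haveI := infinite_points hm (hn ▸ hd)
  set 𝔪 := RingHom.ker φ with h𝔪
  have hbot : 𝔪 ≠ ⊥ := by
    intro hb
    obtain ⟨ψ, hψ⟩ := exists_ne φ
    apply hψ
    refine AlgHom.ext fun a => ?_
    have : a - algebraMap L _ (φ a) ∈ 𝔪 := by rw [h𝔪, RingHom.mem_ker]; simp
    rw [hb, Ideal.mem_bot, sub_eq_zero] at this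
    conv_lhs => rw [this]
    simp
  have htop : 𝔪 ≠ ⊤ := RingHom.ker_ne_top _
  let V : ℕ → Submodule L (AdjoinRoot P ⧸ Ideal.span {h}) := fun i =>
    ((𝔪 ^ i).map (Ideal.Quotient.mk (Ideal.span {h}))).restrictScalars L
  have hV : ∀ i, i ≤ n → Module.finrank L (V i) + i ≤ Module.finrank L (AdjoinRoot P ⧸ Ideal.span {h}) := by
    intro i
    induction i with
    | zero => intro _; rw [add_zero]; exact Submodule.finrank_le _
    | succ i ih =>
      intro hi
      have h1 := ih (by omega)
      have hlt : V (i + 1) < V i := by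
        refine lt_of_le_of_ne ?_ ?_
        · exact Ideal.map_mono (Ideal.pow_le_pow_right (Nat.le_succ i))
        · intro he
          have hle : 𝔪 ^ i ≤ 𝔪 ^ (i + 1) := by
            intro x hx
            have hx1 : Ideal.Quotient.mk (Ideal.span {h}) x ∈ V i := Ideal.mem_map_of_mem _ hx
            rw [← he] at hx1
            have hx2 : Ideal.Quotient.mk (Ideal.span {h}) x ∈ (𝔪 ^ (i + 1)).map (Ideal.Quotient.mk (Ideal.span {h})) := hx1
            rw [Ideal.mem_map_iff_of_surjective _ Ideal.Quotient.mk_surjective] at hx2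
            obtain ⟨z, hz, hzx⟩ := hx2
            rw [Ideal.Quotient.eq] at hzx
            have h2 : Ideal.span {h} ≤ 𝔪 ^ (i + 1) := by
              rw [Ideal.span_singleton_le_iff_mem]
              exact Ideal.pow_le_pow_right hi hmem
            have := sub_mem hz (h2 hzx)
            simpa using this
          have hall : ∀ j, 𝔪 ^ i ≤ 𝔪 ^ j := by
            intro j
            induction j with
            | zero => simp
            | succ j ihj =>
              rcases Nat.lt_or_ge j i with hji | hji
              · exact Ideal.pow_le_pow_right hji
              · calc 𝔪 ^ i ≤ 𝔪 ^ (i + 1) := hle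
                  _ = 𝔪 ^ i * 𝔪 := pow_succ _ _
                  _ ≤ 𝔪 ^ j * 𝔪 := Ideal.mul_mono_left ihj
                  _ = 𝔪 ^ (j + 1) := (pow_succ _ _).symm
          have := Ideal.iInf_pow_eq_bot_of_isDomain 𝔪 htop
          have hb : 𝔪 ^ i ≤ ⊥ := this ▸ le_iInf hall
          exact pow_ne_zero i hbot (le_bot_iff.1 hb)
      have := Submodule.finrank_lt_finrank_of_lt hlt
      omega
  have := hV n le_rfl
  omega

theorem nonvanish (p b B G : ℕ) [Fact p.Prime] [CharP L p] (hB : d * B < p ^ b)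
    (β : (Sm P.natDegree B) × (Sm P.natDegree G) → L) (hβ : β ≠ 0) :
    ∑ x, β x • (bas hm x.1 * (bas hm x.2) ^ p ^ b) ≠ 0 := by
  classical
  intro h
  have hpb : 0 < p ^ b := pow_pos (Fact.out : p.Prime).pos _
  have : ∀ x, ∃ z, z ^ p ^ b = β x := fun x => IsAlgClosed.exists_pow_nat_eq _ hpb
  choose β' hβ' using this
  haveI : CharP (AdjoinRoot P) p := charP_of_injective_algebraMap (algebraMap L (AdjoinRoot P)).injective p
  set w : Sm P.natDegree B → AdjoinRoot P := fun l => ∑ j, β' (l, j) • bas hm j.1 with hw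
  have hw1 : ∑ l, bas hm l.1 * w l ^ p ^ b = 0 := by
    rw [← h, Fintype.sum_prod_type]
    refine Finset.sum_congr rfl fun l _ => ?_
    rw [hw, sum_pow_char_pow, Finset.mul_sum]
    refine Finset.sum_congr rfl fun j _ => ?_
    rw [_root_.smul_pow, hβ', mul_smul_comm]
  obtain ⟨l0, hl0⟩ : ∃ l, w l ≠ 0 := by
    by_contra hall
    push Not at hall
    apply hβ
    funext ⟨l, j⟩
    have hli : LinearIndependent L (fun j : Sm P.natDegree G => bas hm j.1) :=
      (bas hm).linearIndependent.comp _ Subtype.val_injective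
    have := Fintype.linearIndependent_iff.1 hli (fun j => β' (l, j)) (hall l) j
    rw [← hβ', this, zero_pow hpb.ne']; rfl
  haveI := infinite_points hm (hn ▸ hd)
  obtain ⟨φ, hφ⟩ : ∃ φ : AdjoinRoot P →ₐ[L] L, φ (w l0) ≠ 0 := by
    by_contra hall
    push Not at hall
    obtain ⟨m, hm'⟩ := Am_exists (w l0)
    obtain ⟨S, hS⟩ := Infinite.exists_subset_card_eq (AdjoinRoot P →ₐ[L] L) (d * m + 1)
    have := card_points_le hm hn ht (w l0) hm' hl0 S (fun φ _ => hall φ)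
    omega
  have hh0 : ∑ l, (φ (w l)) ^ p ^ b • bas hm l.1 ≠ 0 := by
    intro h1
    have hli : LinearIndependent L (fun j : Sm P.natDegree B => bas hm j.1) :=
      (bas hm).linearIndependent.comp _ Subtype.val_injective
    have := Fintype.linearIndependent_iff.1 hli (fun j => (φ (w j)) ^ p ^ b) h1 l0
    exact hφ (eq_zero_of_pow_eq_zero this)
  have hmem : ∑ l, (φ (w l)) ^ p ^ b • bas hm l.1 ∈ (RingHom.ker φ) ^ (p ^ b) := by
    have e : ∑ l, (φ (w l)) ^ p ^ b • bas hm l.1 =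
        ∑ l, bas hm l.1 * (algebraMap L _ (φ (w l)) - w l) ^ p ^ b := by
      rw [← sub_zero (∑ l, (φ (w l)) ^ p ^ b • bas hm l.1), ← hw1, ← Finset.sum_sub_distrib]
      refine Finset.sum_congr rfl fun l _ => ?_
      rw [sub_pow_char_pow, mul_sub, ← map_pow (algebraMap L (AdjoinRoot P)), mul_comm (bas hm l.1) (algebraMap _ _ _), ← Algebra.smul_def]
    rw [e]
    refine Ideal.sum_mem _ fun l _ => Ideal.mul_mem_left _ _ (Ideal.pow_mem_pow ?_ _)
    rw [RingHom.mem_ker]; simp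
  have hA : ∑ l, (φ (w l)) ^ p ^ b • bas hm l.1 ∈ Am P B :=
    Submodule.sum_mem _ fun l _ => Submodule.smul_mem _ _ (bas_mem hm l.2)
  have := pow_mem_bound hm hn ht hd φ B (p ^ b) _ hA hh0 hmem
  omega

theorem stepanov (p a b B G e : ℕ) [Fact p.Prime] [CharP L p]
    (τ : ℕ × Fin P.natDegree → Fin e → AdjoinRoot P) (hτ : ∀ j ∈ Sm P.natDegree G, ∀ i, τ j i ∈ Am P G)
    (S : Finset (AdjoinRoot P →ₐ[L] L))
    (hS : ∀ φ ∈ S, ∃ y : Fin e → L, ∀ j ∈ Sm P.natDegree G,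
      φ (bas hm j) ^ (p ^ a * p ^ b) = ∑ i, φ (τ j i) * y i)
    (hdm : e * hdim d (p ^ a * B + G) < hdim d B * hdim d G) (hB : d * B < p ^ b) :
    S.card ≤ d * (B + p ^ b * G) := by
  classical
  have hpb : 0 < p ^ b := pow_pos (Fact.out : p.Prime).pos _
  have hpa : 0 < p ^ a := pow_pos (Fact.out : p.Prime).pos _
  haveI := finite_Am hm hn ht (p ^ a * B + G)
  let v : (Sm P.natDegree B) × (Sm P.natDegree G) → (Fin e → Am P (p ^ a * B + G)) := fun x i =>
    ⟨bas hm x.1 ^ p ^ a * τ x.2 i, Am_mul (Am_pow (bas_mem hm x.1.2) _) (hτ _ x.2.2 i)⟩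
  obtain ⟨γ, hγ, hγ0⟩ := (Submodule.ne_bot_iff _).1 (LinearMap.ker_ne_bot_of_finrank_lt
    (f := Fintype.linearCombination L v) (by
      rw [Module.finrank_pi_fintype, Module.finrank_pi]
      simp only [finrank_Am hm hn ht, Finset.sum_const, Finset.card_univ, Fintype.card_fin, smul_eq_mul,
        Fintype.card_prod, Fintype.card_coe, card_Sm]
      rw [hn]; exact hdm))
  have hγ1 : ∀ i, ∑ x : (Sm P.natDegree B) × (Sm P.natDegree G), γ x • (bas hm x.1 ^ p ^ a * τ x.2 i) = 0 := by
    intro i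
    rw [LinearMap.mem_ker, Fintype.linearCombination_apply] at hγ
    have := congrArg (fun z => ((z i : Am P (p ^ a * B + G)) : AdjoinRoot P)) hγ
    simpa [v] using this
  have : ∀ x, ∃ z, z ^ p ^ a = γ x := fun x => IsAlgClosed.exists_pow_nat_eq _ hpa
  choose β hβ using this
  have hβ0 : β ≠ 0 := by
    intro h; apply hγ0; funext x; rw [← hβ, h]; exact zero_pow hpa.ne'
  have hR := nonvanish hm hn ht hd p b B G hB β hβ0
  refine card_points_le hm hn ht _ ?_ hR S ?_
  · refine Submodule.sum_mem _ fun x _ => Submodule.smul_mem _ _ (Am_mul (bas_mem hm x.1.2) (Am_pow (bas_mem hm x.2.2) _))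
  · intro φ hφ
    obtain ⟨y, hy⟩ := hS φ hφ
    apply eq_zero_of_pow_eq_zero (n := p ^ a)
    rw [map_sum, sum_pow_char_pow]
    have e1 : ∀ x : (Sm P.natDegree B) × (Sm P.natDegree G),
        (φ (β x • (bas hm x.1 * (bas hm x.2) ^ p ^ b))) ^ p ^ a =
          ∑ i, y i * φ (γ x • (bas hm x.1 ^ p ^ a * τ x.2 i)) := by
      intro x
      rw [map_smul, map_mul, map_pow, _root_.smul_pow, hβ, mul_pow, ← pow_mul, mul_comm (p ^ b), hy _ x.2.2]
      simp only [map_smul, map_mul, map_pow, smul_eq_mul]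
      rw [Finset.mul_sum, Finset.mul_sum]
      exact Finset.sum_congr rfl fun i _ => by ring
    rw [Finset.sum_congr rfl fun x _ => e1 x, Finset.sum_comm]
    refine Finset.sum_eq_zero fun i _ => ?_
    rw [← Finset.mul_sum, ← map_sum, hγ1, map_zero, mul_zero]

end Step

end NTW


namespace NTW

open Polynomial Polynomial.Bivariate

section Params

theorem hdim_le (d m : ℕ) : hdim d m ≤ d * (m + 1) := by
  rw [hdim]
  calc ∑ c ∈ Finset.range d, (m + 1 - c) ≤ ∑ c ∈ Finset.range d, (m + 1) := Finset.sum_le_sum fun c _ => by omega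
    _ = _ := by simp

theorem params (d e : ℕ) (hd : 1 ≤ d) (he : 1 ≤ e) : ∃ n0 U : ℕ, ∀ Q0 Q1 : ℕ, n0 ≤ Q0 → Q0 ≤ Q1 →
    ∃ B G, e * hdim d (Q0 * B + G) < hdim d B * hdim d G ∧ d * B < Q1 ∧
      d * (B + Q1 * G) ≤ e * (Q0 * Q1) + U * Q1 := by
  -- `κ = h(m) - d m`
  have hκ : ∃ κ : ℤ, (∀ m : ℕ, d ≤ m → (hdim d m : ℤ) = d * m + κ) ∧ κ ≤ d ∧ - (d:ℤ)^2 ≤ κ := by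
    refine ⟨(hdim d d : ℤ) - d * d, ?_, ?_, ?_⟩
    · intro m hm
      obtain ⟨j, rfl⟩ := Nat.exists_eq_add_of_le hm
      rw [hdim_add d d j (by omega)]; push_cast; ring
    · have := hdim_le d d
      have h2 : (hdim d d : ℤ) ≤ d * (d + 1) := by exact_mod_cast this
      linarith
    · have : (0:ℤ) ≤ hdim d d := by positivity
      nlinarith
  obtain ⟨κ, hκ, hκ1, hκ2⟩ := hκ
  set v : ℕ := e + d ^ 2 with hv
  set u0 : ℕ := 4 * v * e + 1 + d + d ^ 2 with hu0
  refine ⟨4 * v + 2 * d ^ 2 + 4 * d + 4, u0 + d + 1, fun Q0 Q1 h0 h1 => ?_⟩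
  have hQ0 : 0 < Q0 := by omega
  set B := (Q1 - 1) / d with hB
  set G := (e * Q0 + u0) / d + 1 with hG
  have hB1 : d * B ≤ Q1 - 1 := Nat.mul_div_le _ _
  have hB2 : Q1 - 1 < d * B + d := by
    have := Nat.lt_mul_div_succ (Q1 - 1) (show 0 < d by omega)
    rw [mul_add, mul_one] at this; exact this
  have hG1 : e * Q0 + u0 < d * G := by
    exact Nat.lt_mul_div_succ _ (show 0 < d by omega)
  have hG2 : d * G ≤ e * Q0 + u0 + d := by
    rw [hG, mul_add, mul_one]
    have := Nat.mul_div_le (e * Q0 + u0) d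
    omega
  have hdB : d ≤ B := by
    rw [hB, Nat.le_div_iff_mul_le (by omega)]
    have : d * d = d ^ 2 := by ring
    omega
  have hdG : d ≤ G := by
    by_contra hlt
    have : d * G ≤ d * d := Nat.mul_le_mul_left _ (by omega)
    have h3 : d * d = d ^ 2 := by ring
    have : Q0 ≤ e * Q0 := Nat.le_mul_of_pos_left _ he
    omega
  refine ⟨B, G, ?_, by omega, ?_⟩
  · have hx : 2 * (d * B) ≥ Q0 ∧ d * B ≥ 2 * v := by omega
    have e1 := hκ B hdB
    have e2 := hκ G hdG
    have e3 := hκ (Q0 * B + G) (by omega)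
    zify
    rw [e1, e2, e3]
    push_cast
    obtain ⟨hx1, hx2⟩ := hx
    zify at hx1 hx2 hG1 hB1 hv hu0 he
    generalize hxx : (d * B : ℤ) = x at *
    obtain ⟨u, hu⟩ : ∃ u : ℤ, (d * G : ℤ) = e * Q0 + u - κ := ⟨d * G - e * Q0 + κ, by ring⟩
    have hu1 : 4 * v * e + 1 ≤ u := by nlinarith
    have e4 : (d * (Q0 * B + G) : ℤ) = Q0 * x + (e * Q0 + u - κ) := by rw [← hxx, ← hu]; ring
    rw [e4, hu]
    have hvk : (e : ℤ) - κ ≤ v := by nlinarith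
    have hv0 : (0:ℤ) ≤ v := by positivity
    have hQ : (0:ℤ) < Q0 := by exact_mod_cast hQ0
    have hE : (0:ℤ) ≤ e * Q0 := by positivity
    have huv : 0 < u := by nlinarith
    -- need x u > (e - κ)(e Q0 + u)
    have k1 : ((e:ℤ) - κ) * (e * Q0 + u) ≤ v * (e * Q0 + u) := by
      apply mul_le_mul_of_nonneg_right hvk; linarith
    have k2 : (v:ℤ) * (e * Q0 + u) < x * u := by
      have a1 : (2 * v : ℤ) * u ≤ x * u := mul_le_mul_of_nonneg_right hx2 huv.le
      have a2 : (Q0 : ℤ) * u ≤ 2 * x * u := mul_le_mul_of_nonneg_right hx1 huv.le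
      have a3 : (Q0 : ℤ) * (4 * v * e + 1) ≤ Q0 * u := mul_le_mul_of_nonneg_left hu1 hQ.le
      clear k1
      linarith
    linarith
  · have : d * (B + Q1 * G) = d * B + Q1 * (d * G) := by ring
    rw [this]
    have h5 : Q1 * (d * G) ≤ Q1 * (e * Q0 + u0 + d) := Nat.mul_le_mul_left _ hG2
    have h6 : Q1 * (e * Q0 + u0 + d) + Q1 = e * (Q0 * Q1) + (u0 + d + 1) * Q1 := by ring
    omega

end Params

section Count

variable {L : Type*} [Field L] [IsAlgClosed L]

theorem homs_of_pairs (P : L[X][Y]) (T : Finset (L × L))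
    (hT : ∀ z ∈ T, eval₂ ((aeval z.1 : L[X] →ₐ[L] L) : L[X] →+* L) z.2 P = 0) :
    ∃ S : Finset (AdjoinRoot P →ₐ[L] L), S.card = T.card ∧ ∀ φ ∈ S, (φ (cs P), φ (ct P)) ∈ T := by
  classical
  refine ⟨T.attach.image (fun z => pt P z.1.1 z.1.2 (hT z.1 z.2)), ?_, ?_⟩
  · rw [Finset.card_image_of_injective, Finset.card_attach]
    intro a b hab
    have h1 := congrArg (fun φ => φ (cs P)) hab
    have h2 := congrArg (fun φ => φ (ct P)) hab
    simp only [pt_cs, pt_ct] at h1 h2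
    exact Subtype.ext (Prod.ext h1 h2)
  · intro φ hφ
    obtain ⟨z, -, rfl⟩ := Finset.mem_image.1 hφ
    simp only [pt_cs, pt_ct]
    exact z.2

/-- the fibre polynomial -/
noncomputable def fib (P : L[X][Y]) (x : L) : L[X] := P.map ((aeval x : L[X] →ₐ[L] L) : L[X] →+* L)

theorem eval_fib (P : L[X][Y]) (x y : L) :
    (fib P x).eval y = eval₂ ((aeval x : L[X] →ₐ[L] L) : L[X] →+* L) y P := by
  rw [fib, eval_map]

theorem stepanov_bound (p : ℕ) [Fact p.Prime] [CharP L p] {d : ℕ} {P : L[X][Y]} [IsDomain (AdjoinRoot P)]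
    (hm : P.Monic) (hn : P.natDegree = d) (ht : TD d P) (hd : 0 < d) (e : ℕ) (he : 1 ≤ e) :
    ∃ n0 U : ℕ, ∀ n, n0 ≤ p ^ (n / 2) → ∀ (S : Finset (AdjoinRoot P →ₐ[L] L)),
      (∀ G, ∃ τ : ℕ × Fin P.natDegree → Fin e → AdjoinRoot P, (∀ j ∈ Sm P.natDegree G, ∀ i, τ j i ∈ Am P G) ∧
        ∀ φ ∈ S, ∃ y : Fin e → L, ∀ j ∈ Sm P.natDegree G, φ (bas hm j) ^ p ^ n = ∑ i, φ (τ j i) * y i) →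
      S.card ≤ e * p ^ n + U * p ^ (n - n / 2) := by
  obtain ⟨n0, U, h⟩ := params d e hd he
  refine ⟨n0, U, fun n hn0 S hS => ?_⟩
  have hpp := (Fact.out : p.Prime).pos
  obtain ⟨B, G, h1, h2, h3⟩ := h (p ^ (n / 2)) (p ^ (n - n / 2)) hn0 (Nat.pow_le_pow_right hpp (by omega))
  have hpn : p ^ (n / 2) * p ^ (n - n / 2) = p ^ n := by rw [← pow_add]; congr 1; omega
  rw [hpn] at h3
  obtain ⟨τ, hτ, hφ⟩ := hS G
  refine le_trans ?_ h3
  exact stepanov hm hn ht hd p (n / 2) (n - n / 2) B G e τ hτ S (by rw [hpn]; exact hφ) h1 h2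

/-- the fixed field of the `Q`-Frobenius as a finset -/
noncomputable def FQ (L : Type*) [Field L] (Q : ℕ) : Finset L := by
  classical exact (X ^ Q - X : L[X]).roots.toFinset

theorem mem_FQ {Q : ℕ} (hQ : 1 < Q) (x : L) : x ∈ FQ L Q ↔ x ^ Q = x := by
  classical
  rw [FQ, Multiset.mem_toFinset, mem_roots (FiniteField.X_pow_card_sub_X_ne_zero L hQ)]
  simp [sub_eq_zero]

theorem card_FQ (p n : ℕ) [Fact p.Prime] [CharP L p] (hn : n ≠ 0) : (FQ L (p ^ n)).card = p ^ n := by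
  classical
  rw [FQ, Multiset.toFinset_card_of_nodup, IsAlgClosed.card_roots_eq_natDegree,
    FiniteField.X_pow_card_pow_sub_X_natDegree_eq L hn (Fact.out : p.Prime).one_lt]
  exact nodup_roots (galois_poly_separable p _ (dvd_pow_self p hn))

theorem card_bad {d : ℕ} {P : L[X][Y]} [IsDomain (AdjoinRoot P)] [DecidableEq L]
    (hm : P.Monic) (hn : P.natDegree = d) (ht : TD d P) (hP' : derivative P ≠ 0) (T : Finset L) :
    (T.filter fun x => (fib P x).roots.toFinset.card < d).card ≤ d * (d - 1) := by
  have : ∀ x : L, ∃ y, (fib P x).roots.toFinset.card < d → (fib P x).eval y = 0 ∧ (fib (derivative P) x).eval y = 0 := by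
    intro x
    by_cases h : (fib P x).roots.toFinset.card < d
    · have hmon : (fib P x).Monic := hm.map _
      have hnd : ¬ (fib P x).roots.Nodup := by
        intro hnd
        rw [Multiset.toFinset_card_of_nodup hnd, IsAlgClosed.card_roots_eq_natDegree, fib, hm.natDegree_map] at h
        omega
      rw [Multiset.nodup_iff_count_le_one] at hnd
      push Not at hnd
      obtain ⟨y, hy⟩ := hnd
      rw [count_roots, one_lt_rootMultiplicity_iff_isRoot hmon.ne_zero] at hy
      refine ⟨y, fun _ => ⟨hy.1, ?_⟩⟩
      have := hy.2
      rw [fib, derivative_map] at this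
      exact this
    · exact ⟨0, fun h' => absurd h' h⟩
  choose y hy using this
  set T' := T.filter fun x => (fib P x).roots.toFinset.card < d with hT'
  obtain ⟨S, hS1, hS2⟩ := homs_of_pairs P (T'.image fun x => (x, y x)) (by
    intro z hz
    obtain ⟨x, hx, rfl⟩ := Finset.mem_image.1 hz
    have := (hy x (Finset.mem_filter.1 hx).2).1
    rwa [eval_fib] at this)
  rw [Finset.card_image_of_injective _ (fun a b h => (Prod.mk.inj h).1)] at hS1
  rw [← hS1]
  refine card_points_le hm hn ht (AdjoinRoot.mk P (derivative P)) ⟨_, ?_, rfl⟩ ?_ S ?_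
  · rcases d with _ | d
    · exfalso
      have : P = 1 := hm.natDegree_eq_zero.1 hn
      rw [this] at hP'; simp at hP'
    · exact TD_derivative ht
  · intro h0
    rw [AdjoinRoot.mk_eq_zero] at h0
    exact hP' (eq_zero_of_dvd_of_degree_lt h0 (degree_derivative_lt hm.ne_zero))
  · intro φ hφ
    obtain ⟨x, hx, hxy⟩ := Finset.mem_image.1 (hS2 φ hφ)
    rw [Prod.mk.injEq] at hxy
    rw [hom_mk, ← hxy.1, ← hxy.2, ← eval_fib]
    exact (hy x (Finset.mem_filter.1 hx).2).2

end Count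

end NTW


namespace NTW

open Polynomial Polynomial.Bivariate

theorem Good.isDomain {k : Type*} [Field k] {d : ℕ} {P : k[X][Y]} (h : Good d P) (hd : 0 < d) :
    IsDomain (AdjoinRoot P) :=
  AdjoinRoot.isDomain_of_prime (h.irreducible hd).prime

theorem Good.derivative_ne_zero {k : Type*} [Field k] {d : ℕ} {P : k[X][Y]} (h : Good d P) (hd : 0 < d) :
    derivative P ≠ 0 := by
  intro h0
  have h1 := top_derivative (d - 1) P
  rw [h0, show d - 1 + 1 = d by omega] at h1
  have h2 : derivative (top d P) = 0 := by
    rw [← h1]; ext j; rw [coeff_top]; simp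
  have hs := h.sep
  rw [separable_def, h2, isCoprime_zero_right] at hs
  have := natDegree_eq_zero_of_isUnit hs
  rw [natDegree_top_of h.monic h.natDegree] at this
  omega

section Lower

variable {k K : Type*} [Field k] [Field K] [Algebra k K]

/-- coefficients of `(P - P(t)) / (Y - t)` -/
noncomputable def P2 (P : k[X][Y]) (d i : ℕ) : AdjoinRoot P :=
  ∑ j ∈ Finset.range (d + 1), if i < j then AdjoinRoot.of P (P.coeff j) * ct P ^ (j - 1 - i) else 0

theorem cs_mem (P : k[X][Y]) : cs P ∈ Am P 1 := by
  refine ⟨C X, ?_, rfl⟩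
  intro i j hij
  rw [coeff_C]
  split_ifs with h
  · rw [coeff_X, if_neg (by omega)]
  · simp

theorem ct_mem (P : k[X][Y]) : ct P ∈ Am P 1 := by
  refine ⟨X, ?_, rfl⟩
  intro i j hij
  rw [coeff_X]
  split_ifs with h
  · rw [coeff_one, if_neg (by omega)]
  · simp

theorem of_mem {P : k[X][Y]} {m : ℕ} {p : k[X]} (hp : ∀ i, m < i → p.coeff i = 0) : AdjoinRoot.of P p ∈ Am P m := by
  refine ⟨C p, ?_, rfl⟩
  intro i j hij
  rw [coeff_C]
  split_ifs with h
  · exact hp i (by omega)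
  · simp

theorem P2_mem {P : k[X][Y]} {d i : ℕ} (ht : TD d P) : P2 P d i ∈ Am P (d - 1 - i) := by
  refine Submodule.sum_mem _ fun j hj => ?_
  rw [Finset.mem_range] at hj
  split_ifs with h
  · have h1 : AdjoinRoot.of P (P.coeff j) ∈ Am P (d - j) := of_mem fun a ha => ht a j (by omega)
    have h2 := Am_pow (ct_mem P) (j - 1 - i)
    have := Am_mul h1 h2
    rwa [show d - j + (j - 1 - i) * 1 = d - 1 - i by omega] at this
  · exact Submodule.zero_mem _

theorem P2_eq {P : k[X][Y]} {d : ℕ} (hn : P.natDegree = d) (φ : AdjoinRoot P →ₐ[k] K) (y' : K)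
    (hy : eval₂ ((aeval (φ (cs P)) : k[X] →ₐ[k] K) : k[X] →+* K) y' P = 0) (hne : y' ≠ φ (ct P)) :
    ∑ i ∈ Finset.range d, φ (P2 P d i) * y' ^ i = 0 := by
  have h0 := hom_root φ
  set y := φ (ct P) with hyy
  set f := ((aeval (φ (cs P)) : k[X] →ₐ[k] K) : k[X] →+* K) with hf
  have hof : ∀ p, φ (AdjoinRoot.of P p) = f p := by
    intro p
    have := hom_mk φ (C p)
    rwa [eval₂_C] at this
  rw [eval₂_eq_sum_range, hn] at hy h0
  have key : (∑ i ∈ Finset.range d, φ (P2 P d i) * y' ^ i) * (y' - y) = 0 := by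
    rw [← sub_eq_zero.2 (hy.trans h0.symm), ← Finset.sum_sub_distrib]
    have e1 : ∀ i, φ (P2 P d i) * y' ^ i = ∑ j ∈ Finset.range (d + 1), if i < j then f (P.coeff j) * (y' ^ i * y ^ (j - 1 - i)) else 0 := by
      intro i
      rw [P2, map_sum, Finset.sum_mul]
      refine Finset.sum_congr rfl fun j _ => ?_
      split_ifs
      · rw [map_mul, map_pow, hof]; ring
      · simp
    rw [Finset.sum_congr rfl fun i _ => e1 i, Finset.sum_comm, Finset.sum_mul]
    refine Finset.sum_congr rfl fun j hj => ?_
    rw [Finset.mem_range] at hj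
    rw [← mul_sub, ← geom_sum₂_mul, ← Finset.sum_filter, ← Finset.mul_sum, mul_assoc]
    congr 2
    refine Finset.sum_congr ?_ fun _ _ => rfl
    ext i; simp; omega
  rcases mul_eq_zero.1 key with h | h
  · exact h
  · exact absurd (sub_eq_zero.1 h) hne

theorem P2_last {P : k[X][Y]} {d : ℕ} (hm : P.Monic) (hn : P.natDegree = d) (hd : 0 < d) : P2 P d (d - 1) = 1 := by
  rw [P2, Finset.sum_eq_single d]
  · rw [if_pos (by omega), ← hn, hm.coeff_natDegree]; simp
  · intro j hj hjd
    rw [Finset.mem_range] at hj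
    rw [if_neg (by omega)]
  · intro h; simp at h

end Lower

section Count

variable {L : Type*} [Field L] [IsAlgClosed L]

/-- the affine points fixed by the `Q`-Frobenius -/
noncomputable def ptsQ (P : L[X][Y]) (Q : ℕ) : Finset (L × L) := by
  classical exact (FQ L Q ×ˢ FQ L Q).filter fun z => (fib P z.1).eval z.2 = 0

theorem count_L (p : ℕ) [Fact p.Prime] [CharP L p] {d : ℕ} {P : L[X][Y]} (hG : Good d P) (hd : 2 ≤ d) :
    ∃ n0 U : ℕ, ∀ n, n0 ≤ p ^ (n / 2) → n ≠ 0 →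
      (∀ x y, x ^ p ^ n = x → (fib P x).eval y = 0 → (fib P x).eval (y ^ p ^ n) = 0) →
      (ptsQ P (p ^ n)).card ≤ p ^ n + U * p ^ (n - n / 2) ∧
        p ^ n ≤ (ptsQ P (p ^ n)).card + U * p ^ (n - n / 2) := by
  classical
  haveI := hG.isDomain (by omega)
  have hm := hG.monic
  have hn := hG.natDegree
  have ht := hG.td
  obtain ⟨n1, U1, H1⟩ := stepanov_bound p hm hn ht (by omega) 1 le_rfl
  obtain ⟨n2, U2, H2⟩ := stepanov_bound p hm hn ht (by omega) (d - 1) (by omega)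
  refine ⟨max n1 n2, U1 + U2 + d * (d * (d - 1)), fun n hn0 hn1 hfix => ?_⟩
  have hpp := (Fact.out : p.Prime)
  have hQ1 : 1 < p ^ n := Nat.one_lt_pow hn1 hpp.one_lt
  have hpos : 0 < p ^ (n - n / 2) := pow_pos hpp.pos _
  constructor
  · obtain ⟨S, hS1, hS2⟩ := homs_of_pairs P (ptsQ P (p ^ n)) (by
      intro z hz
      rw [ptsQ, Finset.mem_filter] at hz
      rw [← eval_fib]; exact hz.2)
    rw [← hS1]
    have := H1 n (le_trans (le_max_left _ _) hn0) S (fun G => ⟨fun j _ => bas hm j, fun j hj _ => bas_mem hm hj, fun φ hφ => ⟨fun _ => 1, fun j hj => ?_⟩⟩)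
    · refine this.trans ?_
      rw [one_mul]
      have : U1 * p ^ (n - n / 2) ≤ (U1 + U2 + d * (d * (d - 1))) * p ^ (n - n / 2) :=
        Nat.mul_le_mul_right _ (by omega)
      omega
    · have h := hS2 φ hφ
      rw [ptsQ, Finset.mem_filter, Finset.mem_product, mem_FQ hQ1, mem_FQ hQ1] at h
      rw [bas_eq, map_mul, map_pow, map_pow, mul_pow, ← pow_mul, ← pow_mul, mul_comm j.1, mul_comm (j.2 : ℕ), pow_mul, pow_mul,
        h.1.1, h.1.2]
      simp [bas_eq]
  · set Yt : Finset (L × L) := (FQ L (p ^ n)).biUnion fun x => ((fib P x).roots.toFinset).image fun y => (x, y) with hY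
    have hmon : ∀ x, fib P x ≠ 0 := fun x => (hm.map _).ne_zero
    have hYm : ∀ z : L × L, z ∈ Yt ↔ z.1 ^ p ^ n = z.1 ∧ (fib P z.1).eval z.2 = 0 := by
      rintro ⟨x, y⟩
      simp only [hY, Finset.mem_biUnion, Finset.mem_image, Multiset.mem_toFinset, Prod.mk.injEq]
      constructor
      · rintro ⟨a, ha, b, hb, rfl, rfl⟩
        exact ⟨(mem_FQ hQ1 _).1 ha, (mem_roots (hmon _)).1 hb⟩
      · rintro ⟨h1, h2⟩
        exact ⟨x, (mem_FQ hQ1 _).2 h1, y, (mem_roots (hmon _)).2 h2, rfl, rfl⟩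
    have hYcard : Yt.card = ∑ x ∈ FQ L (p ^ n), (fib P x).roots.toFinset.card := by
      rw [hY, Finset.card_biUnion]
      · refine Finset.sum_congr rfl fun x _ => Finset.card_image_of_injective _ fun a b h => (Prod.mk.inj h).2
      · intro a _ b _ hab
        rw [Function.onFun, Finset.disjoint_left]
        intro z hz1 hz2
        obtain ⟨_, _, rfl⟩ := Finset.mem_image.1 hz1
        obtain ⟨_, _, h⟩ := Finset.mem_image.1 hz2
        exact hab (Prod.mk.inj h).1.symm
    have hYlow : d * p ^ n ≤ Yt.card + d * (d * (d - 1)) := by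
      have hb := card_bad hm hn ht (hG.derivative_ne_zero (by omega)) (FQ L (p ^ n))
      rw [hYcard]
      have hc : d * p ^ n = ∑ x ∈ FQ L (p ^ n), d := by
        rw [Finset.sum_const, card_FQ p n hn1, smul_eq_mul, mul_comm]
      rw [hc]
      calc ∑ x ∈ FQ L (p ^ n), d ≤ ∑ x ∈ FQ L (p ^ n), ((fib P x).roots.toFinset.card + if (fib P x).roots.toFinset.card < d then d else 0) := by
            refine Finset.sum_le_sum fun x _ => ?_
            split_ifs <;> omega
        _ = ∑ x ∈ FQ L (p ^ n), (fib P x).roots.toFinset.card + (((FQ L (p ^ n)).filter fun x => (fib P x).roots.toFinset.card < d).card) * d := by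
            rw [Finset.sum_add_distrib, ← Finset.sum_filter, Finset.sum_const, smul_eq_mul]
        _ ≤ _ := by
            have := Nat.mul_le_mul_left d hb
            rw [mul_comm _ d]; omega
    have hsplit : Yt.card = (ptsQ P (p ^ n)).card + (Yt.filter fun z => ¬ z.2 ^ p ^ n = z.2).card := by
      rw [← Finset.card_filter_add_card_filter_not (s := Yt) (fun z => z.2 ^ p ^ n = z.2)]
      congr 2
      ext z
      rw [Finset.mem_filter, hYm, ptsQ, Finset.mem_filter, Finset.mem_product, mem_FQ hQ1, mem_FQ hQ1]
      tauto
    obtain ⟨S, hS1, hS2⟩ := homs_of_pairs P (Yt.filter fun z => ¬ z.2 ^ p ^ n = z.2) (by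
      intro z hz
      rw [Finset.mem_filter, hYm] at hz
      rw [← eval_fib]; exact hz.1.2)
    have hS : S.card ≤ (d - 1) * p ^ n + U2 * p ^ (n - n / 2) := by
      refine H2 n (le_trans (le_max_right _ _) hn0) S (fun G => ⟨fun j i =>
        if (j.2 : ℕ) = d - 1 then - (cs P ^ j.1 * P2 P d i) else if (j.2 : ℕ) = i then cs P ^ j.1 else 0, ?_, ?_⟩)
      · intro j hj i
        rw [mem_Sm] at hj
        have h1 := Am_pow (cs_mem P) j.1
        beta_reduce
        split_ifs with h2 h3
        · refine Submodule.neg_mem _ (Am_mono ?_ (Am_mul h1 (P2_mem ht)))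
          omega
        · exact Am_mono (by omega) h1
        · exact Submodule.zero_mem _
      · intro φ hφ
        have h := hS2 φ hφ
        rw [Finset.mem_filter, hYm] at h
        obtain ⟨⟨hx, hroot⟩, hne⟩ := h
        refine ⟨fun i => (φ (ct P) ^ p ^ n) ^ (i : ℕ), fun j hj => ?_⟩
        have hroot' := hfix _ _ hx hroot
        rw [eval_fib] at hroot'
        have key := P2_eq hn φ _ hroot' hne
        have hsx : φ (cs P ^ j.1) ^ p ^ n = φ (cs P) ^ j.1 := by
          rw [map_pow, ← pow_mul, mul_comm, pow_mul]
          congr 1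
        rw [bas_eq, map_mul, mul_pow, hsx, map_pow, ← pow_mul, mul_comm (j.2 : ℕ), pow_mul]
        by_cases hjd : (j.2 : ℕ) = d - 1
        · simp only [hjd, if_true]
          rw [show d = d - 1 + 1 by omega, Finset.sum_range_succ] at key
          rw [show d - 1 + 1 = d by omega, P2_last hm hn (by omega), map_one, one_mul] at key
          rw [eq_neg_of_add_eq_zero_right key, ← Fin.sum_univ_eq_sum_range (fun i => φ (P2 P d i) * (φ (ct P) ^ p ^ n) ^ i),
            mul_neg, Finset.mul_sum, ← Finset.sum_neg_distrib]
          refine Finset.sum_congr rfl fun i _ => ?_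
          rw [map_neg, map_mul, map_pow]; ring
        · have hlt : (j.2 : ℕ) < d - 1 := by have := j.2.2; omega
          simp only [hjd, if_false]
          rw [Finset.sum_eq_single ⟨j.2, hlt⟩]
          · simp
          · intro i _ hi
            rw [if_neg (fun h => hi (Fin.ext h.symm)), map_zero, zero_mul]
          · intro h; exact absurd (Finset.mem_univ _) h
    rw [hS1] at hS
    have h7 : d * p ^ n = (d - 1) * p ^ n + p ^ n := by
      conv_lhs => rw [show d = d - 1 + 1 by omega]
      ring
    have h8 : (U1 + U2 + d * (d * (d - 1))) * p ^ (n - n / 2) = U1 * p ^ (n - n / 2) + U2 * p ^ (n - n / 2) + d * (d * (d - 1)) * p ^ (n - n / 2) := by ring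
    have h9 : d * (d * (d - 1)) ≤ d * (d * (d - 1)) * p ^ (n - n / 2) := Nat.le_mul_of_pos_right _ hpos
    omega

end Count

end NTW


namespace NTW

open Polynomial Polynomial.Bivariate

theorem Good.map {k K : Type*} [Field k] [Field K] (f : k →+* K) {d : ℕ} {P : k[X][Y]} (h : Good d P) :
    Good d (P.map (mapRingHom f)) := by
  have hc : ∀ (p : k[X][Y]) i j, ((p.map (mapRingHom f)).coeff j).coeff i = f ((p.coeff j).coeff i) := by
    intro p i j
    rw [coeff_map, coe_mapRingHom, coeff_map]
  refine ⟨h.monic.map _, ?_, ?_, ?_, ?_⟩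
  · rw [h.monic.natDegree_map, h.natDegree]
  · intro i j hij
    rw [hc, h.td i j hij, map_zero]
  · have : top d (P.map (mapRingHom f)) = (top d P).map f := by
      ext j
      rw [coeff_map, coeff_top, coeff_top, hc]
      split_ifs <;> simp
    rw [this]
    exact h.sep.map
  · obtain ⟨u, v, w, huvw⟩ := h.smooth
    refine ⟨u.map (mapRingHom f), v.map (mapRingHom f), w.map (mapRingHom f), ?_⟩
    have h1 : pX (P.map (mapRingHom f)) = (pX P).map (mapRingHom f) := by
      ext j i
      rw [coeff_pX, hc, hc, coeff_pX]; simp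
    rw [h1, derivative_map, ← Polynomial.map_mul, ← Polynomial.map_mul, ← Polynomial.map_mul,
      ← Polynomial.map_add, ← Polynomial.map_add, huvw, Polynomial.map_one]

section

variable {k : Type*} [Field k] [Fintype k]

theorem frob_fix {L : Type*} [Field L] [Algebra k L] (n : ℕ) (c : k) :
    (algebraMap k L c) ^ (Fintype.card k) ^ n = algebraMap k L c := by
  rw [← map_pow, FiniteField.pow_card_pow]

theorem exists_frob (L : Type*) [Field L] [Algebra k L] (n : ℕ) :
    ∃ F : L →ₐ[k] L, ∀ x, F x = x ^ (Fintype.card k) ^ n := by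
  obtain ⟨p, hp⟩ := CharP.exists k
  haveI := Fact.mk (CharP.char_is_prime k p)
  obtain ⟨m, -, hm⟩ := FiniteField.card k p
  haveI : CharP L p := charP_of_injective_algebraMap (algebraMap k L).injective p
  have hF : ∀ x : L, iterateFrobenius L p (m * n) x = x ^ (Fintype.card k) ^ n := by
    intro x; rw [iterateFrobenius_def, hm, ← pow_mul]
  refine ⟨{ iterateFrobenius L p (m * n) with commutes' := fun c => ?_ }, fun x => hF x⟩
  change iterateFrobenius L p (m * n) _ = _
  rw [hF, frob_fix]

/-- number of geometric points of a `k`-algebra fixed by the `n`-th power of Frobenius -/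
noncomputable def Npt (k A : Type*) [Field k] [Fintype k] [CommRing A] [Algebra k A] (n : ℕ) : ℕ :=
  Nat.card {φ : A →ₐ[k] AlgebraicClosure k // ∀ a, φ a ^ (Fintype.card k) ^ n = φ a}

theorem fib_map {L : Type*} [Field L] [IsAlgClosed L] [Algebra k L] (P : k[X][Y]) (x y : L) :
    (fib (P.map (mapRingHom (algebraMap k L))) x).eval y = eval₂ ((aeval x : k[X] →ₐ[k] L) : k[X] →+* L) y P := by
  rw [eval_fib, eval₂_map]
  congr 1
  apply Polynomial.ringHom_ext
  · intro a; simp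
  · simp

theorem Npt_eq (P : k[X][Y]) (n : ℕ) (hn : n ≠ 0) :
    Npt k (AdjoinRoot P) n =
      (ptsQ (P.map (mapRingHom (algebraMap k (AlgebraicClosure k)))) ((Fintype.card k) ^ n)).card := by
  classical
  have hQ : 1 < (Fintype.card k) ^ n := Nat.one_lt_pow hn Fintype.one_lt_card
  set P' := P.map (mapRingHom (algebraMap k (AlgebraicClosure k))) with hP'
  rw [Npt, ← Nat.card_eq_finsetCard]
  have hmem : ∀ z : AlgebraicClosure k × AlgebraicClosure k, z ∈ ptsQ P' ((Fintype.card k) ^ n) ↔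
      (z.1 ^ (Fintype.card k) ^ n = z.1 ∧ z.2 ^ (Fintype.card k) ^ n = z.2) ∧
      eval₂ ((aeval z.1 : k[X] →ₐ[k] AlgebraicClosure k) : k[X] →+* AlgebraicClosure k) z.2 P = 0 := by
    intro z
    rw [ptsQ, Finset.mem_filter, Finset.mem_product, mem_FQ hQ, mem_FQ hQ, fib_map]
  refine Nat.card_congr
    { toFun := fun φ => ⟨(φ.1 (cs P), φ.1 (ct P)), (hmem _).2 ⟨⟨φ.2 _, φ.2 _⟩, hom_root φ.1⟩⟩
      invFun := fun z => ⟨pt P z.1.1 z.1.2 ((hmem _).1 z.2).2, ?_⟩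
      left_inv := fun φ => Subtype.ext (hom_ext (by simp [pt_cs]) (by simp [pt_ct]))
      right_inv := fun z => Subtype.ext (by simp [pt_cs, pt_ct]) }
  obtain ⟨F, hF⟩ := exists_frob (k := k) (AlgebraicClosure k) n
  have hz := (hmem _).1 z.2
  have : F.comp (pt P z.1.1 z.1.2 hz.2) = pt P z.1.1 z.1.2 hz.2 := by
    apply hom_ext
    · rw [AlgHom.comp_apply, pt_cs, hF, hz.1.1]
    · rw [AlgHom.comp_apply, pt_ct, hF, hz.1.2]
  intro a
  rw [← hF]
  exact DFunLike.congr_fun this a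

theorem Npt_bound {d : ℕ} {P : k[X][Y]} (hG : Good d P) (hd : 2 ≤ d) :
    ∃ C : ℕ, ∀ n, 1 ≤ n → |(Npt k (AdjoinRoot P) n : ℝ) - (Fintype.card k : ℝ) ^ n| ≤
      C * (Real.sqrt (Fintype.card k)) ^ n := by
  classical
  obtain ⟨p, hp⟩ := CharP.exists k
  haveI := Fact.mk (CharP.char_is_prime k p)
  have hpp : p.Prime := Fact.out
  obtain ⟨m, -, hm⟩ := FiniteField.card k p
  haveI : CharP (AlgebraicClosure k) p :=
    charP_of_injective_algebraMap (algebraMap k (AlgebraicClosure k)).injective p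
  obtain ⟨n0, U, H⟩ := count_L p (hG.map (algebraMap k (AlgebraicClosure k))) hd
  set q := Fintype.card k with hq
  have hq1 : 1 < q := Fintype.one_lt_card
  refine ⟨U * p + (p * n0 ^ 2) ^ 2, fun n hn => ?_⟩
  rw [Npt_eq P n (by omega)]
  set P' := P.map (mapRingHom (algebraMap k (AlgebraicClosure k))) with hP'
  have hqn : q ^ n = p ^ (m * n) := by rw [hm, pow_mul]
  have hs : (Real.sqrt q) ^ n = Real.sqrt ((q:ℝ) ^ n) := by
    rw [Real.sqrt_eq_rpow, Real.sqrt_eq_rpow, ← Real.rpow_natCast, ← Real.rpow_natCast, ← Real.rpow_mul (by positivity),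
      ← Real.rpow_mul (by positivity), mul_comm]
  have hs1 : 1 ≤ (Real.sqrt q) ^ n := by
    rw [hs, Real.one_le_sqrt]
    exact one_le_pow₀ (by exact_mod_cast hq1.le)
  have hmn : (m : ℕ) * n ≠ 0 := mul_ne_zero m.pos.ne' (by omega)
  by_cases hn0 : n0 ≤ p ^ (m * n / 2)
  · obtain ⟨h1, h2⟩ := H (m * n) hn0 hmn (by
      intro x y hx hy
      rw [fib_map] at hy ⊢
      obtain ⟨F, hF⟩ := exists_frob (k := k) (AlgebraicClosure k) n
      rw [← hq, hqn] at hF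
      rw [← hF]
      have hcomp : ((F : AlgebraicClosure k →+* AlgebraicClosure k).comp ((aeval x : k[X] →ₐ[k] AlgebraicClosure k) : k[X] →+* AlgebraicClosure k)) = ((aeval x : k[X] →ₐ[k] AlgebraicClosure k) : k[X] →+* AlgebraicClosure k) := by
        apply Polynomial.ringHom_ext
        · intro a; simp
        · simp [hF, hx]
      have := congrArg F hy
      rw [map_zero] at this
      have h2 := hom_eval₂ P ((aeval x : k[X] →ₐ[k] AlgebraicClosure k) : k[X] →+* AlgebraicClosure k) (F : AlgebraicClosure k →+* AlgebraicClosure k) y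
      rw [hcomp] at h2
      exact h2.symm.trans this)
    rw [← hqn] at h1 h2
    have h3 : ((p ^ (m * n - m * n / 2) : ℕ) : ℝ) ≤ p * (Real.sqrt q) ^ n := by
      rw [hs, ← Real.sqrt_sq (show (0:ℝ) ≤ p by positivity), ← Real.sqrt_mul (by positivity)]
      apply Real.le_sqrt_of_sq_le
      rw [← Nat.cast_pow (p ^ _), ← Nat.cast_pow q, ← Nat.cast_pow p 2, ← Nat.cast_mul, Nat.cast_le, hqn, ← pow_mul, ← pow_add]
      exact Nat.pow_le_pow_right hpp.pos (by omega)
    have h4 : (U:ℝ) * ((p ^ (m * n - m * n / 2) : ℕ) : ℝ) ≤ U * (p * (Real.sqrt q) ^ n) :=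
      mul_le_mul_of_nonneg_left h3 (by positivity)
    have h1' : ((ptsQ P' (q ^ n)).card : ℝ) ≤ (q:ℝ) ^ n + U * ((p ^ (m * n - m * n / 2) : ℕ) : ℝ) := by exact_mod_cast h1
    have h2' : (q:ℝ) ^ n ≤ ((ptsQ P' (q ^ n)).card : ℝ) + U * ((p ^ (m * n - m * n / 2) : ℕ) : ℝ) := by exact_mod_cast h2
    have h5 : (0:ℝ) ≤ (p * n0 ^ 2 : ℕ) ^ 2 * (Real.sqrt q) ^ n := by positivity
    push_cast at h5 ⊢
    rw [abs_le]
    constructor <;> nlinarith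
  · push Not at hn0
    have h1 : q ^ n ≤ p * n0 ^ 2 := by
      rw [hqn]
      calc p ^ (m * n) ≤ p ^ (1 + (m * n / 2 + m * n / 2)) := Nat.pow_le_pow_right hpp.pos (by omega)
        _ = p * (p ^ (m * n / 2)) ^ 2 := by rw [pow_add, pow_add]; ring
        _ ≤ p * n0 ^ 2 := by gcongr
    have h2 : (ptsQ P' (q ^ n)).card ≤ (q ^ n) ^ 2 := by
      rw [ptsQ]
      refine (Finset.card_filter_le _ _).trans ?_
      rw [Finset.card_product, hqn, card_FQ p _ hmn, sq]
    have h3 : (ptsQ P' (q ^ n)).card ≤ (p * n0 ^ 2) ^ 2 := h2.trans (Nat.pow_le_pow_left h1 2)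
    have h4 : q ^ n ≤ (p * n0 ^ 2) ^ 2 := h1.trans (Nat.le_self_pow two_ne_zero _)
    have h3' : ((ptsQ P' (q ^ n)).card : ℝ) ≤ ((p * n0 ^ 2) ^ 2 : ℕ) := by exact_mod_cast h3
    have h4' : (q:ℝ) ^ n ≤ ((p * n0 ^ 2) ^ 2 : ℕ) := by exact_mod_cast h4
    have h5 : (0:ℝ) ≤ ((p * n0 ^ 2) ^ 2 : ℕ) := by positivity
    have h6 : (((p * n0 ^ 2) ^ 2 : ℕ) : ℝ) ≤ ((p * n0 ^ 2) ^ 2 : ℕ) * (Real.sqrt q) ^ n := le_mul_of_one_le_right h5 hs1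
    have h7 : (0:ℝ) ≤ (U * p : ℕ) * (Real.sqrt q) ^ n := by positivity
    have h8 : (0:ℝ) ≤ (q:ℝ) ^ n := by positivity
    have h9 : (0:ℝ) ≤ ((ptsQ P' (q ^ n)).card : ℝ) := by positivity
    rw [Nat.cast_add, add_mul, abs_le]
    constructor <;> linarith

end

end NTW


namespace NTW

open Polynomial Polynomial.Bivariate

section chi

variable {G : Type*} [AddCommGroup G]

theorem chi_aux {U' U : AddSubgroup G} (h : U' ≤ U) (W : AddSubgroup G) :
    U'.relIndex U = U'.relIndex (U ⊓ W) * (U' ⊔ W).relIndex (U ⊔ W) := by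
  have hV : U ⊓ (U' ⊔ W) = U' ⊔ (U ⊓ W) := by
    rw [inf_comm, sup_inf_assoc_of_le W h, inf_comm W U]
  have h1 : U'.relIndex (U ⊓ (U' ⊔ W)) = U'.relIndex (U ⊓ W) := by
    rw [hV, AddSubgroup.relIndex_sup_left]
  have h2 : (U' ⊔ W).relIndex (U ⊔ W) = (U ⊓ (U' ⊔ W)).relIndex U := by
    rw [inf_comm, AddSubgroup.inf_relIndex_right]
    have : U ⊔ W = U ⊔ (U' ⊔ W) := by rw [← sup_assoc, sup_of_le_left h]
    rw [this, AddSubgroup.relIndex_sup_right]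
  rw [h2, ← h1]
  exact (AddSubgroup.relIndex_mul_relIndex _ _ _ (le_inf h le_sup_left) inf_le_left).symm

/-- multiplicative Euler characteristic of two subgroups -/
noncomputable def chi (U W : AddSubgroup G) : ℚ := (Nat.card (U ⊓ W : AddSubgroup G) : ℚ) / (U ⊔ W).index

/-- both parts of the Euler characteristic are finite -/
def Fchi (U W : AddSubgroup G) : Prop := Nat.card (U ⊓ W : AddSubgroup G) ≠ 0 ∧ (U ⊔ W).index ≠ 0

theorem chi_left {U' U W : AddSubgroup G} (h : U' ≤ U) (hr : U'.relIndex U ≠ 0) (hf : Fchi U W) :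
    Fchi U' W ∧ chi U W = chi U' W * U'.relIndex U := by
  have h0 := chi_aux h W
  have h1 : U'.relIndex (U ⊓ W) * Nat.card (U' ⊓ W : AddSubgroup G) = Nat.card (U ⊓ W : AddSubgroup G) := by
    rw [← AddSubgroup.relIndex_bot_left (U ⊓ W), ← AddSubgroup.relIndex_bot_left (U' ⊓ W),
      ← AddSubgroup.inf_relIndex_right U', ← inf_assoc, inf_of_le_left h, mul_comm]
    exact AddSubgroup.relIndex_mul_relIndex _ _ _ bot_le (inf_le_inf_right _ h)
  have h2 : (U' ⊔ W).relIndex (U ⊔ W) * (U ⊔ W).index = (U' ⊔ W).index :=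
    AddSubgroup.relIndex_mul_index (sup_le_sup_right h _)
  rw [h0] at hr
  have ha := left_ne_zero_of_mul hr
  have hb := right_ne_zero_of_mul hr
  obtain ⟨hf1, hf2⟩ := hf
  have h3 : Fchi U' W := by
    refine ⟨?_, ?_⟩
    · rw [← h1] at hf1; exact right_ne_zero_of_mul hf1
    · rw [← h2]; exact mul_ne_zero hb hf2
  refine ⟨h3, ?_⟩
  rw [chi, chi, h0, ← h1, ← h2]
  push_cast
  have hb' : ((U' ⊔ W).relIndex (U ⊔ W) : ℚ) ≠ 0 := by exact_mod_cast hb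
  have hf2' : ((U ⊔ W).index : ℚ) ≠ 0 := by exact_mod_cast hf2
  field_simp

theorem chi_comm (U W : AddSubgroup G) : chi U W = chi W U := by
  rw [chi, chi, inf_comm, sup_comm]

theorem Fchi_comm {U W : AddSubgroup G} (h : Fchi U W) : Fchi W U := by
  rw [Fchi, inf_comm, sup_comm]; exact h

theorem chi_right {U W' W : AddSubgroup G} (h : W' ≤ W) (hr : W'.relIndex W ≠ 0) (hf : Fchi U W) :
    Fchi U W' ∧ chi U W = chi U W' * W'.relIndex W := by
  have := chi_left h hr (Fchi_comm hf)
  exact ⟨Fchi_comm this.1, by rw [chi_comm, this.2, chi_comm]⟩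

theorem chi_left' {U' U W : AddSubgroup G} (h : U' ≤ U) (hr : U'.relIndex U ≠ 0) (hf : Fchi U' W) :
    Fchi U W := by
  have h0 := chi_aux h W
  have h1 : U'.relIndex (U ⊓ W) * Nat.card (U' ⊓ W : AddSubgroup G) = Nat.card (U ⊓ W : AddSubgroup G) := by
    rw [← AddSubgroup.relIndex_bot_left (U ⊓ W), ← AddSubgroup.relIndex_bot_left (U' ⊓ W),
      ← AddSubgroup.inf_relIndex_right U', ← inf_assoc, inf_of_le_left h, mul_comm]
    exact AddSubgroup.relIndex_mul_relIndex _ _ _ bot_le (inf_le_inf_right _ h)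
  have h2 : (U' ⊔ W).relIndex (U ⊔ W) * (U ⊔ W).index = (U' ⊔ W).index :=
    AddSubgroup.relIndex_mul_index (sup_le_sup_right h _)
  rw [h0] at hr
  have ha := left_ne_zero_of_mul hr
  have hb := right_ne_zero_of_mul hr
  obtain ⟨hf1, hf2⟩ := hf
  refine ⟨?_, ?_⟩
  · rw [← h1]; exact mul_ne_zero ha hf1
  · rw [← h2] at hf2; exact right_ne_zero_of_mul hf2

theorem chi_right' {U W' W : AddSubgroup G} (h : W' ≤ W) (hr : W'.relIndex W ≠ 0) (hf : Fchi U W') :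
    Fchi U W := Fchi_comm (chi_left' h hr (Fchi_comm hf))

theorem chi_mono {U' U W' W : AddSubgroup G} (h : U' ≤ U) (h' : W' ≤ W) (hf : Fchi U W) (hf' : Fchi U' W') :
    chi U' W' ≤ chi U W := by
  rw [chi, chi]
  have h1 : Nat.card (U' ⊓ W' : AddSubgroup G) ≤ Nat.card (U ⊓ W : AddSubgroup G) := by
    haveI := Nat.finite_of_card_ne_zero hf.1
    exact Nat.card_mono (Set.toFinite _) (inf_le_inf h h')
  have h2 : (U ⊔ W).index ≤ (U' ⊔ W').index :=
    Nat.le_of_dvd (Nat.pos_of_ne_zero hf'.2) (AddSubgroup.index_dvd_of_le (sup_le_sup h h'))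
  have h3 : 0 < (U ⊔ W).index := Nat.pos_of_ne_zero hf.2
  gcongr

theorem chi_map (e : G →+ G) (he : Function.Bijective e) (U W : AddSubgroup G) :
    chi (U.map e) (W.map e) = chi U W ∧ (Fchi (U.map e) (W.map e) ↔ Fchi U W) := by
  have h1 : Nat.card (U.map e ⊓ W.map e : AddSubgroup G) = Nat.card (U ⊓ W : AddSubgroup G) := by
    rw [← AddSubgroup.map_inf _ _ _ he.1]
    exact AddSubgroup.card_map_of_injective he.1
  have h2 : (U.map e ⊔ W.map e).index = (U ⊔ W).index := by
    rw [← AddSubgroup.map_sup, AddSubgroup.index_map_of_bijective he]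
  simp only [chi, Fchi, h1, h2, true_and]

end chi

open Submodule in
theorem cardQuot_mul' {S : Type*} [CommRing S] [IsDedekindDomain S] [Infinite S] (I J : Ideal S) :
    cardQuot (I * J) = cardQuot I * cardQuot J := by
  exact UniqueFactorizationMonoid.multiplicative_of_coprime cardQuot I J (cardQuot_bot _ _)
      (fun {I J} hI => by simp [Ideal.isUnit_iff.mp hI, Ideal.mul_top])
      (fun {I} i hI =>
        have : Ideal.IsPrime I := Ideal.isPrime_of_prime hI
        cardQuot_pow_of_prime hI.ne_zero)
      fun {I J} hIJ => cardQuot_mul_of_coprime <| Ideal.isCoprime_iff_sup_eq.mpr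
        (Ideal.isUnit_iff.mp
          (hIJ (Ideal.dvd_iff_le.mpr le_sup_left) (Ideal.dvd_iff_le.mpr le_sup_right)))

section lat

variable {K A : Type*} [Field K] [CommRing A] [Algebra A K]

/-- image of an ideal in the field, scaled by `z` -/
noncomputable def lat (z : K) (I : Ideal A) : AddSubgroup K :=
  (I.toAddSubgroup.map (algebraMap A K).toAddMonoidHom).map (AddMonoidHom.mulLeft z)

theorem mem_lat {z : K} {I : Ideal A} {x : K} : x ∈ lat z I ↔ ∃ a ∈ I, x = z * algebraMap A K a := by
  simp only [lat, AddSubgroup.mem_map]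
  constructor
  · rintro ⟨_, ⟨a, ha, rfl⟩, rfl⟩; exact ⟨a, ha, rfl⟩
  · rintro ⟨a, ha, rfl⟩; exact ⟨_, ⟨a, ha, rfl⟩, rfl⟩

theorem lat_mul (z w : K) (I : Ideal A) : (lat w I).map (AddMonoidHom.mulLeft z) = lat (z * w) I := by
  ext x
  simp only [AddSubgroup.mem_map, mem_lat]
  constructor
  · rintro ⟨_, ⟨a, ha, rfl⟩, rfl⟩; exact ⟨a, ha, by simp [mul_assoc]⟩
  · rintro ⟨a, ha, rfl⟩; exact ⟨_, ⟨a, ha, rfl⟩, by simp [mul_assoc]⟩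

theorem mulLeft_bij {z : K} (hz : z ≠ 0) : Function.Bijective (AddMonoidHom.mulLeft z) :=
  ⟨mul_right_injective₀ hz, fun x => ⟨z⁻¹ * x, by simp [hz]⟩⟩

theorem lat_mono (z : K) {I J : Ideal A} (h : I ≤ J) : lat z I ≤ lat z J := by
  intro x hx
  obtain ⟨a, ha, rfl⟩ := mem_lat.1 hx
  exact mem_lat.2 ⟨a, h ha, rfl⟩

theorem relIndex_lat (hinj : Function.Injective (algebraMap A K)) {z : K} (hz : z ≠ 0) (I : Ideal A) :
    (lat z I).relIndex (lat z (⊤ : Ideal A)) = I.cardQuot := by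
  rw [lat, lat, AddSubgroup.relIndex_map_map_of_injective _ _ (mulLeft_bij hz).1,
    AddSubgroup.relIndex_map_map_of_injective _ _ hinj]
  exact AddSubgroup.relIndex_top_right _

theorem lat_span (z : K) (a : A) : lat z (Ideal.span {a}) = lat (z * algebraMap A K a) (⊤ : Ideal A) := by
  ext x
  simp only [mem_lat, Ideal.mem_span_singleton']
  constructor
  · rintro ⟨_, ⟨b, rfl⟩, rfl⟩; exact ⟨b, trivial, by rw [map_mul]; ring⟩
  · rintro ⟨b, -, rfl⟩; exact ⟨_, ⟨b, rfl⟩, by rw [map_mul]; ring⟩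

end lat

/-- abstract data of a curve with affine ring `A` and ring at infinity `O` -/
structure Curve (k K A O : Type*) [Field k] [Fintype k] [Field K] [CommRing A] [CommRing O] [Algebra A K] [Algebra O K]
    [Algebra k K] (s : K) (d g : ℕ) : Prop where
  hd : 3 ≤ d
  hdg : (d : ℤ) * (d - 3) = 2 * g - 2
  s0 : s ≠ 0
  injA : Function.Injective (algebraMap A K)
  injO : Function.Injective (algebraMap O K)
  linA : ∀ (c : k) (a : A), ∃ b : A, algebraMap A K b = c • algebraMap A K a
  linO : ∀ (c : k) (a : O), ∃ b : O, algebraMap O K b = c • algebraMap O K a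
  exhO : ∀ y : K, ∃ (n : ℕ) (o : O), y = s ^ n * algebraMap O K o
  finA : ∀ I : Ideal A, I ≠ ⊥ → I.cardQuot ≠ 0
  finO : ∀ I : Ideal O, I ≠ ⊥ → I.cardQuot ≠ 0
  euler : ∀ m : ℤ, Fchi (lat 1 (⊤ : Ideal A)) (lat (s ^ m) (⊤ : Ideal O)) ∧
    NTW.chi (lat 1 (⊤ : Ideal A)) (lat (s ^ m) (⊤ : Ideal O)) = (Fintype.card k : ℚ) ^ ((d:ℤ) * m + 1 - g)
  triv : ∀ m : ℤ, m < 0 → lat 1 (⊤ : Ideal A) ⊓ lat (s ^ m) (⊤ : Ideal O) = ⊥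
  lam : ∃ l : K →ₗ[k] k, (∀ a : A, l (algebraMap A K a) = 0) ∧ (∀ o : O, l (s ^ (d - 3) * algebraMap O K o) = 0) ∧
    (∀ w, (∀ a : A, l (w * algebraMap A K a) = 0) → ∃ a : A, w = algebraMap A K a) ∧
    (∀ w, (∀ o : O, l (w * algebraMap O K o) = 0) → ∃ o : O, w = s ^ (d - 3) * algebraMap O K o)

end NTW


namespace NTW

open Polynomial Polynomial.Bivariate

section

variable {k K A O : Type*} [Field k] [Fintype k] [Field K] [CommRing A] [CommRing O] [Algebra A K] [Algebra O K]
    [Algebra k K] {s : K} {d g : ℕ}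

theorem Curve.chi_ideal (C : Curve k K A O s d g) {I : Ideal A} {J : Ideal O} (hI : I ≠ ⊥) (hJ : J ≠ ⊥) (m : ℤ) :
    Fchi (lat 1 I : AddSubgroup K) (lat (s ^ m) J) ∧
      chi (lat 1 I : AddSubgroup K) (lat (s ^ m) J) * (I.cardQuot * J.cardQuot) =
        (Fintype.card k : ℚ) ^ ((d:ℤ) * m + 1 - g) := by
  obtain ⟨h1, h2⟩ := C.euler m
  have hs : s ^ m ≠ 0 := zpow_ne_zero _ C.s0
  have e1 := relIndex_lat C.injA one_ne_zero I
  have e2 := relIndex_lat C.injO hs J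
  obtain ⟨h3, h4⟩ := chi_left (lat_mono (1:K) (le_top : I ≤ ⊤)) (by rw [e1]; exact C.finA I hI) h1
  obtain ⟨h5, h6⟩ := chi_right (lat_mono (s ^ m) (le_top : J ≤ ⊤)) (by rw [e2]; exact C.finO J hJ) h3
  refine ⟨h5, ?_⟩
  rw [← h2, h4, h6, e1, e2]; ring

/-- a lattice sum as a `k`-submodule -/
theorem Curve.exists_submodule (C : Curve k K A O s d g) (m : ℤ) :
    ∃ U : Submodule k K, U.toAddSubgroup = lat 1 (⊤ : Ideal A) ⊔ lat (s ^ m) (⊤ : Ideal O) := by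
  refine ⟨{ (lat 1 (⊤ : Ideal A) ⊔ lat (s ^ m) (⊤ : Ideal O) : AddSubgroup K) with smul_mem' := ?_ }, ?_⟩
  · intro c x hx
    change x ∈ lat 1 (⊤ : Ideal A) ⊔ lat (s ^ m) (⊤ : Ideal O) at hx
    change c • x ∈ lat 1 (⊤ : Ideal A) ⊔ lat (s ^ m) (⊤ : Ideal O)
    obtain ⟨y, hy, z, hz, rfl⟩ := AddSubgroup.mem_sup.1 hx
    obtain ⟨a, -, rfl⟩ := mem_lat.1 hy
    obtain ⟨b, -, rfl⟩ := mem_lat.1 hz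
    obtain ⟨a', ha'⟩ := C.linA c a
    obtain ⟨b', hb'⟩ := C.linO c b
    refine AddSubgroup.mem_sup.2 ⟨_, mem_lat.2 ⟨a', trivial, rfl⟩, _, mem_lat.2 ⟨b', trivial, rfl⟩, ?_⟩
    rw [ha', hb', smul_add, mul_smul_comm, mul_smul_comm]
  · rfl

theorem Curve.lam_inj (C : Curve k K A O s d g) {l : K →ₗ[k] k}
    (h3 : ∀ w, (∀ a : A, l (w * algebraMap A K a) = 0) → ∃ a : A, w = algebraMap A K a)
    (h4 : ∀ w, (∀ o : O, l (w * algebraMap O K o) = 0) → ∃ o : O, w = s ^ (d - 3) * algebraMap O K o)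
    {w : K} (hw : ∀ y, l (w * y) = 0) : w = 0 := by
  by_contra h0
  have h := C.triv (-1) (by norm_num)
  have : (1:K) ∈ lat 1 (⊤ : Ideal A) ⊓ lat (s ^ (-1:ℤ)) (⊤ : Ideal O) := by
    constructor
    · obtain ⟨a, ha⟩ := h3 1 (fun a => by
        have := hw (w⁻¹ * algebraMap A K a); rwa [mul_inv_cancel_left₀ h0, ← one_mul (algebraMap A K a)] at this)
      exact mem_lat.2 ⟨a, trivial, by rw [← ha, one_mul]⟩
    · obtain ⟨a, ha⟩ := h4 (s ^ (d - 3) * s) (fun a => by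
        have := hw (w⁻¹ * (s ^ (d - 3) * s * algebraMap O K a)); rwa [mul_inv_cancel_left₀ h0] at this)
      refine mem_lat.2 ⟨a, trivial, ?_⟩
      have := mul_left_cancel₀ (pow_ne_zero _ C.s0) ha
      rw [← this, zpow_neg_one, inv_mul_cancel₀ C.s0]
  rw [h] at this
  exact one_ne_zero ((AddSubgroup.mem_bot).1 this)

theorem Curve.repr (C : Curve k K A O s d g) {l : K →ₗ[k] k}
    (h1 : ∀ a : A, l (algebraMap A K a) = 0) (h2 : ∀ o : O, l (s ^ (d - 3) * algebraMap O K o) = 0)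
    (h3 : ∀ w, (∀ a : A, l (w * algebraMap A K a) = 0) → ∃ a : A, w = algebraMap A K a)
    (h4 : ∀ w, (∀ o : O, l (w * algebraMap O K o) = 0) → ∃ o : O, w = s ^ (d - 3) * algebraMap O K o)
    {n : ℤ} (hn : n < 0) (φ : K →ₗ[k] k) (hA : ∀ a : A, φ (algebraMap A K a) = 0)
    (hO : ∀ o : O, φ (s ^ n * algebraMap O K o) = 0) : ∃ w, ∀ y, φ y = l (w * y) := by
  classical
  obtain ⟨U, hU⟩ := C.exists_submodule n
  have memU : ∀ {x}, x ∈ U ↔ x ∈ lat 1 (⊤ : Ideal A) ⊔ lat (s ^ n) (⊤ : Ideal O) := by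
    intro x; rw [← hU]; rfl
  have vanish : ∀ ψ : K →ₗ[k] k, (∀ a : A, ψ (algebraMap A K a) = 0) →
      (∀ o : O, ψ (s ^ n * algebraMap O K o) = 0) → ψ ∈ U.dualAnnihilator := by
    intro ψ ha ho
    rw [Submodule.mem_dualAnnihilator]
    intro x hx
    obtain ⟨y, hy, z, hz, rfl⟩ := AddSubgroup.mem_sup.1 (memU.1 hx)
    obtain ⟨a, -, rfl⟩ := mem_lat.1 hy
    obtain ⟨b, -, rfl⟩ := mem_lat.1 hz
    rw [map_add, one_mul, ha, ho, add_zero]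
  set M : ℤ := d - 3 - n with hM
  let B : AddSubgroup K := lat 1 (⊤ : Ideal A) ⊓ lat (s ^ M) (⊤ : Ideal O)
  obtain ⟨⟨c1, c2⟩, c3⟩ := C.euler M
  obtain ⟨⟨e1, e2⟩, e3⟩ := C.euler n
  have hq : (1:ℚ) < Fintype.card k := by exact_mod_cast Fintype.one_lt_card
  -- cardinalities
  have hcB : (U.toAddSubgroup.index : ℚ) ≤ Nat.card B := by
    rw [hU]
    rw [chi, C.triv n hn] at e3
    rw [chi] at c3
    have e2' : ((lat 1 (⊤ : Ideal A) ⊔ lat (s ^ n) (⊤ : Ideal O) : AddSubgroup K).index : ℚ) ≠ 0 := by exact_mod_cast e2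
    have c2' : (1:ℚ) ≤ ((lat 1 (⊤ : Ideal A) ⊔ lat (s ^ M) (⊤ : Ideal O) : AddSubgroup K).index : ℚ) := by
      exact_mod_cast Nat.one_le_iff_ne_zero.2 c2
    rw [div_eq_iff (by positivity)] at c3
    rw [div_eq_iff e2', AddSubgroup.card_bot, Nat.cast_one] at e3
    have : ((lat 1 (⊤ : Ideal A) ⊔ lat (s ^ n) (⊤ : Ideal O) : AddSubgroup K).index : ℚ)
        = (Fintype.card k : ℚ) ^ ((d:ℤ) * M + 1 - g) := by
      have h5 : (d:ℤ) * M + 1 - g = -((d:ℤ) * n + 1 - g) := by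
        rw [hM]; linear_combination C.hdg
      rw [h5, zpow_neg]
      exact eq_inv_of_mul_eq_one_right e3.symm
    rw [this, c3]
    exact le_mul_of_one_le_right (by positivity) c2'
  have hidx : U.toAddSubgroup.index ≠ 0 := by rw [hU]; exact e2
  haveI : Finite (K ⧸ U) := Nat.finite_of_card_ne_zero hidx
  haveI : Finite (Module.Dual k (K ⧸ U)) := Module.finite_of_finite k
  haveI : Finite U.dualAnnihilator := Finite.of_equiv _ U.dualQuotEquivDualAnnihilator.toEquiv
  have hcU : Nat.card U.dualAnnihilator = U.toAddSubgroup.index := by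
    rw [← Nat.card_congr U.dualQuotEquivDualAnnihilator.toEquiv]
    change _ = Nat.card (K ⧸ U)
    rw [Module.natCard_eq_pow_finrank (K := k), Module.natCard_eq_pow_finrank (K := k) (V := K ⧸ U), Subspace.dual_finrank_eq]
  haveI : Finite B := Nat.finite_of_card_ne_zero c1
  let Φ : B → U.dualAnnihilator := fun w => ⟨l.comp (LinearMap.mulLeft k (w:K)), by
    obtain ⟨hw1, hw2⟩ := w.2
    obtain ⟨a, -, ha⟩ := mem_lat.1 hw1
    obtain ⟨b, -, hb⟩ := mem_lat.1 hw2
    apply vanish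
    · intro a'
      rw [LinearMap.comp_apply, LinearMap.mulLeft_apply, ha, one_mul, ← map_mul, h1]
    · intro o
      rw [LinearMap.comp_apply, LinearMap.mulLeft_apply, hb]
      have : s ^ M * algebraMap O K b * (s ^ n * algebraMap O K o) = s ^ (d - 3) * algebraMap O K (b * o) := by
        have h6 : s ^ (d - 3) = s ^ M * s ^ n := by
          rw [← zpow_add₀ C.s0, ← zpow_natCast]
          congr 1
          have := C.hd
          rw [hM]; push_cast [this]; ring
        rw [h6, map_mul]; ring
      rw [this, h2]⟩
  have hΦ : Function.Injective Φ := by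
    intro w w' hww
    have h7 : l.comp (LinearMap.mulLeft k (w:K)) = l.comp (LinearMap.mulLeft k (w':K)) := congrArg Subtype.val hww
    apply Subtype.ext
    rw [← sub_eq_zero]
    apply C.lam_inj h3 h4
    intro y
    have := LinearMap.congr_fun h7 y
    simp only [LinearMap.comp_apply, LinearMap.mulLeft_apply] at this
    rw [sub_mul, map_sub, this, sub_self]
  have hbij : Function.Bijective Φ := by
    apply hΦ.bijective_of_nat_card_le
    rw [hcU]; exact_mod_cast hcB
  obtain ⟨w, hw⟩ := hbij.2 ⟨φ, vanish φ hA hO⟩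
  refine ⟨w, fun y => ?_⟩
  have := LinearMap.congr_fun (congrArg Subtype.val hw) y
  exact this.symm

/-- nonspeciality -/
theorem Curve.sup_eq_top (C : Curve k K A O s d g) {I : Ideal A} {J : Ideal O} (hI : I ≠ ⊥) (hJ : J ≠ ⊥) (m : ℤ)
    (hlinI : ∀ (c : k), ∀ a ∈ I, ∃ b ∈ I, algebraMap A K b = c • algebraMap A K a)
    (hlinJ : ∀ (c : k), ∀ a ∈ J, ∃ b ∈ J, algebraMap O K b = c • algebraMap O K a)
    (hdeg : (I.cardQuot * J.cardQuot : ℚ) * (Fintype.card k : ℚ) ^ (2 * (g:ℤ) - 1) ≤ (Fintype.card k : ℚ) ^ ((d:ℤ) * m)) :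
    (lat 1 I ⊔ lat (s ^ m) J : AddSubgroup K) = ⊤ := by
  classical
  by_contra htop
  obtain ⟨l, h1, h2, h3, h4⟩ := C.lam
  -- submodule
  let U : Submodule k K := { (lat 1 I ⊔ lat (s ^ m) J : AddSubgroup K) with
    smul_mem' := by
      intro c x hx
      change x ∈ (lat 1 I ⊔ lat (s ^ m) J : AddSubgroup K) at hx
      change c • x ∈ (lat 1 I ⊔ lat (s ^ m) J : AddSubgroup K)
      obtain ⟨y, hy, z, hz, rfl⟩ := AddSubgroup.mem_sup.1 hx
      obtain ⟨a, ha, rfl⟩ := mem_lat.1 hy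
      obtain ⟨b, hb, rfl⟩ := mem_lat.1 hz
      obtain ⟨a', ha, ha'⟩ := hlinI c a ha
      obtain ⟨b', hb, hb'⟩ := hlinJ c b hb
      refine AddSubgroup.mem_sup.2 ⟨_, mem_lat.2 ⟨a', ha, rfl⟩, _, mem_lat.2 ⟨b', hb, rfl⟩, ?_⟩
      rw [ha', hb', smul_add, mul_smul_comm, mul_smul_comm] }
  have memU : ∀ {x}, x ∈ U ↔ x ∈ (lat 1 I ⊔ lat (s ^ m) J : AddSubgroup K) := fun {x} => Iff.rfl
  have hUtop : U < ⊤ := by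
    rw [lt_top_iff_ne_top]
    intro h
    apply htop
    rw [eq_top_iff]
    intro x _
    exact memU.1 (h ▸ Submodule.mem_top)
  obtain ⟨φ, hφ0, hφ⟩ := Submodule.exists_le_ker_of_lt_top U hUtop
  have hφI : ∀ a ∈ I, φ (algebraMap A K a) = 0 := fun a ha =>
    hφ (memU.2 (AddSubgroup.mem_sup_left (mem_lat.2 ⟨a, ha, by rw [one_mul]⟩)))
  have hφJ : ∀ a ∈ J, φ (s ^ m * algebraMap O K a) = 0 := fun a ha =>
    hφ (memU.2 (AddSubgroup.mem_sup_right (mem_lat.2 ⟨a, ha, rfl⟩)))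
  obtain ⟨x, hxI, hx0⟩ := Submodule.exists_mem_ne_zero_of_ne_bot hI
  obtain ⟨j, hjJ, hj0⟩ := Submodule.exists_mem_ne_zero_of_ne_bot hJ
  have hx0' : algebraMap A K x ≠ 0 := by rwa [Ne, map_eq_zero_iff _ C.injA]
  have hj0' : algebraMap O K j ≠ 0 := by rwa [Ne, map_eq_zero_iff _ C.injO]
  obtain ⟨e, o, he⟩ := C.exhO (algebraMap A K x * s ^ (-1 - |m| - m) / algebraMap O K j)
  have hn : -1 - |m| - e < 0 := by have := abs_nonneg m; omega
  obtain ⟨w, hw⟩ := C.repr h1 h2 h3 h4 hn (φ.comp (LinearMap.mulLeft k (algebraMap A K x)))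
    (fun a => by
      rw [LinearMap.comp_apply, LinearMap.mulLeft_apply, ← map_mul]
      exact hφI _ (I.mul_mem_right _ hxI))
    (fun o' => by
      rw [LinearMap.comp_apply, LinearMap.mulLeft_apply]
      have h5 : algebraMap A K x * (s ^ (-1 - |m| - e) * algebraMap O K o') = s ^ m * algebraMap O K (j * (o * o')) := by
        rw [div_eq_iff hj0'] at he
        have h6 : s ^ (-1 - |m| - e) = s ^ (-1 - |m| - m) * s ^ m * (s ^ e)⁻¹ := by
          rw [← zpow_add₀ C.s0, ← zpow_natCast, ← zpow_neg, ← zpow_add₀ C.s0]; congr 1; ring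
        have hse : s ^ e ≠ 0 := pow_ne_zero _ C.s0
        calc _ = (algebraMap A K x * s ^ (-1 - |m| - m)) * (s ^ m * (s ^ e)⁻¹ * algebraMap O K o') := by rw [h6]; ring
          _ = _ := by rw [he, map_mul, map_mul]; field_simp
      rw [h5]
      exact hφJ _ (J.mul_mem_right _ hjJ))
  set z := w / algebraMap A K x with hz
  have hφz : ∀ y, φ y = l (z * y) := by
    intro y
    have := hw ((algebraMap A K x)⁻¹ * y)
    rw [LinearMap.comp_apply, LinearMap.mulLeft_apply, mul_inv_cancel_left₀ hx0'] at this
    rw [this, hz]; congr 1; ring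
  have hz0 : z ≠ 0 := by
    intro h
    apply hφ0
    ext y
    rw [hφz, h, zero_mul, map_zero, LinearMap.zero_apply]
  have hzI : (lat 1 I : AddSubgroup K).map (AddMonoidHom.mulLeft z) ≤ lat 1 (⊤ : Ideal A) := by
    rintro _ ⟨y, hy, rfl⟩
    obtain ⟨a, ha, rfl⟩ := mem_lat.1 hy
    obtain ⟨b, hb⟩ := h3 (z * algebraMap A K a) (fun a' => by
      rw [mul_assoc, ← hφz, ← map_mul]; exact hφI _ (I.mul_mem_right _ ha))
    exact mem_lat.2 ⟨b, trivial, by rw [one_mul, one_mul, ← hb]; rfl⟩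
  have hzJ : (lat (s ^ m) J : AddSubgroup K).map (AddMonoidHom.mulLeft z) ≤ lat (s ^ ((d - 3 : ℕ) : ℤ)) (⊤ : Ideal O) := by
    rintro _ ⟨y, hy, rfl⟩
    obtain ⟨a, ha, rfl⟩ := mem_lat.1 hy
    obtain ⟨b, hb⟩ := h4 (z * (s ^ m * algebraMap O K a)) (fun a' => by
      rw [mul_assoc, ← hφz, mul_assoc, ← map_mul]; exact hφJ _ (J.mul_mem_right _ ha))
    exact mem_lat.2 ⟨b, trivial, by rw [zpow_natCast, ← hb]; rfl⟩
  obtain ⟨c1, c2⟩ := C.chi_ideal hI hJ m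
  obtain ⟨m1, m2⟩ := chi_map _ (mulLeft_bij hz0) (lat 1 I : AddSubgroup K) (lat (s ^ m) J)
  obtain ⟨e1, e2⟩ := C.euler ((d - 3 : ℕ) : ℤ)
  have hle := chi_mono hzI hzJ e1 (m2.2 c1)
  rw [m1, e2] at hle
  have hq : (1:ℚ) < Fintype.card k := by exact_mod_cast Fintype.one_lt_card
  have hq0 : (0:ℚ) < Fintype.card k := by linarith
  have hexp : (d:ℤ) * ((d - 3 : ℕ) : ℤ) + 1 - g = g - 1 := by
    have := C.hd
    push_cast [this]; linear_combination C.hdg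
  rw [hexp] at hle
  have hN : (0:ℚ) < I.cardQuot * J.cardQuot := by
    have a1 := Nat.pos_of_ne_zero (C.finA I hI)
    have a2 := Nat.pos_of_ne_zero (C.finO J hJ)
    positivity
  have h8 := mul_le_mul_of_nonneg_right hle hN.le
  rw [c2] at h8
  set q : ℚ := (Fintype.card k : ℚ)
  have h9 : q ^ ((d:ℤ) * m + 1 - g) = q ^ ((d:ℤ) * m) * q ^ (1 - (g:ℤ)) := by
    rw [← zpow_add₀ hq0.ne']; congr 1; ring
  have h10 : q ^ (2 * (g:ℤ) - 1) * q ^ (1 - (g:ℤ)) = q ^ (g:ℤ) := by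
    rw [← zpow_add₀ hq0.ne']; congr 1; ring
  have h11 := mul_le_mul_of_nonneg_right hdeg (zpow_pos hq0 (1 - (g:ℤ))).le
  rw [← h9, mul_assoc, h10] at h11
  have h12 : q ^ (g:ℤ) ≤ q ^ ((g:ℤ) - 1) := by
    have := h11.trans h8
    rw [mul_comm] at this
    exact le_of_mul_le_mul_right this hN
  have h13 := (zpow_le_zpow_iff_right₀ hq).1 h12
  omega

theorem Curve.rr (C : Curve k K A O s d g) {I : Ideal A} {J : Ideal O} (hI : I ≠ ⊥) (hJ : J ≠ ⊥) (m : ℤ)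
    (hlinI : ∀ (c : k), ∀ a ∈ I, ∃ b ∈ I, algebraMap A K b = c • algebraMap A K a)
    (hlinJ : ∀ (c : k), ∀ a ∈ J, ∃ b ∈ J, algebraMap O K b = c • algebraMap O K a)
    (n n' : ℕ) (hIJ : I.cardQuot * J.cardQuot = Fintype.card k ^ n) (hm : (d:ℤ) * m = n + n') (hn' : 2 * g - 1 ≤ n')
    (hg : 1 ≤ g) :
    Nat.card (lat 1 I ⊓ lat (s ^ m) J : AddSubgroup K) = Fintype.card k ^ (n' + 1 - g) := by
  have hq : (1:ℚ) < Fintype.card k := by exact_mod_cast Fintype.one_lt_card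
  have hq0 : (0:ℚ) < Fintype.card k := by linarith
  have hIJ' : (I.cardQuot * J.cardQuot : ℚ) = (Fintype.card k : ℚ) ^ (n:ℤ) := by rw [zpow_natCast]; exact_mod_cast hIJ
  have ht := C.sup_eq_top hI hJ m hlinI hlinJ (by
    rw [hIJ', ← zpow_add₀ hq0.ne']
    apply zpow_le_zpow_right₀ hq.le
    rw [hm]; omega)
  obtain ⟨c1, c2⟩ := C.chi_ideal hI hJ m
  rw [chi, ht, AddSubgroup.index_top, Nat.cast_one, div_one, hIJ', ← eq_div_iff (zpow_pos hq0 _).ne', ← zpow_sub₀ hq0.ne'] at c2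
  have h1 : (d:ℤ) * m + 1 - g - n = ((n' + 1 - g : ℕ) : ℤ) := by rw [hm]; omega
  rw [h1, zpow_natCast] at c2
  exact_mod_cast c2

theorem Curve.principal (C : Curve k K A O s d g) (m : ℤ) (a : A) (o : O) (ha : a ≠ 0)
    (hao : algebraMap A K a = s ^ m * algebraMap O K o) :
    ((Ideal.span {a}).cardQuot * (Ideal.span {o}).cardQuot : ℚ) = (Fintype.card k : ℚ) ^ ((d:ℤ) * m) := by
  have ha' : algebraMap A K a ≠ 0 := by rwa [Ne, map_eq_zero_iff _ C.injA]
  have ho : o ≠ 0 := by rintro rfl; rw [map_zero, mul_zero] at hao; exact ha' hao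
  obtain ⟨c1, c2⟩ := C.chi_ideal (I := Ideal.span {a}) (J := Ideal.span {o}) (by simpa using ha) (by simpa using ho) m
  have hq0 : (0:ℚ) < Fintype.card k := by exact_mod_cast Fintype.card_pos
  rw [lat_span, lat_span, ← hao, one_mul, ← mul_one (algebraMap A K a)] at c2
  rw [← lat_mul, ← lat_mul, (chi_map _ (mulLeft_bij ha') _ _).1] at c2
  have c3 := (C.euler 0).2
  rw [zpow_zero] at c3
  rw [c3, mul_zero, zero_add] at c2
  have : (d:ℤ) * m + 1 - g = (1 - g) + d * m := by ring
  rw [this, zpow_add₀ hq0.ne'] at c2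
  exact mul_left_cancel₀ (zpow_pos hq0 _).ne' c2

end

end NTW


namespace NTW

section newton

variable {S : Type*} (deg : S → ℕ) (hpos : ∀ p, 0 < deg p) (hfin : ∀ n, {p | deg p ≤ n}.Finite)

/-- degree of an effective divisor -/
def dg (D : Multiset S) : ℕ := (D.map deg).sum

theorem dg_add (D E : Multiset S) : dg deg (D + E) = dg deg D + dg deg E := by simp [dg]

theorem dg_cons (p : S) (D : Multiset S) : dg deg (p ::ₘ D) = deg p + dg deg D := by simp [dg]

theorem dg_replicate (p : S) (e : ℕ) : dg deg (Multiset.replicate e p) = e * deg p := by simp [dg]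

include hpos in
theorem count_le_dg [DecidableEq S] (D : Multiset S) (p : S) : D.count p * deg p ≤ dg deg D := by
  obtain ⟨E, hE⟩ := Multiset.le_iff_exists_add.1 (Multiset.le_count_iff_replicate_le.1 (le_refl (D.count p)))
  conv_rhs => rw [hE, dg_add, dg_replicate]
  exact Nat.le_add_right _ _

include hpos hfin in
theorem finite_dg (n : ℕ) : {D : Multiset S | dg deg D = n}.Finite := by
  classical
  refine Set.Finite.subset ((n • (hfin n).toFinset.val).powerset.toFinset.finite_toSet) ?_
  intro D hD
  have hD : dg deg D = n := hD
  simp only [Finset.mem_coe, Multiset.mem_toFinset, Multiset.mem_powerset]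
  rw [Multiset.le_iff_count]
  intro p
  have h1 := count_le_dg deg hpos D p
  rw [hD] at h1
  by_cases hp : p ∈ D
  · have h2 : 0 < D.count p := Multiset.count_pos.2 hp
    have h3 : deg p ≤ n := le_trans (Nat.le_mul_of_pos_left _ h2) h1
    rw [Multiset.count_nsmul, Multiset.count_eq_one_of_mem (Finset.nodup _) (by simpa using h3), mul_one]
    exact le_trans (Nat.le_mul_of_pos_right _ (hpos p)) h1
  · rw [Multiset.count_eq_zero_of_notMem hp]; exact Nat.zero_le _

/-- number of effective divisors of degree n -/
noncomputable def An (n : ℕ) : ℕ := Nat.card {D : Multiset S // dg deg D = n}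

/-- the point counting function -/
noncomputable def Nn (j : ℕ) : ℕ := if j = 0 then 0 else ∑ᶠ p ∈ {p | deg p ∣ j}, deg p

include hpos hfin in
theorem newton (n : ℕ) : n * An deg n = ∑ x ∈ Finset.HasAntidiagonal.antidiagonal n, An deg x.1 * Nn deg x.2 := by
  classical
  let S' : Finset S := (hfin n).toFinset
  have hS' : ∀ p, p ∈ S' ↔ deg p ≤ n := fun p => by simp [S']
  let D' : ℕ → Finset (Multiset S) := fun n => (finite_dg deg hpos hfin n).toFinset
  have hD' : ∀ n D, D ∈ D' n ↔ dg deg D = n := fun n D => by simp [D']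
  have hAn : ∀ n, An deg n = (D' n).card := by
    intro n
    rw [An, ← Nat.card_eq_finsetCard]
    exact Nat.card_congr (Equiv.subtypeEquivRight (fun D => (hD' n D).symm))
  have hNn : ∀ j, j ≠ 0 → j ≤ n → Nn deg j = ∑ p ∈ S', if deg p ∣ j then deg p else 0 := by
    intro j hj hjn
    rw [Nn, if_neg hj, ← Finset.sum_filter]
    rw [← finsum_mem_coe_finset]
    apply finsum_mem_congr _ (fun _ _ => rfl)
    ext p
    simp only [Set.mem_setOf_eq, Finset.coe_filter, hS']
    constructor
    · intro h; exact ⟨(Nat.le_of_dvd (Nat.pos_of_ne_zero hj) h).trans hjn, h⟩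
    · exact fun h => h.2
  have hcount : ∀ p e, e * deg p ≤ n → ((D' n).filter (fun D => e ≤ D.count p)).card = (D' (n - e * deg p)).card := by
    intro p e he
    symm
    apply Finset.card_bij (fun D _ => Multiset.replicate e p + D)
    · intro D hD
      rw [hD'] at hD
      rw [Finset.mem_filter, hD', dg_add, dg_replicate, hD]
      refine ⟨by omega, ?_⟩
      simp
    · intro D _ E _ h; exact add_left_cancel h
    · intro D hD
      rw [Finset.mem_filter, hD'] at hD
      obtain ⟨E, hE⟩ := Multiset.le_iff_exists_add.1 (Multiset.le_count_iff_replicate_le.1 hD.2)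
      refine ⟨E, ?_, hE.symm⟩
      rw [hD', ← hD.1, hE, dg_add, dg_replicate]; omega
  have h1 : n * An deg n = ∑ p ∈ S', ∑ j ∈ Finset.Icc 1 n, if deg p ∣ j then deg p * (D' (n - j)).card else 0 := by
    have h2 : n * An deg n = ∑ D ∈ D' n, ∑ p ∈ S', D.count p * deg p := by
      rw [hAn, mul_comm, ← smul_eq_mul, ← Finset.sum_const]
      apply Finset.sum_congr rfl
      intro D hD
      rw [hD'] at hD
      conv_lhs => rw [← hD, dg, Finset.sum_multiset_map_count]
      apply Finset.sum_subset
      · intro p hp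
        rw [hS']
        have := count_le_dg deg hpos D p
        have h2 : 0 < D.count p := Multiset.count_pos.2 (Multiset.mem_toFinset.1 hp)
        rw [hD] at this
        exact le_trans (Nat.le_mul_of_pos_left _ h2) this
      · intro p _ hp
        rw [Multiset.mem_toFinset] at hp
        rw [Multiset.count_eq_zero_of_notMem hp, zero_smul]
    rw [h2, Finset.sum_comm]
    apply Finset.sum_congr rfl
    intro p hp
    have h3 : ∀ D ∈ D' n, D.count p * deg p = ∑ e ∈ Finset.Icc 1 n, if e ≤ D.count p then deg p else 0 := by
      intro D hD
      rw [hD'] at hD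
      have := count_le_dg deg hpos D p
      rw [hD] at this
      have h4 : D.count p ≤ n := le_trans (Nat.le_mul_of_pos_right _ (hpos p)) this
      rw [← Finset.sum_filter, Finset.sum_const, smul_eq_mul]
      congr 1
      have : (Finset.Icc 1 n).filter (fun e => e ≤ D.count p) = Finset.Icc 1 (D.count p) := by
        ext e; simp only [Finset.mem_filter, Finset.mem_Icc]; omega
      rw [this, Nat.card_Icc]; omega
    rw [Finset.sum_congr rfl h3, Finset.sum_comm]
    have h5 : ∀ e ∈ Finset.Icc 1 n, (∑ D ∈ D' n, if e ≤ D.count p then deg p else 0) =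
        if e * deg p ≤ n then deg p * (D' (n - e * deg p)).card else 0 := by
      intro e _
      rw [← Finset.sum_filter, Finset.sum_const, smul_eq_mul]
      split_ifs with h
      · rw [hcount p e h, mul_comm]
      · rw [Finset.card_eq_zero.2, zero_mul]
        apply Finset.filter_eq_empty_iff.2
        intro D hD hle
        rw [hD'] at hD
        have := count_le_dg deg hpos D p
        rw [hD] at this
        exact h (le_trans (Nat.mul_le_mul_right _ hle) this)
    rw [Finset.sum_congr rfl h5, ← Finset.sum_filter, ← Finset.sum_filter]
    apply Finset.sum_bij (fun e _ => e * deg p)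
    · intro e he
      simp only [Finset.mem_filter, Finset.mem_Icc] at he ⊢
      exact ⟨⟨Nat.mul_pos he.1.1 (hpos p), he.2⟩, dvd_mul_left _ _⟩
    · intro e _ e' _ h; exact Nat.eq_of_mul_eq_mul_right (hpos p) h
    · intro j hj
      simp only [Finset.mem_filter, Finset.mem_Icc] at hj
      obtain ⟨⟨h1, h2⟩, e, rfl⟩ := hj
      refine ⟨e, ?_, mul_comm _ _⟩
      simp only [Finset.mem_filter, Finset.mem_Icc]
      refine ⟨⟨Nat.pos_of_ne_zero ?_, le_trans (Nat.le_mul_of_pos_left _ (hpos p)) h2⟩, by rwa [mul_comm]⟩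
      rintro rfl; simp at h1
    · intro e _; rfl
  rw [h1, Finset.sum_comm, Finset.Nat.sum_antidiagonal_eq_sum_range_succ_mk]
  rw [← Finset.sum_range_reflect, Finset.sum_range_succ']
  simp only [Nat.succ_sub_one]
  have h0 : Nn deg 0 = 0 := by simp [Nn]
  rw [show n - (n - 0) = 0 by omega, h0, mul_zero, add_zero]
  rw [Finset.range_eq_Ico, Finset.sum_Ico_add' (fun j => An deg (n - j) * Nn deg (n - (n - j))) 0 n 1]
  apply Finset.sum_congr
  · ext; simp only [Finset.mem_Icc, Finset.mem_Ico]; omega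
  · intro j hj
    have hj : 1 ≤ j ∧ j ≤ n := by
      simp only [Finset.mem_Ico] at hj; omega
    rw [show n - (n - j) = j by omega, hNn j (by omega) hj.2, hAn, Finset.mul_sum]
    apply Finset.sum_congr rfl
    intro p _
    split_ifs <;> ring

theorem An_zero (hpos : ∀ p, 0 < deg p) : An deg 0 = 1 := by
  rw [An, Nat.card_eq_one_iff_unique]
  refine ⟨⟨fun a b => ?_⟩, ⟨⟨0, by simp [dg]⟩⟩⟩
  have : ∀ D : Multiset S, dg deg D = 0 → D = 0 := by
    intro D hD
    induction D using Multiset.induction with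
    | empty => rfl
    | cons p D _ => rw [dg_cons] at hD; have := hpos p; omega
  exact Subtype.ext ((this _ a.2).trans (this _ b.2).symm)

end newton

section div

open UniqueFactorizationMonoid IsDedekindDomain

variable {A O : Type*} [CommRing A] [CommRing O] [IsDedekindDomain A] [IsDedekindDomain O]

/-- finite part of a divisor -/
noncomputable def IA (D : Multiset (HeightOneSpectrum A ⊕ HeightOneSpectrum O)) : Ideal A :=
  (D.map (Sum.elim (fun v => v.asIdeal) (fun _ => 1))).prod

/-- infinite part of a divisor -/
noncomputable def JO (D : Multiset (HeightOneSpectrum A ⊕ HeightOneSpectrum O)) : Ideal O :=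
  (D.map (Sum.elim (fun _ => 1) (fun v => v.asIdeal))).prod

theorem IA_add (D E : Multiset (HeightOneSpectrum A ⊕ HeightOneSpectrum O)) : IA (D + E) = IA D * IA E := by simp [IA]
theorem JO_add (D E : Multiset (HeightOneSpectrum A ⊕ HeightOneSpectrum O)) : JO (D + E) = JO D * JO E := by simp [JO]

theorem IA_ne (D : Multiset (HeightOneSpectrum A ⊕ HeightOneSpectrum O)) : IA D ≠ ⊥ := by
  rw [← Ideal.zero_eq_bot]
  induction D using Multiset.induction with
  | empty => simp [IA]
  | cons p D ih =>
    rw [IA, Multiset.map_cons, Multiset.prod_cons]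
    refine mul_ne_zero ?_ ih
    cases p with
    | inl v => exact v.ne_bot
    | inr v => exact one_ne_zero

theorem JO_ne (D : Multiset (HeightOneSpectrum A ⊕ HeightOneSpectrum O)) : JO D ≠ ⊥ := by
  rw [← Ideal.zero_eq_bot]
  induction D using Multiset.induction with
  | empty => simp [JO]
  | cons p D ih =>
    rw [JO, Multiset.map_cons, Multiset.prod_cons]
    refine mul_ne_zero ?_ ih
    cases p with
    | inr v => exact v.ne_bot
    | inl v => exact one_ne_zero

open Classical in
theorem count_IA (D : Multiset (HeightOneSpectrum A ⊕ HeightOneSpectrum O)) (v : HeightOneSpectrum A) :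
    (normalizedFactors (IA D)).count v.asIdeal = D.count (Sum.inl v) := by
  induction D using Multiset.induction with
  | empty => rw [IA, Multiset.map_zero, Multiset.prod_zero, normalizedFactors_one, Multiset.count_zero, Multiset.count_zero]
  | cons p D ih =>
    have hD : IA D ≠ 0 := IA_ne D
    have : IA (p ::ₘ D) = (Sum.elim (fun v => v.asIdeal) (fun _ => 1) p) * IA D := by simp [IA]
    rw [this, Multiset.count_cons]
    cases p with
    | inl w =>
      rw [Sum.elim_inl, normalizedFactors_mul w.ne_bot hD, normalizedFactors_irreducible w.irreducible,
        normalize_eq, Multiset.count_add, ih, Multiset.count_singleton, add_comm]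
      congr 1
      simp [HeightOneSpectrum.ext_iff]
    | inr w => simp [ih]

open Classical in
theorem count_JO (D : Multiset (HeightOneSpectrum A ⊕ HeightOneSpectrum O)) (v : HeightOneSpectrum O) :
    (normalizedFactors (JO D)).count v.asIdeal = D.count (Sum.inr v) := by
  induction D using Multiset.induction with
  | empty => rw [JO, Multiset.map_zero, Multiset.prod_zero, normalizedFactors_one, Multiset.count_zero, Multiset.count_zero]
  | cons p D ih =>
    have hD : JO D ≠ 0 := JO_ne D
    have : JO (p ::ₘ D) = (Sum.elim (fun _ => 1) (fun v => v.asIdeal) p) * JO D := by simp [JO]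
    rw [this, Multiset.count_cons]
    cases p with
    | inr w =>
      rw [Sum.elim_inr, normalizedFactors_mul w.ne_bot hD, normalizedFactors_irreducible w.irreducible,
        normalize_eq, Multiset.count_add, ih, Multiset.count_singleton, add_comm]
      congr 1
      simp [HeightOneSpectrum.ext_iff]
    | inl w => simp [ih]

theorem div_ext {D E : Multiset (HeightOneSpectrum A ⊕ HeightOneSpectrum O)} (h1 : IA D = IA E) (h2 : JO D = JO E) : D = E := by
  classical
  ext p
  cases p with
  | inl v => rw [← count_IA, ← count_IA, h1]
  | inr v => rw [← count_JO, ← count_JO, h2]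

theorem exists_div {I : Ideal A} {J : Ideal O} (hI : I ≠ ⊥) (hJ : J ≠ ⊥) :
    ∃ D : Multiset (HeightOneSpectrum A ⊕ HeightOneSpectrum O), IA D = I ∧ JO D = J := by
  have h1 : ∀ I : Ideal A, I ≠ ⊥ → ∃ D : Multiset (HeightOneSpectrum A ⊕ HeightOneSpectrum O), IA D = I ∧ JO D = 1 := by
    intro I
    refine induction_on_prime I ?_ ?_ ?_
    · intro h; exact absurd rfl h
    · intro x hx _
      exact ⟨0, by rw [Ideal.isUnit_iff.1 hx]; simp [IA], by simp [JO]⟩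
    · intro J p hJ hp ih _
      obtain ⟨D, hD1, hD2⟩ := ih hJ
      refine ⟨Sum.inl ⟨p, Ideal.isPrime_of_prime hp, hp.ne_zero⟩ ::ₘ D, ?_, ?_⟩
      · rw [← hD1]; simp [IA]
      · rw [← hD2]; simp [JO]
  have h2 : ∀ I : Ideal O, I ≠ ⊥ → ∃ D : Multiset (HeightOneSpectrum A ⊕ HeightOneSpectrum O), IA D = 1 ∧ JO D = I := by
    intro I
    refine induction_on_prime I ?_ ?_ ?_
    · intro h; exact absurd rfl h
    · intro x hx _
      exact ⟨0, by simp [IA], by rw [Ideal.isUnit_iff.1 hx]; simp [JO]⟩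
    · intro J p hJ hp ih _
      obtain ⟨D, hD1, hD2⟩ := ih hJ
      refine ⟨Sum.inr ⟨p, Ideal.isPrime_of_prime hp, hp.ne_zero⟩ ::ₘ D, ?_, ?_⟩
      · rw [← hD1]; simp [IA]
      · rw [← hD2]; simp [JO]
  obtain ⟨D, hD, hD'⟩ := h1 I hI
  obtain ⟨E, hE, hE'⟩ := h2 J hJ
  exact ⟨D + E, by rw [IA_add, hD, hE, mul_one], by rw [JO_add, hD', hE', one_mul]⟩

end div

end NTW


namespace NTW

open IsDedekindDomain

section

variable {k K A O : Type*} [Field k] [Fintype k] [Field K] [CommRing A] [CommRing O] [Algebra A K] [Algebra O K]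
    [Algebra k K] {s : K} {d g : ℕ} [IsDedekindDomain A] [IsDedekindDomain O] [Infinite A] [Infinite O]
    [Algebra k A] [Algebra k O] [IsScalarTower k A K] [IsScalarTower k O K]

/-- degree of a closed point -/
noncomputable def pdeg (k A O : Type*) [Field k] [CommRing A] [CommRing O] [IsDedekindDomain A] [IsDedekindDomain O]
    [Algebra k A] [Algebra k O] : HeightOneSpectrum A ⊕ HeightOneSpectrum O → ℕ :=
  Sum.elim (fun v => Module.finrank k (A ⧸ v.asIdeal)) (fun v => Module.finrank k (O ⧸ v.asIdeal))

theorem cardQuot_eq_pow {B : Type*} [CommRing B] [Algebra k B] (I : Ideal B) (h : I.cardQuot ≠ 0) :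
    I.cardQuot = Fintype.card k ^ Module.finrank k (B ⧸ I) := by
  rw [Submodule.cardQuot_apply] at h ⊢
  haveI : Finite (B ⧸ I) := Nat.finite_of_card_ne_zero h
  rw [Module.natCard_eq_pow_finrank (K := k), Nat.card_eq_fintype_card]

theorem finrank_pos_of {B : Type*} [CommRing B] [Algebra k B] (I : Ideal B) [I.IsPrime] (h : I.cardQuot ≠ 0) :
    0 < Module.finrank k (B ⧸ I) := by
  rw [Submodule.cardQuot_apply] at h
  haveI : Finite (B ⧸ I) := Nat.finite_of_card_ne_zero h
  exact Module.finrank_pos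

omit [Infinite A] [Infinite O] [IsScalarTower k A K] [IsScalarTower k O K] in
theorem Curve.pdeg_pos (C : Curve k K A O s d g) (p) : 0 < pdeg k A O p := by
  cases p with
  | inl v => exact finrank_pos_of _ (C.finA _ v.ne_bot)
  | inr v => exact finrank_pos_of _ (C.finO _ v.ne_bot)

omit [IsScalarTower k A K] [IsScalarTower k O K] in
theorem Curve.norm_div (C : Curve k K A O s d g) (D : Multiset (HeightOneSpectrum A ⊕ HeightOneSpectrum O)) :
    (IA D).cardQuot * (JO D).cardQuot = Fintype.card k ^ dg (pdeg k A O) D := by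
  induction D using Multiset.induction with
  | empty => simp [IA, JO, dg]
  | cons p D ih =>
    have h1 : IA (p ::ₘ D) = (Sum.elim (fun v => v.asIdeal) (fun _ => 1) p) * IA D := by simp [IA]
    have h2 : JO (p ::ₘ D) = (Sum.elim (fun _ => 1) (fun v => v.asIdeal) p) * JO D := by simp [JO]
    rw [h1, h2, cardQuot_mul', cardQuot_mul', dg_cons, pow_add, ← ih]
    cases p with
    | inl v =>
      rw [Sum.elim_inl, Sum.elim_inl, Ideal.one_eq_top, Submodule.cardQuot_top,
        cardQuot_eq_pow (k := k) v.asIdeal (C.finA _ v.ne_bot)]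
      simp only [pdeg, Sum.elim_inl]; ring
    | inr v =>
      rw [Sum.elim_inr, Sum.elim_inr, Ideal.one_eq_top, Submodule.cardQuot_top,
        cardQuot_eq_pow (k := k) v.asIdeal (C.finO _ v.ne_bot)]
      simp only [pdeg, Sum.elim_inr]; ring

/-- pairs (divisor, section) -/
def TT (k : Type*) {K A O : Type*} [Field k] [Field K] [CommRing A] [CommRing O] [Algebra A K] [Algebra O K]
    [IsDedekindDomain A] [IsDedekindDomain O] [Algebra k A] [Algebra k O] (s : K) (m n : ℕ) : Type _ :=
  Σ D : {D : Multiset (HeightOneSpectrum A ⊕ HeightOneSpectrum O) // dg (pdeg k A O) D = n},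
    {x : (lat 1 (IA D.1) ⊓ lat (s ^ (m:ℤ)) (JO D.1) : AddSubgroup K) // x ≠ 0}

theorem Curve.card_TT (C : Curve k K A O s d g) (hg : 1 ≤ g) (hfin : ∀ n, {p | pdeg k A O p ≤ n}.Finite)
    (m n n' : ℕ) (hnn : n + n' = d * m) (hn' : 2 * g - 1 ≤ n') :
    Nat.card (TT (A := A) (O := O) k s m n) = An (pdeg k A O) n * (Fintype.card k ^ (n' + 1 - g) - 1) ∧
      Finite (TT (A := A) (O := O) k s m n) := by
  classical
  haveI : Finite {D : Multiset (HeightOneSpectrum A ⊕ HeightOneSpectrum O) // dg (pdeg k A O) D = n} :=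
    (finite_dg _ C.pdeg_pos hfin n)
  have hc : ∀ D : {D : Multiset (HeightOneSpectrum A ⊕ HeightOneSpectrum O) // dg (pdeg k A O) D = n},
      Nat.card (lat 1 (IA D.1) ⊓ lat (s ^ (m:ℤ)) (JO D.1) : AddSubgroup K) = Fintype.card k ^ (n' + 1 - g) := by
    intro D
    apply C.rr (IA_ne _) (JO_ne _) m _ _ n n' _ _ hn' hg
    · intro c a ha
      refine ⟨c • a, ?_, ?_⟩
      · rw [Algebra.smul_def]; exact Ideal.mul_mem_left _ _ ha
      · rw [Algebra.smul_def, Algebra.smul_def, map_mul, ← IsScalarTower.algebraMap_apply]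
    · intro c a ha
      refine ⟨c • a, ?_, ?_⟩
      · rw [Algebra.smul_def]; exact Ideal.mul_mem_left _ _ ha
      · rw [Algebra.smul_def, Algebra.smul_def, map_mul, ← IsScalarTower.algebraMap_apply]
    · rw [C.norm_div, D.2]
    · exact_mod_cast hnn.symm
  haveI hf : ∀ D : {D : Multiset (HeightOneSpectrum A ⊕ HeightOneSpectrum O) // dg (pdeg k A O) D = n},
      Finite (lat 1 (IA D.1) ⊓ lat (s ^ (m:ℤ)) (JO D.1) : AddSubgroup K) := by
    intro D
    apply Nat.finite_of_card_ne_zero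
    rw [hc]; exact pow_ne_zero _ Fintype.card_ne_zero
  have hc' : ∀ D : {D : Multiset (HeightOneSpectrum A ⊕ HeightOneSpectrum O) // dg (pdeg k A O) D = n},
      Nat.card {x : (lat 1 (IA D.1) ⊓ lat (s ^ (m:ℤ)) (JO D.1) : AddSubgroup K) // x ≠ 0} =
        Fintype.card k ^ (n' + 1 - g) - 1 := by
    intro D
    rw [← hc D]
    letI := Fintype.ofFinite (lat 1 (IA D.1) ⊓ lat (s ^ (m:ℤ)) (JO D.1) : AddSubgroup K)
    rw [Nat.card_eq_fintype_card, Nat.card_eq_fintype_card, Fintype.card_subtype_compl, Fintype.card_subtype_eq]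
  constructor
  · letI := Fintype.ofFinite {D : Multiset (HeightOneSpectrum A ⊕ HeightOneSpectrum O) // dg (pdeg k A O) D = n}
    rw [TT, Nat.card_sigma, Finset.sum_congr rfl (fun D _ => hc' D), Finset.sum_const, smul_eq_mul, An,
      Nat.card_eq_fintype_card, Finset.card_univ]
  · unfold TT; infer_instance

theorem Curve.exists_dual (C : Curve k K A O s d g) (m n n' : ℕ) (hnn : n + n' = d * m)
    (T : TT (A := A) (O := O) k s m n) : ∃ T' : TT (A := A) (O := O) k s m n', (T'.2.1 : K) = T.2.1 ∧
      ∃ (a : A) (o : O), a ≠ 0 ∧ o ≠ 0 ∧ algebraMap A K a = T.2.1 ∧ s ^ m * algebraMap O K o = T.2.1 ∧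
        IA T.1.1 * IA T'.1.1 = Ideal.span {a} ∧ JO T.1.1 * JO T'.1.1 = Ideal.span {o} := by
  obtain ⟨⟨D, hD⟩, ⟨⟨x, hx⟩, hx0⟩⟩ := T
  obtain ⟨a, ha, hxa⟩ := mem_lat.1 hx.1
  obtain ⟨o, ho, hxo⟩ := mem_lat.1 hx.2
  have hx0 : x ≠ 0 := fun h => hx0 (Subtype.ext h)
  rw [one_mul] at hxa
  have ha0 : a ≠ 0 := by rintro rfl; rw [map_zero] at hxa; exact hx0 hxa
  have ho0 : o ≠ 0 := by rintro rfl; rw [map_zero, mul_zero] at hxo; exact hx0 hxo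
  obtain ⟨I', hI'⟩ := Ideal.dvd_iff_le.2 ((Ideal.span_singleton_le_iff_mem _).2 ha)
  obtain ⟨J', hJ'⟩ := Ideal.dvd_iff_le.2 ((Ideal.span_singleton_le_iff_mem _).2 ho)
  have hI0 : I' ≠ ⊥ := by rintro rfl; rw [Ideal.mul_bot] at hI'; simp at hI'; exact ha0 hI'
  have hJ0 : J' ≠ ⊥ := by rintro rfl; rw [Ideal.mul_bot] at hJ'; simp at hJ'; exact ho0 hJ'
  obtain ⟨D', rfl, rfl⟩ := exists_div hI0 hJ0
  have hdeg : dg (pdeg k A O) D' = n' := by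
    have h1 := C.principal m a o ha0 (by rw [← hxa, hxo])
    rw [hI', hJ', cardQuot_mul', cardQuot_mul'] at h1
    have h2 : (((IA D).cardQuot * (JO D).cardQuot) * ((IA D').cardQuot * (JO D').cardQuot) : ℕ) = Fintype.card k ^ (d * m) := by
      have h3 : ((d:ℤ) * (m:ℤ)) = ((d * m : ℕ) : ℤ) := by push_cast; ring
      rw [h3, zpow_natCast] at h1
      have h4 : (((((IA D).cardQuot * (JO D).cardQuot) * ((IA D').cardQuot * (JO D').cardQuot) : ℕ)) : ℚ) = ((Fintype.card k ^ (d * m) : ℕ) : ℚ) := by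
        push_cast at h1 ⊢
        rw [← h1]; ring
      exact_mod_cast h4
    rw [C.norm_div, C.norm_div, ← pow_add, hD] at h2
    have := Nat.pow_right_injective (Fintype.one_lt_card (α := k)) h2
    omega
  refine ⟨⟨⟨D', hdeg⟩, ⟨⟨x, ?_, ?_⟩, fun h => hx0 (congrArg Subtype.val h)⟩⟩, rfl, a, o, ha0, ho0, hxa.symm, ?_, hI'.symm, hJ'.symm⟩
  · refine mem_lat.2 ⟨a, ?_, by rw [one_mul, hxa]⟩
    rw [← Ideal.span_singleton_le_iff_mem, hI']; exact Ideal.mul_le_right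
  · refine mem_lat.2 ⟨o, ?_, hxo⟩
    rw [← Ideal.span_singleton_le_iff_mem, hJ']; exact Ideal.mul_le_right
  · change s ^ m * algebraMap O K o = x
    rw [← zpow_natCast]; exact hxo.symm

theorem Curve.TT_le (C : Curve k K A O s d g) (m n n' : ℕ) (hnn : n + n' = d * m)
    [Finite (TT (A := A) (O := O) k s m n')] :
    Nat.card (TT (A := A) (O := O) k s m n) ≤ Nat.card (TT (A := A) (O := O) k s m n') := by
  choose f hf a o ha0 ho0 ha ho hI hJ using C.exists_dual m n n' hnn
  apply Nat.card_le_card_of_injective f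
  intro T U h
  have hx : (T.2.1 : K) = U.2.1 := by rw [← hf T, ← hf U, h]
  have haa : a T = a U := C.injA (by rw [ha, ha, hx])
  have hoo : o T = o U := C.injO (mul_left_cancel₀ (pow_ne_zero m C.s0) (by rw [ho, ho, hx]))
  have h1 : IA T.1.1 = IA U.1.1 := by
    have : IA T.1.1 * IA (f T).1.1 = IA U.1.1 * IA (f T).1.1 := by rw [hI, h, hI, haa]
    exact mul_right_cancel₀ (IA_ne _) this
  have h2 : JO T.1.1 = JO U.1.1 := by
    have : JO T.1.1 * JO (f T).1.1 = JO U.1.1 * JO (f T).1.1 := by rw [hJ, h, hJ, hoo]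
    exact mul_right_cancel₀ (JO_ne _) this
  have h3 := div_ext h1 h2
  obtain ⟨⟨D, hD⟩, ⟨⟨x, hxm⟩, hx0⟩⟩ := T
  obtain ⟨⟨E, hE⟩, ⟨⟨y, hym⟩, hy0⟩⟩ := U
  dsimp only at h3 hx
  subst h3
  subst hx
  rfl

theorem Curve.weil (C : Curve k K A O s d g) (hg : 1 ≤ g) (hfin : ∀ n, {p | pdeg k A O p ≤ n}.Finite)
    (c : ℕ) (hC : ∀ n, 1 ≤ n → |(Nn (pdeg k A O) n:ℝ) - (Fintype.card k:ℝ)^n| ≤ c * (Real.sqrt (Fintype.card k))^n) :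
    |(Nn (pdeg k A O) 1:ℝ) - Fintype.card k - 1| ≤ 2*g*Real.sqrt (Fintype.card k) := by
  refine weil_of_zeta (Fintype.card k) d g Fintype.one_lt_card (by have := C.hd; omega) hg (An (pdeg k A O)) (Nn (pdeg k A O)) c
    (An_zero _ C.pdeg_pos) (by simp [Nn]) (newton _ C.pdeg_pos hfin) hC ?_
  rintro n n' ⟨m, hm⟩ hn hn'
  obtain ⟨h1, h2⟩ := C.card_TT hg hfin m n n' hm hn'
  obtain ⟨h3, h4⟩ := C.card_TT hg hfin m n' n (by omega) hn
  rw [← h1, ← h3]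
  exact le_antisymm (C.TT_le m n n' hm) (C.TT_le m n' n (by omega))

end

end NTW


namespace NTW

open IsDedekindDomain

section

variable {k : Type*} [Field k] [Fintype k]

theorem pow_fix_iff {E : Type*} [Field E] [Algebra k E] [Finite E] (j : ℕ) :
    (∀ x : E, x ^ (Fintype.card k) ^ j = x) ↔ Module.finrank k E ∣ j := by
  haveI : Module.Finite k E := Module.Finite.of_finite
  haveI : Algebra.IsAlgebraic k E := Algebra.IsAlgebraic.of_finite k E
  rw [← FiniteField.orderOf_frobeniusAlgHom k E, orderOf_dvd_iff_pow_eq_one, DFunLike.ext_iff]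
  refine forall_congr' fun x => ?_
  rw [AlgHom.coe_pow, FiniteField.coe_frobeniusAlgHom, pow_iterate, AlgHom.one_apply]

theorem Npt_primes {B : Type*} [CommRing B] [IsDedekindDomain B] [Infinite B] [Algebra k B]
    (hfinB : ∀ I : Ideal B, I ≠ ⊥ → I.cardQuot ≠ 0) (j : ℕ) (hj : 1 ≤ j)
    (hfin : Finite {φ : B →ₐ[k] AlgebraicClosure k // ∀ a, φ a ^ (Fintype.card k)^j = φ a}) :
    {v : HeightOneSpectrum B | Module.finrank k (B ⧸ v.asIdeal) ∣ j}.Finite ∧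
    Npt k B j = ∑ᶠ v ∈ {v : HeightOneSpectrum B | Module.finrank k (B ⧸ v.asIdeal) ∣ j}, Module.finrank k (B ⧸ v.asIdeal) := by
  set S := {v : HeightOneSpectrum B | Module.finrank k (B ⧸ v.asIdeal) ∣ j} with hS
  have hQ : ∀ v : HeightOneSpectrum B, Finite (B ⧸ v.asIdeal) := fun v => by
    have := hfinB _ v.ne_bot
    rw [Submodule.cardQuot_apply] at this
    exact Nat.finite_of_card_ne_zero this
  letI : ∀ v : HeightOneSpectrum B, Field (B ⧸ v.asIdeal) := fun v =>
    haveI := v.isMaximal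
    Ideal.Quotient.field _
  let Ψ : (Σ v : S, (B ⧸ v.1.asIdeal →ₐ[k] AlgebraicClosure k)) →
      {φ : B →ₐ[k] AlgebraicClosure k // ∀ a, φ a ^ (Fintype.card k)^j = φ a} := fun x =>
    ⟨x.2.comp (Ideal.Quotient.mkₐ k x.1.1.asIdeal), fun a => by
      haveI := hQ x.1.1
      have := (pow_fix_iff (k := k) (E := B ⧸ x.1.1.asIdeal) j).2 x.1.2 (Ideal.Quotient.mkₐ k x.1.1.asIdeal a)
      rw [AlgHom.comp_apply, ← map_pow, this]⟩
  have hker : ∀ x, RingHom.ker (Ψ x).1 = x.1.1.asIdeal := by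
    intro x
    ext a
    rw [RingHom.mem_ker]
    change x.2 (Ideal.Quotient.mkₐ k x.1.1.asIdeal a) = 0 ↔ _
    rw [map_eq_zero]
    exact Ideal.Quotient.eq_zero_iff_mem
  have hbij : Function.Bijective Ψ := by
    constructor
    · rintro ⟨⟨v, hv⟩, ψ⟩ ⟨⟨v', hv'⟩, ψ'⟩ h
      have h1 := hker ⟨⟨v, hv⟩, ψ⟩
      rw [h, hker] at h1
      have h2 : v' = v := HeightOneSpectrum.ext h1
      subst h2
      have h3 : ψ = ψ' := by
        apply Ideal.Quotient.algHom_ext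
        exact congrArg Subtype.val h
      rw [h3]
    · rintro ⟨φ, hφ⟩
      have hne : RingHom.ker φ ≠ ⊥ := by
        intro hb
        have hi : Function.Injective φ := (RingHom.injective_iff_ker_eq_bot φ.toRingHom).2 hb
        have hf : Finite B := by
          have : Set.Finite {x : AlgebraicClosure k | x ^ (Fintype.card k)^j = x} := by
            have := (Polynomial.rootSet_finite (Polynomial.X ^ (Fintype.card k)^j - Polynomial.X : Polynomial (AlgebraicClosure k)) (AlgebraicClosure k))
            refine this.subset fun x hx => ?_
            rw [Polynomial.mem_rootSet]
            refine ⟨FiniteField.X_pow_card_sub_X_ne_zero _ ?_, ?_⟩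
            · exact Nat.one_lt_pow (by omega) Fintype.one_lt_card
            · simpa [sub_eq_zero] using hx
          haveI := this.to_subtype
          exact Finite.of_injective (fun b => (⟨φ b, hφ b⟩ : {x : AlgebraicClosure k | x ^ (Fintype.card k)^j = x}))
            fun a b h => hi (congrArg Subtype.val h)
        exact not_finite B
      let v : HeightOneSpectrum B := ⟨RingHom.ker φ, RingHom.ker_isPrime _, hne⟩
      let ψ : B ⧸ v.asIdeal →ₐ[k] AlgebraicClosure k := Ideal.Quotient.liftₐ _ φ (fun a ha => ha)
      have hψ : ∀ a, ψ (Ideal.Quotient.mkₐ k v.asIdeal a) = φ a := fun a => rfl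
      have hv : v ∈ S := by
        haveI := hQ v
        refine (pow_fix_iff (k := k) (E := B ⧸ v.asIdeal) j).1 fun x => ?_
        obtain ⟨a, rfl⟩ := Ideal.Quotient.mkₐ_surjective k v.asIdeal x
        apply RingHom.injective ψ.toRingHom
        change ψ _ = ψ _
        rw [map_pow, hψ, hφ]
      exact ⟨⟨⟨v, hv⟩, ψ⟩, Subtype.ext (AlgHom.ext hψ)⟩
  haveI hfS : Finite (Σ v : S, (B ⧸ v.1.asIdeal →ₐ[k] AlgebraicClosure k)) := Finite.of_injective Ψ hbij.1
  have hne : ∀ v : S, Nonempty (B ⧸ v.1.asIdeal →ₐ[k] AlgebraicClosure k) := fun v => by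
    haveI := hQ v.1
    haveI : Module.Finite k (B ⧸ v.1.asIdeal) := Module.Finite.of_finite
    exact ⟨IsAlgClosed.lift⟩
  haveI hSf : Finite S := Finite.of_surjective (fun x : (Σ v : S, (B ⧸ v.1.asIdeal →ₐ[k] AlgebraicClosure k)) => x.1)
    fun v => ⟨⟨v, (hne v).some⟩, rfl⟩
  refine ⟨Set.toFinite S, ?_⟩
  rw [Npt, ← Nat.card_congr (Equiv.ofBijective Ψ hbij)]
  haveI := Fintype.ofFinite S
  haveI : ∀ v : S, Finite (B ⧸ v.1.asIdeal →ₐ[k] AlgebraicClosure k) := fun v =>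
    haveI := hQ v.1
    haveI : Module.Finite k (B ⧸ v.1.asIdeal) := Module.Finite.of_finite
    inferInstance
  rw [Nat.card_sigma, ← finsum_set_coe_eq_finsum_mem, finsum_eq_sum_of_fintype]
  refine Finset.sum_congr rfl fun v _ => ?_
  haveI := hQ v.1
  haveI : Module.Finite k (B ⧸ v.1.asIdeal) := Module.Finite.of_finite
  rw [Nat.card_eq_fintype_card, AlgHom.card]

theorem finite_fix (P : Polynomial (Polynomial k)) (j : ℕ) (hj : 1 ≤ j) :
    Finite {φ : AdjoinRoot P →ₐ[k] AlgebraicClosure k // ∀ a, φ a ^ (Fintype.card k)^j = φ a} := by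
  have hQ : 1 < (Fintype.card k) ^ j := Nat.one_lt_pow (by omega) Fintype.one_lt_card
  refine Finite.of_injective (β := (FQ (AlgebraicClosure k) ((Fintype.card k) ^ j)) × (FQ (AlgebraicClosure k) ((Fintype.card k) ^ j)))
    (fun φ => (⟨φ.1 (cs P), (mem_FQ hQ _).2 (φ.2 _)⟩, ⟨φ.1 (ct P), (mem_FQ hQ _).2 (φ.2 _)⟩)) ?_
  intro φ ψ h
  simp only [Prod.mk.injEq, Subtype.mk.injEq] at h
  exact Subtype.ext (hom_ext h.1 h.2)

theorem cardQuot_prod {B : Type*} [CommRing B] [IsDedekindDomain B] [Infinite B] [Algebra k B]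
    (hfinB : ∀ I : Ideal B, I ≠ ⊥ → I.cardQuot ≠ 0) (t : Finset (HeightOneSpectrum B)) :
    (∏ v ∈ t, v.asIdeal).cardQuot = Fintype.card k ^ ∑ v ∈ t, Module.finrank k (B ⧸ v.asIdeal) := by
  classical
  induction t using Finset.induction_on with
  | empty => simp
  | insert v t hv ih =>
    rw [Finset.prod_insert hv, Finset.sum_insert hv, cardQuot_mul', ih, pow_add, cardQuot_eq_pow (k := k) _ (hfinB _ v.ne_bot)]

theorem sum_deg_le {B : Type*} [CommRing B] [IsDedekindDomain B] [Infinite B] [Algebra k B]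
    (hfinB : ∀ I : Ideal B, I ≠ ⊥ → I.cardQuot ≠ 0) (σ : B) (h0 : σ ≠ 0) (d : ℕ)
    (hσ : (Ideal.span {σ}).cardQuot = Fintype.card k ^ d) (hσp : ∀ v : HeightOneSpectrum B, σ ∈ v.asIdeal) :
    Finite (HeightOneSpectrum B) ∧ ∀ t : Finset (HeightOneSpectrum B), ∑ v ∈ t, Module.finrank k (B ⧸ v.asIdeal) ≤ d := by
  have hb : Ideal.span {σ} ≠ ⊥ := by simpa using h0
  have hdv : ∀ v : HeightOneSpectrum B, v.asIdeal ∣ Ideal.span {σ} := fun v => by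
    rw [Ideal.dvd_span_singleton]; exact hσp v
  constructor
  · have := Ideal.finite_factors hb
    have h2 : {v : HeightOneSpectrum B | v.asIdeal ∣ Ideal.span {σ}} = Set.univ := by
      ext v; simpa using hdv v
    rw [h2] at this
    exact Set.finite_univ_iff.1 this
  · intro t
    have h1 : (∏ v ∈ t, v.asIdeal) ∣ Ideal.span {σ} := by
      apply Finset.prod_dvd_of_coprime
      · intro v _ w _ hvw
        have h1 := v.isMaximal
        have h2 := w.isMaximal
        exact Ideal.isCoprime_iff_sup_eq.2 (h1.coprime_of_ne h2 fun h => hvw (HeightOneSpectrum.ext h))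
      · intro v _; exact hdv v
    obtain ⟨J, hJ⟩ := h1
    have h2 : J ≠ ⊥ := by rintro rfl; rw [Ideal.mul_bot] at hJ; exact hb hJ
    rw [hJ, cardQuot_mul', cardQuot_prod (k := k) hfinB] at hσ
    have h3 : 1 ≤ J.cardQuot := Nat.one_le_iff_ne_zero.2 (hfinB _ h2)
    have h4 : Fintype.card k ^ ∑ v ∈ t, Module.finrank k (B ⧸ v.asIdeal) ≤ Fintype.card k ^ d := by
      rw [← hσ]; exact Nat.le_mul_of_pos_right _ h3
    exact (Nat.pow_le_pow_iff_right Fintype.one_lt_card).1 h4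

variable {K A O : Type*} [Field K] [CommRing A] [CommRing O] [Algebra A K] [Algebra O K]
    [Algebra k K] {s : K} {d g : ℕ} [IsDedekindDomain A] [IsDedekindDomain O] [Infinite A] [Infinite O]
    [Algebra k A] [Algebra k O] [IsScalarTower k A K] [IsScalarTower k O K]

theorem Curve.weil_final (C : Curve k K A O s d g) (hg : 1 ≤ g) (c : ℕ)
    (hA : ∀ n, 1 ≤ n → |(Npt k A n : ℝ) - (Fintype.card k : ℝ) ^ n| ≤ c * (√(Fintype.card k : ℝ)) ^ n)
    (hfA : ∀ j, 1 ≤ j → Finite {φ : A →ₐ[k] AlgebraicClosure k // ∀ a, φ a ^ (Fintype.card k)^j = φ a})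
    (σ : O) (h0 : σ ≠ 0)
    (hσ : (Ideal.span {σ}).cardQuot = Fintype.card k ^ d) (hσp : ∀ v : HeightOneSpectrum O, σ ∈ v.asIdeal) :
    |(Npt k A 1 : ℝ) - Fintype.card k| ≤ 2 * g * √(Fintype.card k : ℝ) + d := by
  classical
  obtain ⟨hfO, hsO⟩ := sum_deg_le (k := k) C.finO σ h0 d hσ hσp
  have hset : ∀ j, {p | pdeg k A O p ∣ j} = Sum.inl '' {v : HeightOneSpectrum A | Module.finrank k (A ⧸ v.asIdeal) ∣ j} ∪
      Sum.inr '' {v : HeightOneSpectrum O | Module.finrank k (O ⧸ v.asIdeal) ∣ j} := by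
    intro j
    ext p
    cases p <;> simp [pdeg]
  have hfj : ∀ j, 1 ≤ j → {p | pdeg k A O p ∣ j}.Finite := by
    intro j hj
    rw [hset]
    exact ((Npt_primes C.finA j hj (hfA j hj)).1.image _).union ((Set.toFinite _).image _)
  have hfin : ∀ n, {p | pdeg k A O p ≤ n}.Finite := by
    intro n
    have : {p | pdeg k A O p ≤ n} ⊆ ⋃ j ∈ Finset.Icc 1 n, {p | pdeg k A O p ∣ j} := by
      intro p hp
      simp only [Set.mem_iUnion]
      exact ⟨pdeg k A O p, Finset.mem_Icc.2 ⟨C.pdeg_pos p, hp⟩, dvd_refl _⟩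
    refine Set.Finite.subset (Set.Finite.biUnion (Finset.finite_toSet _) fun j hj => ?_) this
    exact hfj j (Finset.mem_Icc.1 hj).1
  have hN : ∀ j, 1 ≤ j → ∃ e : ℕ, e ≤ d ∧ Nn (pdeg k A O) j = Npt k A j + e := by
    intro j hj
    obtain ⟨h1, h2⟩ := Npt_primes C.finA j hj (hfA j hj)
    have h3 : {v : HeightOneSpectrum O | Module.finrank k (O ⧸ v.asIdeal) ∣ j}.Finite := Set.toFinite _
    refine ⟨∑ᶠ v ∈ {v : HeightOneSpectrum O | Module.finrank k (O ⧸ v.asIdeal) ∣ j}, Module.finrank k (O ⧸ v.asIdeal), ?_, ?_⟩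
    · rw [finsum_mem_eq_finite_toFinset_sum _ h3]
      exact hsO _
    · rw [Nn, if_neg (by omega), hset, finsum_mem_union _ (h1.image _) (h3.image _), finsum_mem_image Sum.inl_injective.injOn,
        finsum_mem_image Sum.inr_injective.injOn, h2]
      · rfl
      · rw [Set.disjoint_left]
        rintro _ ⟨v, _, rfl⟩ ⟨w, _, hw⟩
        cases hw
  have hq1 : (1:ℝ) ≤ √(Fintype.card k : ℝ) := by
    rw [Real.one_le_sqrt]; exact_mod_cast Fintype.card_pos
  have hw := C.weil hg hfin (c + d) (by
    intro n hn
    obtain ⟨e, he, h⟩ := hN n hn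
    have h1 := hA n hn
    rw [h]
    push_cast
    have h2 : (e:ℝ) ≤ d := by exact_mod_cast he
    have h3 : (1:ℝ) ≤ (√(Fintype.card k : ℝ)) ^ n := one_le_pow₀ hq1
    have h4 : (0:ℝ) ≤ e := Nat.cast_nonneg _
    rw [abs_le] at h1 ⊢
    constructor <;> nlinarith)
  obtain ⟨e, he, h⟩ := hN 1 le_rfl
  rw [h] at hw
  push_cast at hw
  have h2 : (e:ℝ) ≤ d := by exact_mod_cast he
  have h4 : (0:ℝ) ≤ e := Nat.cast_nonneg _
  have h5 : (1:ℝ) ≤ d := by have := C.hd; exact_mod_cast (by omega : 1 ≤ d)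
  rw [abs_le] at hw ⊢
  constructor <;> linarith [hw.1, hw.2]

end

end NTW


namespace NTW

open Polynomial IsLocalRing

theorem prime_two_gen {R : Type*} [CommRing R] [IsDomain R] [IsPrincipalIdealRing R]
    (n : Ideal R[X]) [hn : n.IsPrime] (hc : n.comap C ≠ ⊥) :
    ∃ (π : R) (v : R[X]), n = Ideal.span {C π, v} := by
  obtain ⟨π, hπ⟩ : ∃ π, n.comap C = Ideal.span {π} := ⟨_, (Submodule.IsPrincipal.span_singleton_generator _).symm⟩
  haveI hp : (n.comap C).IsPrime := Ideal.comap_isPrime C n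
  haveI hmax : (n.comap C).IsMaximal := IsPrime.to_maximal_ideal hc
  letI : Field (R ⧸ n.comap C) := Ideal.Quotient.field _
  set f := mapRingHom (Ideal.Quotient.mk (n.comap C)) with hf
  have hfs : Function.Surjective f := map_surjective _ Ideal.Quotient.mk_surjective
  obtain ⟨w, hw⟩ : ∃ w, n.map f = Ideal.span {w} := ⟨_, (Submodule.IsPrincipal.span_singleton_generator _).symm⟩
  have hwm : w ∈ n.map f := by rw [hw]; exact Ideal.mem_span_singleton_self w
  obtain ⟨v, hv, hvw⟩ := (Ideal.mem_map_iff_of_surjective f hfs).1 hwm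
  have hCπ : C π ∈ n := by
    have : π ∈ n.comap C := by rw [hπ]; exact Ideal.mem_span_singleton_self π
    exact this
  refine ⟨π, v, le_antisymm ?_ ?_⟩
  · intro x hx
    have h1 : f x ∈ n.map f := Ideal.mem_map_of_mem f hx
    rw [hw, Ideal.mem_span_singleton] at h1
    obtain ⟨y, hy⟩ := h1
    obtain ⟨z, rfl⟩ := hfs y
    have h2 : f (x - v * z) = 0 := by rw [map_sub, map_mul, hvw, hy, sub_self]
    have h3 : C π ∣ x - v * z := by
      rw [C_dvd_iff_dvd_coeff]
      intro i
      have := congrArg (fun p => p.coeff i) h2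
      simp only [hf, coe_mapRingHom, coeff_map, coeff_zero] at this
      rw [Ideal.Quotient.eq_zero_iff_mem, hπ, Ideal.mem_span_singleton] at this
      exact this
    obtain ⟨u, hu⟩ := h3
    rw [Ideal.mem_span_pair]
    exact ⟨u, z, by linear_combination -hu⟩
  · rw [Ideal.span_le]
    rintro x (rfl | rfl)
    · exact hCπ
    · exact hv

theorem dedekind_adjoinRoot {R : Type*} [CommRing R] [IsDomain R] [IsPrincipalIdealRing R] (P : R[X]) (hP : P.Monic)
    [IsDomain (AdjoinRoot P)]
    (h : ∀ n : Ideal R[X], n.IsPrime → n.comap C ≠ ⊥ → P ∈ n → P ∉ n ^ 2) :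
    IsDedekindDomain (AdjoinRoot P) := by
  haveI : Module.Finite R (AdjoinRoot P) := hP.finite_adjoinRoot
  haveI : IsNoetherianRing (AdjoinRoot P) := IsNoetherianRing.of_finite R (AdjoinRoot P)
  suffices IsDedekindDomainDvr (AdjoinRoot P) by infer_instance
  refine ⟨fun m hm hmp => ?_⟩
  set n := m.comap (AdjoinRoot.mk P) with hn
  haveI hnp : n.IsPrime := Ideal.comap_isPrime _ _
  have hnc : n.comap C ≠ ⊥ := by
    obtain ⟨x, hx, hx0⟩ := Submodule.exists_mem_ne_zero_of_ne_bot hm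
    have := Ideal.comap_ne_bot_of_integral_mem (R := R) hx0 hx (Algebra.IsIntegral.isIntegral x)
    exact this
  have hPn : P ∈ n := by
    rw [hn, Ideal.mem_comap, AdjoinRoot.mk_self]; exact zero_mem _
  have hP2 := h n hnp hnc hPn
  obtain ⟨π, v, hπv⟩ := prime_two_gen n hnc
  have hPn' := hPn
  rw [hπv, Ideal.mem_span_pair] at hPn'
  obtain ⟨a, b, hab⟩ := hPn'
  have hπn : C π ∈ n := by rw [hπv]; exact Ideal.subset_span (by simp)
  have hvn : v ∈ n := by rw [hπv]; exact Ideal.subset_span (by simp)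
  have hor : a ∉ n ∨ b ∉ n := by
    by_contra hcon
    push Not at hcon
    apply hP2
    rw [← hab, pow_two]
    exact add_mem (Ideal.mul_mem_mul hcon.1 hπn) (Ideal.mul_mem_mul hcon.2 hvn)
  set L := Localization.AtPrime m
  have hfield : ¬ IsField L := by
    rw [isField_iff_maximalIdeal_eq, ← Localization.AtPrime.map_eq_maximalIdeal,
      Ideal.map_eq_bot_iff_of_injective (IsLocalization.injective L m.primeCompl_le_nonZeroDivisors)]
    exact hm
  have hm2 : m = Ideal.span {AdjoinRoot.mk P (C π), AdjoinRoot.mk P v} := by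
    have : m = n.map (AdjoinRoot.mk P) := (Ideal.map_comap_of_surjective _ AdjoinRoot.mk_surjective m).symm
    rw [this, hπv, Ideal.map_span, Set.image_pair]
  have hrel : AdjoinRoot.mk P a * AdjoinRoot.mk P (C π) + AdjoinRoot.mk P b * AdjoinRoot.mk P v = 0 := by
    rw [← map_mul, ← map_mul, ← map_add, hab, AdjoinRoot.mk_self]
  apply ((IsDiscreteValuationRing.TFAE L hfield).out 0 4).2
  set g := algebraMap (AdjoinRoot P) L
  have hmax : maximalIdeal L = Ideal.span {g (AdjoinRoot.mk P (C π)), g (AdjoinRoot.mk P v)} := by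
    rw [← Localization.AtPrime.map_eq_maximalIdeal]
    refine (congrArg (Ideal.map g) hm2).trans ?_
    rw [Ideal.map_span, Set.image_pair]
  have hrel2 := congrArg g hrel
  rw [map_add, map_mul, map_mul, map_zero] at hrel2
  have hu : ∀ c : R[X], c ∉ n → IsUnit (g (AdjoinRoot.mk P c)) := fun c hc =>
    IsLocalization.map_units L (⟨AdjoinRoot.mk P c, hc⟩ : m.primeCompl)
  rw [hmax]
  rcases hor with ha | hb
  · obtain ⟨u, hu⟩ := hu a ha
    refine ⟨⟨g (AdjoinRoot.mk P v), ?_⟩⟩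
    have : g (AdjoinRoot.mk P (C π)) = -(↑u⁻¹ * g (AdjoinRoot.mk P b)) * g (AdjoinRoot.mk P v) := by
      rw [← hu] at hrel2
      have h1 := u.inv_mul
      linear_combination (↑u⁻¹ : L) * hrel2 - g (AdjoinRoot.mk P (C π)) * h1
    apply le_antisymm
    · rw [Ideal.span_le]
      rintro x (rfl | rfl)
      · rw [SetLike.mem_coe, this]; exact Ideal.mul_mem_left _ _ (Ideal.mem_span_singleton_self _)
      · exact Ideal.mem_span_singleton_self _
    · exact Ideal.span_mono (by simp)
  · obtain ⟨u, hu⟩ := hu b hb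
    refine ⟨⟨g (AdjoinRoot.mk P (C π)), ?_⟩⟩
    have : g (AdjoinRoot.mk P v) = -(↑u⁻¹ * g (AdjoinRoot.mk P a)) * g (AdjoinRoot.mk P (C π)) := by
      rw [← hu] at hrel2
      have h1 := u.inv_mul
      linear_combination (↑u⁻¹ : L) * hrel2 - g (AdjoinRoot.mk P v) * h1
    apply le_antisymm
    · rw [Ideal.span_le]
      rintro x (rfl | rfl)
      · exact Ideal.mem_span_singleton_self _
      · rw [SetLike.mem_coe, this]; exact Ideal.mul_mem_left _ _ (Ideal.mem_span_singleton_self _)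
    · exact Ideal.span_mono (by simp)

end NTW


namespace NTW

open Polynomial

section laurent

variable {k : Type*} [Field k]

/-- expansion at infinity of a polynomial -/
noncomputable def eL : k[X] →+* LaurentSeries k := eval₂RingHom (HahnSeries.C : k →+* HahnSeries ℤ k) (HahnSeries.single (-1 : ℤ) (1 : k))

theorem eL_monomial (i : ℕ) (a : k) : eL (monomial i a) = HahnSeries.single (-(i : ℤ)) a := by
  rw [eL, coe_eval₂RingHom, eval₂_monomial, HahnSeries.single_pow, HahnSeries.C_apply, HahnSeries.single_mul_single]
  simp

theorem eL_coeff (p : k[X]) (n : ℤ) : (eL p).coeff n = if n ≤ 0 then p.coeff (-n).toNat else 0 := by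
  induction p using Polynomial.induction_on' with
  | add p q hp hq =>
    rw [map_add, HahnSeries.coeff_add, hp, hq]; split_ifs <;> simp
  | monomial i a =>
    rw [eL_monomial, HahnSeries.coeff_single, coeff_monomial]
    split_ifs <;> first | rfl | omega

theorem eL_injective : Function.Injective (eL : k[X] →+* LaurentSeries k) := by
  rw [injective_iff_map_eq_zero]
  intro p hp
  ext i
  have := congrArg (fun x => HahnSeries.coeff x (-(i:ℤ))) hp
  simpa [eL_coeff] using this

variable (k) (F : Type*) [Field F] [Algebra k[X] F] [IsFractionRing k[X] F] [Algebra k F] [IsScalarTower k k[X] F]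

/-- expansion at infinity -/
noncomputable def iL : F →+* LaurentSeries k := IsFractionRing.lift (g := eL) eL_injective

theorem iL_poly (p : k[X]) : iL k F (algebraMap k[X] F p) = eL p := by
  exact IsFractionRing.lift_algebraMap _ _

/-- the coordinate -/
noncomputable def sF : F := algebraMap k[X] F X

theorem sF_ne : sF k F ≠ 0 := by
  rw [sF, Ne, map_eq_zero_iff _ (IsFractionRing.injective k[X] F)]
  exact X_ne_zero

theorem iL_s : iL k F (sF k F) = HahnSeries.single (-1 : ℤ) (1:k) := by
  rw [sF, iL_poly, eL, coe_eval₂RingHom, eval₂_X]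

omit [IsScalarTower k k[X] F] [Algebra k F] in
theorem eL_C (c : k) : eL (C c) = HahnSeries.C c := by
  rw [eL, coe_eval₂RingHom, eval₂_C]

theorem iL_smul (c : k) (f : F) (n : ℤ) : (iL k F (c • f)).coeff n = c * (iL k F f).coeff n := by
  rw [Algebra.smul_def, IsScalarTower.algebraMap_apply k k[X] F, map_mul, iL_poly, Polynomial.algebraMap_apply, Algebra.algebraMap_self_apply, eL_C, HahnSeries.C_apply, HahnSeries.coeff_single_mul, sub_zero]

theorem iL_spow (m : ℤ) : iL k F (sF k F ^ m) = HahnSeries.single (-m) (1:k) := by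
  have h : (HahnSeries.single (-1 : ℤ) (1:k)) = (HahnSeries.single (1 : ℤ) (1:k))⁻¹ := by
    rw [HahnSeries.inv_single, inv_one]
  rw [map_zpow₀, iL_s, RatFunc.single_zpow (-m), h, inv_zpow, zpow_neg]

theorem iL_spow_mul (m : ℤ) (f : F) (n : ℤ) : (iL k F (sF k F ^ m * f)).coeff n = (iL k F f).coeff (n + m) := by
  rw [map_mul, iL_spow, HahnSeries.coeff_single_mul, one_mul, sub_neg_eq_add]

/-- elements of degree at most `m` -/
noncomputable def VF (m : ℤ) : Submodule k F where
  carrier := {f | ∀ n < -m, (iL k F f).coeff n = 0}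
  add_mem' := by
    intro a b ha hb n hn
    rw [map_add, HahnSeries.coeff_add, ha n hn, hb n hn, add_zero]
  zero_mem' := by intro n _; rw [map_zero]; rfl
  smul_mem' := by
    intro c a ha n hn
    rw [iL_smul, ha n hn, mul_zero]

variable {F}

theorem mem_VF {m : ℤ} {f : F} : f ∈ VF k F m ↔ ∀ n < -m, (iL k F f).coeff n = 0 := Iff.rfl

theorem VF_mono {m n : ℤ} (h : m ≤ n) : VF k F m ≤ VF k F n := fun _ hf i hi => hf i (by omega)

theorem VF_mul {m n : ℤ} {f g : F} (hf : f ∈ VF k F m) (hg : g ∈ VF k F n) : f * g ∈ VF k F (m + n) := by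
  intro N hN
  rw [map_mul, HahnSeries.coeff_mul]
  refine Finset.sum_eq_zero fun x hx => ?_
  rw [Finset.mem_addAntidiagonal] at hx
  by_cases h : x.1 < -m
  · rw [hf _ h, zero_mul]
  · rw [hg x.2 (by omega), mul_zero]

theorem VF_spow (m : ℤ) : sF k F ^ m ∈ VF k F m := by
  intro n hn
  rw [iL_spow, HahnSeries.coeff_single_of_ne (by omega)]

theorem VF_spow_mul {m j : ℤ} {f : F} : sF k F ^ j * f ∈ VF k F (m + j) ↔ f ∈ VF k F m := by
  constructor
  · intro h
    have h2 := VF_mul k (VF_spow k (F := F) (-j)) h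
    rw [← mul_assoc, ← zpow_add₀ (sF_ne k F)] at h2
    simpa using h2
  · intro h
    rw [add_comm]
    exact VF_mul k (VF_spow k j) h

theorem VF_one : (1 : F) ∈ VF k F 0 := by simpa using VF_spow k (F := F) 0

theorem VF_poly {m : ℤ} {p : k[X]} : algebraMap k[X] F p ∈ VF k F m ↔ ∀ i : ℕ, m < i → p.coeff i = 0 := by
  constructor
  · intro h i hi
    have := h (-i) (by omega)
    rw [iL_poly, eL_coeff] at this
    simpa using this
  · intro h n hn
    rw [iL_poly, eL_coeff]
    split_ifs with h0
    · exact h _ (by omega)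
    · rfl

theorem VF_exists (f : F) : ∃ n : ℕ, f ∈ VF k F n := by
  refine ⟨(-(iL k F f).order).toNat, fun n hn => HahnSeries.coeff_eq_zero_of_lt_order (by omega)⟩

theorem iL_inj {f g : F} (h : ∀ n, (iL k F f).coeff n = (iL k F g).coeff n) : f = g :=
  RingHom.injective (iL k F) (HahnSeries.ext (funext h))

theorem VF_split (f : F) : ∃ p : k[X], f - algebraMap k[X] F p ∈ VF k F (-1) := by
  obtain ⟨m, hm⟩ := VF_exists k f
  refine ⟨∑ i ∈ Finset.range (m + 1), monomial i ((iL k F f).coeff (-i)), fun n hn => ?_⟩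
  rw [map_sub, HahnSeries.coeff_sub, iL_poly, eL_coeff, if_pos (by omega), finset_sum_coeff]
  simp only [coeff_monomial]
  rw [Finset.sum_ite_eq']
  split_ifs with h
  · rw [show (-((-n).toNat : ℤ)) = n by omega, sub_self]
  · rw [Finset.mem_range] at h
    rw [hm n (by omega), sub_zero]

theorem VF_detect_poly (f : F) (h : ∀ j : ℕ, (iL k F (sF k F ^ j * f)).coeff 1 = 0) :
    ∃ p : k[X], algebraMap k[X] F p = f := by
  obtain ⟨p, hp⟩ := VF_split k f
  refine ⟨p, ?_⟩
  apply iL_inj k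
  intro n
  by_cases hn : n < 1
  · have := hp n (by omega)
    rw [map_sub, HahnSeries.coeff_sub, sub_eq_zero] at this
    exact this.symm
  · have := h (n - 1).toNat
    rw [← zpow_natCast, iL_spow_mul] at this
    rw [show (1 : ℤ) + ((n-1).toNat : ℤ) = n by omega] at this
    rw [this, iL_poly, eL_coeff, if_neg (by omega)]

theorem VF_detect (f : F) (h : ∀ j : ℕ, (iL k F (sF k F ^ (-j : ℤ) * f)).coeff 1 = 0) : f ∈ VF k F (-2) := by
  intro n hn
  have := h (1 - n).toNat
  rw [iL_spow_mul] at this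
  rwa [show (1 : ℤ) + -((1-n).toNat : ℤ) = n by omega] at this

theorem VF_unit (f : F) (hf : f ≠ 0) : ∃ n : ℤ, sF k F ^ n * f ∈ VF k F 0 ∧ (sF k F ^ n * f)⁻¹ ∈ VF k F 0 ∧
    ∀ m, f ∈ VF k F m ↔ -n ≤ m := by
  have hne : iL k F f ≠ 0 := by
    rw [Ne, map_eq_zero]; exact hf
  set N := (iL k F f).order with hN
  have h1 : sF k F ^ N * f ∈ VF k F 0 := by
    intro n hn
    rw [iL_spow_mul]
    exact HahnSeries.coeff_eq_zero_of_lt_order (by omega)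
  refine ⟨N, h1, ?_, ?_⟩
  · set u := sF k F ^ N * f with hu
    have hu0 : u ≠ 0 := mul_ne_zero (zpow_ne_zero _ (sF_ne k F)) hf
    have hiu : iL k F u ≠ 0 := by rw [Ne, map_eq_zero]; exact hu0
    have ho : (iL k F u).order = 0 := by
      apply le_antisymm
      · apply HahnSeries.order_le_of_coeff_ne_zero
        rw [hu, iL_spow_mul, zero_add, Ne, HahnSeries.coeff_order_eq_zero]
        exact hne
      · by_contra hcon
        push Not at hcon
        have := h1 _ (by simpa using hcon)
        rw [HahnSeries.coeff_order_eq_zero] at this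
        exact hiu this
    have hiu2 : iL k F u⁻¹ ≠ 0 := by rw [Ne, map_eq_zero]; exact inv_ne_zero hu0
    have h3 : (iL k F u * iL k F u⁻¹).order = 0 := by
      rw [← map_mul, mul_inv_cancel₀ hu0, map_one, HahnSeries.order_one]
    rw [HahnSeries.order_mul hiu hiu2, ho, zero_add] at h3
    intro n hn
    exact HahnSeries.coeff_eq_zero_of_lt_order (by omega)
  · intro m
    constructor
    · intro h
      by_contra hcon
      have := h N (by omega)
      rw [HahnSeries.coeff_order_eq_zero] at this
      exact hne this
    · intro h n hn
      exact HahnSeries.coeff_eq_zero_of_lt_order (by omega)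

end laurent
end NTW


namespace NTW

open Polynomial Polynomial.Bivariate

theorem deriv_mem_of_sq {R : Type*} [CommRing R] (D : R → R) (hadd : ∀ a b, D (a + b) = D a + D b)
    (hmul : ∀ a b, D (a * b) = D a * b + a * D b) (n : Ideal R) {x : R} (hx : x ∈ n ^ 2) : D x ∈ n := by
  rw [pow_two] at hx
  refine Submodule.mul_induction_on hx ?_ ?_
  · intro a ha b hb
    rw [hmul]
    exact add_mem (n.mul_mem_left _ hb) (n.mul_mem_right _ ha)
  · intro a b ha hb
    rw [hadd]; exact add_mem ha hb

theorem derivative_mem_of_sq {R : Type*} [CommRing R] (n : Ideal R[X]) {x : R[X]} (hx : x ∈ n ^ 2) : derivative x ∈ n :=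
  deriv_mem_of_sq (fun p => derivative p) (fun a b => by simp) (fun a b => by rw [derivative_mul]) n hx

section
variable (k : Type*) [Field k]
variable (F : Type*) [Field F] [Algebra k[X] F] [IsFractionRing k[X] F] [Algebra k F] [IsScalarTower k k[X] F]

/-- the local ring at infinity of the line -/
noncomputable def O0 : Subalgebra k F where
  carrier := VF k F 0
  mul_mem' := by
    intro a b ha hb
    simpa using VF_mul k ha hb
  add_mem' := by
    intro a b ha hb
    exact add_mem ha hb
  algebraMap_mem' := by
    intro c
    rw [Algebra.algebraMap_eq_smul_one]
    exact (VF k F 0).smul_mem c (VF_one k)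

variable {k F}
theorem mem_O0 {x : F} : x ∈ O0 k F ↔ x ∈ VF k F 0 := Iff.rfl

variable (k F)
/-- uniformizer -/
noncomputable def sg : O0 k F := ⟨(sF k F)⁻¹, by
  rw [mem_O0]
  have := VF_spow k (F := F) (-1)
  rw [zpow_neg_one] at this
  exact VF_mono k (by norm_num) this⟩

theorem sg_not_unit : ¬ IsUnit (sg k F) := by
  intro h
  obtain ⟨u, hu⟩ := h.exists_right_inv
  have h1 : (sF k F)⁻¹ * (u : F) = 1 := congrArg Subtype.val hu
  have h2 : (u : F) = sF k F := by
    have := sF_ne k F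
    field_simp at h1
    exact h1
  have h3 : (u : F) ∈ VF k F 0 := u.2
  rw [h2, sF, VF_poly] at h3
  have := h3 1 (by norm_num)
  simp at this

theorem sg_ne : sg k F ≠ 0 := by
  intro h
  have h1 : (sF k F)⁻¹ = 0 := congrArg Subtype.val h
  exact sF_ne k F (inv_eq_zero.1 h1)

theorem sg_assoc (x : O0 k F) (hx : x ≠ 0) : ∃ n : ℕ, Associated (sg k F ^ n) x := by
  have hx0 : (x : F) ≠ 0 := fun h => hx (Subtype.ext h)
  obtain ⟨n, h1, h2, h3⟩ := VF_unit k (x : F) hx0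
  have hn : 0 ≤ n := by have := (h3 0).1 x.2; omega
  have hs := sF_ne k F
  have hu0 : sF k F ^ n * (x:F) ≠ 0 := mul_ne_zero (zpow_ne_zero _ hs) hx0
  let u : (O0 k F)ˣ := ⟨⟨sF k F ^ n * x, h1⟩, ⟨_, h2⟩, Subtype.ext (mul_inv_cancel₀ hu0), Subtype.ext (inv_mul_cancel₀ hu0)⟩
  refine ⟨n.toNat, u, Subtype.ext ?_⟩
  change ((sF k F)⁻¹) ^ n.toNat * (sF k F ^ n * x) = x
  rw [← zpow_natCast, Int.toNat_of_nonneg hn, inv_zpow, ← mul_assoc, inv_mul_cancel₀ (zpow_ne_zero _ hs), one_mul]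

theorem sg_irreducible : Irreducible (sg k F) := by
  refine ⟨sg_not_unit k F, fun a b hab => ?_⟩
  have h0 := sg_ne k F
  have ha : a ≠ 0 := by rintro rfl; simp at hab; exact h0 hab
  have hb : b ≠ 0 := by rintro rfl; simp at hab; exact h0 hab
  obtain ⟨i, hi⟩ := sg_assoc k F a ha
  obtain ⟨j, hj⟩ := sg_assoc k F b hb
  rcases Nat.eq_zero_or_pos i with rfl | hi0
  · left; rw [pow_zero] at hi; exact hi.symm.isUnit_iff.2 isUnit_one
  rcases Nat.eq_zero_or_pos j with rfl | hj0
  · right; rw [pow_zero] at hj; exact hj.symm.isUnit_iff.2 isUnit_one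
  exfalso
  have h1 : sg k F ∣ a := (dvd_pow_self _ (by omega)).trans hi.dvd
  have h2 : sg k F ∣ b := (dvd_pow_self _ (by omega)).trans hj.dvd
  obtain ⟨c, hc⟩ := mul_dvd_mul h1 h2
  rw [← hab] at hc
  apply sg_not_unit k F
  refine IsUnit.of_mul_eq_one c (mul_left_cancel₀ h0 ?_)
  rw [← mul_assoc, ← hc, mul_one]

instance : IsDiscreteValuationRing (O0 k F) :=
  IsDiscreteValuationRing.ofHasUnitMulPowIrreducibleFactorization
    ⟨sg k F, sg_irreducible k F, fun {x} hx => sg_assoc k F x hx⟩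

variable {k F}
theorem coeff0_iff {f : F} (hf : f ∈ VF k F 0) (c : k) :
    f - algebraMap k F c ∈ VF k F (-1) ↔ (iL k F f).coeff 0 = c := by
  have h1 : ∀ n, (iL k F (algebraMap k F c)).coeff n = if n = 0 then c else 0 := by
    intro n
    rw [Algebra.algebraMap_eq_smul_one, iL_smul, map_one, HahnSeries.coeff_one]
    simp
  constructor
  · intro h
    have := h 0 (by norm_num)
    rw [map_sub, HahnSeries.coeff_sub, h1, if_pos rfl, sub_eq_zero] at this
    exact this
  · intro h n hn
    rw [map_sub, HahnSeries.coeff_sub, h1]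
    split_ifs with h0
    · rw [h0, h, sub_self]
    · rw [hf n (by omega), sub_zero]

variable (k F)
/-- residue map -/
noncomputable def rho : O0 k F →+* k where
  toFun x := (iL k F x).coeff 0
  map_one' := by
    change (iL k F (1 : F)).coeff 0 = 1
    simp
  map_mul' := by
    intro x y
    have hx := (coeff0_iff x.2 _).2 rfl
    have hy := (coeff0_iff y.2 _).2 rfl
    rw [← coeff0_iff (x * y).2]
    have h1 := VF_mul k (show (x:F) ∈ VF k F 0 from x.2) hy
    have h2 := (VF k F (-1)).smul_mem ((iL k F y).coeff 0) hx
    rw [zero_add] at h1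
    convert add_mem h1 h2 using 1
    rw [Algebra.smul_def, map_mul]
    push_cast
    ring
  map_zero' := by
    change (iL k F (0 : F)).coeff 0 = 0
    simp
  map_add' := by
    intro x y
    change (iL k F ((x : F) + y)).coeff 0 = _
    rw [map_add, HahnSeries.coeff_add]

theorem rho_apply (x : O0 k F) : rho k F x = (iL k F x).coeff 0 := rfl

theorem rho_algebraMap (c : k) : rho k F (algebraMap k (O0 k F) c) = c := by
  rw [rho_apply]
  apply (coeff0_iff _ _).1
  · change algebraMap k F c - algebraMap k F c ∈ _
    rw [sub_self]; exact zero_mem _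
  · exact (algebraMap k (O0 k F) c).2

theorem rho_eq_zero (x : O0 k F) : rho k F x = 0 ↔ sg k F ∣ x := by
  constructor
  · intro h
    have h1 : (x:F) ∈ VF k F (-1) := by
      have := (coeff0_iff x.2 0).2 h
      simpa using this
    have h2 : sF k F * (x:F) ∈ VF k F 0 := by
      have := (VF_spow_mul k (m := -1) (j := 1)).2 h1
      simpa using this
    refine ⟨⟨_, h2⟩, Subtype.ext ?_⟩
    change (x:F) = (sF k F)⁻¹ * (sF k F * x)
    rw [inv_mul_cancel_left₀ (sF_ne k F)]
  · rintro ⟨y, rfl⟩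
    rw [map_mul]
    have : rho k F (sg k F) = 0 := by
      rw [rho_apply]
      change (iL k F (sF k F)⁻¹).coeff 0 = 0
      rw [← zpow_neg_one, iL_spow, HahnSeries.coeff_single_of_ne (by norm_num)]
    rw [this, zero_mul]

variable {k F}

/-- the equation of the curve at infinity -/
theorem exists_Q {d : ℕ} {P : k[X][Y]} (hm : P.Monic) (hn : P.natDegree = d) (ht : TD d P) :
    ∃ Q : (O0 k F)[X], Q.map (algebraMap (O0 k F) F) = (P.map (algebraMap k[X] F)).scaleRoots (sF k F)⁻¹ ∧
      Q.natDegree = d ∧ Q.Monic ∧ Q.map (rho k F) = top d P := by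
  set Pb := P.map (algebraMap k[X] F) with hPb
  have hPbm : Pb.Monic := hm.map _
  have hPbn : Pb.natDegree = d := by rw [hPb, hm.natDegree_map, hn]
  have hc : ∀ j, (Pb.scaleRoots (sF k F)⁻¹).coeff j = sF k F ^ (-((d - j : ℕ):ℤ)) * algebraMap k[X] F (P.coeff j) := by
    intro j
    rw [coeff_scaleRoots, hPbn, hPb, coeff_map, zpow_neg, zpow_natCast, inv_pow, mul_comm]
  have hlift : Pb.scaleRoots (sF k F)⁻¹ ∈ lifts (algebraMap (O0 k F) F) := by
    rw [lifts_iff_coeff_lifts]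
    intro j
    rw [hc]
    refine ⟨⟨_, ?_⟩, rfl⟩
    rw [mem_O0]
    by_cases hj : j ≤ d
    · have : algebraMap k[X] F (P.coeff j) ∈ VF k F ((d - j : ℕ) : ℤ) := by
        rw [VF_poly]
        intro i hi
        exact ht i j (by omega)
      have h2 := (VF_spow_mul k (j := -((d - j : ℕ):ℤ))).2 this
      rwa [add_neg_cancel] at h2
    · have h0 : P.coeff j = 0 := coeff_eq_zero_of_natDegree_lt (by omega)
      have h1 : sF k F ^ (-((d - j : ℕ):ℤ)) * algebraMap k[X] F (P.coeff j) = 0 := by rw [h0, map_zero, mul_zero]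
      have h2 : sF k F ^ (-((d - j : ℕ):ℤ)) * algebraMap k[X] F (P.coeff j) ∈ VF k F 0 := by
        rw [h1]; exact zero_mem _
      exact h2
  obtain ⟨Q, h1, h2, h3⟩ := lifts_and_natDegree_eq_and_monic hlift ((monic_scaleRoots_iff _).2 hPbm)
  refine ⟨Q, h1, by rw [h2, natDegree_scaleRoots, hPbn], h3, ?_⟩
  ext j
  rw [coeff_map, rho_apply, coeff_top]
  have h4 : ((Q.coeff j : O0 k F) : F) = (Q.map (algebraMap (O0 k F) F)).coeff j := by
    rw [coeff_map]; rfl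
  rw [h4, h1, hc, iL_spow_mul, iL_poly, eL_coeff]
  split_ifs with h5 h6 h6
  · congr 1; omega
  · have h0 : P.coeff j = 0 := coeff_eq_zero_of_natDegree_lt (by omega)
    rw [h0, coeff_zero]
  · omega
  · rfl

theorem Q_smooth (Q : (O0 k F)[X]) (hs : (Q.map (rho k F)).Separable) (n : Ideal (O0 k F)[X]) (hn : n.IsPrime)
    (hc : n.comap C ≠ ⊥) (hQ : Q ∈ n) : Q ∉ n ^ 2 := by
  intro h2
  have hd : derivative Q ∈ n := derivative_mem_of_sq n h2
  have hσ : C (sg k F) ∈ n := by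
    obtain ⟨x, hx, hx0⟩ := Submodule.exists_mem_ne_zero_of_ne_bot hc
    obtain ⟨m, hm⟩ := sg_assoc k F x hx0
    obtain ⟨y, hy⟩ := hm.symm.dvd
    apply hn.mem_of_pow_mem m
    rw [← C_pow, hy, C_mul]
    exact n.mul_mem_right _ hx
  obtain ⟨a, b, hab⟩ := hs
  set a' := a.map (algebraMap k (O0 k F))
  set b' := b.map (algebraMap k (O0 k F))
  have hr : (rho k F).comp (algebraMap k (O0 k F)) = RingHom.id k := RingHom.ext (rho_algebraMap k F)
  have ha : a'.map (rho k F) = a := by rw [map_map, hr, map_id]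
  have hb : b'.map (rho k F) = b := by rw [map_map, hr, map_id]
  have h3 : (a' * Q + b' * derivative Q - 1).map (rho k F) = 0 := by
    rw [Polynomial.map_sub, Polynomial.map_add, Polynomial.map_mul, Polynomial.map_mul, ha, hb, ← derivative_map, hab, Polynomial.map_one, sub_self]
  have h4 : C (sg k F) ∣ a' * Q + b' * derivative Q - 1 := by
    rw [C_dvd_iff_dvd_coeff]
    intro i
    rw [← rho_eq_zero, ← coeff_map, h3, coeff_zero]
  obtain ⟨z, hz⟩ := h4
  apply hn.ne_top
  rw [Ideal.eq_top_iff_one]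
  have : (1 : (O0 k F)[X]) = a' * Q + b' * derivative Q - C (sg k F) * z := by rw [← hz]; ring
  rw [this]
  exact sub_mem (add_mem (n.mul_mem_left _ hQ) (n.mul_mem_left _ hd)) (n.mul_mem_right _ hσ)

theorem A_smooth {d : ℕ} {P : k[X][Y]} (hG : Good d P) (n : Ideal k[X][Y]) (hn : n.IsPrime)
    (hQ : P ∈ n) : P ∉ n ^ 2 := by
  intro h2
  have hd : derivative P ∈ n := derivative_mem_of_sq n h2
  have hx : pX P ∈ n := deriv_mem_of_sq pX pX_add pX_mul n h2
  obtain ⟨u, v, w, h⟩ := hG.smooth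
  apply hn.ne_top
  rw [Ideal.eq_top_iff_one, ← h]
  exact add_mem (add_mem (n.mul_mem_left _ hQ) (n.mul_mem_left _ hx)) (n.mul_mem_left _ hd)

end
end NTW


namespace NTW

open Polynomial

section coords

variable {k F K A O : Type*} [Field k] [Field F] [Algebra k[X] F] [IsFractionRing k[X] F] [Algebra k F] [IsScalarTower k k[X] F]
  [Field K] [Algebra F K] [Algebra k K] [IsScalarTower k F K] [CommRing A] [CommRing O] [Algebra A K] [Algebra O K]

/-- coordinate description of the two rings of a curve -/
structure Crd (k F K A O : Type*) [Field k] [Field F] [Algebra k[X] F] [IsFractionRing k[X] F] [Algebra k F] [IsScalarTower k k[X] F]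
  [Field K] [Algebra F K] [Algebra k K] [IsScalarTower k F K] [CommRing A] [CommRing O] [Algebra A K] [Algebra O K] (d : ℕ)
  (b : Module.Basis (Fin d) F K) (t : K) : Prop where
  hd : 3 ≤ d
  hb : ∀ i, b i = t ^ (i : ℕ)
  hA : ∀ x, (∃ a : A, algebraMap A K a = x) ↔ ∀ i, ∃ p, algebraMap k[X] F p = b.repr x i
  hO : ∀ x, (∃ o : O, algebraMap O K o = x) ↔ ∀ i : Fin d, b.repr x i ∈ VF k F (-((i : ℕ) : ℤ))
  injA : Function.Injective (algebraMap A K)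
  injO : Function.Injective (algebraMap O K)

variable {d : ℕ} {b : Module.Basis (Fin d) F K} {t : K}

theorem repr_algebraMap_mul (f : F) (x : K) (i : Fin d) : b.repr (algebraMap F K f * x) i = f * b.repr x i := by
  rw [← Algebra.smul_def, map_smul, Finsupp.smul_apply, smul_eq_mul]

namespace Crd

variable (C : Crd k F K A O d b t)
include C

theorem memA (x : K) : x ∈ lat 1 (⊤ : Ideal A) ↔ ∀ i, ∃ p, algebraMap k[X] F p = b.repr x i := by
  rw [mem_lat, ← C.hA]
  constructor
  · rintro ⟨a, -, rfl⟩; exact ⟨a, by simp⟩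
  · rintro ⟨a, rfl⟩; exact ⟨a, trivial, by simp⟩

theorem memO (m : ℤ) (x : K) : x ∈ lat ((algebraMap F K (sF k F)) ^ m) (⊤ : Ideal O) ↔ ∀ i : Fin d, b.repr x i ∈ VF k F (m - ((i : ℕ) : ℤ)) := by
  have hs := sF_ne k F
  have e : ∀ i : Fin d, b.repr x i ∈ VF k F (m - ((i : ℕ) : ℤ)) ↔ b.repr (algebraMap F K (sF k F ^ (-m)) * x) i ∈ VF k F (-((i : ℕ) : ℤ)) := by
    intro i
    rw [repr_algebraMap_mul, ← VF_spow_mul k (j := -m) (m := m - ((i:ℕ):ℤ))]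
    rw [show m - ((i:ℕ):ℤ) + -m = -((i:ℕ):ℤ) by ring]
  simp only [e, ← C.hO, mem_lat]
  have hs' : algebraMap F K (sF k F) ≠ 0 := by simpa using hs
  constructor
  · rintro ⟨a, -, rfl⟩
    refine ⟨a, ?_⟩
    rw [map_zpow₀, zpow_neg, inv_mul_cancel_left₀ (zpow_ne_zero _ hs')]
  · rintro ⟨a, h⟩
    refine ⟨a, trivial, ?_⟩
    rw [h, map_zpow₀, zpow_neg, mul_inv_cancel_left₀ (zpow_ne_zero _ hs')]

theorem repr_pow (i : ℕ) (hi : i < d) (f : F) : b.repr (algebraMap F K f * t ^ i) = Finsupp.single ⟨i, hi⟩ f := by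
  rw [show t ^ i = b ⟨i, hi⟩ by rw [C.hb], ← Algebra.smul_def, map_smul, b.repr_self]
  simp

theorem repr_shift (x : K) (n : ℕ) (hn : n < d) (h : ∀ i : Fin d, n < i → b.repr x i = 0) (l : Fin d) (hl : (l : ℕ) = d - 1) :
    b.repr (x * t ^ (d - 1 - n)) l = b.repr x ⟨n, hn⟩ := by
  conv_lhs => rw [← b.sum_repr x]
  rw [Finset.sum_mul, map_sum, Finsupp.finset_sum_apply, Finset.sum_eq_single ⟨n, hn⟩]
  · rw [C.hb, smul_mul_assoc, ← pow_add, Algebra.smul_def, C.repr_pow _ (by simp only; omega)]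
    rw [Finsupp.single_apply, if_pos]
    ext; simp only; omega
  · intro i _ hi
    by_cases hin : n < i
    · rw [h i hin]; simp
    · have : (i:ℕ) ≠ n := fun h => hi (by ext; exact h)
      rw [C.hb, smul_mul_assoc, ← pow_add, Algebra.smul_def, C.repr_pow _ (by omega), Finsupp.single_apply, if_neg]
      intro he
      have := congrArg Fin.val he
      simp only at this
      omega
  · simp

/-- index of the last coordinate -/
theorem triv (m : ℤ) (hm : m < 0) : lat 1 (⊤ : Ideal A) ⊓ lat ((algebraMap F K (sF k F)) ^ m) (⊤ : Ideal O) = ⊥ := by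
  rw [eq_bot_iff]
  rintro x ⟨h1, h2⟩
  have h1 := (C.memA x).1 h1
  have h2 := (C.memO m x).1 h2
  have : b.repr x = 0 := by
    ext i
    obtain ⟨p, hp⟩ := h1 i
    have h3 := h2 i
    rw [← hp, VF_poly] at h3
    have : p = 0 := by ext j; exact h3 j (by omega)
    rw [← hp, this]; simp
  simpa using this

theorem index_sigma [Fintype k] (m : ℤ) : (lat ((algebraMap F K (sF k F)) ^ (m - 1)) (⊤ : Ideal O)).relIndex
    (lat ((algebraMap F K (sF k F)) ^ m) (⊤ : Ideal O)) = Fintype.card k ^ d := by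
  let φ : K →+ (Fin d → k) :=
    { toFun := fun x i => (iL k F (b.repr x i)).coeff ((i : ℕ) - m)
      map_zero' := by ext; simp
      map_add' := by intro x y; ext; simp }
  set U := lat ((algebraMap F K (sF k F)) ^ m) (⊤ : Ideal O) with hU
  have h1 : lat ((algebraMap F K (sF k F)) ^ (m - 1)) (⊤ : Ideal O) = φ.ker ⊓ U := by
    ext x
    rw [AddSubgroup.mem_inf, C.memO, hU, C.memO, AddMonoidHom.mem_ker, funext_iff]
    simp only [mem_VF]
    constructor
    · intro h
      exact ⟨fun i => h i _ (by omega), fun i n hn => h i n (by omega)⟩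
    · rintro ⟨h1, h2⟩ i n hn
      rcases eq_or_ne n ((i:ℕ) - m) with rfl | hne
      · exact h1 i
      · exact h2 i n (by omega)
  rw [h1, AddSubgroup.inf_relIndex_right, AddSubgroup.relIndex_ker]
  have : U.map φ = ⊤ := by
    rw [eq_top_iff]
    intro c _
    refine ⟨∑ i : Fin d, (sF k F ^ (m - (i:ℕ)) * algebraMap k[X] F (Polynomial.C (c i))) • b i, ?_, ?_⟩
    · rw [hU]
      refine (C.memO m _).2 fun i => ?_
      rw [b.repr_sum_self]
      have := (VF_spow_mul k (F := F) (j := m - (i:ℕ)) (m := 0) (f := algebraMap k[X] F (Polynomial.C (c i)))).2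
        ((VF_poly k).2 fun j hj => by rw [coeff_C, if_neg]; omega)
      simpa using this
    · funext i
      change (iL k F (b.repr _ i)).coeff _ = _
      rw [b.repr_sum_self, iL_spow_mul, iL_poly, eL_coeff]
      simp
  rw [this]
  simp

theorem cardInf [Fintype k] (m : ℕ) : Nat.card (lat 1 (⊤ : Ideal A) ⊓ lat ((algebraMap F K (sF k F)) ^ (m : ℤ)) (⊤ : Ideal O) : AddSubgroup K) =
    Fintype.card k ^ hdim d m := by
  let Ψ : (∀ i : Fin d, degreeLT k (m + 1 - i)) → K := fun p => ∑ i, algebraMap k[X] F (p i : k[X]) • b i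
  have hr : ∀ p i, b.repr (Ψ p) i = algebraMap k[X] F (p i : k[X]) := fun p i => congrFun (b.repr_sum_self _) i
  have hinj : Function.Injective Ψ := by
    intro p p' h
    funext i
    apply Subtype.ext
    apply IsFractionRing.injective k[X] F
    rw [← hr, ← hr, h]
  have hrange : Set.range Ψ = ((lat 1 (⊤ : Ideal A) ⊓ lat ((algebraMap F K (sF k F)) ^ (m : ℤ)) (⊤ : Ideal O) : AddSubgroup K) : Set K) := by
    ext x
    rw [SetLike.mem_coe, AddSubgroup.mem_inf, C.memA, C.memO]
    constructor
    · rintro ⟨p, rfl⟩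
      refine ⟨fun i => ⟨_, (hr p i).symm⟩, fun i => ?_⟩
      rw [hr, VF_poly]
      intro j hj
      have h := (p i).2
      rw [mem_degreeLT] at h
      apply coeff_eq_zero_of_degree_lt
      refine h.trans_le ?_
      exact_mod_cast (by omega : m + 1 - (i:ℕ) ≤ j)
    · rintro ⟨h1, h2⟩
      choose p hp using h1
      refine ⟨fun i => ⟨p i, ?_⟩, ?_⟩
      · have h3 := h2 i
        rw [← hp, VF_poly] at h3
        rw [mem_degreeLT, degree_lt_iff_coeff_zero]
        intro j hj
        exact h3 j (by omega)
      · apply b.repr.injective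
        ext i
        rw [hr]; exact hp i
  have e : Nat.card (Set.range Ψ) = Nat.card (lat 1 (⊤ : Ideal A) ⊓ lat ((algebraMap F K (sF k F)) ^ (m : ℤ)) (⊤ : Ideal O) : AddSubgroup K) := by
    rw [hrange]; rfl
  rw [← e, Nat.card_congr (Equiv.ofInjective Ψ hinj).symm, Nat.card_pi]
  have h1 : ∀ n, Nat.card (degreeLT k n) = Fintype.card k ^ n := by
    intro n
    rw [Nat.card_congr (degreeLTEquiv k n).toEquiv]; simp
  simp only [h1]
  rw [Finset.prod_pow_eq_pow_sum, hdim, Finset.sum_range]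

theorem sup_top (m : ℤ) (hm : (d : ℤ) - 2 ≤ m) : lat 1 (⊤ : Ideal A) ⊔ lat ((algebraMap F K (sF k F)) ^ m) (⊤ : Ideal O) = ⊤ := by
  rw [eq_top_iff]
  intro x _
  choose p hp using fun i => VF_split k (b.repr x i)
  set a := ∑ i, algebraMap k[X] F (p i) • b i with ha
  have hr : ∀ i, b.repr a i = algebraMap k[X] F (p i) := fun i => congrFun (b.repr_sum_self _) i
  rw [← add_sub_cancel a x]
  apply AddSubgroup.add_mem_sup
  · exact (C.memA _).2 fun i => ⟨p i, (hr i).symm⟩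
  · refine (C.memO _ _).2 fun i => ?_
    rw [map_sub, Finsupp.sub_apply, hr]
    exact VF_mono k (by omega) (hp i)

theorem exhO (y : K) : ∃ (n : ℕ) (o : O), y = (algebraMap F K (sF k F)) ^ n * algebraMap O K o := by
  choose n hn using fun i => VF_exists k (b.repr y i)
  have : y ∈ lat ((algebraMap F K (sF k F)) ^ ((∑ i, n i + d : ℕ) : ℤ)) (⊤ : Ideal O) := by
    refine (C.memO _ _).2 fun i => VF_mono k ?_ (hn i)
    have : n i ≤ ∑ i, n i := Finset.single_le_sum (fun _ _ => Nat.zero_le _) (Finset.mem_univ i)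
    push_cast
    have h2 := i.2
    zify at this h2
    omega
  obtain ⟨o, -, ho⟩ := mem_lat.1 this
  exact ⟨_, o, by rw [ho, zpow_natCast]⟩

theorem sigma : ∃ σ : O, algebraMap O K σ = (algebraMap F K (sF k F))⁻¹ := by
  refine (C.hO _).2 fun i => ?_
  have := C.hd
  have h := C.repr_pow 0 (by omega) (sF k F)⁻¹
  rw [pow_zero, mul_one, map_inv₀] at h
  rw [h, Finsupp.single_apply]
  split_ifs with h
  · have h1 := (VF_spow_mul k (F := F) (j := -1) (m := 0) (f := 1)).2 (VF_one k)
    have : (i:ℕ) = 0 := by rw [← h]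
    rw [this]
    simp only [zpow_neg, zpow_one, mul_one] at h1
    exact VF_mono k (by simp) h1
  · exact Submodule.zero_mem _

theorem sigma_card [Fintype k] (σ : O) (hσ : algebraMap O K σ = (algebraMap F K (sF k F))⁻¹) :
    (Ideal.span {σ}).cardQuot = Fintype.card k ^ d := by
  rw [← relIndex_lat C.injO one_ne_zero, lat_span, hσ, ← C.index_sigma 0]
  simp

theorem euler [Fintype k] (g : ℕ) (hg : (d : ℤ) * (d - 3) = 2 * g - 2) (m : ℤ) :
    Fchi (lat 1 (⊤ : Ideal A)) (lat ((algebraMap F K (sF k F)) ^ m) (⊤ : Ideal O)) ∧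
    NTW.chi (lat 1 (⊤ : Ideal A)) (lat ((algebraMap F K (sF k F)) ^ m) (⊤ : Ideal O)) = (Fintype.card k : ℚ) ^ ((d:ℤ) * m + 1 - g) := by
  have hq : (Fintype.card k : ℚ) ≠ 0 := by simp
  have big : ∀ m : ℕ, d - 2 ≤ m → Fchi (lat 1 (⊤ : Ideal A)) (lat ((algebraMap F K (sF k F)) ^ (m:ℤ)) (⊤ : Ideal O)) ∧
    NTW.chi (lat 1 (⊤ : Ideal A)) (lat ((algebraMap F K (sF k F)) ^ (m:ℤ)) (⊤ : Ideal O)) = (Fintype.card k : ℚ) ^ ((d:ℤ) * m + 1 - g) := by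
    intro m hm
    have h1 := C.cardInf m
    have h2 := C.sup_top m (by omega)
    have h3 := hdim_eq d m (by omega)
    have h4 : (d:ℤ) * m + 1 - g = (hdim d m : ℕ) := by
      have : 2 * ((d:ℤ) * m + 1 - g) = 2 * (hdim d m : ℕ) := by rw [h3]; linear_combination hg
      omega
    refine ⟨⟨?_, ?_⟩, ?_⟩
    · rw [h1]; exact pow_ne_zero _ (by simp)
    · rw [h2]; simp
    · rw [NTW.chi, h1, h2, h4]; simp
  have step : ∀ n : ℕ, ∀ m : ℤ, (d:ℤ) - 2 ≤ m + n → Fchi (lat 1 (⊤ : Ideal A)) (lat ((algebraMap F K (sF k F)) ^ m) (⊤ : Ideal O)) ∧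
    NTW.chi (lat 1 (⊤ : Ideal A)) (lat ((algebraMap F K (sF k F)) ^ m) (⊤ : Ideal O)) = (Fintype.card k : ℚ) ^ ((d:ℤ) * m + 1 - g) := by
    intro n
    induction n with
    | zero =>
      intro m hm
      have := C.hd
      obtain ⟨m', rfl⟩ := Int.eq_ofNat_of_zero_le (a := m) (by omega)
      exact big m' (by omega)
    | succ n ih =>
      intro m hm
      obtain ⟨h1, h2⟩ := ih (m + 1) (by push_cast at hm; linarith)
      have h3 := C.index_sigma (m + 1)
      rw [add_sub_cancel_right] at h3
      have hle : lat ((algebraMap F K (sF k F)) ^ m) (⊤ : Ideal O) ≤ lat ((algebraMap F K (sF k F)) ^ (m+1)) (⊤ : Ideal O) := by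
        intro x hx
        exact (C.memO _ _).2 fun i => VF_mono k (by omega) ((C.memO _ _).1 hx i)
      obtain ⟨h4, h5⟩ := chi_right hle (by rw [h3]; exact pow_ne_zero _ (by simp)) h1
      refine ⟨h4, ?_⟩
      rw [h2, h3] at h5
      have h6 : (Fintype.card k : ℚ) ^ ((d:ℤ) * (m+1) + 1 - g) = (Fintype.card k : ℚ) ^ ((d:ℤ) * m + 1 - g) * (Fintype.card k : ℚ) ^ d := by
        rw [← zpow_natCast, ← zpow_add₀ hq]; congr 1; ring
      rw [h6] at h5
      push_cast at h5
      exact (mul_right_cancel₀ (pow_ne_zero _ hq) h5).symm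
  exact step (d + m.natAbs) m (by omega)

theorem pow_mem_of_ne (σ : O) (hσ : algebraMap O K σ = (algebraMap F K (sF k F))⁻¹) (I : Ideal O) (hI : I ≠ ⊥) : ∃ n, σ ^ n ∈ I := by
  obtain ⟨y, hy, hy0⟩ := Submodule.exists_mem_ne_zero_of_ne_bot hI
  have hy' : algebraMap O K y ≠ 0 := fun h => hy0 (C.injO (by rw [h, map_zero]))
  obtain ⟨n, o, ho⟩ := C.exhO (algebraMap O K y)⁻¹
  refine ⟨n, ?_⟩
  have hs' : algebraMap F K (sF k F) ≠ 0 := by simpa using sF_ne k F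
  have : σ ^ n = o * y := by
    apply C.injO
    rw [map_pow, map_mul, hσ]
    have h2 : 1 = algebraMap F K (sF k F) ^ n * algebraMap O K o * algebraMap O K y := by
      rw [← ho, inv_mul_cancel₀ hy']
    rw [inv_pow]
    exact inv_eq_of_mul_eq_one_right (by rw [← mul_assoc, ← h2])
  rw [this]
  exact I.mul_mem_left _ hy

theorem memA' (x : K) (h : ∀ i, ∃ p, algebraMap k[X] F p = b.repr x i) : ∃ a : A, algebraMap A K a = x := (C.hA x).2 h

theorem pow_memA (i j : ℕ) (hi : i < d) (p : k[X]) : ∃ a : A, algebraMap A K a = algebraMap F K (algebraMap k[X] F p) * t ^ i := by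
  refine (C.hA _).2 fun l => ?_
  rw [C.repr_pow i hi, Finsupp.single_apply]
  split_ifs
  · exact ⟨p, rfl⟩
  · exact ⟨0, map_zero _⟩

theorem pow_memO (i : ℕ) (hi : i < d) (f : F) (hf : f ∈ VF k F (-(i:ℤ))) : ∃ a : O, algebraMap O K a = algebraMap F K f * t ^ i := by
  refine (C.hO _).2 fun l => ?_
  rw [C.repr_pow i hi, Finsupp.single_apply]
  split_ifs with h
  · rw [← h]; exact hf
  · exact Submodule.zero_mem _

/-- the residue functional -/
noncomputable def lamF (k : Type*) {F K : Type*} [Field k] [Field F] [Algebra k[X] F] [IsFractionRing k[X] F] [Algebra k F] [IsScalarTower k k[X] F]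
  [Field K] [Algebra F K] [Algebra k K] [IsScalarTower k F K] {d : ℕ} (b : Module.Basis (Fin d) F K) (l : Fin d) : K →ₗ[k] k where
  toFun x := (iL k F (b.repr x l)).coeff 1
  map_add' x y := by simp
  map_smul' c x := by
    rw [← algebraMap_smul F c x, map_smul, Finsupp.smul_apply, algebraMap_smul, iL_smul]
    rfl

theorem lamF_A (l : Fin d) (x : K) (h : ∀ i, ∃ p, algebraMap k[X] F p = b.repr x i) : lamF k b l x = 0 := by
  obtain ⟨p, hp⟩ := h l
  change (iL k F (b.repr x l)).coeff 1 = 0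
  rw [← hp, iL_poly, eL_coeff]; simp

theorem lamF_O (l : Fin d) (hl : (l:ℕ) = d - 1) (x : K) (h : ∀ i : Fin d, b.repr x i ∈ VF k F ((d:ℤ) - 3 - (i:ℕ))) : lamF k b l x = 0 := by
  have := (mem_VF k).1 (h l) 1 (by have := C.hd; rw [hl]; omega)
  exact this

theorem detA (l : Fin d) (hl : (l:ℕ) = d - 1) (n : ℕ) : ∀ w : K, n ≤ d → (∀ i : Fin d, n ≤ i → b.repr w i = 0) →
    (∀ a : A, lamF k b l (w * algebraMap A K a) = 0) → ∀ i, ∃ p, algebraMap k[X] F p = b.repr w i := by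
  induction n with
  | zero =>
    intro w _ h _ i
    exact ⟨0, by rw [h i (Nat.zero_le _), map_zero]⟩
  | succ n ih =>
    intro w hn h hl0
    have h1 : ∃ p, algebraMap k[X] F p = b.repr w ⟨n, hn⟩ := by
      apply VF_detect_poly k
      intro j
      obtain ⟨a, ha⟩ := C.pow_memA (d - 1 - n) 0 (by omega) (X ^ j)
      have h2 := hl0 a
      rw [ha] at h2
      change (iL k F (b.repr _ l)).coeff 1 = 0 at h2
      rw [mul_left_comm, repr_algebraMap_mul, C.repr_shift w n hn (fun i hi => h i hi) l hl, map_pow] at h2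
      exact h2
    obtain ⟨p, hp⟩ := h1
    obtain ⟨a', ha'⟩ := C.pow_memA n 0 hn p
    have h3 := ih (w - algebraMap A K a') (by omega) ?_ ?_
    · intro i
      obtain ⟨p1, hp1⟩ := h3 i
      obtain ⟨p2, hp2⟩ := (C.hA _).1 ⟨a', rfl⟩ i
      refine ⟨p1 + p2, ?_⟩
      rw [map_add, hp1, hp2, map_sub, Finsupp.sub_apply, sub_add_cancel]
    · intro i hi
      rw [ha', map_sub, Finsupp.sub_apply, C.repr_pow n hn, Finsupp.single_apply]
      split_ifs with h5
      · rw [← h5, hp, sub_self]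
      · rw [h i, sub_zero]
        have : n ≠ (i:ℕ) := fun h => h5 (by ext; exact h)
        omega
    · intro a
      rw [sub_mul, map_sub, hl0, ← map_mul, C.lamF_A l _ ((C.hA _).1 ⟨_, rfl⟩), sub_zero]

theorem detO (l : Fin d) (hl : (l:ℕ) = d - 1) (n : ℕ) : ∀ w : K, n ≤ d → (∀ i : Fin d, n ≤ i → b.repr w i = 0) →
    (∀ a : O, lamF k b l (w * algebraMap O K a) = 0) → ∀ i : Fin d, b.repr w i ∈ VF k F ((d:ℤ) - 3 - (i:ℕ)) := by
  have hs' : algebraMap F K (sF k F) ≠ 0 := by simpa using sF_ne k F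
  induction n with
  | zero =>
    intro w _ h _ i
    rw [h i (Nat.zero_le _)]; exact Submodule.zero_mem _
  | succ n ih =>
    intro w hn h hl0
    have h1 : b.repr w ⟨n, hn⟩ ∈ VF k F ((d:ℤ) - 3 - n) := by
      have : sF k F ^ (-((d:ℤ) - 1 - n)) * b.repr w ⟨n, hn⟩ ∈ VF k F (-2) := by
        apply VF_detect k
        intro j
        obtain ⟨a, ha⟩ := C.pow_memO (d - 1 - n) (by omega) (sF k F ^ (-(j:ℤ)) * sF k F ^ (-((d:ℤ) - 1 - n))) (by
          rw [← zpow_add₀ (sF_ne k F)]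
          have := (VF_spow_mul k (F := F) (j := (-(j:ℤ)) + (-((d:ℤ) - 1 - n))) (m := 0) (f := 1)).2 (VF_one k)
          rw [mul_one] at this
          exact VF_mono k (by omega) this)
        have h2 := hl0 a
        rw [ha] at h2
        change (iL k F (b.repr _ l)).coeff 1 = 0 at h2
        rw [mul_left_comm, repr_algebraMap_mul, C.repr_shift w n hn (fun i hi => h i hi) l hl, mul_assoc] at h2
        exact h2
      have h2 := (VF_spow_mul k (F := F) (j := -((d:ℤ) - 1 - n)) (m := (d:ℤ) - 3 - n) (f := b.repr w ⟨n, hn⟩)).1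
      apply h2
      rwa [show (d:ℤ) - 3 - n + -((d:ℤ) - 1 - n) = -2 by ring]
    set c := b.repr w ⟨n, hn⟩ with hc
    have hmem : ∀ i : Fin d, b.repr (algebraMap F K c * t ^ n) i ∈ VF k F ((d:ℤ) - 3 - (i:ℕ)) := by
      intro i
      rw [C.repr_pow n hn, Finsupp.single_apply]
      split_ifs with h5
      · rw [← h5]; exact h1
      · exact Submodule.zero_mem _
    have h3 := ih (w - algebraMap F K c * t ^ n) (by omega) ?_ ?_
    · intro i
      have := Submodule.add_mem _ (h3 i) (hmem i)
      rwa [map_sub, Finsupp.sub_apply, sub_add_cancel] at this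
    · intro i hi
      rw [map_sub, Finsupp.sub_apply, C.repr_pow n hn, Finsupp.single_apply]
      split_ifs with h5
      · rw [← h5, ← hc, sub_self]
      · rw [h i, sub_zero]
        have : n ≠ (i:ℕ) := fun h => h5 (by ext; exact h)
        omega
    · intro a
      rw [sub_mul, map_sub, hl0, zero_sub, neg_eq_zero]
      apply C.lamF_O l hl
      rw [← C.memO ((d:ℤ)-3)] at hmem ⊢
      obtain ⟨o, -, ho⟩ := mem_lat.1 hmem
      rw [ho]
      exact mem_lat.2 ⟨o * a, trivial, by rw [map_mul]; ring⟩

theorem lam : ∃ l : K →ₗ[k] k, (∀ a : A, l (algebraMap A K a) = 0) ∧ (∀ o : O, l (algebraMap F K (sF k F) ^ (d - 3) * algebraMap O K o) = 0) ∧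
    (∀ w, (∀ a : A, l (w * algebraMap A K a) = 0) → ∃ a : A, w = algebraMap A K a) ∧
    (∀ w, (∀ o : O, l (w * algebraMap O K o) = 0) → ∃ o : O, w = algebraMap F K (sF k F) ^ (d - 3) * algebraMap O K o) := by
  have hd := C.hd
  have e : algebraMap F K (sF k F) ^ (d - 3) = algebraMap F K (sF k F) ^ ((d:ℤ) - 3) := by
    rw [← zpow_natCast]; congr 1; omega
  refine ⟨lamF k b ⟨d - 1, by omega⟩, fun a => C.lamF_A _ _ ((C.hA _).1 ⟨a, rfl⟩), fun o => C.lamF_O _ rfl _ ?_, ?_, ?_⟩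
  · rw [← C.memO, e]; exact mem_lat.2 ⟨o, trivial, rfl⟩
  · intro w hw
    obtain ⟨a, ha⟩ := (C.hA w).2 (C.detA _ rfl d w le_rfl (fun i hi => absurd i.2 (by omega)) hw)
    exact ⟨a, ha.symm⟩
  · intro w hw
    have h := C.detO _ rfl d w le_rfl (fun i hi => absurd i.2 (by omega)) hw
    rw [← C.memO] at h
    obtain ⟨o, -, ho⟩ := mem_lat.1 h
    exact ⟨o, by rw [ho, e]⟩

theorem curve [Fintype k] [IsDedekindDomain O] [Infinite O] (g : ℕ) (hg : (d : ℤ) * (d - 3) = 2 * g - 2)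
    (finA : ∀ I : Ideal A, I ≠ ⊥ → I.cardQuot ≠ 0) :
    Curve k K A O (algebraMap F K (sF k F)) d g where
  hd := C.hd
  hdg := hg
  s0 := by simpa using sF_ne k F
  injA := C.injA
  injO := C.injO
  linA := by
    intro c a
    refine (C.hA _).2 fun i => ?_
    obtain ⟨p, hp⟩ := (C.hA _).1 ⟨a, rfl⟩ i
    refine ⟨c • p, ?_⟩
    rw [← algebraMap_smul F c (algebraMap A K a), b.repr.map_smul, Finsupp.smul_apply, algebraMap_smul, ← hp]
    rw [Algebra.smul_def c, map_mul, ← IsScalarTower.algebraMap_apply, ← Algebra.smul_def]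
  linO := by
    intro c a
    refine (C.hO _).2 fun i => ?_
    rw [← algebraMap_smul F c (algebraMap O K a), map_smul, Finsupp.smul_apply, algebraMap_smul]
    exact Submodule.smul_mem _ _ ((C.hO _).1 ⟨a, rfl⟩ i)
  exhO := C.exhO
  finA := finA
  finO := by
    intro I hI
    obtain ⟨σ, hσ⟩ := C.sigma
    obtain ⟨n, hn⟩ := C.pow_mem_of_ne σ hσ I hI
    have h1 : (Ideal.span {σ} ^ n).cardQuot ≠ 0 := by
      have : ∀ n, (Ideal.span {σ} ^ n).cardQuot = (Fintype.card k ^ d) ^ n := by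
        intro n
        induction n with
        | zero => simp
        | succ n ih => rw [pow_succ, cardQuot_mul', ih, C.sigma_card σ hσ, pow_succ]
      rw [this]
      exact pow_ne_zero _ (pow_ne_zero _ (by simp))
    have hle : Ideal.span {σ} ^ n ≤ I := by
      rw [Ideal.span_singleton_pow, Ideal.span_singleton_le_iff_mem]; exact hn
    intro h0
    exact h1 (Nat.eq_zero_of_zero_dvd (h0 ▸ AddSubgroup.index_dvd_of_le (H := (Ideal.span {σ} ^ n).toAddSubgroup) (K := I.toAddSubgroup) hle))
  euler := C.euler g hg
  triv := C.triv
  lam := C.lam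

end Crd
end coords
end NTW


namespace NTW

open Polynomial Polynomial.Bivariate

section emb

variable {R F K : Type*} [CommRing R] [Nontrivial R] [Field F] [Field K] [Algebra F K] (ι : R →+* F) (hι : Function.Injective ι)
  {d : ℕ} {b : Module.Basis (Fin d) F K} {t : K} (hb : ∀ i, b i = t ^ (i : ℕ)) {z : F} (hz : z ≠ 0)
  {Q : R[X]} (hQ : Q.Monic) (hn : Q.natDegree = d)
  (h : eval₂ ((algebraMap F K).comp ι) (algebraMap F K z * t) Q = 0)

include hQ hn in
omit [Nontrivial R] in
theorem exists_rep [Nontrivial R] (x : AdjoinRoot Q) : ∃ p : R[X], AdjoinRoot.mk Q p = x ∧ ∀ i, d ≤ i → p.coeff i = 0 := by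
  obtain ⟨p, rfl⟩ := AdjoinRoot.mk_surjective x
  refine ⟨p %ₘ Q, ?_, fun i hi => ?_⟩
  · conv_rhs => rw [← modByMonic_add_div p Q]
    simp
  · apply coeff_eq_zero_of_degree_lt
    refine (degree_modByMonic_lt p hQ).trans_le ?_
    rw [degree_eq_natDegree hQ.ne_zero, hn]
    exact_mod_cast hi

include hb in
omit [Nontrivial R] in
theorem repr_lift (p : R[X]) (hp : ∀ i, d ≤ i → p.coeff i = 0) (i : Fin d) :
    b.repr (AdjoinRoot.lift ((algebraMap F K).comp ι) (algebraMap F K z * t) h (AdjoinRoot.mk Q p)) i = z ^ (i:ℕ) * ι (p.coeff i) := by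
  have hp' : p.degree < d := by rw [degree_lt_iff_coeff_zero]; exact hp
  have : AdjoinRoot.lift ((algebraMap F K).comp ι) (algebraMap F K z * t) h (AdjoinRoot.mk Q p) =
      ∑ i : Fin d, (z ^ (i:ℕ) * ι (p.coeff i)) • b i := by
    rw [AdjoinRoot.lift_mk]
    by_cases hp0 : p = 0
    · subst hp0; simp
    · rw [eval₂_eq_sum_range' _ ((natDegree_lt_iff_degree_lt hp0).2 hp'), Finset.sum_range]
      refine Finset.sum_congr rfl fun i _ => ?_
      rw [hb, Algebra.smul_def, RingHom.comp_apply, mul_pow, map_mul, map_pow]; ring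
  rw [this, congrFun (b.repr_sum_self _) i]

include hι hb hz hQ hn in
theorem lift_inj : Function.Injective (AdjoinRoot.lift ((algebraMap F K).comp ι) (algebraMap F K z * t) h) := by
  rw [injective_iff_map_eq_zero]
  intro x hx
  obtain ⟨p, rfl, hp⟩ := exists_rep hQ hn x
  have : p = 0 := by
    ext i
    by_cases hi : d ≤ i
    · simpa using hp i hi
    · have := repr_lift ι hb h p hp ⟨i, by omega⟩
      rw [hx, map_zero, Finsupp.zero_apply, eq_comm, mul_eq_zero, or_iff_right (pow_ne_zero _ hz)] at this
      exact hι (by simpa using this)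
  rw [this, map_zero]

include hb hQ hn in
theorem lift_range (x : K) : (∃ a, AdjoinRoot.lift ((algebraMap F K).comp ι) (algebraMap F K z * t) h a = x) ↔
    ∀ i : Fin d, ∃ r, z ^ (i:ℕ) * ι r = b.repr x i := by
  constructor
  · rintro ⟨a, rfl⟩ i
    obtain ⟨p, rfl, hp⟩ := exists_rep hQ hn a
    exact ⟨_, (repr_lift ι hb h p hp i).symm⟩
  · intro hx
    choose c hc using hx
    set p : R[X] := ∑ i : Fin d, monomial (i:ℕ) (c i) with hpd
    have hcoef : ∀ i : Fin d, p.coeff i = c i := by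
      intro i
      rw [hpd, finset_sum_coeff, Finset.sum_eq_single i]
      · simp
      · intro j _ hj
        rw [coeff_monomial, if_neg]
        intro h; exact hj (Fin.ext h)
      · simp
    have hp : ∀ i, d ≤ i → p.coeff i = 0 := by
      intro i hi
      rw [hpd, finset_sum_coeff]
      refine Finset.sum_eq_zero fun j _ => ?_
      rw [coeff_monomial, if_neg]
      have := j.2; omega
    refine ⟨AdjoinRoot.mk Q p, ?_⟩
    apply b.repr.injective
    ext i
    rw [repr_lift ι hb h p hp, hcoef, hc]

end emb

theorem weil_good {k : Type*} [Field k] [Fintype k] {d : ℕ} (hd : 3 ≤ d) {P : k[X][Y]} (hG : Good d P) :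
    |(Npt k (AdjoinRoot P) 1 : ℝ) - Fintype.card k| ≤ ((d:ℝ) - 1) * (d - 2) * √(Fintype.card k : ℝ) + d := by
  let F := RatFunc k
  haveI hdomA : IsDomain (AdjoinRoot P) := hG.isDomain (by omega)
  set Pb : F[X] := P.map (algebraMap k[X] F) with hPb
  have hPbm : Pb.Monic := hG.monic.map _
  have hPbn : Pb.natDegree = d := by rw [hPb, hG.monic.natDegree_map, hG.natDegree]
  haveI hirr : Fact (Irreducible Pb) :=
    ⟨(hG.monic.irreducible_iff_irreducible_map_fraction_map (K := F)).1 (hG.irreducible (by omega))⟩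
  let K := AdjoinRoot Pb
  let t : K := AdjoinRoot.root Pb
  let pb := AdjoinRoot.powerBasis' hPbm
  have hdim : pb.dim = d := hPbn
  let b : Module.Basis (Fin d) F K := pb.basis.reindex (finCongr hdim)
  have hb : ∀ i, b i = t ^ (i:ℕ) := by
    intro i
    rw [Module.Basis.reindex_apply, pb.basis_eq_pow]
    rfl
  have hroot : eval₂ (algebraMap F K) t Pb = 0 := AdjoinRoot.eval₂_root Pb
  obtain ⟨Q, hQ1, hQ2, hQ3, hQ4⟩ := exists_Q (F := F) hG.monic hG.natDegree hG.td
  have hA0 : eval₂ ((algebraMap F K).comp (algebraMap k[X] F)) (algebraMap F K 1 * t) P = 0 := by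
    rw [map_one, one_mul, ← eval₂_map]; exact hroot
  have hO0 : eval₂ ((algebraMap F K).comp (algebraMap (O0 k F) F)) (algebraMap F K (sF k F)⁻¹ * t) Q = 0 := by
    rw [← eval₂_map, hQ1]
    exact scaleRoots_eval₂_eq_zero _ hroot
  have hιA : Function.Injective (algebraMap k[X] F) := IsFractionRing.injective k[X] F
  have hιO : Function.Injective (algebraMap (O0 k F) F) := Subtype.val_injective
  have hz : (sF k F)⁻¹ ≠ 0 := inv_ne_zero (sF_ne k F)
  letI algA : Algebra (AdjoinRoot P) K := (AdjoinRoot.lift _ _ hA0).toAlgebra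
  letI algO : Algebra (AdjoinRoot Q) K := (AdjoinRoot.lift _ _ hO0).toAlgebra
  have hinjA : Function.Injective (algebraMap (AdjoinRoot P) K) := lift_inj _ hιA hb one_ne_zero hG.monic hG.natDegree hA0
  have hinjO : Function.Injective (algebraMap (AdjoinRoot Q) K) := lift_inj _ hιO hb hz hQ3 hQ2 hO0
  haveI : IsDomain (AdjoinRoot Q) := hinjO.isDomain (algebraMap (AdjoinRoot Q) K)
  haveI : IsDedekindDomain (AdjoinRoot P) := dedekind_adjoinRoot P hG.monic fun n hn _ hP => A_smooth hG n hn hP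
  haveI : IsDedekindDomain (AdjoinRoot Q) := dedekind_adjoinRoot Q hQ3 fun n hn hc hP =>
    Q_smooth Q (by rw [hQ4]; exact hG.sep) n hn hc hP
  have C : Crd k F K (AdjoinRoot P) (AdjoinRoot Q) d b t :=
    { hd := hd
      hb := hb
      hA := by
        intro x
        refine (lift_range _ hb hG.monic hG.natDegree hA0 x).trans ?_
        simp
      hO := by
        intro x
        refine (lift_range _ hb hQ3 hQ2 hO0 x).trans (forall_congr' fun i => ?_)
        constructor
        · rintro ⟨r, hr⟩
          rw [← hr, ← zpow_natCast, inv_zpow']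
          have := (VF_spow_mul k (F := F) (j := -((i:ℕ):ℤ)) (m := 0) (f := algebraMap (O0 k F) F r)).2 r.2
          rwa [zero_add] at this
        · intro hx
          have := (VF_spow_mul k (F := F) (j := ((i:ℕ):ℤ)) (m := -((i:ℕ):ℤ)) (f := b.repr x i)).2 hx
          rw [neg_add_cancel] at this
          refine ⟨⟨_, this⟩, ?_⟩
          change (sF k F)⁻¹ ^ (i:ℕ) * (sF k F ^ ((i:ℕ):ℤ) * b.repr x i) = _
          rw [zpow_natCast, inv_pow, inv_mul_cancel_left₀ (pow_ne_zero _ (sF_ne k F))]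
      injA := hinjA
      injO := hinjO }
  haveI : IsScalarTower k (AdjoinRoot P) K := by
    refine IsScalarTower.of_algebraMap_eq fun c => ?_
    change _ = AdjoinRoot.lift _ _ hA0 (AdjoinRoot.of P (algebraMap k k[X] c))
    rw [AdjoinRoot.lift_of, RingHom.comp_apply, ← IsScalarTower.algebraMap_apply, ← IsScalarTower.algebraMap_apply]
  haveI : IsScalarTower k (AdjoinRoot Q) K := by
    refine IsScalarTower.of_algebraMap_eq fun c => ?_
    change _ = AdjoinRoot.lift _ _ hO0 (AdjoinRoot.of Q (algebraMap k (O0 k F) c))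
    rw [AdjoinRoot.lift_of, RingHom.comp_apply, ← IsScalarTower.algebraMap_apply, ← IsScalarTower.algebraMap_apply]
  haveI : Infinite (AdjoinRoot P) := by
    have h1 : Function.Injective (AdjoinRoot.of P) :=
      AdjoinRoot.of.injective_of_degree_ne_zero (by rw [degree_eq_natDegree hG.monic.ne_zero, hG.natDegree]; exact_mod_cast (by omega))
    exact Infinite.of_injective _ h1
  haveI : Infinite (AdjoinRoot Q) := by
    obtain ⟨σ, hσ⟩ := C.sigma
    have hcard := C.sigma_card σ hσ
    rw [← not_finite_iff_infinite]
    intro hfin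
    have h1 : IsField (AdjoinRoot Q) := by
      letI := Fintype.ofFinite (AdjoinRoot Q)
      exact Finite.isField_of_domain _
    have hσ0 : σ ≠ 0 := by
      intro h
      rw [h, map_zero, eq_comm, inv_eq_zero] at hσ
      exact sF_ne k F (by simpa using hσ)
    obtain ⟨y, hy⟩ := h1.mul_inv_cancel hσ0
    have : Ideal.span {σ} = ⊤ := Ideal.span_singleton_eq_top.2 (IsUnit.of_mul_eq_one y hy)
    rw [this, Submodule.cardQuot_top] at hcard
    have : 1 < Fintype.card k ^ d := Nat.one_lt_pow (by omega) Fintype.one_lt_card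
    omega
  have finA : ∀ I : Ideal (AdjoinRoot P), I ≠ ⊥ → I.cardQuot ≠ 0 := by
    intro I hI
    obtain ⟨y, hy, hy0⟩ := Submodule.exists_mem_ne_zero_of_ne_bot hI
    obtain ⟨B, hB⟩ := Am_exists (P := P) y
    obtain ⟨h1, -⟩ := finrank_quot hG.monic hG.natDegree hG.td y hB hy0
    haveI : Finite (AdjoinRoot P ⧸ Ideal.span {y}) := Module.finite_of_finite k
    have h2 : (Ideal.span {y}).cardQuot ≠ 0 := by
      rw [Submodule.cardQuot_apply]; exact Nat.card_pos.ne'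
    have hle : Ideal.span {y} ≤ I := by rwa [Ideal.span_singleton_le_iff_mem]
    intro h0
    exact h2 (Nat.eq_zero_of_zero_dvd (h0 ▸ AddSubgroup.index_dvd_of_le (H := (Ideal.span {y}).toAddSubgroup) (K := I.toAddSubgroup) hle))
  obtain ⟨g, hg⟩ : ∃ g : ℕ, (d - 1) * (d - 2) = 2 * g := by
    obtain ⟨e, rfl⟩ : ∃ e, d = e + 3 := ⟨d - 3, by omega⟩
    have := Nat.even_mul_succ_self (e + 1)
    obtain ⟨g, hg⟩ := this
    exact ⟨g, by rw [show e + 3 - 1 = e + 1 + 1 by omega, show e + 3 - 2 = e + 1 by omega, mul_comm]; omega⟩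
  have hg1 : 1 ≤ g := by
    have : 0 < (d - 1) * (d - 2) := Nat.mul_pos (by omega) (by omega)
    omega
  have hgz : ((d:ℤ) - 1) * (d - 2) = 2 * g := by
    have := congrArg (Nat.cast : ℕ → ℤ) hg
    rw [Nat.cast_mul, Nat.cast_sub (by omega), Nat.cast_sub (by omega)] at this
    exact_mod_cast this
  have CC := C.curve g (by linear_combination hgz) finA
  obtain ⟨c, hc⟩ := Npt_bound hG (by omega)
  obtain ⟨σ, hσ⟩ := C.sigma
  have hσ0 : σ ≠ 0 := by
    intro h
    rw [h, map_zero, eq_comm, inv_eq_zero] at hσ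
    exact sF_ne k F (by simpa using hσ)
  have hfin := CC.weil_final hg1 c hc (fun j hj => finite_fix P j hj) σ hσ0 (C.sigma_card σ hσ) (fun v => by
    obtain ⟨n, hn⟩ := C.pow_mem_of_ne σ hσ v.asIdeal v.ne_bot
    exact v.isPrime.mem_of_pow_mem n hn)
  have hgr : ((d:ℝ) - 1) * (d - 2) = 2 * g := by exact_mod_cast hgz
  rw [hgr]
  exact hfin

theorem pow_card_eq_iff {k L : Type*} [Field k] [Fintype k] [Field L] [Algebra k L] (x : L) :
    x ^ Fintype.card k = x ↔ ∃ c : k, algebraMap k L c = x := by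
  classical
  constructor
  · intro hx
    have hQ : 1 < Fintype.card k := Fintype.one_lt_card
    have mem_FQ : ∀ x : L, x ∈ FQ L (Fintype.card k) ↔ x ^ Fintype.card k = x := by
      intro x
      rw [FQ, Multiset.mem_toFinset, mem_roots (FiniteField.X_pow_card_sub_X_ne_zero L hQ)]
      simp [sub_eq_zero]
    have h1 : Finset.univ.map ⟨algebraMap k L, (algebraMap k L).injective⟩ = FQ L (Fintype.card k) := by
      apply Finset.eq_of_subset_of_card_le
      · intro y hy
        obtain ⟨c, -, rfl⟩ := Finset.mem_map.1 hy
        rw [mem_FQ]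
        change (algebraMap k L c) ^ _ = algebraMap k L c
        rw [← map_pow, FiniteField.pow_card]
      · rw [Finset.card_map, Finset.card_univ, FQ]
        refine (Multiset.toFinset_card_le _).trans ((card_roots' _).trans ?_)
        rw [FiniteField.X_pow_card_sub_X_natDegree_eq _ hQ]
    have h2 := (mem_FQ x).2 hx
    rw [← h1] at h2
    obtain ⟨c, -, hc⟩ := Finset.mem_map.1 h2
    exact ⟨c, hc⟩
  · rintro ⟨c, rfl⟩
    rw [← map_pow, FiniteField.pow_card]

theorem Npt_one {k : Type*} [Field k] [Fintype k] (P : k[X][Y]) :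
    Npt k (AdjoinRoot P) 1 = Nat.card {z : k × k // P.evalEval z.1 z.2 = 0} := by
  rw [Npt]
  have hQ : 1 < Fintype.card k := Fintype.one_lt_card
  symm
  have hev : ∀ z : k × k, eval₂ ((aeval (algebraMap k (AlgebraicClosure k) z.1) : k[X] →ₐ[k] AlgebraicClosure k) : k[X] →+* AlgebraicClosure k)
      (algebraMap k (AlgebraicClosure k) z.2) P = algebraMap k (AlgebraicClosure k) (P.evalEval z.1 z.2) := by
    intro z
    rw [← eval₂_evalRingHom, hom_eval₂]
    congr 1
    ext <;> simp
  obtain ⟨Fr, hFr⟩ := exists_frob (k := k) (AlgebraicClosure k) 1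
  refine Nat.card_congr (Equiv.ofBijective (fun z => ⟨pt P (algebraMap k (AlgebraicClosure k) z.1.1) (algebraMap k (AlgebraicClosure k) z.1.2)
    (by rw [hev, z.2, map_zero]), ?_⟩) ⟨?_, ?_⟩)
  · intro a
    rw [← hFr]
    have : Fr.comp (pt P (algebraMap k (AlgebraicClosure k) z.1.1) (algebraMap k (AlgebraicClosure k) z.1.2)
      (by rw [hev, z.2, map_zero])) = pt P (algebraMap k (AlgebraicClosure k) z.1.1) (algebraMap k (AlgebraicClosure k) z.1.2)
      (by rw [hev, z.2, map_zero]) := by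
      apply hom_ext
      · simp [pt_cs]
      · simp [pt_ct]
    exact congrArg (fun f => f a) this
  · intro z w h
    have h1 := congrArg (fun f => f.1 (cs P)) h
    have h2 := congrArg (fun f => f.1 (ct P)) h
    simp only [pt_cs, pt_ct] at h1 h2
    exact Subtype.ext (Prod.ext ((algebraMap k _).injective h1) ((algebraMap k _).injective h2))
  · rintro ⟨φ, hφ⟩
    obtain ⟨x, hx⟩ := (pow_card_eq_iff (k := k) _).1 (by simpa using hφ (cs P))
    obtain ⟨y, hy⟩ := (pow_card_eq_iff (k := k) _).1 (by simpa using hφ (ct P))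
    have h0 := hom_root φ
    rw [← hx, ← hy, hev (x, y)] at h0
    refine ⟨⟨(x, y), by simpa using h0⟩, ?_⟩
    apply Subtype.ext
    apply hom_ext
    · rw [pt_cs, hx]
    · rw [pt_ct, hy]

end NTW


namespace NTW

open Polynomial Polynomial.Bivariate

section macaulay

variable {k : Type*} [Field k]

theorem TD_of_mul {m d : ℕ} {u P : k[X][Y]} (ht : TD d P) (h0 : top d P ≠ 0) (h : TD (m + d) (u * P)) : TD m u := by
  by_cases hu : u = 0
  · subst hu; exact TD_zero m
  obtain ⟨n, hn⟩ := TD_exists u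
  induction n with
  | zero => exact hn.mono (Nat.zero_le _)
  | succ n ih =>
    by_cases hnm : n + 1 ≤ m
    · exact hn.mono hnm
    · apply ih
      apply TD_pred hn
      have h1 := top_mul hn ht
      rw [top_eq_zero_of_TD (by omega) h] at h1
      exact (mul_eq_zero.1 h1.symm).resolve_right h0

theorem mem_of_mul_deriv {d : ℕ} {P : k[X][Y]} (hG : Good d P) (hd : 1 ≤ d) (m : ℕ) (z : AdjoinRoot P)
    (h : z * AdjoinRoot.mk P (derivative P) ∈ Am P (m + (d - 1))) : z ∈ Am P m := by
  obtain ⟨n, hn⟩ := Am_exists z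
  induction n with
  | zero => exact Am_mono (Nat.zero_le _) hn
  | succ n ih =>
    by_cases hnm : n + 1 ≤ m
    · exact Am_mono hnm hn
    apply ih
    obtain ⟨e, rfl⟩ : ∃ e, d = e + 1 := ⟨d - 1, by omega⟩
    rw [Nat.add_sub_cancel] at h
    obtain ⟨f, hf, rfl⟩ := hn
    obtain ⟨g, hg, hgf⟩ := h
    rw [← map_mul, eq_comm, AdjoinRoot.mk_eq_mk] at hgf
    obtain ⟨u, hu⟩ := hgf
    have hder : TD e (derivative P) := TD_derivative hG.td
    have htm : (top (e+1) P).Monic := top_monic_of hG.monic hG.natDegree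
    have h1 : TD (n + (e+1)) (u * P) := by
      rw [mul_comm, ← hu]
      exact TD.sub ((hf.mul hder).mono (by omega)) (hg.mono (by omega))
    have hut : TD n u := TD_of_mul hG.td htm.ne_zero h1
    have h2 : top (n + 1) f * derivative (top (e + 1) P) = top n u * top (e + 1) P := by
      rw [← top_derivative, ← top_mul hf hder, ← top_mul hut hG.td, mul_comm u P, ← hu, top_sub, show n + (e + 1) = n + 1 + e by ring,
        top_eq_zero_of_TD (m := m + e) (by omega) hg, sub_zero]
    have h3 : top (e + 1) P ∣ top (n + 1) f := by
      apply IsCoprime.dvd_of_dvd_mul_right hG.sep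
      rw [h2]; exact dvd_mul_left _ _
    obtain ⟨w, hw⟩ := h3
    have hdn : (top (e+1) P).natDegree = e + 1 := natDegree_top_of hG.monic hG.natDegree
    by_cases hne : e ≤ n
    · have hwn : w.natDegree ≤ n - e := by
        by_cases hw0 : w = 0
        · simp [hw0]
        have := natDegree_top_le f (n + 1)
        rw [hw, htm.natDegree_mul' hw0, hdn] at this
        omega
      refine ⟨f - hom (n - e) w * P, ?_, by simp⟩
      have h4 : n + 1 = n - e + (e + 1) := by omega
      apply TD_pred
      · refine hf.sub ?_
        have := (TD_hom (n - e) w).mul hG.td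
        rwa [← h4] at this
      · rw [top_sub, hw, sub_eq_zero, h4, top_mul (TD_hom _ _) hG.td, top_hom _ _ hwn, mul_comm]
    · have hw0 : w = 0 := by
        by_contra hw0
        have := natDegree_top_le f (n + 1)
        rw [hw, htm.natDegree_mul' hw0, hdn] at this
        omega
      exact ⟨f, TD_pred hf (by rw [hw, hw0, mul_zero]), rfl⟩

theorem macaulay {d : ℕ} {P : k[X][Y]} (hG : Good d P) (hd : 2 ≤ d) (G : k[X][Y]) (hGt : TD (3 * d - 4) G) :
    ∃ u v w, TD (2 * d - 4) u ∧ TD (2 * d - 3) v ∧ TD (2 * d - 3) w ∧ G = u * P + v * pX P + w * derivative P := by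
  haveI : IsDomain (AdjoinRoot P) := hG.isDomain (by omega)
  have hP1 : TD (d - 1 + 1) P := by rw [show d - 1 + 1 = d by omega]; exact hG.td
  set ps := AdjoinRoot.mk P (pX P) with hps
  set pt := AdjoinRoot.mk P (derivative P) with hpt
  have hpsm : ps ∈ Am P (d - 1) := ⟨_, TD_pX hP1, rfl⟩
  have hptm : pt ∈ Am P (d - 1) := ⟨_, TD_derivative hP1, rfl⟩
  have hpt0 : pt ≠ 0 := by
    intro h0
    have := mem_of_mul_deriv hG (by omega) 0 (AdjoinRoot.of P X)
    have h1 : ∀ x : AdjoinRoot P, x ∈ Am P 0 := fun x => mem_of_mul_deriv hG (by omega) 0 x (by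
      rw [← hpt, h0, mul_zero]; exact Submodule.zero_mem _)
    have h2 : Am P 0 = Am P (d - 2 + 1) := le_antisymm (Am_mono (Nat.zero_le _)) (fun x _ => h1 x)
    have h3 := finrank_Am hG.monic hG.natDegree hG.td 0
    rw [h2, finrank_Am hG.monic hG.natDegree hG.td] at h3
    have e1 : 1 ≤ hdim d 0 := by
      rw [hdim]; exact (by simp : 1 ≤ 0 + 1 - 0).trans (Finset.single_le_sum (f := fun c => 0 + 1 - c) (fun _ _ => Nat.zero_le _) (Finset.mem_range.2 (by omega : 0 < d)))
    have e2 : hdim d 0 < hdim d (d - 2 + 1) := by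
      rw [hdim, hdim]
      exact Finset.sum_lt_sum (fun i _ => by omega) ⟨0, Finset.mem_range.2 (by omega), by omega⟩
    omega
  have q1 : 2 * d - 3 + (d - 1) = 3 * d - 4 := by omega
  have q2 : d - 2 + (d - 1) = 2 * d - 3 := by omega
  let Φ : (Am P (2 * d - 3) × Am P (2 * d - 3)) →ₗ[k] Am P (3 * d - 4) :=
    { toFun := fun z => ⟨z.1 * ps + z.2 * pt, Submodule.add_mem _ (q1 ▸ Am_mul z.1.2 hpsm) (q1 ▸ Am_mul z.2.2 hptm)⟩
      map_add' := by intro x y; apply Subtype.ext; simp; ring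
      map_smul' := by intro c x; apply Subtype.ext; simp [mul_comm, smul_add] }
  let Ψ : Am P (d - 2) →ₗ[k] (Am P (2 * d - 3) × Am P (2 * d - 3)) :=
    { toFun := fun z => (⟨z * pt, q2 ▸ Am_mul z.2 hptm⟩, ⟨- (z * ps), Submodule.neg_mem _ (q2 ▸ Am_mul z.2 hpsm)⟩)
      map_add' := by intro x y; ext <;> simp <;> ring
      map_smul' := by intro c x; ext <;> simp }
  haveI := fun m => finite_Am hG.monic hG.natDegree hG.td m
  have hΨ : Function.Injective Ψ := by
    rw [← LinearMap.ker_eq_bot, LinearMap.ker_eq_bot']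
    intro z hz
    have h1 : (z : AdjoinRoot P) * pt = 0 := congrArg (fun y => (y.1 : AdjoinRoot P)) hz
    exact Subtype.ext ((mul_eq_zero.1 h1).resolve_right hpt0)
  have hker : LinearMap.ker Φ ≤ LinearMap.range Ψ := by
    rintro ⟨v, w⟩ hvw
    have h1 : (v : AdjoinRoot P) * ps + w * pt = 0 := congrArg Subtype.val (LinearMap.mem_ker.1 hvw)
    obtain ⟨u0, v0, w0, h0⟩ := hG.smooth
    have h2 : AdjoinRoot.mk P v0 * ps + AdjoinRoot.mk P w0 * pt = 1 := by
      have := congrArg (AdjoinRoot.mk P) h0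
      simpa using this
    set α := AdjoinRoot.mk P v0
    set β := AdjoinRoot.mk P w0
    set z := β * v - α * w with hz
    have hv : z * pt = v := by
      rw [hz]; linear_combination (v : AdjoinRoot P) * h2 - α * h1
    have hw : -(z * ps) = w := by
      rw [hz]; linear_combination (w : AdjoinRoot P) * h2 - β * h1
    have hzm : z ∈ Am P (d - 2) := mem_of_mul_deriv hG (by omega) _ z (by rw [← hpt, hv, q2]; exact v.2)
    exact ⟨⟨z, hzm⟩, Prod.ext (Subtype.ext hv) (Subtype.ext hw)⟩
  have hr := LinearMap.finrank_range_add_finrank_ker Φ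
  have hk := (Submodule.finrank_mono hker).trans (LinearMap.finrank_range_of_inj hΨ).le
  rw [Module.finrank_prod, finrank_Am hG.monic hG.natDegree hG.td] at hr
  rw [finrank_Am hG.monic hG.natDegree hG.td] at hk
  have htop : LinearMap.range Φ = ⊤ := by
    apply Submodule.eq_top_of_finrank_eq
    apply le_antisymm (Submodule.finrank_le _)
    rw [finrank_Am hG.monic hG.natDegree hG.td]
    have e1 := hdim_eq d (2 * d - 3) (by omega)
    have e2 := hdim_eq d (d - 2) (by omega)
    have e3 := hdim_eq d (3 * d - 4) (by omega)
    rw [Nat.cast_sub (by omega)] at e1 e2 e3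
    push_cast at e1 e2 e3
    have : (hdim d (3 * d - 4) : ℤ) + hdim d (d - 2) = 2 * hdim d (2 * d - 3) := by
      have : 2 * ((hdim d (3 * d - 4) : ℤ) + hdim d (d - 2)) = 2 * (2 * hdim d (2 * d - 3)) := by
        rw [mul_add, e2, e3, mul_left_comm, e1]; ring
      linarith
    omega
  have hmem : (⟨AdjoinRoot.mk P G, ⟨G, hGt, rfl⟩⟩ : Am P (3 * d - 4)) ∈ LinearMap.range Φ := by rw [htop]; trivial
  obtain ⟨⟨⟨_, v, hv, rfl⟩, ⟨_, w, hw, rfl⟩⟩, hvw⟩ := hmem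
  have hvw' : AdjoinRoot.mk P v * ps + AdjoinRoot.mk P w * pt = AdjoinRoot.mk P G := congrArg Subtype.val hvw
  rw [hps, hpt, ← map_mul, ← map_mul, ← map_add, eq_comm, AdjoinRoot.mk_eq_mk] at hvw'
  obtain ⟨u, hu⟩ := hvw'
  refine ⟨u, v, w, ?_, hv, hw, ?_⟩
  · apply TD_of_mul hG.td (top_monic_of hG.monic hG.natDegree).ne_zero
    rw [mul_comm u, ← hu, show 2 * d - 4 + d = 3 * d - 4 by omega]
    refine hGt.sub ?_
    rw [← q1]
    exact (hv.mul (TD_pX hP1)).add (hw.mul (TD_derivative hP1))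
  · linear_combination hu

/-- surjectivity in degree `3 * d - 4` implies goodness -/
theorem good_of_surj {d : ℕ} {P : k[X][Y]} (hd : 2 ≤ d) (hm : P.Monic) (hn : P.natDegree = d) (ht : TD d P)
    (h : ∀ G, TD (3 * d - 4) G → ∃ u v w, TD (2 * d - 4) u ∧ TD (2 * d - 3) v ∧ TD (2 * d - 3) w ∧ G = u * P + v * pX P + w * derivative P) :
    Good d P := by
  have hP1 : TD (d - 1 + 1) P := by rw [show d - 1 + 1 = d by omega]; exact ht
  refine ⟨hm, hn, ht, ?_, ?_⟩
  · obtain ⟨u, v, w, hu, hv, hw, he⟩ := h (hom (3 * d - 4) 1) (TD_hom _ _)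
    have h1 := congrArg (top (3 * d - 4)) he
    have q1 : 2 * d - 3 + (d - 1) = 3 * d - 4 := by omega
    have q2 : 2 * d - 4 + d = 3 * d - 4 := by omega
    have t1 := top_mul hu ht
    have t2 := top_mul hv (TD_pX hP1)
    have t3 := top_mul hw (TD_derivative hP1)
    rw [q2] at t1
    rw [q1] at t2 t3
    rw [top_hom _ _ (by simp), top_add, top_add, t1, t2, t3, top_derivative, top_pX, show d - 1 + 1 = d by omega] at h1
    refine ⟨top (2*d-4) u + top (2*d-3) v * C (((d - 1 : ℕ) : k) + 1), top (2*d-3) w - top (2*d-3) v * X, ?_⟩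
    rw [h1]; ring
  · obtain ⟨u, v, w, -, -, -, he⟩ := h 1 ((by
      intro i j hij
      rw [Polynomial.coeff_one]
      split_ifs with h0
      · rw [Polynomial.coeff_one, if_neg (by omega)]
      · simp : TD 0 (1 : k[X][Y])).mono (Nat.zero_le _))
    exact ⟨u, v, w, he.symm⟩

end macaulay
end NTW


namespace NTW

open Polynomial Polynomial.Bivariate

section cert

/-- index set of monomials of total degree at most `n` -/
abbrev Mon (n : ℕ) := {x : Fin (n + 1) × Fin (n + 1) // (x.1 : ℕ) + (x.2 : ℕ) ≤ n}

abbrev Cols (d : ℕ) := Mon (2 * d - 4) ⊕ Mon (2 * d - 3) ⊕ Mon (2 * d - 3)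

/-- shifted coefficient -/
def shf {R : Type*} [CommRing R] (c : ℕ → ℕ → R) (i j I J : ℕ) : R :=
  if i ≤ I ∧ j ≤ J then c (I - i) (J - j) else 0

def cmat {R : Type*} [CommRing R] (d : ℕ) (c : ℕ → ℕ → R) : Matrix (Mon (3 * d - 4)) (Cols d) R :=
  fun row col => match col with
  | Sum.inl x => shf c x.1.1 x.1.2 row.1.1 row.1.2
  | Sum.inr (Sum.inl x) => shf (fun i j => c (i + 1) j * (i + 1)) x.1.1 x.1.2 row.1.1 row.1.2
  | Sum.inr (Sum.inr x) => shf (fun i j => c i (j + 1) * (j + 1)) x.1.1 x.1.2 row.1.1 row.1.2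

theorem cmat_map {R S : Type*} [CommRing R] [CommRing S] (φ : R →+* S) (d : ℕ) (c : ℕ → ℕ → R) :
    (cmat d c).map φ = cmat d (fun i j => φ (c i j)) := by
  ext row col
  rcases col with x | x | x <;> simp only [Matrix.map_apply, cmat, shf] <;> split_ifs <;> simp

theorem cmat_smul {R : Type*} [CommRing R] (a : R) (d : ℕ) (c : ℕ → ℕ → R) :
    cmat d (fun i j => a * c i j) = a • cmat d c := by
  ext row col
  rcases col with x | x | x <;> simp only [Matrix.smul_apply, cmat, shf] <;> split_ifs <;> simp [mul_assoc]

variable {k : Type*} [Field k]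

noncomputable def pol {n : ℕ} (x : Mon n → k) : k[X][Y] :=
  ∑ t : Mon n, monomial (t.1.2 : ℕ) (monomial (t.1.1 : ℕ) (x t))

theorem TD_sum {ι : Type*} (s : Finset ι) (n : ℕ) (p : ι → k[X][Y]) (h : ∀ i ∈ s, TD n (p i)) : TD n (∑ i ∈ s, p i) := by
  intro i j hij
  rw [Polynomial.finset_sum_coeff, Polynomial.finset_sum_coeff]
  exact Finset.sum_eq_zero fun t ht => h t ht i j hij

theorem TD_pol {n : ℕ} (x : Mon n → k) : TD n (pol x) :=
  TD_sum _ _ _ fun t _ => (TD_monomial _ _ _).mono t.2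

theorem coeff_mono_mul (i j : ℕ) (a : k) (P : k[X][Y]) (I J : ℕ) :
    (((monomial j (monomial i a)) * P).coeff J).coeff I = a * shf (fun i j => (P.coeff j).coeff i) i j I J := by
  unfold shf
  rw [← Polynomial.C_mul_X_pow_eq_monomial, mul_assoc, Polynomial.coeff_C_mul, Polynomial.coeff_X_pow_mul']
  by_cases hj : j ≤ J
  · rw [if_pos hj, ← Polynomial.C_mul_X_pow_eq_monomial, mul_assoc, Polynomial.coeff_C_mul, Polynomial.coeff_X_pow_mul']
    simp [hj]
  · simp [hj]

theorem coeff_pol_mul {n : ℕ} (x : Mon n → k) (P : k[X][Y]) (I J : ℕ) :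
    (((pol x) * P).coeff J).coeff I = ∑ t : Mon n, shf (fun i j => (P.coeff j).coeff i) t.1.1 t.1.2 I J * x t := by
  unfold pol
  rw [Finset.sum_mul, Polynomial.finset_sum_coeff, Polynomial.finset_sum_coeff]
  exact Finset.sum_congr rfl fun t _ => by rw [coeff_mono_mul, mul_comm]

theorem coeff_pol {n : ℕ} (x : Mon n → k) (t : Mon n) : ((pol x).coeff t.1.2).coeff t.1.1 = x t := by
  unfold pol
  rw [Polynomial.finset_sum_coeff, Polynomial.finset_sum_coeff, Finset.sum_eq_single t]
  · simp
  · intro b _ hb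
    rw [Polynomial.coeff_monomial]
    split_ifs with h
    · rw [Polynomial.coeff_monomial, if_neg]
      intro h2
      exact hb (Subtype.ext (Prod.ext (Fin.ext h2) (Fin.ext h)))
    · simp
  · simp

theorem ext_TD {n : ℕ} {p q : k[X][Y]} (hp : TD n p) (hq : TD n q)
    (h : ∀ t : Mon n, (p.coeff t.1.2).coeff t.1.1 = (q.coeff t.1.2).coeff t.1.1) : p = q := by
  ext j i
  by_cases hij : i + j ≤ n
  · exact h ⟨(⟨i, by omega⟩, ⟨j, by omega⟩), hij⟩
  · rw [hp i j (by omega), hq i j (by omega)]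

theorem pol_coeff {n : ℕ} {p : k[X][Y]} (hp : TD n p) : pol (fun t : Mon n => (p.coeff t.1.2).coeff t.1.1) = p :=
  ext_TD (TD_pol _) hp fun t => coeff_pol _ t

noncomputable def cf (P : k[X][Y]) : ℕ → ℕ → k := fun i j => (P.coeff j).coeff i

theorem cmat_mulVec (d : ℕ) (P : k[X][Y]) (x : Cols d → k) (row : Mon (3 * d - 4)) :
    (cmat d (cf P)).mulVec x row =
      ((pol (fun t => x (Sum.inl t)) * P + pol (fun t => x (Sum.inr (Sum.inl t))) * pX P
        + pol (fun t => x (Sum.inr (Sum.inr t))) * derivative P).coeff row.1.2).coeff row.1.1 := by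
  rw [Polynomial.coeff_add, Polynomial.coeff_add, Polynomial.coeff_add, Polynomial.coeff_add,
    coeff_pol_mul, coeff_pol_mul, coeff_pol_mul]
  unfold Matrix.mulVec dotProduct
  rw [Fintype.sum_sum_type, Fintype.sum_sum_type, ← add_assoc]
  have e1 : (fun i j => ((pX P).coeff j).coeff i) = fun i j => cf P (i + 1) j * ((i : k) + 1) := by
    ext i j; rw [coeff_pX]; rfl
  have e2 : (fun i j => ((derivative P).coeff j).coeff i) = fun i j => cf P i (j + 1) * ((j : k) + 1) := by
    ext i j
    rw [Polynomial.coeff_derivative]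
    have : ((j : k[X]) + 1) = C ((j : k) + 1) := by simp
    rw [this, Polynomial.coeff_mul_C]; rfl
  rw [e1, e2]
  rfl

theorem exists_minor {d : ℕ} (hd : 2 ≤ d) {P : k[X][Y]} (hG : Good d P) :
    ∃ e : Mon (3 * d - 4) → Cols d, ((cmat d (cf P)).submatrix id e).det ≠ 0 := by
  classical
  have hs : ∀ g : Mon (3 * d - 4) → k, ∃ x, (cmat d (cf P)).mulVec x = g := by
    intro g
    obtain ⟨u, v, w, hu, hv, hw, he⟩ := macaulay hG hd (pol g) (TD_pol g)
    refine ⟨Sum.elim (fun t => (u.coeff t.1.2).coeff t.1.1)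
      (Sum.elim (fun t => (v.coeff t.1.2).coeff t.1.1) (fun t => (w.coeff t.1.2).coeff t.1.1)), ?_⟩
    ext row
    rw [cmat_mulVec]
    simp only [Sum.elim_inl, Sum.elim_inr]
    rw [pol_coeff hu, pol_coeff hv, pol_coeff hw, ← he, coeff_pol]
  set A := cmat d (cf P) with hA
  have hspan : Submodule.span k (Set.range A.col) = ⊤ := by
    rw [eq_top_iff]
    rintro g -
    obtain ⟨x, hx⟩ := hs g
    rw [← hx, Matrix.mulVec_eq_sum]
    refine Submodule.sum_mem _ fun c _ => ?_
    rw [op_smul_eq_smul]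
    exact Submodule.smul_mem _ (x c) (Submodule.subset_span (Set.mem_range_self (f := A.col) c))
  obtain ⟨κ, a, ha, hsp, hli⟩ := exists_linearIndependent' k A.col
  rw [hspan] at hsp
  let b := Module.Basis.mk hli hsp.ge
  have hfin : Finite κ := Finite.of_injective a ha
  have := Fintype.ofFinite κ
  have hc : Fintype.card (Mon (3 * d - 4)) = Fintype.card κ := by
    rw [← Module.finrank_eq_card_basis b, Module.finrank_fintype_fun_eq_card]
  let ε := Fintype.equivOfCardEq hc
  refine ⟨a ∘ ε, ?_⟩
  have h2 : LinearIndependent k (A.submatrix id (a ∘ ε)).col := hli.comp ε ε.injective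
  rw [Matrix.linearIndependent_cols_iff_isUnit, Matrix.isUnit_iff_isUnit_det] at h2
  exact h2.ne_zero

theorem good_of_minor {d : ℕ} (hd : 2 ≤ d) {P : k[X][Y]} (ht : TD d P) (h0 : (P.coeff d).coeff 0 ≠ 0)
    (e : Mon (3 * d - 4) → Cols d) (he : ((cmat d (cf P)).submatrix id e).det ≠ 0) :
    Good d (C (C ((P.coeff d).coeff 0)⁻¹) * P) := by
  classical
  set α := (P.coeff d).coeff 0 with hα
  set Q := C (C α⁻¹) * P with hQ
  have hcQ : ∀ i j, (Q.coeff j).coeff i = α⁻¹ * (P.coeff j).coeff i := by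
    intro i j; rw [hQ, Polynomial.coeff_C_mul, Polynomial.coeff_C_mul]
  have htQ : TD d Q := fun i j h => by rw [hcQ, ht i j h, mul_zero]
  have hQd : Q.coeff d = 1 := by
    ext i
    rw [hcQ, Polynomial.coeff_one]
    split_ifs with hi
    · subst hi; exact inv_mul_cancel₀ h0
    · rw [ht i d (by omega), mul_zero]
  have hdeg : Q.natDegree ≤ d := by
    rw [Polynomial.natDegree_le_iff_coeff_eq_zero]
    intro j hj
    ext i
    rw [htQ i j (by omega)]; simp
  have hnd : Q.natDegree = d := le_antisymm hdeg (Polynomial.le_natDegree_of_ne_zero (by rw [hQd]; exact one_ne_zero))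
  have hmon : Q.Monic := by unfold Polynomial.Monic Polynomial.leadingCoeff; rw [hnd, hQd]
  have hdet : ((cmat d (cf Q)).submatrix id e).det ≠ 0 := by
    have : cf Q = fun i j => α⁻¹ * cf P i j := by ext i j; exact hcQ i j
    rw [this, cmat_smul, Matrix.submatrix_smul, Pi.smul_apply, Pi.smul_apply, Matrix.det_smul]
    exact mul_ne_zero (pow_ne_zero _ (inv_ne_zero h0)) he
  refine good_of_surj hd hmon hnd htQ ?_
  intro G hG
  set B := (cmat d (cf Q)).submatrix id e with hB
  have hu : IsUnit B.det := isUnit_iff_ne_zero.2 hdet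
  set y := B⁻¹.mulVec (fun t => (G.coeff t.1.2).coeff t.1.1) with hy
  have hy1 : B.mulVec y = fun t => (G.coeff t.1.2).coeff t.1.1 := by
    rw [hy, Matrix.mulVec_mulVec, Matrix.mul_nonsing_inv _ hu, Matrix.one_mulVec]
  set x : Cols d → k := ∑ i, y i • Pi.single (e i) 1 with hx
  have hx1 : (cmat d (cf Q)).mulVec x = B.mulVec y := by
    rw [hx, Matrix.mulVec_sum]
    ext row
    simp only [Matrix.mulVec_smul, Matrix.mulVec_single_one, Finset.sum_apply, Pi.smul_apply, smul_eq_mul]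
    unfold Matrix.mulVec dotProduct
    exact Finset.sum_congr rfl fun i _ => mul_comm _ _
  refine ⟨_, _, _, TD_pol (fun t => x (Sum.inl t)), TD_pol (fun t => x (Sum.inr (Sum.inl t))), TD_pol (fun t => x (Sum.inr (Sum.inr t))), ?_⟩
  have hQ1 : TD (d - 1 + 1) Q := by rw [show d - 1 + 1 = d by omega]; exact htQ
  refine ext_TD hG ?_ ?_
  · refine TD.add (TD.add ?_ ?_) ?_
    · exact ((TD_pol _).mul htQ).mono (by omega)
    · exact ((TD_pol _).mul (TD_pX hQ1)).mono (by omega)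
    · exact ((TD_pol _).mul (TD_derivative hQ1)).mono (by omega)
  · intro t
    rw [← cmat_mulVec, hx1, hy1]

theorem card_Mon_le (n : ℕ) : Fintype.card (Mon n) ≤ (n + 1) ^ 2 := by
  refine (Fintype.card_subtype_le _).trans ?_
  simp [sq]

theorem totalDegree_minor {σ R : Type*} [CommRing R] {d D : ℕ} (c : ℕ → ℕ → MvPolynomial σ R)
    (hc : ∀ i j, (c i j).totalDegree ≤ D) (e : Mon (3 * d - 4) → Cols d) :
    ((cmat d c).submatrix id e).det.totalDegree ≤ Fintype.card (Mon (3 * d - 4)) * D := by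
  have hent : ∀ row col, (cmat d c row col).totalDegree ≤ D := by
    have h3 : ∀ (n i j : ℕ), (c i j * ((n : MvPolynomial σ R) + 1)).totalDegree ≤ D := by
      intro n i j
      refine (MvPolynomial.totalDegree_mul _ _).trans ?_
      have : ((n : MvPolynomial σ R) + 1) = MvPolynomial.C ((n : R) + 1) := by simp
      rw [this, MvPolynomial.totalDegree_C]
      exact hc i j
    intro row col
    rcases col with x | x | x <;> simp only [cmat, shf] <;> split_ifs <;> first | exact hc _ _ | exact h3 _ _ _ | simp
  rw [Matrix.det_apply]
  refine MvPolynomial.totalDegree_finsetSum_le fun s _ => ?_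
  refine (MvPolynomial.totalDegree_smul_le _ _).trans ?_
  refine (MvPolynomial.totalDegree_finsetProd _ _).trans ?_
  refine (Finset.sum_le_card_nsmul _ _ D fun i _ => hent _ _).trans ?_
  simp

end cert
end NTW


namespace NTW

open Polynomial

section rank

variable {F Ω : Type*} [Field F] [Field Ω] [Algebra F Ω]

variable (F) in
noncomputable abbrev mat (Ω : Type*) [Field Ω] [Algebra F Ω] : Matroid Ω := AlgebraicIndependent.matroid F Ω

variable (F) in
/-- the algebraic closure of the field generated by `s`, as a subalgebra -/
theorem clo_exists (s : Set Ω) : ∃ S : Subalgebra F Ω, (S : Set Ω) = (mat F Ω).closure s ∧ ∀ a : Ω, IsAlgebraic S a → a ∈ S := by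
  have h := (mat F Ω).isFlat_closure s
  obtain ⟨S, hS, h2⟩ := AlgebraicIndependent.matroid_isFlat_iff.1 h
  refine ⟨S, hS, fun a ha => ?_⟩
  have := h2 a ha
  rw [← hS] at this
  exact this

variable (F) in
noncomputable def clo (s : Set Ω) : Subalgebra F Ω := (clo_exists F s).choose

theorem clo_eq (s : Set Ω) : (clo F s : Set Ω) = (mat F Ω).closure s := (clo_exists F s).choose_spec.1

theorem clo_alg (s : Set Ω) : ∀ a : Ω, IsAlgebraic (clo F s) a → a ∈ clo F s := (clo_exists F s).choose_spec.2

theorem subset_clo (s : Set Ω) : s ⊆ clo F s := by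
  rw [clo_eq]; exact (mat F Ω).subset_closure s

theorem clo_root (s : Set Ω) (p : Polynomial Ω) (hp : p ≠ 0) (hc : ∀ n, p.coeff n ∈ clo F s) (z : Ω) (hz : p.eval z = 0) :
    z ∈ clo F s := by
  apply clo_alg
  have hl : p ∈ Polynomial.lifts (algebraMap (clo F s) Ω) := by
    rw [Polynomial.lifts_iff_coeff_lifts]
    intro n
    exact ⟨⟨_, hc n⟩, rfl⟩
  obtain ⟨P, hP⟩ := (Polynomial.mem_lifts _).1 hl
  refine ⟨P, ?_, ?_⟩
  · rintro rfl; apply hp; rw [← hP]; simp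
  · change aeval z P = 0
    rw [← Polynomial.eval_map_algebraMap, hP, hz]

theorem clo_inv {s : Set Ω} {z : Ω} (h : z ∈ clo F s) : z⁻¹ ∈ clo F s := by
  by_cases hz : z = 0
  · subst hz; rw [inv_zero]; exact zero_mem _
  refine clo_root s (C z * X - 1) ?_ ?_ _ ?_
  · intro h; have := congrArg (fun p => p.coeff 1) h
    simp [Polynomial.coeff_one] at this; exact hz this
  · intro n
    rw [Polynomial.coeff_sub, Polynomial.coeff_C_mul]
    refine sub_mem (mul_mem h ?_) ?_
    · rw [Polynomial.coeff_X]; split_ifs; exacts [one_mem _, zero_mem _]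
    · rw [Polynomial.coeff_one]; split_ifs; exacts [one_mem _, zero_mem _]
  · simp [hz]

theorem clo_aeval {s : Set Ω} {z : Ω} (h : z ∈ clo F s) (p : F[X]) : aeval z p ∈ clo F s := by
  rw [Polynomial.aeval_eq_sum_range]
  exact sum_mem fun i _ => Subalgebra.smul_mem _ (pow_mem h i) _

theorem eRk_le_of_clo {s t : Set Ω} (h : s ⊆ clo F t) : (mat F Ω).eRk s ≤ (mat F Ω).eRk t := by
  rw [clo_eq] at h
  exact ((mat F Ω).eRk_mono h).trans ((mat F Ω).eRk_closure_eq t).le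

theorem eRk_le_card {s t : Set Ω} (h : s ⊆ clo F t) : (mat F Ω).eRk s ≤ t.encard :=
  (eRk_le_of_clo h).trans ((mat F Ω).eRk_le_encard t)

theorem eRk_indep {ι : Type*} [Fintype ι] (v : ι → Ω) (h : AlgebraicIndependent F v) :
    (mat F Ω).eRk (Set.range v) = Fintype.card ι := by
  have h1 : (mat F Ω).Indep (Set.range v) := AlgebraicIndependent.matroid_indep_iff.2 h.to_subtype_range
  rw [h1.eRk_eq_encard, ← Set.image_univ, h.injective.encard_image]
  simp

/-- a polynomial equation `aeval z g = w` with `g` nonconstant -/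
theorem clo_of_aeval {s : Set Ω} (g : F[X]) (hg : 0 < g.natDegree) (z w : Ω) (hw : w ∈ clo F s) (h : aeval z g = w) :
    z ∈ clo F s := by
  refine clo_root s (g.map (algebraMap F Ω) - C w) ?_ ?_ z ?_
  · intro h0
    have := congrArg Polynomial.natDegree h0
    rw [Polynomial.natDegree_sub_C, Polynomial.natDegree_map] at this
    simp at this; omega
  · intro n
    rw [Polynomial.coeff_sub, Polynomial.coeff_map, Polynomial.coeff_C]
    refine sub_mem (Subalgebra.algebraMap_mem _ _) ?_
    split_ifs; exacts [hw, zero_mem _]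
  · rw [Polynomial.eval_sub, Polynomial.eval_map_algebraMap, h, Polynomial.eval_C, sub_self]

theorem encard_image_compl_le {r : ℕ} (x : Fin r → Ω) (s : Finset (Fin r)) : (x '' (sᶜ : Finset (Fin r))).encard ≤ (r - s.card : ℕ) := by
  refine (Set.encard_image_le _ _).trans ?_
  rw [Set.encard_coe_eq_coe_finsetCard, Finset.card_compl, Fintype.card_fin]

end rank

section QQ

variable {F : Type*} [Field F] {r : ℕ}

/-- `ε ∏ v_j - ∑ h_j(v_j)` -/
noncomputable def QQ {B : Type*} [CommRing B] [Algebra F B] (ε : F) (h : Fin r → F[X]) (v : Fin r → B) : B :=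
  algebraMap F B ε * ∏ j, v j - ∑ j, aeval (v j) (h j)

noncomputable def dQ {B : Type*} [CommRing B] [Algebra F B] (ε : F) (h : Fin r → F[X]) (v : Fin r → B) (l : Fin r) : B :=
  algebraMap F B ε * ∏ j ∈ Finset.univ.erase l, v j - aeval (v l) (derivative (h l))

theorem map_QQ {B B' : Type*} [CommRing B] [Algebra F B] [CommRing B'] [Algebra F B'] (φ : B →ₐ[F] B')
    (ε : F) (h : Fin r → F[X]) (v : Fin r → B) : φ (QQ ε h v) = QQ ε h (fun j => φ (v j)) := by
  simp only [QQ, map_sub, map_mul, map_prod, map_sum, AlgHom.commutes, Polynomial.aeval_algHom_apply]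

theorem map_dQ {B B' : Type*} [CommRing B] [Algebra F B] [CommRing B'] [Algebra F B'] (φ : B →ₐ[F] B')
    (ε : F) (h : Fin r → F[X]) (v : Fin r → B) (l : Fin r) : φ (dQ ε h v l) = dQ ε h (fun j => φ (v j)) l := by
  simp only [dQ, map_sub, map_mul, map_prod, AlgHom.commutes, Polynomial.aeval_algHom_apply]

theorem deriv_QQ {B : Type*} [CommRing B] [Algebra F B] (D : Derivation F B B)
    (ε : F) (h : Fin r → F[X]) (v : Fin r → B) : D (QQ ε h v) = ∑ l, dQ ε h v l * D (v l) := by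
  have hprod : D (∏ j, v j) = ∑ l, (∏ j ∈ Finset.univ.erase l, v j) * D (v l) := by
    suffices H : ∀ s : Finset (Fin r), D (∏ j ∈ s, v j) = ∑ l ∈ s, (∏ j ∈ s.erase l, v j) * D (v l) from H _
    intro s
    induction s using Finset.induction_on with
    | empty => simp
    | insert a s ha ih =>
      rw [Finset.prod_insert ha, D.leibniz, ih, Finset.sum_insert ha, Finset.erase_insert ha, smul_eq_mul, smul_eq_mul, add_comm,
        Finset.mul_sum]
      congr 1
      · refine Finset.sum_congr rfl fun l hl => ?_
        have hal : a ≠ l := fun h => ha (h ▸ hl)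
        rw [Finset.erase_insert_of_ne hal, Finset.prod_insert (fun h => ha (Finset.mem_of_mem_erase h))]
        ring
  unfold QQ dQ
  rw [map_sub, ← Algebra.smul_def, D.map_smul, map_sum, hprod, Algebra.smul_def, Finset.mul_sum, ← Finset.sum_sub_distrib]
  refine Finset.sum_congr rfl fun l _ => ?_
  rw [D.map_aeval, smul_eq_mul]; ring

variable {Ω : Type*} [Field Ω] [Algebra F Ω]

theorem rank_nonsing (ε : F) (h : Fin r → F[X]) (x : Fin r → Ω) (hx : QQ ε h x = 0) (i : Fin r) (hi : dQ ε h x i ≠ 0) :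
    (mat F Ω).eRk (Set.range x) ≤ (r - 1 : ℕ) := by
  classical
  set T := x '' (({i} : Finset (Fin r))ᶜ : Finset (Fin r)) with hT
  have hmem : ∀ j, j ≠ i → x j ∈ clo F T := fun j hj => subset_clo T ⟨j, by simpa using hj, rfl⟩
  set A := algebraMap F Ω ε * ∏ j ∈ Finset.univ.erase i, x j with hA
  set B := ∑ j ∈ Finset.univ.erase i, aeval (x j) (h j) with hB
  have hAm : A ∈ clo F T := mul_mem (Subalgebra.algebraMap_mem _ _) (prod_mem fun j hj => hmem j (Finset.ne_of_mem_erase hj))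
  have hBm : B ∈ clo F T := sum_mem fun j hj => clo_aeval (hmem j (Finset.ne_of_mem_erase hj)) _
  have hxi : x i ∈ clo F T := by
    refine clo_root T (C A * X - (h i).map (algebraMap F Ω) - C B) ?_ ?_ _ ?_
    · intro h0
      apply hi
      have := congrArg (fun p => (derivative p).eval (x i)) h0
      simpa [dQ, ← hA, Polynomial.derivative_map, Polynomial.eval_map_algebraMap] using this
    · intro n
      rw [Polynomial.coeff_sub, Polynomial.coeff_sub, Polynomial.coeff_map, Polynomial.coeff_C, Polynomial.coeff_C_mul, Polynomial.coeff_X]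
      refine sub_mem (sub_mem (mul_mem hAm ?_) (Subalgebra.algebraMap_mem _ _)) ?_
      · split_ifs; exacts [one_mem _, zero_mem _]
      · split_ifs; exacts [hBm, zero_mem _]
    · rw [QQ, ← Finset.mul_prod_erase _ _ (Finset.mem_univ i), ← Finset.add_sum_erase _ _ (Finset.mem_univ i)] at hx
      simp only [Polynomial.eval_sub, Polynomial.eval_mul, Polynomial.eval_C, Polynomial.eval_X, Polynomial.eval_map_algebraMap]
      rw [← hx, hA, hB]; ring
  refine (eRk_le_card (t := T) ?_).trans (encard_image_compl_le x {i})
  rintro _ ⟨j, rfl⟩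
  by_cases hj : j = i
  · rw [hj]; exact hxi
  · exact hmem j hj

/-- singular points when `ε = 1` : either two zero coordinates, or a one-parameter situation -/
theorem sing_cases (h : Fin r → F[X]) (hu : ∀ i j, derivative (h i) = 0 → derivative (h j) = 0)
    (x : Fin r → Ω) (hs : ∀ i, dQ 1 h x i = 0) (hr : 0 < r) :
    (∃ i j, i ≠ j ∧ x i = 0 ∧ x j = 0) ∨
    ((∀ i, derivative (h i) ≠ 0) ∧ ∀ i, aeval (x i) (X * derivative (h i)) = ∏ j, x j) := by
  classical
  by_cases h2 : ∃ i j, i ≠ j ∧ x i = 0 ∧ x j = 0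
  · exact Or.inl h2
  right
  push Not at h2
  have hs' : ∀ i, ∏ j ∈ Finset.univ.erase i, x j = aeval (x i) (derivative (h i)) := by
    intro i
    have := hs i
    rwa [dQ, map_one, one_mul, sub_eq_zero] at this
  have hex : ∃ i, ∏ j ∈ Finset.univ.erase i, x j ≠ 0 := by
    by_cases hz : ∃ i, x i = 0
    · obtain ⟨i, hi⟩ := hz
      refine ⟨i, Finset.prod_ne_zero_iff.2 fun j hj => h2 i j (Finset.ne_of_mem_erase hj).symm hi⟩
    · push Not at hz
      exact ⟨⟨0, hr⟩, Finset.prod_ne_zero_iff.2 fun j _ => hz j⟩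
  obtain ⟨i, hi⟩ := hex
  have hdi : derivative (h i) ≠ 0 := by
    intro h0; apply hi; rw [hs' i, h0]; simp
  refine ⟨fun j hj => hdi (hu j i hj), fun j => ?_⟩
  rw [map_mul, Polynomial.aeval_X, ← hs' j, Finset.mul_prod_erase _ _ (Finset.mem_univ j)]

theorem natDegree_X_mul_pos {R : Type*} [Field R] (g : R[X]) (hg : g ≠ 0) : 0 < (X * g).natDegree := by
  rw [Polynomial.natDegree_X_mul hg]; omega

/-- valuation argument -/
theorem alg_of_three (g : Fin 3 → F[X]) (e : ℕ) (he : ∀ i, (g i).natDegree = e) (he3 : e ≠ 3)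
    (x : Fin 3 → Ω) (l : Ω) (hx : ∀ i, aeval (x i) (g i) = l) (hl : ∏ i, x i = l) : IsAlgebraic F l := by
  by_contra hna
  rw [isAlgebraic_iff_isIntegral] at hna
  haveI : IsIntegrallyClosedIn (integralClosure F Ω).toSubring Ω :=
    inferInstanceAs (IsIntegrallyClosedIn (integralClosure F Ω) Ω)
  obtain ⟨V, hV, hlV⟩ := Subring.exists_le_valuationSubring_of_isIntegrallyClosedIn
    (x := l) (R := (integralClosure F Ω).toSubring) hna
  have hF : ∀ a : F, algebraMap F Ω a ∈ V := fun a => hV (isIntegral_algebraMap)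
  set v := V.valuation with hv
  have hvF : ∀ a : F, a ≠ 0 → v (algebraMap F Ω a) = 1 := by
    intro a ha
    apply le_antisymm ((V.valuation_le_one_iff _).2 (hF a))
    have h1 := (V.valuation_le_one_iff _).2 (hF a⁻¹)
    rw [map_inv₀, map_inv₀] at h1
    have h0 : v (algebraMap F Ω a) ≠ 0 := by simpa using ha
    exact (inv_le_one₀ (zero_lt_iff.2 h0)).1 h1
  have hvl : 1 < v l := by
    rw [← not_le]; intro h; exact hlV ((V.valuation_le_one_iff _).1 h)
  have hpow : ∀ i, v (x i) ^ e = v l := by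
    intro i
    have hxi : 1 < v (x i) := by
      rw [← not_le]; intro h
      have hxV := (V.valuation_le_one_iff _).1 h
      apply hlV
      rw [← hx i, Polynomial.aeval_eq_sum_range]
      refine sum_mem fun n _ => ?_
      rw [Algebra.smul_def]
      exact mul_mem (hF _) (pow_mem hxV n)
    have hg0 : g i ≠ 0 := by
      intro h0
      have := hx i
      rw [h0, map_zero] at this
      rw [← this, map_zero] at hvl
      exact absurd hvl (by simp)
    rw [← hx i, Polynomial.aeval_eq_sum_range, Finset.sum_range_succ, Valuation.map_add_eq_of_lt_right]
    · rw [Algebra.smul_def, map_mul, map_pow, hvF, one_mul, he]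
      rw [Polynomial.coeff_natDegree]; exact Polynomial.leadingCoeff_ne_zero.2 hg0
    · have hpos : v (x i) ≠ 0 := ne_of_gt (lt_trans zero_lt_one hxi)
      have hR : v ((g i).coeff (g i).natDegree • x i ^ (g i).natDegree) = v (x i) ^ (g i).natDegree := by
        rw [Algebra.smul_def, map_mul, map_pow, hvF, one_mul]
        rw [Polynomial.coeff_natDegree]; exact Polynomial.leadingCoeff_ne_zero.2 hg0
      rw [hR]
      apply Valuation.map_sum_lt
      · exact pow_ne_zero _ hpos
      · intro n hn
        rw [Algebra.smul_def, map_mul, map_pow]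
        refine lt_of_le_of_lt (mul_le_of_le_one_left' ((V.valuation_le_one_iff _).2 (hF _))) ?_
        exact pow_lt_pow_right₀ hxi (Finset.mem_range.1 hn)
  have h3 : v l ^ 3 = v l ^ e := by
    conv_rhs => rw [← hl, map_prod, ← Finset.prod_pow]
    simp [hpow]
  exact he3 (pow_right_injective₀ (zero_lt_one.trans hvl) hvl.ne' h3).symm

end QQ
end NTW


namespace NTW

open Polynomial

section sing

variable {F : Type*} [Field F] {r : ℕ} {Ω : Type*} [Field Ω] [Algebra F Ω]

theorem third {r : ℕ} (hr : 3 ≤ r) (i j : Fin r) : ∃ l, l ≠ i ∧ l ≠ j := by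
  classical
  by_contra h
  push Not at h
  have : (Finset.univ : Finset (Fin r)) ⊆ {i, j} := by
    intro l _
    by_cases hl : l = i
    · simp [hl]
    · simp [h l hl]
  have := Finset.card_le_card this
  have h2 := Finset.card_le_two (a := i) (b := j)
  simp at this; omega

theorem rank_param (g : Fin r → F[X]) (hg : ∀ i, 0 < (g i).natDegree) (x : Fin r → Ω) (l : Ω)
    (hx : ∀ i, aeval (x i) (g i) = l) : (mat F Ω).eRk (Set.range x) ≤ 1 := by
  refine (eRk_le_card (t := {l}) ?_).trans (by simp)
  rintro _ ⟨i, rfl⟩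
  exact clo_of_aeval (g i) (hg i) _ l (subset_clo _ rfl) (hx i)

theorem rank_two_zero (x : Fin r → Ω) (i j : Fin r) (hij : i ≠ j) (hi : x i = 0) (hj : x j = 0) :
    (mat F Ω).eRk (Set.range x) ≤ (r - 2 : ℕ) := by
  classical
  have h2 : ({i, j} : Finset (Fin r)).card = 2 := Finset.card_pair hij
  refine (eRk_le_card (t := x '' (({i, j} : Finset (Fin r))ᶜ : Finset (Fin r))) ?_).trans
    ((encard_image_compl_le x {i, j}).trans (by rw [h2]))
  rintro _ ⟨l, rfl⟩
  by_cases hl : l = i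
  · rw [hl, hi]; exact zero_mem _
  by_cases hl2 : l = j
  · rw [hl2, hj]; exact zero_mem _
  exact subset_clo _ ⟨l, by simp [hl, hl2], rfl⟩

theorem rank_sing_affine (hr : 3 ≤ r) (g : Fin r → F[X]) (hk : ∀ i, 0 < (g i).natDegree)
    (hu : ∀ i j, derivative (g i) = 0 → derivative (g j) = 0)
    (e : ℕ) (he : ∀ i, (derivative (g i)).natDegree = e) (he3 : r = 3 → e ≠ 2)
    (x : Fin r → Ω) (hx : QQ 1 g x = 0) (hs : ∀ i, dQ 1 g x i = 0) :
    (mat F Ω).eRk (Set.range x) ≤ (r - 3 : ℕ) := by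
  classical
  rcases sing_cases g hu x hs (by omega) with ⟨i, j, hij, hi, hj⟩ | ⟨hd, hp⟩
  · obtain ⟨l, hli, hlj⟩ := third hr i j
    have h3 : ({i, j, l} : Finset (Fin r)).card = 3 := Finset.card_eq_three.2 ⟨i, j, l, hij, hli.symm, hlj.symm, rfl⟩
    set T := x '' (({i, j, l} : Finset (Fin r))ᶜ : Finset (Fin r)) with hT
    have hmem : ∀ m, m ≠ l → x m ∈ clo F T := by
      intro m hm
      by_cases hmi : m = i
      · rw [hmi, hi]; exact zero_mem _
      by_cases hmj : m = j
      · rw [hmj, hj]; exact zero_mem _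
      exact subset_clo _ ⟨m, by simp [hmi, hmj, hm], rfl⟩
    refine (eRk_le_card (t := T) ?_).trans ((encard_image_compl_le x {i, j, l}).trans (by rw [h3]))
    rintro _ ⟨m, rfl⟩
    by_cases hm : m = l
    · rw [hm]
      refine clo_of_aeval (g l) (hk l) _ (-∑ j ∈ Finset.univ.erase l, aeval (x j) (g j)) ?_ ?_
      · exact neg_mem (sum_mem fun j hj => clo_aeval (hmem j (Finset.ne_of_mem_erase hj)) _)
      · rw [QQ, Finset.prod_eq_zero (Finset.mem_univ i) hi, ← Finset.add_sum_erase _ _ (Finset.mem_univ l)] at hx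
        linear_combination -hx
    · exact hmem m hm
  · by_cases hr3 : r = 3
    · subst hr3
      have halg : IsAlgebraic F (∏ j, x j) := by
        refine alg_of_three (fun i => X * derivative (g i)) (e + 1) ?_ (by have := he3 rfl; omega) x _ hp rfl
        intro i
        rw [Polynomial.natDegree_X_mul (hd i), he]
      have : (mat F Ω).eRk (Set.range x) ≤ (∅ : Set Ω).encard := by
        refine eRk_le_card ?_
        have hl : ∏ j, x j ∈ clo F (∅ : Set Ω) := by
          obtain ⟨p, hp0, hpz⟩ := halg
          refine clo_root _ (p.map (algebraMap F Ω)) ((Polynomial.map_ne_zero_iff (algebraMap F Ω).injective).2 hp0) ?_ _ ?_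
          · intro n; rw [Polynomial.coeff_map]; exact Subalgebra.algebraMap_mem _ _
          · rw [Polynomial.eval_map_algebraMap, hpz]
        rintro _ ⟨i, rfl⟩
        exact clo_of_aeval _ (natDegree_X_mul_pos _ (hd i)) _ _ hl (hp i)
      simpa using this
    · refine (rank_param _ (fun i => natDegree_X_mul_pos _ (hd i)) x _ hp).trans ?_
      have : 1 ≤ r - 3 := by omega
      exact_mod_cast this

/-- data of the top form -/
noncomputable def tE (F : Type*) [Field F] (k r : ℕ) : F := if k ≤ r then 1 else 0
noncomputable def tH (k : ℕ) (g : Fin r → F[X]) : Fin r → F[X] :=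
  fun j => if r ≤ k then monomial k ((g j).coeff k) else 0

theorem rank_sing_top (k : ℕ) (g : Fin r → F[X]) (hk : ∀ i, (g i).natDegree = k) (hk1 : 1 ≤ k) (hr : 3 ≤ r)
    (hc : (k > r ∧ (k : F) ≠ 0) ∨ k ≤ r)
    (x : Fin r → Ω) (hs : ∀ i, dQ (tE F k r) (tH k g) x i = 0) :
    (mat F Ω).eRk (Set.range x) ≤ (r - 2 : ℕ) := by
  classical
  have hlc : ∀ i, (g i).coeff k ≠ 0 := by
    intro i
    rw [← hk i, Polynomial.coeff_natDegree, Polynomial.leadingCoeff_ne_zero]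
    intro h0
    have := hk i
    rw [h0] at this; simp at this; omega
  rcases hc with ⟨hkr, hk0⟩ | hkr
  · have hx : ∀ i, x i = 0 := by
      intro i
      have := hs i
      rw [dQ, tE, if_neg (by omega), tH, if_pos (by omega), Polynomial.derivative_monomial, Polynomial.aeval_monomial] at this
      simp only [map_zero, zero_mul, zero_sub, neg_eq_zero, mul_eq_zero, map_mul, FaithfulSMul.algebraMap_eq_zero_iff] at this
      rcases this with (h | h) | h
      · exact absurd h (hlc i)
      · exact absurd h hk0
      · exact pow_eq_zero_iff (by omega) |>.1 h
    exact rank_two_zero x ⟨0, by omega⟩ ⟨1, by omega⟩ (by simp) (hx _) (hx _)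
  · rw [tE, if_pos hkr] at hs
    have hu : ∀ i j, derivative (tH k g i) = 0 → derivative (tH k g j) = 0 := by
      intro i j
      unfold tH
      split_ifs
      · rw [Polynomial.derivative_monomial, Polynomial.derivative_monomial, Polynomial.monomial_eq_zero_iff, Polynomial.monomial_eq_zero_iff,
          mul_eq_zero, mul_eq_zero]
        intro h; right; exact h.resolve_left (hlc i)
      · simp
    rcases sing_cases _ hu x hs (by omega) with ⟨i, j, hij, hi, hj⟩ | ⟨hd, hp⟩
    · exact rank_two_zero x i j hij hi hj
    · refine (rank_param _ (fun i => natDegree_X_mul_pos _ (hd i)) x _ hp).trans ?_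
      have : 1 ≤ r - 2 := by omega
      exact_mod_cast this

end sing
end NTW


namespace NTW

open Polynomial Polynomial.Bivariate

section slice

variable {F : Type*} [Field F] {r : ℕ}

noncomputable def lin {R : Type*} [CommRing R] (a b c : R) : R[X][Y] := C (C a + C b * X) + C (C c) * X

noncomputable def Sl {R : Type*} [CommRing R] [Algebra F R] (g : Fin r → F[X]) (a b c : Fin r → R) : R[X][Y] :=
  QQ 1 g (fun j => lin (a j) (b j) (c j))

noncomputable def mapXY {R S : Type*} [CommRing R] [CommRing S] [Algebra F R] [Algebra F S] (φ : R →ₐ[F] S) : R[X][Y] →ₐ[F] S[X][Y] :=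
  Polynomial.mapAlgHom (Polynomial.mapAlgHom φ)

theorem coeff_mapXY {R S : Type*} [CommRing R] [CommRing S] [Algebra F R] [Algebra F S] (φ : R →ₐ[F] S) (p : R[X][Y]) (i j : ℕ) :
    ((mapXY φ p).coeff j).coeff i = φ ((p.coeff j).coeff i) := by
  simp [mapXY]

theorem mapXY_lin {R S : Type*} [CommRing R] [CommRing S] [Algebra F R] [Algebra F S] (φ : R →ₐ[F] S) (a b c : R) :
    mapXY φ (lin a b c) = lin (φ a) (φ b) (φ c) := by
  simp [mapXY, lin]

theorem mapXY_Sl {R S : Type*} [CommRing R] [CommRing S] [Algebra F R] [Algebra F S] (φ : R →ₐ[F] S) (g : Fin r → F[X]) (a b c : Fin r → R) :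
    mapXY φ (Sl g a b c) = Sl g (fun j => φ (a j)) (fun j => φ (b j)) (fun j => φ (c j)) := by
  unfold Sl
  rw [map_QQ]
  simp only [mapXY_lin]

noncomputable def evA (F : Type*) [Field F] {R : Type*} [CommRing R] [Algebra F R] (s t : R) : R[X][Y] →ₐ[F] R :=
  { evalEvalRingHom s t with
    commutes' := fun x => by
      change evalEval s t (algebraMap F R[X][Y] x) = _
      rw [Polynomial.algebraMap_apply, Polynomial.algebraMap_apply]
      simp }

theorem evA_apply {R : Type*} [CommRing R] [Algebra F R] (s t : R) (p : R[X][Y]) : evA F s t p = evalEval s t p := rfl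

theorem evalEval_lin {R : Type*} [CommRing R] (s t a b c : R) : evalEval s t (lin a b c) = a + b * s + c * t := by
  simp [lin, evalEval]

theorem evalEval_Sl {R : Type*} [CommRing R] [Algebra F R] (g : Fin r → F[X]) (a b c : Fin r → R) (s t : R) :
    evalEval s t (Sl g a b c) = QQ 1 g (fun j => a j + b j * s + c j * t) := by
  rw [← evA_apply (F := F), Sl, map_QQ]
  simp only [evA_apply, evalEval_lin]

variable {K : Type*} [Field K] [Algebra F K]

noncomputable def dY (F K : Type*) [Field F] [Field K] [Algebra F K] : Derivation F K[X][Y] K[X][Y] :=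
  (Polynomial.derivative' : Derivation K[X] K[X][Y] K[X][Y]).restrictScalars F

theorem dY_apply (p : K[X][Y]) : dY F K p = derivative p := rfl

noncomputable def dX (F K : Type*) [Field F] [Field K] [Algebra F K] : Derivation F K[X][Y] K[X][Y] :=
  Derivation.mk'
    { toFun := pX
      map_add' := pX_add
      map_smul' := fun a p => by
        ext j i
        simp [coeff_pX] }
    (fun p q => by
      change pX (p * q) = p • pX q + q • pX p
      rw [pX_mul, smul_eq_mul, smul_eq_mul]; ring)

theorem dX_apply (p : K[X][Y]) : dX F K p = pX p := rfl

theorem derivative_lin (a b c : K) : derivative (lin a b c) = C (C c) := by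
  simp [lin]

theorem pX_lin (a b c : K) : pX (lin a b c) = C (C b) := by
  ext j i
  rw [coeff_pX, lin, Polynomial.coeff_add, Polynomial.coeff_C_mul, Polynomial.coeff_X, Polynomial.coeff_C, Polynomial.coeff_C]
  by_cases hj : j = 0
  · subst hj
    simp only [if_true, if_false, Polynomial.coeff_add, Polynomial.coeff_C_mul, Polynomial.coeff_C, Polynomial.coeff_X]
    by_cases hi : i = 0
    · subst hi; simp
    · simp [hi, Ne.symm hi]
  · by_cases hj1 : 1 = j
    · subst hj1; simp [Polynomial.coeff_C]
    · simp [hj, hj1]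

theorem evalEval_derivative_Sl (g : Fin r → F[X]) (a b c : Fin r → K) (s t : K) :
    evalEval s t (derivative (Sl g a b c)) = ∑ l, dQ 1 g (fun j => a j + b j * s + c j * t) l * c l := by
  rw [← dY_apply (F := F), Sl, deriv_QQ, ← evA_apply (F := F), map_sum]
  refine Finset.sum_congr rfl fun l _ => ?_
  rw [map_mul, map_dQ, dY_apply, derivative_lin]
  simp only [evA_apply, evalEval_lin]
  simp

theorem evalEval_pX_Sl (g : Fin r → F[X]) (a b c : Fin r → K) (s t : K) :
    evalEval s t (pX (Sl g a b c)) = ∑ l, dQ 1 g (fun j => a j + b j * s + c j * t) l * b l := by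
  rw [← dX_apply (F := F), Sl, deriv_QQ, ← evA_apply (F := F), map_sum]
  refine Finset.sum_congr rfl fun l _ => ?_
  rw [map_mul, map_dQ, dX_apply, pX_lin]
  simp only [evA_apply, evalEval_lin]
  simp

theorem coeff_lin (a b c : K) (i j : ℕ) : ((lin a b c).coeff j).coeff i =
    (if i = 0 ∧ j = 0 then a else 0) + (if i = 1 ∧ j = 0 then b else 0) + (if i = 0 ∧ j = 1 then c else 0) := by
  rw [lin, Polynomial.coeff_add, Polynomial.coeff_C_mul, Polynomial.coeff_X, Polynomial.coeff_C]
  rcases j with _ | _ | j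
  · rcases i with _ | _ | i <;> simp [Polynomial.coeff_C, Polynomial.coeff_X]
  · rcases i with _ | i <;> simp [Polynomial.coeff_C]
  · simp

theorem TD_lin (a b c : K) : TD 1 (lin a b c) := by
  intro i j hij
  rw [coeff_lin, if_neg (by omega), if_neg (by omega), if_neg (by omega)]; simp

theorem top_lin (a b c : K) : top 1 (lin a b c) = C b + C c * X := by
  ext j
  rw [coeff_top]
  rcases j with _ | _ | j
  · simp [coeff_lin]
  · simp [coeff_lin, Polynomial.coeff_C]
  · rw [if_neg (by omega), Polynomial.coeff_add, Polynomial.coeff_C_mul, Polynomial.coeff_C, Polynomial.coeff_X]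
    simp

theorem TD_CC (a : K) : TD 0 (C (C a) : K[X][Y]) := by
  intro i j hij
  rw [Polynomial.coeff_C]
  split_ifs
  · rw [Polynomial.coeff_C, if_neg (by omega)]
  · simp

theorem top_CC (a : K) : top 0 (C (C a) : K[X][Y]) = C a := by
  ext j
  rw [coeff_top, Polynomial.coeff_C (R := K)]
  rcases j with _ | j <;> simp

theorem TD_top_prod {ι : Type*} (s : Finset ι) (L : ι → K[X][Y]) (h : ∀ i, TD 1 (L i)) :
    TD s.card (∏ i ∈ s, L i) ∧ top s.card (∏ i ∈ s, L i) = ∏ i ∈ s, top 1 (L i) := by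
  classical
  induction s using Finset.induction_on with
  | empty =>
    have h1 : (1 : K[X][Y]) = C (C 1) := by simp
    rw [Finset.prod_empty, Finset.prod_empty, Finset.card_empty, h1, top_CC]
    exact ⟨TD_CC 1, by simp⟩
  | insert a s ha ih =>
    rw [Finset.prod_insert ha, Finset.prod_insert ha, Finset.card_insert_of_notMem ha, add_comm]
    exact ⟨(h a).mul ih.1, by rw [top_mul (h a) ih.1, ih.2]⟩

theorem TD_top_pow (L : K[X][Y]) (h : TD 1 L) (n : ℕ) : TD n (L ^ n) ∧ top n (L ^ n) = (top 1 L) ^ n := by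
  have := TD_top_prod (Finset.range n) (fun _ => L) (fun _ => h)
  simpa using this

theorem top_sum {ι : Type*} (s : Finset ι) (n : ℕ) (p : ι → K[X][Y]) : top n (∑ i ∈ s, p i) = ∑ i ∈ s, top n (p i) := by
  simp [top, Polynomial.finset_sum_coeff]

theorem TD_top_aeval (L : K[X][Y]) (hL : TD 1 L) (h : F[X]) (n : ℕ) (hn : h.natDegree ≤ n) :
    TD n (aeval L h) ∧ top n (aeval L h) = aeval (top 1 L) (monomial n (h.coeff n)) := by
  have hterm : ∀ i, TD i (h.coeff i • L ^ i) ∧ top i (h.coeff i • L ^ i) = aeval (top 1 L) (monomial i (h.coeff i)) := by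
    intro i
    have e : h.coeff i • L ^ i = C (C (algebraMap F K (h.coeff i))) * L ^ i := by
      rw [Algebra.smul_def, Polynomial.algebraMap_apply, Polynomial.algebraMap_apply]
    obtain ⟨h1, h2⟩ := TD_top_pow L hL i
    have h3 := (TD_CC (algebraMap F K (h.coeff i))).mul h1
    have h4 := top_mul (TD_CC (algebraMap F K (h.coeff i))) h1
    rw [zero_add] at h3 h4
    rw [e]
    refine ⟨h3, ?_⟩
    rw [h4, top_CC, h2, Polynomial.aeval_monomial, Polynomial.algebraMap_apply]
  rw [Polynomial.aeval_eq_sum_range' (n := n + 1) (by omega)]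
  constructor
  · refine TD_sum _ _ _ fun i hi => (hterm i).1.mono ?_
    have := Finset.mem_range.1 hi; omega
  · rw [Finset.sum_range_succ, top_add, (hterm n).2, top_sum, Finset.sum_eq_zero, zero_add]
    intro i hi
    exact top_eq_zero_of_TD (Finset.mem_range.1 hi) (hterm i).1

theorem TD_top_Sl (k : ℕ) (g : Fin r → F[X]) (hk : ∀ i, (g i).natDegree = k) (a b c : Fin r → K) :
    TD (max k r) (Sl g a b c) ∧ top (max k r) (Sl g a b c) = QQ (tE F k r) (tH k g) (fun j => C (b j) + C (c j) * X) := by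
  have hp := TD_top_prod Finset.univ (fun j => lin (a j) (b j) (c j)) (fun j => TD_lin _ _ _)
  have ha := fun j => TD_top_aeval (lin (a j) (b j) (c j)) (TD_lin _ _ _) (g j) k (hk j).le
  simp only [top_lin, Finset.card_univ, Fintype.card_fin] at hp ha
  unfold Sl QQ
  rw [map_one, one_mul, top_sub, top_sum]
  constructor
  · exact (hp.1.mono (le_max_right _ _)).sub (TD_sum _ _ _ fun j _ => (ha j).1.mono (le_max_left _ _))
  · congr 1
    · unfold tE
      split_ifs with h
      · rw [max_eq_right h, hp.2]; simp
      · rw [top_eq_zero_of_TD (by omega) hp.1]; simp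
    · refine Finset.sum_congr rfl fun j _ => ?_
      unfold tH
      split_ifs with h
      · rw [max_eq_left h, (ha j).2]
      · rw [top_eq_zero_of_TD (by omega) (ha j).1]; simp

theorem coeff_top_Sl (k : ℕ) (g : Fin r → F[X]) (b c : Fin r → K) :
    (QQ (tE F k r) (tH k g) (fun j => C (b j) + C (c j) * X)).coeff (max k r) = QQ (tE F k r) (tH k g) c := by
  have hl : ∀ j, (C (b j) + C (c j) * X).natDegree ≤ 1 := by
    intro j; rw [add_comm]; exact Polynomial.natDegree_linear_le
  have hc1 : ∀ j, (C (b j) + C (c j) * X).coeff 1 = c j := by intro j; simp [Polynomial.coeff_C]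
  unfold QQ
  rw [Polynomial.coeff_sub, Polynomial.finset_sum_coeff]
  congr 1
  · rw [Polynomial.algebraMap_apply]
    change (C _ * _).coeff _ = _
    rw [Polynomial.coeff_C_mul]
    unfold tE
    split_ifs with h
    · rw [max_eq_right h]
      have := Polynomial.coeff_prod_of_natDegree_le (s := Finset.univ) (fun j => C (b j) + C (c j) * X) 1 (fun j _ => hl j)
      simp only [hc1, Finset.card_univ, Fintype.card_fin, mul_one] at this
      rw [this]
    · simp
  · refine Finset.sum_congr rfl fun j _ => ?_
    unfold tH
    split_ifs with h
    · rw [max_eq_left h, Polynomial.aeval_monomial, Polynomial.aeval_monomial, Polynomial.algebraMap_apply]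
      change (C _ * _).coeff _ = _
      rw [Polynomial.coeff_C_mul]
      have := Polynomial.coeff_pow_of_natDegree_le (hl j) (m := k)
      rw [hc1, mul_one] at this
      rw [this]
    · simp

end slice
end NTW


namespace NTW

open Polynomial Polynomial.Bivariate

section generic

theorem nullst {K : Type*} [Field K] [IsAlgClosed K] (I : Ideal K[X][Y]) (h : ∀ s t, ∃ p ∈ I, evalEval s t p ≠ 0) : I = ⊤ := by
  by_contra hI
  obtain ⟨m, hm, hIm⟩ := Ideal.exists_le_maximal I hI
  letI : Field (K[X][Y] ⧸ m) := Ideal.Quotient.field m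
  haveI : Algebra.FiniteType K K[X] := inferInstance
  haveI : Algebra.FiniteType K K[X][Y] := Algebra.FiniteType.trans (S := K[X]) inferInstance inferInstance
  haveI : Algebra.FiniteType K (K[X][Y] ⧸ m) := inferInstance
  haveI : Module.Finite K (K[X][Y] ⧸ m) := finite_of_finite_type_of_isJacobsonRing K _
  have hb : Function.Bijective (algebraMap K (K[X][Y] ⧸ m)) := IsAlgClosed.algebraMap_bijective_of_isIntegral
  obtain ⟨s, hs⟩ := hb.2 (Ideal.Quotient.mk m (C X))
  obtain ⟨t, ht⟩ := hb.2 (Ideal.Quotient.mk m X)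
  have hring : Ideal.Quotient.mk m = (algebraMap K (K[X][Y] ⧸ m)).comp (evalEvalRingHom s t) := by
    apply Polynomial.ringHom_ext
    · intro a
      have : (Ideal.Quotient.mk m).comp C = ((algebraMap K (K[X][Y] ⧸ m)).comp (evalEvalRingHom s t)).comp C := by
        apply Polynomial.ringHom_ext
        · intro x
          simp
          rfl
        · simp [hs]
      exact congrArg (fun f => f a) this
    · simp [ht]
  obtain ⟨p, hp, hne⟩ := h s t
  apply hne
  have h0 : Ideal.Quotient.mk m p = 0 := Ideal.Quotient.eq_zero_iff_mem.2 (hIm hp)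
  rw [hring, RingHom.comp_apply] at h0
  exact (map_eq_zero _).1 h0

variable {F : Type*} [Field F] {r : ℕ} {K : Type*} [Field K] [Algebra F K]

theorem encard_pair_le (s t : K) : ({s, t} : Set K).encard ≤ 2 := by
  refine (Set.encard_insert_le _ _).trans ?_
  rw [Set.encard_singleton]
  norm_num

/-- solving a linear relation -/
theorem clo_solve {T : Set K} (u v : Fin r → K) (hu : ∀ l, u l ∈ clo F T) (i : Fin r) (hui : u i ≠ 0)
    (hv : ∀ l, l ≠ i → v l ∈ clo F T) (h : ∑ l, u l * v l = 0) : ∀ l, v l ∈ clo F T := by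
  classical
  intro l
  by_cases hl : l = i
  · subst hl
    rw [← Finset.add_sum_erase _ _ (Finset.mem_univ l)] at h
    have : v l = -(u l)⁻¹ * ∑ j ∈ Finset.univ.erase l, u j * v j := by
      have h2 : u l * v l = -∑ j ∈ Finset.univ.erase l, u j * v j := by linear_combination h
      rw [neg_mul, mul_comm, ← neg_mul, ← h2]
      field_simp
    rw [this]
    exact mul_mem (neg_mem (clo_inv (hu l))) (sum_mem fun j hj => mul_mem (hu j) (hv j (Finset.ne_of_mem_erase hj)))
  · exact hv l hl

theorem dQ_mem {T : Set K} (ε : F) (h : Fin r → F[X]) (x : Fin r → K) (hx : ∀ l, x l ∈ clo F T) (l : Fin r) : dQ ε h x l ∈ clo F T :=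
  sub_mem (mul_mem (Subalgebra.algebraMap_mem _ _) (prod_mem fun j _ => hx j)) (clo_aeval (hx l) _)

theorem affine_smooth (g : Fin r → F[X]) (hr : 3 ≤ r)
    (hsing : ∀ x : Fin r → K, QQ 1 g x = 0 → (∀ i, dQ 1 g x i = 0) → (mat F K).eRk (Set.range x) ≤ (r - 3 : ℕ))
    (a b c : Fin r → K) (hind : AlgebraicIndependent F (Sum.elim a (Sum.elim b c))) (s t : K)
    (h0 : QQ 1 g (fun j => a j + b j * s + c j * t) = 0)
    (h1 : ∑ l, dQ 1 g (fun j => a j + b j * s + c j * t) l * b l = 0)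
    (h2 : ∑ l, dQ 1 g (fun j => a j + b j * s + c j * t) l * c l = 0) : False := by
  classical
  set x : Fin r → K := fun j => a j + b j * s + c j * t with hx
  have key : ∀ T : Set K, (∀ l, x l ∈ clo F T) → s ∈ clo F T → t ∈ clo F T → (∀ l, b l ∈ clo F T) → (∀ l, c l ∈ clo F T) →
      ((3 * r : ℕ) : ℕ∞) ≤ (mat F K).eRk T := by
    intro T hxT hs ht hb hc
    have := eRk_indep _ hind
    simp only [Fintype.card_sum, Fintype.card_fin] at this
    rw [show 3 * r = r + (r + r) by ring, ← this]
    apply eRk_le_of_clo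
    rintro _ ⟨l | l | l, rfl⟩
    · have : a l = x l - b l * s - c l * t := by rw [hx]; ring
      simp only [Sum.elim_inl]
      rw [this]
      exact sub_mem (sub_mem (hxT l) (mul_mem (hb l) hs)) (mul_mem (hc l) ht)
    · exact hb l
    · exact hc l
  by_cases hsg : ∀ i, dQ 1 g x i = 0
  · have hrk := hsing x h0 hsg
    have h3 := key (Set.range x ∪ ({s, t} ∪ (Set.range b ∪ Set.range c))) (fun l => subset_clo _ (by simp)) (subset_clo _ (by simp))
      (subset_clo _ (by simp)) (fun l => subset_clo _ (by simp)) (fun l => subset_clo _ (by simp))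
    have hrange : ∀ y : Fin r → K, (Set.range y).encard ≤ (r : ℕ) := by
      intro y
      rw [← Set.image_univ]
      refine (Set.encard_image_le _ _).trans ?_
      simp
    have h4 : (mat F K).eRk (Set.range x ∪ ({s, t} ∪ (Set.range b ∪ Set.range c))) ≤ (r - 3 : ℕ) + (2 + (r + r)) := by
      refine ((mat F K).eRk_union_le_eRk_add_encard _ _).trans (add_le_add hrk ?_)
      refine (Set.encard_union_le _ _).trans (add_le_add (encard_pair_le s t) ?_)
      exact (Set.encard_union_le _ _).trans (add_le_add (hrange b) (hrange c))
    have h5 := h3.trans h4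
    have h6 : 3 * r ≤ (r - 3) + (2 + (r + r)) := by exact_mod_cast h5
    omega
  · push Not at hsg
    obtain ⟨i, hi⟩ := hsg
    have hrk := rank_nonsing 1 g x h0 i hi
    set B := b '' (({i} : Finset (Fin r))ᶜ : Finset (Fin r)) with hB
    set Cc := c '' (({i} : Finset (Fin r))ᶜ : Finset (Fin r)) with hCc
    set T := Set.range x ∪ ({s, t} ∪ (B ∪ Cc)) with hT
    have hxT : ∀ l, x l ∈ clo F T := fun l => subset_clo _ (by simp [hT])
    have hbT : ∀ l, l ≠ i → b l ∈ clo F T := fun l hl => subset_clo _ (Or.inr (Or.inr (Or.inl ⟨l, by simpa using hl, rfl⟩)))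
    have hcT : ∀ l, l ≠ i → c l ∈ clo F T := fun l hl => subset_clo _ (Or.inr (Or.inr (Or.inr ⟨l, by simpa using hl, rfl⟩)))
    have hdT := dQ_mem (T := T) 1 g x hxT
    have h3 := key T hxT (subset_clo _ (by simp [hT])) (subset_clo _ (by simp [hT])) (clo_solve _ _ hdT i hi hbT h1) (clo_solve _ _ hdT i hi hcT h2)
    have h4 : (mat F K).eRk T ≤ (r - 1 : ℕ) + (2 + ((r - 1 : ℕ) + (r - 1 : ℕ))) := by
      refine ((mat F K).eRk_union_le_eRk_add_encard _ _).trans (add_le_add hrk ?_)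
      refine (Set.encard_union_le _ _).trans (add_le_add (encard_pair_le s t) ?_)
      exact (Set.encard_union_le _ _).trans (add_le_add (encard_image_compl_le b {i}) (encard_image_compl_le c {i}))
    have h5 := h3.trans h4
    have h6 : 3 * r ≤ (r - 1) + (2 + ((r - 1) + (r - 1))) := by exact_mod_cast h5
    omega

theorem infty_smooth (ε : F) (g : Fin r → F[X]) (hr : 3 ≤ r)
    (hsing : ∀ x : Fin r → K, (∀ i, dQ ε g x i = 0) → (mat F K).eRk (Set.range x) ≤ (r - 2 : ℕ))
    (b c : Fin r → K) (hind : AlgebraicIndependent F (Sum.elim b c)) (t : K)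
    (h0 : QQ ε g (fun j => b j + c j * t) = 0)
    (h2 : ∑ l, dQ ε g (fun j => b j + c j * t) l * c l = 0) : False := by
  classical
  set x : Fin r → K := fun j => b j + c j * t with hx
  have key : ∀ T : Set K, (∀ l, x l ∈ clo F T) → t ∈ clo F T → (∀ l, c l ∈ clo F T) →
      ((2 * r : ℕ) : ℕ∞) ≤ (mat F K).eRk T := by
    intro T hxT ht hc
    have := eRk_indep _ hind
    simp only [Fintype.card_sum, Fintype.card_fin] at this
    rw [show 2 * r = r + r by ring, ← this]
    apply eRk_le_of_clo
    rintro _ ⟨l | l, rfl⟩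
    · have : b l = x l - c l * t := by rw [hx]; ring
      simp only [Sum.elim_inl]
      rw [this]
      exact sub_mem (hxT l) (mul_mem (hc l) ht)
    · exact hc l
  by_cases hsg : ∀ i, dQ ε g x i = 0
  · have hrk := hsing x hsg
    have h3 := key (Set.range x ∪ ({t} ∪ Set.range c)) (fun l => subset_clo _ (by simp)) (subset_clo _ (by simp))
      (fun l => subset_clo _ (by simp))
    have hrange : ∀ y : Fin r → K, (Set.range y).encard ≤ (r : ℕ) := by
      intro y
      rw [← Set.image_univ]
      refine (Set.encard_image_le _ _).trans ?_
      simp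
    have h4 : (mat F K).eRk (Set.range x ∪ ({t} ∪ Set.range c)) ≤ (r - 2 : ℕ) + (1 + r) := by
      refine ((mat F K).eRk_union_le_eRk_add_encard _ _).trans (add_le_add hrk ?_)
      exact (Set.encard_union_le _ _).trans (add_le_add (by simp) (hrange c))
    have h5 := h3.trans h4
    have h6 : 2 * r ≤ (r - 2) + (1 + r) := by exact_mod_cast h5
    omega
  · push Not at hsg
    obtain ⟨i, hi⟩ := hsg
    have hrk := rank_nonsing ε g x h0 i hi
    set Cc := c '' (({i} : Finset (Fin r))ᶜ : Finset (Fin r)) with hCc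
    set T := Set.range x ∪ ({t} ∪ Cc) with hT
    have hxT : ∀ l, x l ∈ clo F T := fun l => subset_clo _ (by simp [hT])
    have hcT : ∀ l, l ≠ i → c l ∈ clo F T := fun l hl => subset_clo _ (Or.inr (Or.inr ⟨l, by simpa using hl, rfl⟩))
    have hdT := dQ_mem (T := T) ε g x hxT
    have h3 := key T hxT (subset_clo _ (by simp [hT])) (clo_solve _ _ hdT i hi hcT h2)
    have h4 : (mat F K).eRk T ≤ (r - 1 : ℕ) + (1 + (r - 1 : ℕ)) := by
      refine ((mat F K).eRk_union_le_eRk_add_encard _ _).trans (add_le_add hrk ?_)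
      exact (Set.encard_union_le _ _).trans (add_le_add (by simp) (encard_image_compl_le c {i}))
    have h5 := h3.trans h4
    have h6 : 2 * r ≤ (r - 1) + (1 + (r - 1)) := by exact_mod_cast h5
    omega

theorem top_ne_zero (ε : F) (g : Fin r → F[X]) (hr : 3 ≤ r)
    (hsing : ∀ x : Fin r → K, (∀ i, dQ ε g x i = 0) → (mat F K).eRk (Set.range x) ≤ (r - 2 : ℕ))
    (c : Fin r → K) (hind : AlgebraicIndependent F c) : QQ ε g c ≠ 0 := by
  intro h0
  have hrk : (mat F K).eRk (Set.range c) ≤ (r - 1 : ℕ) := by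
    by_cases hsg : ∀ i, dQ ε g c i = 0
    · refine (hsing c hsg).trans ?_
      exact_mod_cast (by omega : r - 2 ≤ r - 1)
    · push Not at hsg
      obtain ⟨i, hi⟩ := hsg
      exact rank_nonsing ε g c h0 i hi
  rw [eRk_indep _ hind, Fintype.card_fin] at hrk
  have : r ≤ r - 1 := by exact_mod_cast hrk
  omega

/-- the hypotheses on the polynomials -/
structure Hyp (k : ℕ) (g : Fin r → F[X]) : Prop where
  deg : ∀ i, (g i).natDegree = k
  k1 : 1 ≤ k
  r3 : 3 ≤ r
  der : ∀ i j, derivative (g i) = 0 → derivative (g j) = 0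
  e : ∃ e : ℕ, (∀ i, (derivative (g i)).natDegree = e) ∧ (r = 3 → e ≠ 2)
  c : (k > r ∧ (k : F) ≠ 0) ∨ k ≤ r

theorem good_generic [IsAlgClosed K] (k : ℕ) (g : Fin r → F[X]) (H : Hyp k g)
    (a b c : Fin r → K) (hind : AlgebraicIndependent F (Sum.elim a (Sum.elim b c))) :
    ((Sl g a b c).coeff (max k r)).coeff 0 ≠ 0 ∧
    ∃ e, ((cmat (max k r) (cf (Sl g a b c))).submatrix id e).det ≠ 0 := by
  classical
  obtain ⟨e, he, he3⟩ := H.e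
  have hind2 : AlgebraicIndependent F (Sum.elim b c) := by
    have := hind.comp Sum.inr Sum.inr_injective
    simpa using this
  have hind3 : AlgebraicIndependent F c := by
    have := hind2.comp Sum.inr Sum.inr_injective
    simpa using this
  have hst := rank_sing_top (Ω := K) k g H.deg H.k1 H.r3 H.c
  have hsa := rank_sing_affine (Ω := K) H.r3 g (fun i => by rw [H.deg]; exact H.k1) H.der e he he3
  obtain ⟨hTD, htop⟩ := TD_top_Sl k g H.deg a b c
  set d := max k r with hd
  have hd3 : 3 ≤ d := H.r3.trans (le_max_right _ _)
  set S := Sl g a b c with hS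
  set α := (S.coeff d).coeff 0 with hα
  have hα1 : α = QQ (tE F k r) (tH k g) c := by
    have h1 := coeff_top S d d
    rw [if_pos le_rfl, Nat.sub_self, htop, coeff_top_Sl] at h1
    exact h1.symm
  have hα0 : α ≠ 0 := by rw [hα1]; exact top_ne_zero _ _ H.r3 hst c hind3
  refine ⟨hα0, ?_⟩
  have hsep : (top d S).Separable := by
    rw [Polynomial.separable_def]
    refine (Polynomial.isCoprime_iff_aeval_ne_zero_of_isAlgClosed K K _ _).2 ?_
    intro y
    by_contra hcon
    push Not at hcon
    obtain ⟨h1, h2⟩ := hcon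
    rw [htop] at h1 h2
    have hL : ∀ j, aeval y (C (b j) + C (c j) * X) = b j + c j * y := by intro j; simp
    refine infty_smooth (tE F k r) (tH k g) H.r3 hst b c hind2 y ?_ ?_
    · change ((aeval y : K[X] →ₐ[K] K).restrictScalars F) _ = 0 at h1
      rw [map_QQ] at h1
      simpa [hL] using h1
    · have hD := deriv_QQ ((Polynomial.derivative' : Derivation K K[X] K[X]).restrictScalars F) (tE F k r) (tH k g) (fun j => C (b j) + C (c j) * X)
      change derivative _ = ∑ l, _ * derivative _ at hD
      rw [hD] at h2
      change ((aeval y : K[X] →ₐ[K] K).restrictScalars F) _ = 0 at h2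
      rw [map_sum] at h2
      rw [← h2]
      refine Finset.sum_congr rfl fun l _ => ?_
      rw [map_mul, map_dQ]
      simp
  have hsm : Ideal.span {S, pX S, derivative S} = ⊤ := by
    apply nullst
    intro s t
    by_contra hcon
    push Not at hcon
    have h0 := hcon S (Ideal.subset_span (by simp))
    have h1 := hcon (pX S) (Ideal.subset_span (by simp))
    have h2 := hcon (derivative S) (Ideal.subset_span (by simp))
    rw [hS, evalEval_Sl] at h0
    rw [hS, evalEval_pX_Sl] at h1
    rw [hS, evalEval_derivative_Sl] at h2
    exact affine_smooth g H.r3 hsa a b c hind s t h0 h1 h2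
  set Q := C (C α⁻¹) * S with hQ
  have hcQ : ∀ i j, (Q.coeff j).coeff i = α⁻¹ * (S.coeff j).coeff i := by
    intro i j; rw [hQ, Polynomial.coeff_C_mul, Polynomial.coeff_C_mul]
  have htQ : TD d Q := fun i j h => by rw [hcQ, hTD i j h, mul_zero]
  have hQd : Q.coeff d = 1 := by
    ext i
    rw [hcQ, Polynomial.coeff_one]
    split_ifs with hi
    · subst hi; exact inv_mul_cancel₀ hα0
    · rw [hTD i d (by omega), mul_zero]
  have hdeg : Q.natDegree ≤ d := by
    rw [Polynomial.natDegree_le_iff_coeff_eq_zero]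
    intro j hj
    ext i
    rw [htQ i j (by omega)]; simp
  have hnd : Q.natDegree = d := le_antisymm hdeg (Polynomial.le_natDegree_of_ne_zero (by rw [hQd]; exact one_ne_zero))
  have hmon : Q.Monic := by unfold Polynomial.Monic Polynomial.leadingCoeff; rw [hnd, hQd]
  have htopQ : top d Q = C α⁻¹ * top d S := by
    ext j
    rw [coeff_top, Polynomial.coeff_C_mul (p := top d S), coeff_top]
    split_ifs
    · exact hcQ _ _
    · simp
  have hunit : (C (C α) : K[X][Y]) * C (C α⁻¹) = 1 := by
    rw [← C_mul, ← C_mul, mul_inv_cancel₀ hα0]; simp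
  have hpQ : pX Q = C (C α⁻¹) * pX S := by
    ext j i
    rw [coeff_pX, hcQ, Polynomial.coeff_C_mul, Polynomial.coeff_C_mul, coeff_pX, mul_assoc]
  have hdQ : derivative Q = C (C α⁻¹) * derivative S := by
    rw [hQ, Polynomial.derivative_C_mul]
  have hG : Good d Q := by
    refine ⟨hmon, hnd, htQ, ?_, ?_⟩
    · rw [htopQ]
      exact Polynomial.Separable.unit_mul (Polynomial.isUnit_C.2 (inv_ne_zero hα0).isUnit) hsep
    · have h1 : (1 : K[X][Y]) ∈ Ideal.span {S, pX S, derivative S} := by rw [hsm]; trivial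
      rw [Ideal.mem_span_insert] at h1
      obtain ⟨u, z, hz, h1⟩ := h1
      obtain ⟨v, w, hvw⟩ := Ideal.mem_span_pair.1 hz
      refine ⟨u * C (C α), v * C (C α), w * C (C α), ?_⟩
      rw [hpQ, hdQ, h1, ← hvw, hQ]
      linear_combination (u * S + v * pX S + w * derivative S) * hunit
  obtain ⟨e', he'⟩ := exists_minor (by omega) hG
  refine ⟨e', ?_⟩
  have hcf : cf Q = fun i j => α⁻¹ * cf S i j := by ext i j; exact hcQ i j
  rw [hcf, cmat_smul, Matrix.submatrix_smul, Pi.smul_apply, Pi.smul_apply, Matrix.det_smul] at he'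
  exact right_ne_zero_of_mul he'

end generic
end NTW


namespace NTW

section spec

variable {F : Type*} [Field F] {r : ℕ}

open Polynomial Polynomial.Bivariate in
/-- all coefficients have total degree at most `n` -/
def Wd {σ : Type*} (n : ℕ) (P : (MvPolynomial σ F)[X][Y]) : Prop :=
  ∀ i j, ((P.coeff j).coeff i).totalDegree ≤ n

open Polynomial Polynomial.Bivariate

variable {σ : Type*}

theorem Wd.mono {n m : ℕ} {P : (MvPolynomial σ F)[X][Y]} (h : Wd n P) (hm : n ≤ m) : Wd m P :=
  fun i j => (h i j).trans hm

theorem Wd.mul {n m : ℕ} {P Q : (MvPolynomial σ F)[X][Y]} (hP : Wd n P) (hQ : Wd m Q) : Wd (n + m) (P * Q) := by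
  intro i j
  rw [Polynomial.coeff_mul, Polynomial.finset_sum_coeff]
  refine MvPolynomial.totalDegree_finsetSum_le fun x _ => ?_
  rw [Polynomial.coeff_mul]
  refine MvPolynomial.totalDegree_finsetSum_le fun y _ => ?_
  exact (MvPolynomial.totalDegree_mul _ _).trans (add_le_add (hP _ _) (hQ _ _))

theorem Wd.sub {n : ℕ} {P Q : (MvPolynomial σ F)[X][Y]} (hP : Wd n P) (hQ : Wd n Q) : Wd n (P - Q) := by
  intro i j
  rw [Polynomial.coeff_sub, Polynomial.coeff_sub]
  exact (MvPolynomial.totalDegree_sub _ _).trans (max_le (hP _ _) (hQ _ _))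

theorem Wd_sum {ι : Type*} (s : Finset ι) {n : ℕ} (P : ι → (MvPolynomial σ F)[X][Y]) (hP : ∀ i ∈ s, Wd n (P i)) : Wd n (∑ i ∈ s, P i) := by
  intro i j
  rw [Polynomial.finset_sum_coeff, Polynomial.finset_sum_coeff]
  exact MvPolynomial.totalDegree_finsetSum_le fun x hx => hP x hx i j

theorem Wd_C (x : F) : Wd (σ := σ) 0 (algebraMap F (MvPolynomial σ F)[X][Y] x) := by
  intro i j
  rw [Polynomial.algebraMap_apply, Polynomial.algebraMap_apply, Polynomial.coeff_C]
  split_ifs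
  · rw [Polynomial.coeff_C]
    split_ifs
    · rw [MvPolynomial.algebraMap_eq, MvPolynomial.totalDegree_C]
    · simp
  · simp

theorem Wd_one : Wd (F := F) (σ := σ) 0 1 := by
  have := Wd_C (F := F) (σ := σ) 1
  rwa [map_one] at this

theorem Wd_prod {ι : Type*} (s : Finset ι) (P : ι → (MvPolynomial σ F)[X][Y]) (hP : ∀ i ∈ s, Wd 1 (P i)) : Wd s.card (∏ i ∈ s, P i) := by
  classical
  induction s using Finset.induction_on with
  | empty => simpa using Wd_one
  | insert a s ha ih =>
    rw [Finset.prod_insert ha, Finset.card_insert_of_notMem ha, add_comm]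
    exact (hP _ (by simp)).mul (ih fun i hi => hP i (by simp [hi]))

theorem Wd_pow (P : (MvPolynomial σ F)[X][Y]) (hP : Wd 1 P) (n : ℕ) : Wd n (P ^ n) := by
  induction n with
  | zero => simpa using Wd_one
  | succ n ih => rw [pow_succ]; exact ih.mul hP

theorem Wd_aeval (P : (MvPolynomial σ F)[X][Y]) (hP : Wd 1 P) (h : F[X]) : Wd h.natDegree (aeval P h) := by
  rw [Polynomial.aeval_eq_sum_range]
  refine Wd_sum _ _ fun i hi => ?_
  rw [Algebra.smul_def]
  refine ((Wd_C _).mul (Wd_pow P hP i)).mono ?_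
  simp at hi
  omega

theorem Wd_lin (a b c : MvPolynomial σ F) (ha : a.totalDegree ≤ 1) (hb : b.totalDegree ≤ 1) (hc : c.totalDegree ≤ 1) : Wd 1 (lin a b c) := by
  intro i j
  have hl : lin a b c = C (C a + C b * X) + C (C c) * X := rfl
  rw [hl, Polynomial.coeff_add, Polynomial.coeff_add]
  refine (MvPolynomial.totalDegree_add _ _).trans (max_le ?_ ?_)
  · rw [Polynomial.coeff_C]
    split_ifs
    · rw [Polynomial.coeff_add]
      refine (MvPolynomial.totalDegree_add _ _).trans (max_le ?_ ?_)
      · rw [Polynomial.coeff_C]; split_ifs <;> simp [ha]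
      · rw [Polynomial.coeff_C_mul, Polynomial.coeff_X]; split_ifs <;> simp [hb]
    · simp
  · rw [Polynomial.coeff_C_mul, Polynomial.coeff_X]
    split_ifs
    · rw [mul_one, Polynomial.coeff_C]; split_ifs <;> simp [hc]
    · simp

theorem Wd_Sl (k : ℕ) (g : Fin r → F[X]) (hk : ∀ i, (g i).natDegree = k) (a b c : Fin r → MvPolynomial σ F)
    (ha : ∀ j, (a j).totalDegree ≤ 1) (hb : ∀ j, (b j).totalDegree ≤ 1) (hc : ∀ j, (c j).totalDegree ≤ 1) :
    Wd (max k r) (Sl g a b c) := by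
  unfold Sl QQ
  refine Wd.sub ?_ (Wd_sum _ _ fun j _ => ?_)
  · rw [map_one, one_mul]
    have := Wd_prod Finset.univ (fun j => lin (a j) (b j) (c j)) fun j _ => Wd_lin _ _ _ (ha j) (hb j) (hc j)
    rw [Finset.card_univ, Fintype.card_fin] at this
    exact this.mono (le_max_right _ _)
  · have := Wd_aeval _ (Wd_lin _ _ _ (ha j) (hb j) (hc j)) (g j)
    rw [hk] at this
    exact this.mono (le_max_left _ _)

/-- index type of the variables -/
abbrev V3 (r : ℕ) := Fin r ⊕ (Fin r ⊕ Fin r)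

/-- linear forms in a group of variables -/
noncomputable def lf (M : Matrix (Fin r) (Fin r) F) (ι : Fin r → V3 r) (j : Fin r) : MvPolynomial (V3 r) F :=
  ∑ i, MvPolynomial.C (M j i) * MvPolynomial.X (ι i)

theorem lf_deg (M : Matrix (Fin r) (Fin r) F) (ι : Fin r → V3 r) (j : Fin r) : (lf M ι j).totalDegree ≤ 1 := by
  refine MvPolynomial.totalDegree_finsetSum_le fun i _ => ?_
  refine (MvPolynomial.totalDegree_mul _ _).trans ?_
  rw [MvPolynomial.totalDegree_C, MvPolynomial.totalDegree_X]

theorem lf_inv (M : Matrix (Fin r) (Fin r) F) (hM : IsUnit M.det) (ι : Fin r → V3 r) (j : Fin r) :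
    ∑ i, MvPolynomial.C (M⁻¹ j i) * lf M ι i = MvPolynomial.X (ι j) := by
  have h1 : M⁻¹ * M = 1 := Matrix.nonsing_inv_mul M hM
  simp only [lf, Finset.mul_sum]
  rw [Finset.sum_comm]
  simp only [← mul_assoc, ← MvPolynomial.C_mul, ← Finset.sum_mul, ← map_sum]
  have h2 : ∀ l, ∑ i, M⁻¹ j i * M i l = (1 : Matrix (Fin r) (Fin r) F) j l := by
    intro l; rw [← h1, Matrix.mul_apply]
  simp only [h2, Matrix.one_apply]
  simp

noncomputable def lfa (M : Matrix (Fin r) (Fin r) F) : V3 r → MvPolynomial (V3 r) F :=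
  Sum.elim (lf M Sum.inl) (Sum.elim (lf M (fun i => Sum.inr (Sum.inl i))) (lf M (fun i => Sum.inr (Sum.inr i))))

theorem lfa_comp (M : Matrix (Fin r) (Fin r) F) (hM : IsUnit M.det) :
    (MvPolynomial.aeval (lfa M)).comp (MvPolynomial.aeval (lfa M⁻¹)) = AlgHom.id F (MvPolynomial (V3 r) F) := by
  set φ : MvPolynomial (V3 r) F →ₐ[F] MvPolynomial (V3 r) F := MvPolynomial.aeval (lfa M) with hφ
  apply MvPolynomial.algHom_ext
  intro i
  have hX : ∀ i, φ (MvPolynomial.X i) = lfa M i := fun i => MvPolynomial.aeval_X _ _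
  have hC : ∀ x, φ (MvPolynomial.C x) = MvPolynomial.C x := fun x => MvPolynomial.aeval_C _ _
  rw [AlgHom.comp_apply, MvPolynomial.aeval_X, AlgHom.id_apply]
  rcases i with i | i | i <;> simp only [lfa, Sum.elim_inl, Sum.elim_inr] <;>
    rw [lf, map_sum] <;> simp only [map_mul, hX, hC] <;> simp only [lfa, Sum.elim_inl, Sum.elim_inr] <;> exact lf_inv M hM _ _

theorem lfa_indep (M : Matrix (Fin r) (Fin r) F) (hM : IsUnit M.det) : AlgebraicIndependent F (lfa M) := by
  rw [algebraicIndependent_iff_injective_aeval]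
  have h := lfa_comp M⁻¹ (Matrix.isUnit_nonsing_inv_det M hM)
  rw [Matrix.nonsing_inv_nonsing_inv M hM] at h
  refine Function.LeftInverse.injective (g := MvPolynomial.aeval (lfa M⁻¹)) fun x => ?_
  rw [← AlgHom.comp_apply, h, AlgHom.id_apply]

theorem eval_lf (M : Matrix (Fin r) (Fin r) F) (ι : Fin r → V3 r) (j : Fin r) (z : V3 r → F) :
    MvPolynomial.aeval z (lf M ι j) = M.mulVec (fun i => z (ι i)) j := by
  simp [lf, Matrix.mulVec, dotProduct]

/-- the slice attached to a point of the parameter space -/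
noncomputable def Slz (g : Fin r → F[X]) (M : Matrix (Fin r) (Fin r) F) (z : V3 r → F) : F[X][Y] :=
  Sl g (M.mulVec fun i => z (Sum.inl i)) (M.mulVec fun i => z (Sum.inr (Sum.inl i))) (M.mulVec fun i => z (Sum.inr (Sum.inr i)))

theorem spec (k : ℕ) (g : Fin r → F[X]) (H : Hyp k g) (M : Matrix (Fin r) (Fin r) F) (hM : IsUnit M.det) :
    ∃ (Δ τ : MvPolynomial (V3 r) F) (e : Mon (3 * max k r - 4) → Cols (max k r)), Δ ≠ 0 ∧ τ ≠ 0 ∧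
      Δ.totalDegree ≤ max k r * (Fintype.card (Mon (3 * max k r - 4)) + 1) ∧ τ.totalDegree ≤ max k r ∧
      (∀ z, MvPolynomial.eval z τ = ((Slz g M z).coeff (max k r)).coeff 0) ∧
      (∀ z, MvPolynomial.eval z Δ = ((Slz g M z).coeff (max k r)).coeff 0 * ((cmat (max k r) (cf (Slz g M z))).submatrix id e).det) := by
  classical
  set d := max k r with hd
  set A := lf M Sum.inl with hA
  set B := lf M (fun i => Sum.inr (Sum.inl i)) with hB
  set D := lf M (fun i => Sum.inr (Sum.inr i)) with hD
  set S := Sl g A B D with hS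
  set c : ℕ → ℕ → MvPolynomial (V3 r) F := fun i j => (S.coeff j).coeff i with hc
  have hW : Wd d S := Wd_Sl k g H.deg A B D (lf_deg M _) (lf_deg M _) (lf_deg M _)
  set K := AlgebraicClosure (FractionRing (MvPolynomial (V3 r) F)) with hK
  set φ : MvPolynomial (V3 r) F →ₐ[F] K := IsScalarTower.toAlgHom F (MvPolynomial (V3 r) F) K with hφ
  have hinj : Function.Injective φ := by
    change Function.Injective (algebraMap (MvPolynomial (V3 r) F) K)
    rw [IsScalarTower.algebraMap_eq (MvPolynomial (V3 r) F) (FractionRing (MvPolynomial (V3 r) F)) K]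
    exact (algebraMap (FractionRing (MvPolynomial (V3 r) F)) K).injective.comp (IsFractionRing.injective _ _)
  have hind := (lfa_indep M hM).map' hinj
  have hind' : AlgebraicIndependent F (Sum.elim (fun j => φ (A j)) (Sum.elim (fun j => φ (B j)) (fun j => φ (D j)))) := by
    convert hind using 1
    ext i
    rcases i with i | i | i <;> rfl
  obtain ⟨h0, e, he⟩ := good_generic k g H _ _ _ hind'
  rw [← mapXY_Sl φ, coeff_mapXY] at h0
  have hτ : (S.coeff d).coeff 0 ≠ 0 := fun h => h0 (by rw [← hS, ← hd, h, map_zero])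
  have hdet : ((cmat d c).submatrix id e).det ≠ 0 := by
    intro h
    apply he
    have : cf (Sl g (fun j => φ (A j)) (fun j => φ (B j)) (fun j => φ (D j))) = fun i j => φ (c i j) := by
      ext i j
      rw [← mapXY_Sl φ]
      exact coeff_mapXY φ _ i j
    rw [this]
    change ((cmat d fun i j => φ (c i j)).submatrix id e).det = 0
    have h2 := cmat_map (φ : MvPolynomial (V3 r) F →+* K) d c
    simp only [RingHom.coe_coe] at h2
    rw [← h2, Matrix.submatrix_map]
    have h3 := (φ : MvPolynomial (V3 r) F →+* K).map_det ((cmat d c).submatrix id e)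
    rw [h, map_zero] at h3
    exact h3.symm
  have hz : ∀ z : V3 r → F, ∀ i j, MvPolynomial.eval z (c i j) = cf (Slz g M z) i j := by
    intro z i j
    have h1 := coeff_mapXY (MvPolynomial.aeval z : MvPolynomial (V3 r) F →ₐ[F] F) S i j
    rw [hS, mapXY_Sl] at h1
    simp only [hA, hB, hD, eval_lf] at h1
    exact h1.symm
  refine ⟨(S.coeff d).coeff 0 * ((cmat d c).submatrix id e).det, (S.coeff d).coeff 0, e, mul_ne_zero hτ hdet, hτ, ?_, hW _ _, fun z => hz z 0 d, fun z => ?_⟩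
  · refine (MvPolynomial.totalDegree_mul _ _).trans ?_
    have h1 := hW 0 d
    have h2 := totalDegree_minor c (fun i j => hW i j) e
    nlinarith
  · rw [map_mul, RingHom.map_det]
    have h2 := cmat_map (MvPolynomial.eval z) d c
    simp only [hz] at h2
    have h3 : (MvPolynomial.eval z).mapMatrix ((cmat d c).submatrix id e) = (cmat d (cf (Slz g M z))).submatrix id e := by
      rw [show cf (Slz g M z) = fun i j => cf (Slz g M z) i j from rfl, ← h2]
      rfl
    rw [h3, show (S.coeff d).coeff 0 = c 0 d from rfl, hz]
    rfl

open Finset in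
theorem schwartz_zippel' {σ : Type*} [Fintype σ] {k : Type*} [Field k] [Fintype k] [Algebra k F] (p : MvPolynomial σ F) (hp : p ≠ 0) :
    Nat.card {z : σ → k // MvPolynomial.eval (fun i => algebraMap k F (z i)) p = 0} * Fintype.card k ≤ p.totalDegree * Fintype.card k ^ Fintype.card σ := by
  classical
  set n := Fintype.card σ with hn
  let u : σ ≃ Fin n := Fintype.equivFin σ
  set P := MvPolynomial.rename u p with hP
  have hP0 : P ≠ 0 := fun h => hp (MvPolynomial.rename_injective u u.injective (by rw [map_zero]; exact h))
  let S : Finset F := univ.map ⟨algebraMap k F, (algebraMap k F).injective⟩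
  have hS : #S = Fintype.card k := by simp [S]
  have h1 := MvPolynomial.schwartz_zippel_totalDegree hP0 S
  rw [hS] at h1
  have hq : (0 : ℚ≥0) < Fintype.card k := by exact_mod_cast Fintype.card_pos
  rw [div_le_div_iff₀ (by positivity) hq] at h1
  have h2 : #{f ∈ Fintype.piFinset fun _ ↦ S | MvPolynomial.eval f P = 0} * Fintype.card k ≤ P.totalDegree * Fintype.card k ^ n := by
    exact_mod_cast h1
  refine (Nat.mul_le_mul_right _ ?_).trans (h2.trans (Nat.mul_le_mul_right _ (MvPolynomial.totalDegree_rename_le _ _)))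
  rw [Nat.card_eq_fintype_card, Fintype.card_subtype]
  refine Finset.card_le_card_of_injOn (fun z i => algebraMap k F (z (u.symm i))) ?_ ?_
  · intro z hz
    simp only [Finset.coe_filter, Finset.mem_univ, true_and, Set.mem_setOf_eq] at hz
    simp only [Finset.coe_filter, Set.mem_setOf_eq, Fintype.mem_piFinset]
    refine ⟨fun i => by simp [S], ?_⟩
    rw [hP, MvPolynomial.eval_rename]
    convert hz using 3
    funext i
    simp
  · intro z _ w _ h
    ext i
    have := congrFun h (u i)
    simpa using this

end spec
end NTW


namespace NTW

open Polynomial Polynomial.Bivariate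

section frob

variable (k : Type*) [Field k] [Fintype k] {F : Type*} [Field F] [Algebra k F]

/-- the relative Frobenius -/
noncomputable def fr (F : Type*) [Field F] [Algebra k F] : F →+* F := (FiniteField.frobeniusAlgHom k F : F →+* F)

theorem fr_apply (x : F) : fr k F x = x ^ Fintype.card k := rfl

theorem fr_pow (j : ℕ) (x : F) : (fr k F ^ j) x = x ^ Fintype.card k ^ j := by
  induction j with
  | zero => simp
  | succ j ih => rw [pow_succ', RingHom.mul_def, RingHom.comp_apply, ih, fr_apply, ← pow_mul, pow_succ]

/-- the conjugates of the polynomial `f` -/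
noncomputable def gg (r : ℕ) (f : F[X]) (j : Fin r) : F[X] := f.map (fr k F ^ (j : ℕ))

/-- the norm-trace form -/
def HH (r : ℕ) (f : F[X]) (x : F) : F := ∏ j : Fin r, x ^ Fintype.card k ^ (j : ℕ) - ∑ j : Fin r, (f.eval x) ^ Fintype.card k ^ (j : ℕ)

noncomputable def slice (r : ℕ) (f : F[X]) (a b c : F) : F[X][Y] :=
  Sl (gg k r f) (fun j => (fr k F ^ (j : ℕ)) a) (fun j => (fr k F ^ (j : ℕ)) b) (fun j => (fr k F ^ (j : ℕ)) c)

theorem evalEval_slice (r : ℕ) (f : F[X]) (a b c : F) (s t : k) :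
    evalEval (algebraMap k F s) (algebraMap k F t) (slice k r f a b c) = HH k r f (a + b * algebraMap k F s + c * algebraMap k F t) := by
  have hk : ∀ (j : ℕ) (s : k), (fr k F ^ j) (algebraMap k F s) = algebraMap k F s := by
    intro j s
    rw [fr_pow, ← map_pow, FiniteField.pow_card_pow]
  have hx : ∀ j : ℕ, (fr k F ^ j) a + (fr k F ^ j) b * algebraMap k F s + (fr k F ^ j) c * algebraMap k F t
      = (fr k F ^ j) (a + b * algebraMap k F s + c * algebraMap k F t) := by
    intro j
    rw [map_add, map_add, map_mul, map_mul, hk, hk]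
  rw [slice, evalEval_Sl]
  simp only [hx, QQ, map_one, one_mul, HH, gg]
  congr 1
  · exact Finset.prod_congr rfl fun j _ => fr_pow k _ _
  · refine Finset.sum_congr rfl fun j _ => ?_
    rw [Polynomial.coe_aeval_eq_eval, Polynomial.eval_map_apply, fr_pow]

variable [Fintype F] {r : ℕ} (hF : Fintype.card F = Fintype.card k ^ r)

include hF in
theorem fr_r : fr k F ^ r = 1 := by
  ext x
  rw [fr_pow, ← hF, FiniteField.pow_card]
  rfl

theorem sum_shift {A : Type*} [AddCommGroup A] (r : ℕ) (G : ℕ → A) (h : G r = G 0) : ∑ j : Fin r, G (j + 1) = ∑ j : Fin r, G j := by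
  rw [Fin.sum_univ_eq_sum_range (fun j => G (j + 1)), Fin.sum_univ_eq_sum_range G]
  have h1 := Finset.sum_range_succ G r
  rw [Finset.sum_range_succ', h] at h1
  exact add_right_cancel h1

theorem prod_shift {A : Type*} [CommMonoid A] (r : ℕ) (G : ℕ → A) (h : G r = G 0) : ∏ j : Fin r, G (j + 1) = ∏ j : Fin r, G j := by
  rw [Fin.prod_univ_eq_prod_range (fun j => G (j + 1)), Fin.prod_univ_eq_prod_range G]
  cases r with
  | zero => simp
  | succ n => rw [Finset.prod_range_succ, Finset.prod_range_succ', h]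

include hF in
theorem slice_fixed (f : F[X]) (a b c : F) : (slice k r f a b c).map (Polynomial.mapRingHom (fr k F)) = slice k r f a b c := by
  set Φ : F[X][Y] →+* F[X][Y] := Polynomial.mapRingHom (Polynomial.mapRingHom (fr k F)) with hΦ
  change Φ (slice k r f a b c) = _
  have hl : ∀ j : ℕ, Φ (lin ((fr k F ^ j) a) ((fr k F ^ j) b) ((fr k F ^ j) c)) = lin ((fr k F ^ (j+1)) a) ((fr k F ^ (j+1)) b) ((fr k F ^ (j+1)) c) := by
    intro j
    simp [hΦ, lin, pow_succ', RingHom.mul_def]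
  have hC : Φ.comp (algebraMap F F[X][Y]) = (algebraMap F F[X][Y]).comp (fr k F) := by
    ext x
    simp only [RingHom.comp_apply, Polynomial.algebraMap_apply, Algebra.algebraMap_self, RingHom.id_apply]
    simp [hΦ]
  have ha : ∀ (v : F[X][Y]) (h : F[X]), Φ (aeval v h) = aeval (Φ v) (h.map (fr k F)) := by
    intro v h
    rw [Polynomial.aeval_def, Polynomial.hom_eval₂, hC, Polynomial.aeval_def, Polynomial.eval₂_map]
  have hr := fr_r k hF
  simp only [slice, Sl, QQ, map_sub, map_one, one_mul, map_prod, map_sum, ha, hl, gg, Polynomial.map_map]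
  refine congrArg₂ (fun x y => x - y) ?_ ?_
  · exact prod_shift r (fun j => lin ((fr k F ^ j) a) ((fr k F ^ j) b) ((fr k F ^ j) c)) (by simp only [hr, pow_zero])
  · have := sum_shift r (fun j => aeval (lin ((fr k F ^ j) a) ((fr k F ^ j) b) ((fr k F ^ j) c)) (f.map (fr k F ^ j))) (by simp only [hr, pow_zero])
    rw [← this]
    refine Finset.sum_congr rfl fun j _ => ?_
    rw [pow_succ', RingHom.mul_def]

include hF in
theorem slice_descent (f : F[X]) (a b c : F) : ∃ P : k[X][Y], ∀ i j, algebraMap k F ((P.coeff j).coeff i) = ((slice k r f a b c).coeff j).coeff i := by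
  have h := slice_fixed k hF f a b c
  set S := slice k r f a b c with hS
  have h1 : ∀ i j, ∃ x : k, algebraMap k F x = (S.coeff j).coeff i := by
    intro i j
    rw [← pow_card_eq_iff]
    conv_rhs => rw [← h]
    rw [Polynomial.coeff_map, Polynomial.coe_mapRingHom, Polynomial.coeff_map, fr_apply]
  have h2 : S ∈ Polynomial.lifts (Polynomial.mapRingHom (algebraMap k F)) := by
    rw [Polynomial.lifts_iff_coeff_lifts]
    intro j
    have : S.coeff j ∈ Polynomial.lifts (algebraMap k F) := by
      rw [Polynomial.lifts_iff_coeff_lifts]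
      intro i
      exact h1 i j
    exact (Polynomial.mem_lifts _).1 this
  obtain ⟨P, hP⟩ := (Polynomial.mem_lifts _).1 h2
  refine ⟨P, fun i j => ?_⟩
  rw [← hP, Polynomial.coeff_map, Polynomial.coe_mapRingHom, Polynomial.coeff_map]

theorem evalEval_algebraMap (P : k[X][Y]) (S : F[X][Y]) (h : ∀ i j, algebraMap k F ((P.coeff j).coeff i) = (S.coeff j).coeff i) (s t : k) :
    evalEval (algebraMap k F s) (algebraMap k F t) S = algebraMap k F (evalEval s t P) := by
  have : S = P.map (Polynomial.mapRingHom (algebraMap k F)) := by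
    ext j i
    rw [← h, Polynomial.coeff_map, Polynomial.coe_mapRingHom, Polynomial.coeff_map]
  rw [this, Polynomial.map_mapRingHom_evalEval]

/-- number of points of a slice -/
noncomputable def cnt (r : ℕ) (f : F[X]) (a b c : F) : ℕ :=
  Nat.card {z : k × k // HH k r f (a + b * algebraMap k F z.1 + c * algebraMap k F z.2) = 0}

include hF in
theorem cnt_bounds (n : ℕ) (f : F[X]) (hn : f.natDegree = n) (hr : 3 ≤ r) (a b c : F)
    (h0 : ((slice k r f a b c).coeff (max n r)).coeff 0 ≠ 0) :
    cnt k r f a b c ≤ max n r * Fintype.card k ∧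
    ∀ e, ((cmat (max n r) (cf (slice k r f a b c))).submatrix id e).det ≠ 0 →
      |(cnt k r f a b c : ℝ) - Fintype.card k| ≤ (((max n r : ℕ):ℝ) - 1) * ((max n r : ℕ) - 2) * √(Fintype.card k : ℝ) + (max n r : ℕ) := by
  classical
  set d := max n r with hd
  have hd3 : 3 ≤ d := hr.trans (le_max_right _ _)
  obtain ⟨P, hP⟩ := slice_descent k hF f a b c
  set S := slice k r f a b c with hS
  have hTDS : TD d S := by
    refine (TD_top_Sl n (gg k r f) (fun j => ?_) _ _ _).1
    rw [gg, Polynomial.natDegree_map, hn]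
  have hinj := (algebraMap k F).injective
  have hTD : TD d P := fun i j h => hinj (by rw [hP, hTDS i j h, map_zero])
  set α := (P.coeff d).coeff 0 with hα
  have hα0 : α ≠ 0 := fun h => h0 (by rw [← hP, ← hα, h, map_zero])
  have hcnt : cnt k r f a b c = Nat.card {z : k × k // P.evalEval z.1 z.2 = 0} := by
    refine Nat.card_congr (Equiv.subtypeEquivRight fun z => ?_)
    rw [← evalEval_slice, evalEval_algebraMap k P _ hP, map_eq_zero]
  constructor
  · rw [hcnt, Nat.card_eq_fintype_card, Fintype.card_subtype]
    have hfib : ∀ s : k, (Finset.univ.filter fun t : k => P.evalEval s t = 0).card ≤ d := by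
      intro s
      set Q : k[X] := P.map (evalRingHom s) with hQ
      have hc : Q.coeff d = α := by
        rw [hQ, Polynomial.coeff_map, Polynomial.coe_evalRingHom]
        have : P.coeff d = C α := by
          ext i
          rw [Polynomial.coeff_C]
          split_ifs with hi
          · rw [hi]
          · exact hTD i d (by omega)
        rw [this, Polynomial.eval_C]
      have hQ0 : Q ≠ 0 := fun h => hα0 (by rw [← hc, h, Polynomial.coeff_zero])
      have hQd : Q.natDegree ≤ d := by
        rw [Polynomial.natDegree_le_iff_coeff_eq_zero]
        intro j hj
        have : P.coeff j = 0 := by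
          ext i
          rw [hTD i j (by omega)]; simp
        rw [hQ, Polynomial.coeff_map, this, map_zero]
      refine le_trans ?_ ((Polynomial.card_roots' Q).trans hQd)
      refine le_trans (Finset.card_le_card ?_) (Multiset.toFinset_card_le _)
      intro t ht
      simp only [Finset.mem_filter, Finset.mem_univ, true_and] at ht
      rw [Multiset.mem_toFinset, Polynomial.mem_roots hQ0, Polynomial.IsRoot.def, hQ, Polynomial.eval_map]
      rw [← ht]
      rw [Polynomial.eval₂_evalRingHom]
    have := Finset.card_eq_sum_card_fiberwise (s := Finset.univ.filter fun z : k × k => P.evalEval z.1 z.2 = 0) (t := Finset.univ) (f := Prod.fst) (by simp)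
    rw [this]
    calc _ ≤ ∑ s : k, d := Finset.sum_le_sum fun s _ => by
            refine le_trans ?_ (hfib s)
            refine Finset.card_le_card_of_injOn Prod.snd ?_ ?_
            · rintro ⟨s', t⟩ h
              simp at h ⊢
              rw [← h.2]; exact h.1
            · rintro ⟨s', t⟩ h ⟨s'', t'⟩ h' heq
              simp at h h' heq ⊢
              exact ⟨h.2.trans h'.2.symm, heq⟩
      _ = d * Fintype.card k := by simp [mul_comm]
  · intro e he
    have hdet : ((cmat d (cf P)).submatrix id e).det ≠ 0 := by
      intro h
      apply he
      have h1 : cf S = fun i j => algebraMap k F (cf P i j) := by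
        ext i j; exact (hP i j).symm
      have h2 := cmat_map (algebraMap k F) d (cf P)
      rw [h1, ← h2, Matrix.submatrix_map]
      have h3 := (algebraMap k F).map_det ((cmat d (cf P)).submatrix id e)
      rw [h, map_zero] at h3
      exact h3.symm
    have hG := good_of_minor (by omega) hTD hα0 e hdet
    have hw := weil_good hd3 hG
    rw [Npt_one] at hw
    have : Nat.card {z : k × k // evalEval z.1 z.2 (C (C ((P.coeff d).coeff 0)⁻¹) * P) = 0} = cnt k r f a b c := by
      rw [hcnt]
      refine Nat.card_congr (Equiv.subtypeEquivRight fun z => ?_)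
      rw [Polynomial.evalEval_mul, mul_eq_zero]
      simp [Polynomial.evalEval_C, ← hα, hα0]
    rw [this] at hw
    exact hw

end frob
end NTW


namespace NTW

open Polynomial Polynomial.Bivariate

section assemble

variable (k : Type*) [Field k] [Fintype k] {F : Type*} [Field F] [Fintype F] [Algebra k F] {r : ℕ}

/-- the Moore matrix of a basis -/
noncomputable def moore (e : Fin r → F) : Matrix (Fin r) (Fin r) F := fun j i => (fr k F ^ (j : ℕ)) (e i)

theorem moore_unit (hF : Fintype.card F = Fintype.card k ^ r) (e : Module.Basis (Fin r) k F) : IsUnit (moore k e).det := by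
  classical
  rw [isUnit_iff_ne_zero]
  intro hdet
  obtain ⟨μ, hμ, h⟩ := Matrix.exists_vecMul_eq_zero_iff.2 hdet
  apply hμ
  have hfrl : ∀ (j : ℕ) (s : k) (x : F), (fr k F ^ j) (s • x) = s • (fr k F ^ j) x := by
    intro j s x
    rw [Algebra.smul_def, map_mul, Algebra.smul_def, fr_pow, ← map_pow, FiniteField.pow_card_pow]
  have h1 : ∀ x : F, ∑ j : Fin r, μ j * (fr k F ^ (j : ℕ)) x = 0 := by
    intro x
    rw [← e.sum_repr x]
    simp only [map_sum, hfrl, Finset.mul_sum]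
    rw [Finset.sum_comm]
    refine Finset.sum_eq_zero fun i _ => ?_
    have h2 := congrFun h i
    simp only [Matrix.vecMul, dotProduct, moore, Pi.zero_apply] at h2
    simp only [mul_smul_comm]
    rw [← Finset.smul_sum, h2, smul_zero]
  set p : F[X] := ∑ j : Fin r, C (μ j) * X ^ Fintype.card k ^ (j : ℕ) with hp
  have hq : 1 < Fintype.card k := Fintype.one_lt_card
  have hp0 : p = 0 := by
    refine Polynomial.eq_zero_of_natDegree_lt_card_of_eval_eq_zero' p Finset.univ (fun x _ => ?_) ?_
    · rw [hp, Polynomial.eval_finset_sum, ← h1 x]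
      refine Finset.sum_congr rfl fun j _ => ?_
      rw [fr_pow]; simp
    · rw [Finset.card_univ, hF]
      refine lt_of_le_of_lt (Polynomial.natDegree_sum_le_of_forall_le (n := Fintype.card k ^ r - 1) _ _ fun j _ => ?_) (Nat.sub_lt (by positivity) one_pos)
      refine (Polynomial.natDegree_C_mul_X_pow_le _ _).trans ?_
      exact Nat.le_sub_one_of_lt (Nat.pow_lt_pow_right hq j.2)
  funext l
  have h3 : p.coeff (Fintype.card k ^ (l : ℕ)) = μ l := by
    rw [hp, Polynomial.finset_sum_coeff, Finset.sum_eq_single l]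
    · simp
    · intro j _ hj
      rw [Polynomial.coeff_C_mul_X_pow, if_neg]
      intro h4
      exact hj (Fin.ext (Nat.pow_right_injective hq h4).symm)
    · simp
  rw [← h3, hp0]; simp

theorem moore_mulVec (e : Module.Basis (Fin r) k F) (z : Fin r → k) :
    (moore k e).mulVec (fun i => algebraMap k F (z i)) = fun j : Fin r => (fr k F ^ (j : ℕ)) (e.equivFun.symm z) := by
  funext j
  rw [Module.Basis.equivFun_symm_apply, map_sum]
  simp only [Matrix.mulVec, dotProduct, moore]
  refine Finset.sum_congr rfl fun i _ => ?_
  rw [Algebra.smul_def, map_mul, fr_pow k _ (algebraMap k F (z i)), ← map_pow (algebraMap k F), FiniteField.pow_card_pow, mul_comm]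

/-- parametrisation of triples -/
noncomputable def E3 (e : Module.Basis (Fin r) k F) : (V3 r → k) ≃ F × F × F :=
  (Equiv.sumArrowEquivProdArrow _ _ _).trans
    (Equiv.prodCongr e.equivFun.symm.toEquiv ((Equiv.sumArrowEquivProdArrow _ _ _).trans (Equiv.prodCongr e.equivFun.symm.toEquiv e.equivFun.symm.toEquiv)))

theorem Slz_slice (f : F[X]) (e : Module.Basis (Fin r) k F) (z : V3 r → k) :
    Slz (gg k r f) (moore k e) (fun i => algebraMap k F (z i)) = slice k r f (E3 k e z).1 (E3 k e z).2.1 (E3 k e z).2.2 := by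
  unfold Slz slice
  rw [moore_mulVec k e (fun i => z (Sum.inl i)), moore_mulVec k e (fun i => z (Sum.inr (Sum.inl i))), moore_mulVec k e (fun i => z (Sum.inr (Sum.inr i)))]
  rfl

theorem alpha_indep (n : ℕ) (f : F[X]) (hn : f.natDegree = n) (a a' b b' c : F) :
    ((slice k r f a b c).coeff (max n r)).coeff 0 = ((slice k r f a' b' c).coeff (max n r)).coeff 0 := by
  have key : ∀ a b : F, ((slice k r f a b c).coeff (max n r)).coeff 0 = QQ (tE F n r) (tH n (gg k r f)) (fun j => (fr k F ^ (j : ℕ)) c) := by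
    intro a b
    obtain ⟨_, htop⟩ := TD_top_Sl n (gg k r f) (fun j => by rw [gg, Polynomial.natDegree_map, hn]) (fun j : Fin r => (fr k F ^ (j : ℕ)) a) (fun j => (fr k F ^ (j : ℕ)) b) (fun j => (fr k F ^ (j : ℕ)) c)
    have h1 := coeff_top (slice k r f a b c) (max n r) (max n r)
    rw [if_pos le_rfl, Nat.sub_self, slice, htop, coeff_top_Sl] at h1
    exact h1.symm
  rw [key, key]

theorem exists_bc (hF : Fintype.card F = Fintype.card k ^ r) (n : ℕ) (f : F[X]) (hn : f.natDegree = n) (H : Hyp n (gg k r f)) 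
    (hqd : max n r < Fintype.card k) :
    ∃ (b c : F), (∀ a, ((slice k r f a b c).coeff (max n r)).coeff 0 ≠ 0) ∧ ∃ B : Finset F,
      (B.card * Fintype.card k ≤ max n r * (Fintype.card (Mon (3 * max n r - 4)) + 1) * Fintype.card k ^ r) ∧
      ∀ a ∉ B, ∃ e, ((cmat (max n r) (cf (slice k r f a b c))).submatrix id e).det ≠ 0 := by
  classical
  have hfr : Module.finrank k F = r := by
    have h1 := Module.card_eq_pow_finrank (K := k) (V := F)
    rw [hF] at h1
    exact (Nat.pow_right_injective (Fintype.one_lt_card (α := k)) h1).symm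
  let e : Module.Basis (Fin r) k F := Module.finBasisOfFinrankEq k F hfr
  set d := max n r with hd
  obtain ⟨Δ, τ, e', hΔ, hτ, hΔd, hτd, hτe, hΔe⟩ := spec n (gg k r f) H (moore k e) (moore_unit k hF e)
  set D := d * (Fintype.card (Mon (3 * d - 4)) + 1) with hD
  set q := Fintype.card k with hq
  have hq0 : 0 < q := Fintype.card_pos
  have hcV : Fintype.card (V3 r) = r + (r + r) := by simp
  by_cases hqD : q ≤ D
  · -- everything is bad
    have h1 := schwartz_zippel' (k := k) τ hτ
    have : ∃ z : V3 r → k, MvPolynomial.eval (fun i => algebraMap k F (z i)) τ ≠ 0 := by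
      by_contra hcon
      push Not at hcon
      have h2 : Nat.card {z : V3 r → k // MvPolynomial.eval (fun i => algebraMap k F (z i)) τ = 0} = q ^ (r + (r + r)) := by
        rw [Nat.card_congr (Equiv.subtypeUnivEquiv hcon), Nat.card_eq_fintype_card, Fintype.card_fun, hcV]
      rw [h2, hcV, mul_comm] at h1
      have := Nat.le_of_mul_le_mul_right h1 (by positivity)
      omega
    obtain ⟨z, hz⟩ := this
    rw [hτe, Slz_slice] at hz
    refine ⟨(E3 k e z).2.1, (E3 k e z).2.2, fun a => ?_, Finset.univ, ?_, ?_⟩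
    · rw [alpha_indep k n f hn a (E3 k e z).1 _ (E3 k e z).2.1]; exact hz
    · rw [Finset.card_univ, hF, mul_comm]
      exact Nat.mul_le_mul_right _ hqD
    · intro a ha; simp at ha
  · push Not at hqD
    have h1 := schwartz_zippel' (k := k) Δ hΔ
    let bad : F × F × F → Prop := fun w => ((slice k r f w.1 w.2.1 w.2.2).coeff d).coeff 0 * ((cmat d (cf (slice k r f w.1 w.2.1 w.2.2))).submatrix id e').det = 0
    have h2 : Nat.card {z : V3 r → k // MvPolynomial.eval (fun i => algebraMap k F (z i)) Δ = 0} = Nat.card {w // bad w} := by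
      refine Nat.card_congr (Equiv.subtypeEquiv (E3 k e) fun z => ?_)
      rw [hΔe, Slz_slice]
    rw [h2, hcV] at h1
    have h3 : Nat.card {w // bad w} = ∑ w : F × F, (Finset.univ.filter fun a => bad (a, w)).card := by
      rw [Nat.card_eq_fintype_card, Fintype.card_subtype, Finset.card_eq_sum_card_fiberwise (t := Finset.univ) (f := Prod.snd) (by simp)]
      refine Finset.sum_congr rfl fun w _ => ?_
      refine Finset.card_bij (fun x _ => x.1) ?_ ?_ ?_
      · rintro ⟨a, w'⟩ h
        simp only [Finset.mem_filter, Finset.mem_univ, true_and] at h ⊢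
        rw [← h.2]; exact h.1
      · rintro ⟨a, w'⟩ h ⟨a', w''⟩ h' heq
        simp only [Finset.mem_filter, Finset.mem_univ, true_and] at h h' heq
        rw [Prod.mk.injEq]; exact ⟨heq, h.2.trans h'.2.symm⟩
      · intro a ha
        exact ⟨(a, w), by simpa using ha, rfl⟩
    have h4 : ∃ w : F × F, (Finset.univ.filter fun a => bad (a, w)).card * q ≤ D * q ^ r := by
      by_contra hcon
      push Not at hcon
      have h5 : ∑ w : F × F, D * q ^ r < ∑ w : F × F, (Finset.univ.filter fun a => bad (a, w)).card * q :=
        Finset.sum_lt_sum_of_nonempty Finset.univ_nonempty fun w _ => hcon w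
      rw [Finset.sum_const, ← Finset.sum_mul, ← h3, Finset.card_univ, Fintype.card_prod, hF, smul_eq_mul] at h5
      have h6 := h1.trans (Nat.mul_le_mul_right _ hΔd)
      have h7 : q ^ r * q ^ r * (D * q ^ r) = D * q ^ (r + (r + r)) := by ring
      rw [h7] at h5
      exact absurd h6 (not_le.2 h5)
    obtain ⟨⟨b, c⟩, hbc⟩ := h4
    have h8 : ∃ a, ¬ bad (a, b, c) := by
      by_contra hcon
      push Not at hcon
      rw [Finset.filter_true_of_mem (fun a _ => hcon a), Finset.card_univ, hF, mul_comm] at hbc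
      have := Nat.le_of_mul_le_mul_right hbc (by positivity)
      omega
    obtain ⟨a0, ha0⟩ := h8
    refine ⟨b, c, fun a => ?_, Finset.univ.filter fun a => bad (a, b, c), hbc, fun a ha => ⟨e', ?_⟩⟩
    · rw [alpha_indep k n f hn a a0 b b]
      exact left_ne_zero_of_mul ha0
    · simp only [Finset.mem_filter, Finset.mem_univ, true_and] at ha
      exact right_ne_zero_of_mul ha

theorem sum_cnt (f : F[X]) (b c : F) :
    ∑ a : F, cnt k r f a b c = Fintype.card k ^ 2 * Nat.card {x : F // HH k r f x = 0} := by
  classical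
  have h1 : ∀ a, cnt k r f a b c = ∑ z : k × k, if HH k r f (a + b * algebraMap k F z.1 + c * algebraMap k F z.2) = 0 then 1 else 0 := by
    intro a
    rw [cnt, Nat.card_eq_fintype_card, Fintype.card_subtype, Finset.card_filter]
  simp only [h1]
  rw [Finset.sum_comm]
  have h2 : ∀ z : k × k, (∑ a : F, if HH k r f (a + b * algebraMap k F z.1 + c * algebraMap k F z.2) = 0 then 1 else 0) = Nat.card {x : F // HH k r f x = 0} := by
    intro z
    rw [Nat.card_eq_fintype_card, Fintype.card_subtype, Finset.card_filter]
    refine Fintype.sum_equiv (Equiv.addRight (b * algebraMap k F z.1 + c * algebraMap k F z.2)) _ _ fun a => ?_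
    rw [Equiv.coe_addRight, add_assoc]
  simp only [h2]
  simp [pow_two]

theorem main_count (hr : 3 ≤ r) (hF : Fintype.card F = Fintype.card k ^ r) (n : ℕ) (f : F[X]) (hn : f.natDegree = n) (H : Hyp n (gg k r f))
    (hqd : max n r < Fintype.card k) (d : ℕ) (hd : d = max n r) (q : ℕ) (hq : q = Fintype.card k) :
    |(Nat.card {x : F // HH k r f x = 0} : ℝ) - (q : ℝ) ^ (r - 1)| ≤
      (q : ℝ) ^ (r - 2) * (((d:ℝ) - 1) * (d - 2) * √(q : ℝ) + d + d * ((3 * d - 3) ^ 2 + 1) * (d - 1)) := by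
  classical
  obtain ⟨b, c, h0, B, hB, hgood⟩ := exists_bc k hF n f hn H hqd
  have hcb := fun a => cnt_bounds k hF n f hn hr a b c (h0 a)
  rw [← hd, ← hq] at hB hcb
  rw [← hd] at hgood
  have hd3 : 3 ≤ d := hd ▸ hr.trans (le_max_right _ _)
  have hdr : (3 : ℝ) ≤ d := by exact_mod_cast hd3
  set N := Nat.card {x : F // HH k r f x = 0} with hN
  have hsum := sum_cnt k (r := r) f b c
  rw [← hN, ← hq] at hsum
  have hsumR : ∑ a : F, ((cnt k r f a b c : ℝ) - q) = (q:ℝ) ^ 2 * (N - (q:ℝ) ^ (r - 1)) := by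
    rw [Finset.sum_sub_distrib, Finset.sum_const, Finset.card_univ, hF, ← hq]
    have : (∑ a : F, (cnt k r f a b c : ℝ)) = (q:ℝ) ^ 2 * N := by exact_mod_cast hsum
    rw [this, nsmul_eq_mul, mul_sub, ← pow_add]
    push_cast
    rw [← pow_succ, show 2 + (r - 1) = r + 1 by omega]
  set A : ℝ := ((d:ℝ) - 1) * (d - 2) * √(q : ℝ) + d with hA
  have hq0 : 0 < q := hq ▸ Fintype.card_pos
  have hqR : (0:ℝ) < q := by exact_mod_cast hq0
  have hA0 : 0 ≤ A := by
    have : 0 ≤ √(q:ℝ) := Real.sqrt_nonneg _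
    have h2 : 0 ≤ ((d:ℝ) - 1) * (d - 2) := mul_nonneg (by linarith) (by linarith)
    positivity
  have hterm : ∀ a, |(cnt k r f a b c : ℝ) - q| ≤ A + if a ∈ B then ((d:ℝ) - 1) * q else 0 := by
    intro a
    split_ifs with ha
    · have h1 : (cnt k r f a b c : ℝ) ≤ d * q := by exact_mod_cast (hcb a).1
      have h2 : (0:ℝ) ≤ cnt k r f a b c := by positivity
      have h3 : |(cnt k r f a b c : ℝ) - q| ≤ ((d:ℝ) - 1) * q := by
        rw [abs_le]
        constructor <;> nlinarith
      linarith
    · obtain ⟨e, he⟩ := hgood a ha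
      rw [add_zero]
      exact (hcb a).2 e he
  have hBR : (B.card : ℝ) * q ≤ d * (((3:ℝ) * d - 3) ^ 2 + 1) * (q:ℝ) ^ r := by
    have h1 : (B.card : ℝ) * q ≤ (d * (Fintype.card (Mon (3 * d - 4)) + 1) : ℕ) * (q:ℝ) ^ r := by exact_mod_cast hB
    have h2 : Fintype.card (Mon (3 * d - 4)) ≤ (3 * d - 3) ^ 2 := (card_Mon_le (3 * d - 4)).trans (le_of_eq (by congr 1; omega))
    have h3 : (Fintype.card (Mon (3 * d - 4)) : ℝ) ≤ ((3:ℝ) * d - 3) ^ 2 := by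
      have : ((3 * d - 3 : ℕ) : ℝ) = (3:ℝ) * d - 3 := by rw [Nat.cast_sub (by omega)]; push_cast; ring
      rw [← this]
      exact_mod_cast h2
    refine h1.trans ?_
    push_cast
    gcongr
  have htot : (q:ℝ) ^ 2 * |(N:ℝ) - (q:ℝ) ^ (r - 1)| ≤ (q:ℝ) ^ r * A + (B.card : ℝ) * (((d:ℝ) - 1) * q) := by
    calc (q:ℝ) ^ 2 * |(N:ℝ) - (q:ℝ) ^ (r - 1)| = |∑ a : F, ((cnt k r f a b c : ℝ) - q)| := by
          rw [hsumR, abs_mul, abs_of_nonneg (by positivity : (0:ℝ) ≤ (q:ℝ) ^ 2)]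
      _ ≤ ∑ a : F, |(cnt k r f a b c : ℝ) - q| := Finset.abs_sum_le_sum_abs _ _
      _ ≤ ∑ a : F, (A + if a ∈ B then ((d:ℝ) - 1) * q else 0) := Finset.sum_le_sum fun a _ => hterm a
      _ = _ := by
          rw [Finset.sum_add_distrib, Finset.sum_const, Finset.card_univ, hF, ← hq, nsmul_eq_mul]
          simp
  have hqr : (q:ℝ) ^ r = (q:ℝ) ^ 2 * (q:ℝ) ^ (r - 2) := by rw [← pow_add]; congr 1; omega
  have h1 : (q:ℝ) ^ 2 * |(N:ℝ) - (q:ℝ) ^ (r - 1)| ≤ (q:ℝ) ^ 2 * ((q:ℝ) ^ (r - 2) * (A + d * ((3 * d - 3) ^ 2 + 1) * (d - 1))) := by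
    refine htot.trans ?_
    have h2 : (B.card : ℝ) * (((d:ℝ) - 1) * q) ≤ d * (((3:ℝ) * d - 3) ^ 2 + 1) * (q:ℝ) ^ r * (d - 1) := by
      have := mul_le_mul_of_nonneg_right hBR (by linarith : (0:ℝ) ≤ d - 1)
      linarith
    have h3 : (q:ℝ) ^ 2 * ((q:ℝ) ^ (r - 2) * (A + d * ((3 * d - 3) ^ 2 + 1) * (d - 1))) = (q:ℝ) ^ r * (A + d * ((3 * d - 3) ^ 2 + 1) * (d - 1)) := by
      rw [hqr]; ring
    rw [h3]
    linarith
  exact le_of_mul_le_mul_left h1 (by positivity)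

end assemble
end NTW


namespace NTW

open Polynomial

theorem exists_hom (p m r q : ℕ) [Fact p.Prime] (hm : 0 < m) (hq : q = p ^ m)
    (F : Type) [Field F] [Fintype F] (hF : Fintype.card F = q ^ r) [CharP F p] :
    Nonempty (GaloisField p m →+* F) := by
  letI : Algebra (ZMod p) F := ZMod.algebra F p
  have h1 : Module.finrank (ZMod p) F = m * r := by
    have h1 := Module.card_eq_pow_finrank (K := ZMod p) (V := F)
    rw [hF, ZMod.card, hq, ← pow_mul] at h1
    exact (Nat.pow_right_injective (Fact.out : p.Prime).two_le h1).symm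
  have h2 := GaloisField.finrank p hm.ne'
  obtain ⟨φ⟩ := FiniteField.nonempty_algHom_of_finrank_dvd (F := ZMod p) (K := GaloisField p m) (L := F) (by rw [h1, h2]; exact Dvd.intro _ rfl)
  exact ⟨φ.toRingHom⟩

theorem numeric (d : ℕ) (hd : 3 ≤ d) : (d : ℝ) + d * ((3 * d - 3) ^ 2 + 1) * (d - 1) ≤ 5 * (d : ℝ) ^ ((13 : ℝ) / 3) := by
  have hd3 : (3 : ℝ) ≤ d := by exact_mod_cast hd
  have h1 : (d : ℝ) ^ ((13 : ℝ) / 3) = (d:ℝ) ^ 4 * (d : ℝ) ^ ((1 : ℝ) / 3) := by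
    rw [← Real.rpow_natCast, ← Real.rpow_add (by linarith)]
    norm_num
  have hcube : ((d : ℝ) ^ ((1 : ℝ) / 3)) ^ 3 = d := by
    rw [← Real.rpow_natCast, ← Real.rpow_mul (by linarith)]
    norm_num
  set u := (d : ℝ) ^ ((1 : ℝ) / 3) with hu
  have hu0 : 0 ≤ u := by positivity
  rw [h1]
  by_cases h6 : 6 ≤ d
  · have h6' : (6 : ℝ) ≤ d := by exact_mod_cast h6
    have hu18 : (1.8 : ℝ) ≤ u := by
      by_contra h
      push Not at h
      have : u ^ 3 < 1.8 ^ 3 := pow_lt_pow_left₀ h hu0 (by norm_num)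
      rw [hcube] at this
      norm_num at this
      linarith
    have h2 : (d:ℝ) ^ 4 * 1.8 ≤ (d:ℝ) ^ 4 * u := by gcongr
    nlinarith [mul_nonneg (by linarith : (0:ℝ) ≤ d) (by linarith : (0:ℝ) ≤ d - 6), mul_nonneg (mul_nonneg (by linarith : (0:ℝ) ≤ d) (by linarith : (0:ℝ) ≤ d)) (by linarith : (0:ℝ) ≤ d - 6)]
  · have hu14 : (1.4 : ℝ) ≤ u := by
      by_contra h
      push Not at h
      have : u ^ 3 < 1.4 ^ 3 := pow_lt_pow_left₀ h hu0 (by norm_num)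
      rw [hcube] at this
      norm_num at this
      linarith
    have h2 : (d:ℝ) ^ 4 * 1.4 ≤ (d:ℝ) ^ 4 * u := by gcongr
    have : d = 3 ∨ d = 4 ∨ d = 5 := by omega
    rcases this with rfl | rfl | rfl <;> norm_num at h2 ⊢ <;> linarith

theorem hyp_gg {k : Type} [Field k] [Fintype k] {F : Type} [Field F] [Algebra k F] (p r n : ℕ) [CharP F p] (f : F[X])
    (hn : f.natDegree = n) (hn1 : 1 ≤ n)
    (hcase : (n > r ∧ 3 ≤ r ∧ ¬ p ∣ n) ∨ (n = r ∧ 4 ≤ r) ∨ (0 < n ∧ n < r ∧ 3 ≤ r)) : Hyp n (gg k r f) := by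
  have hder : ∀ j, derivative (gg k r f j) = (derivative f).map (fr k F ^ (j : ℕ)) := fun j => by
    rw [gg, Polynomial.derivative_map]
  refine ⟨fun j => by rw [gg, Polynomial.natDegree_map, hn], hn1, by omega, fun i j h => ?_, ⟨(derivative f).natDegree, fun j => ?_, fun hr => ?_⟩, ?_⟩
  · rw [hder] at h ⊢
    rw [Polynomial.map_eq_zero] at h
    rw [h, Polynomial.map_zero]
  · rw [hder, Polynomial.natDegree_map]
  · have hle := Polynomial.natDegree_derivative_le f
    rcases hcase with ⟨h1, h2, h3⟩ | ⟨h1, h2⟩ | ⟨h1, h2, h3⟩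
    · have hk : (n : F) ≠ 0 := fun h => h3 ((CharP.cast_eq_zero_iff F p n).1 h)
      have hc : (derivative f).coeff (n - 1) ≠ 0 := by
        rw [Polynomial.coeff_derivative, show n - 1 + 1 = n by omega]
        refine mul_ne_zero ?_ ?_
        · rw [← hn, Polynomial.coeff_natDegree, Polynomial.leadingCoeff_ne_zero]
          rintro rfl
          simp at hn
          omega
        · have : ((n - 1 : ℕ) : F) + 1 = n := by
            rw [← Nat.cast_succ]; congr 1; omega
          rw [this]; exact hk
      have := Polynomial.le_natDegree_of_ne_zero hc
      omega
    · omega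
    · omega
  · rcases hcase with ⟨h1, h2, h3⟩ | ⟨h1, h2⟩ | ⟨h1, h2, h3⟩
    · exact Or.inl ⟨h1, fun h => h3 ((CharP.cast_eq_zero_iff F p n).1 h)⟩
    · exact Or.inr (by omega)
    · exact Or.inr (by omega)

end NTW


/-- Estimate on the number of affine `F_{q^r}`-rational points of the Norm-Trace curve
lying on `y = f(x)`, under the irreducibility conditions (1), (2), (3) and `q > 2rd²`. -/
theorem stmt_9 (p m r k : ℕ) (hp : p.Prime) (hm : 0 < m) (hr : 2 ≤ r)
    (q : ℕ) (hq : q = p ^ m)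
    (F : Type) [Field F] [Fintype F] (hF : Fintype.card F = q ^ r)
    (f : Polynomial F) (hfk : f.natDegree = k) (hk1 : 1 ≤ k)
    (d : ℕ) (hd : d = max k r)
    (hcase : (k > r ∧ 3 ≤ r ∧ ¬ p ∣ k) ∨ (k = r ∧ 4 ≤ r) ∨ (0 < k ∧ k < r ∧ 3 ≤ r))
    (hq2 : q > 2 * r * d ^ 2) :
    |(Nat.card {x : F // x ^ ((q ^ r - 1) / (q - 1)) =
        ∑ i ∈ Finset.range r, (f.eval x) ^ q ^ i} : ℝ) - (q : ℝ) ^ (r - 1)| ≤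
      ((d : ℝ) - 1) * ((d : ℝ) - 2) * (q : ℝ) ^ ((r : ℝ) - 3 / 2) +
        5 * (d : ℝ) ^ ((13 : ℝ) / 3) * (q : ℝ) ^ (r - 2) := by

  classical
  haveI : Fact p.Prime := ⟨hp⟩
  haveI : CharP F p := charP_of_card_eq_prime_pow (f := m * r) (by rw [hF, hq, ← pow_mul])
  obtain ⟨φ⟩ := NTW.exists_hom p m r q hm hq F hF
  letI : Algebra (GaloisField p m) F := φ.toAlgebra
  letI : Fintype (GaloisField p m) := Fintype.ofFinite _
  have hcard : Fintype.card (GaloisField p m) = q := by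
    rw [← Nat.card_eq_fintype_card, GaloisField.card p m hm.ne', hq]
  have hr3 : 3 ≤ r := by omega
  have hdr : r ≤ d := hd ▸ le_max_right _ _
  have hd3 : 3 ≤ d := hr3.trans hdr
  have hdq : d < q := by nlinarith
  have hq1 : 1 < q := by omega
  have hmain := NTW.main_count (GaloisField p m) hr3 (by rw [hcard, hF]) k f hfk (NTW.hyp_gg p r k f hfk hk1 hcase) (by rw [hcard, ← hd]; exact hdq)
    d hd q hcard.symm
  have hN : Nat.card {x : F // x ^ ((q ^ r - 1) / (q - 1)) = ∑ i ∈ Finset.range r, (f.eval x) ^ q ^ i} =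
      Nat.card {x : F // NTW.HH (GaloisField p m) r f x = 0} := by
    refine Nat.card_congr (Equiv.subtypeEquivRight fun x => ?_)
    rw [NTW.HH, sub_eq_zero, hcard, Finset.prod_pow_eq_pow_sum, Fin.sum_univ_eq_sum_range (fun j => q ^ j),
      Fin.sum_univ_eq_sum_range (fun j => (f.eval x) ^ q ^ j), Nat.geomSum_eq hq1]
  rw [hN]
  refine hmain.trans ?_
  have hqR : (0:ℝ) < q := by exact_mod_cast (by omega : 0 < q)
  have hpow : (q : ℝ) ^ ((r : ℝ) - 3 / 2) = (q:ℝ) ^ (r - 2) * √(q:ℝ) := by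
    rw [Real.sqrt_eq_rpow, ← Real.rpow_natCast, ← Real.rpow_add hqR, Nat.cast_sub hr]
    congr 1
    push_cast
    ring
  have hnum := mul_le_mul_of_nonneg_left (NTW.numeric d hd3) (by positivity : (0:ℝ) ≤ (q:ℝ) ^ (r - 2))
  rw [hpow]
  linarith
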